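/- Let n ≥ 2 and let u : ℝⁿ → ℝ be a C^∞ function such that (i) at every point of ℝⁿ the eigenvalue vector λ(D²u) of the Hessian D²u lies in Γ₂ and σ₂(λ(D²u))/σ₁(λ(D²u)) = 1 (u is an admissible entire solution of the Hessian quotient equation σ₂/σ₁ = 1), and (ii) u is semi-convex, i.e. there exists K > 0 such that D²u(x) + K·I is positive definite for every x ∈ ℝⁿ. Then u is a quadratic polynomial, i.e. there exist a symmetric n×n matrix A, a vector b ∈ ℝⁿ and c ∈ ℝ such that u(x) = (1/2)⟨Ax, x⟩ + ⟨b, x⟩ + c for all x ∈ ℝⁿ. -/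

import Mathlib

/-- The `k`-th elementary symmetric polynomial `σ_k` of `λ ∈ ℝⁿ`. -/
noncomputable def sigma (n k : ℕ) (lam : Fin n → ℝ) : ℝ :=
  ∑ s ∈ Finset.univ.powersetCard k, ∏ i ∈ s, lam i

/-- Gårding's cone `Γ_k`: all `σ_l`, `1 ≤ l ≤ k`, are positive. -/
def InGamma (n k : ℕ) (lam : Fin n → ℝ) : Prop :=
  ∀ l : ℕ, 1 ≤ l → l ≤ k → 0 < sigma n l lam

/-- The Hessian matrix `D²u` of `u : ℝⁿ → ℝ` at `x`. -/
noncomputable def hess {n : ℕ} (u : EuclideanSpace ℝ (Fin n) → ℝ)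
    (x : EuclideanSpace ℝ (Fin n)) : Matrix (Fin n) (Fin n) ℝ :=
  Matrix.of fun i j =>
    fderiv ℝ (fun y => fderiv ℝ u y (EuclideanSpace.single j 1)) x (EuclideanSpace.single i 1)

section HQ
open MeasureTheory Set Filter Topology
open scoped ContDiff Matrix
variable {n : ℕ}

abbrev E (n : ℕ) := EuclideanSpace ℝ (Fin n)

abbrev Mt (n : ℕ) := Matrix (Fin n) (Fin n) ℝ

noncomputable def pd (i : Fin n) (g : E n → ℝ) (x : E n) : ℝ :=
  fderiv ℝ g x (EuclideanSpace.single i 1)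

noncomputable def gr (g : E n → ℝ) (x : E n) : Fin n → ℝ := fun i => pd i g x

lemma hess_apply (g : E n → ℝ) (x : E n) (i j : Fin n) :
    hess g x i j = pd i (pd j g) x := rfl

lemma E_sum_single (v : E n) : v = ∑ i, v i • (EuclideanSpace.single i (1:ℝ) : E n) := by
  ext j
  simp [Finset.sum_apply, Pi.single_apply]

lemma fderiv_eq_sum (g : E n → ℝ) (x v : E n) :
    fderiv ℝ g x v = ∑ i, v i * pd i g x := by
  conv_lhs => rw [E_sum_single v]
  simp [map_sum, pd]

lemma smooth_pd {g : E n → ℝ} (hg : ContDiff ℝ ∞ g) (i : Fin n) :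
    ContDiff ℝ ∞ (pd i g) := by
  have h : ContDiff ℝ ∞ (fderiv ℝ g) := hg.fderiv_right (by simp)
  exact h.clm_apply contDiff_const

lemma ContDiff.dif {g : E n → ℝ} (hg : ContDiff ℝ ∞ g) (x) : DifferentiableAt ℝ g x :=
  (hg.differentiable (by simp)).differentiableAt

lemma pd_mul {f g : E n → ℝ} {x} (hf : DifferentiableAt ℝ f x) (hg : DifferentiableAt ℝ g x)
    (i : Fin n) : pd i (fun y => f y * g y) x = f x * pd i g x + pd i f x * g x := by
  simp only [pd]
  rw [fderiv_fun_mul hf hg]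
  simp [mul_comm]

lemma pd_add {f g : E n → ℝ} {x} (hf : DifferentiableAt ℝ f x) (hg : DifferentiableAt ℝ g x)
    (i : Fin n) : pd i (fun y => f y + g y) x = pd i f x + pd i g x := by
  simp only [pd]
  rw [fderiv_fun_add hf hg]
  simp

lemma pd_sub {f g : E n → ℝ} {x} (hf : DifferentiableAt ℝ f x) (hg : DifferentiableAt ℝ g x)
    (i : Fin n) : pd i (fun y => f y - g y) x = pd i f x - pd i g x := by
  simp only [pd]
  rw [fderiv_fun_sub hf hg]
  simp

lemma pd_const (c : ℝ) (x) (i : Fin n) : pd i (fun _ : E n => c) x = 0 := by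
  simp [pd]

lemma pd_const_mul {f : E n → ℝ} {x} (hf : DifferentiableAt ℝ f x) (c : ℝ)
    (i : Fin n) : pd i (fun y => c * f y) x = c * pd i f x := by
  simp only [pd]
  rw [fderiv_const_mul hf]
  simp

lemma pd_sum {ι : Type*} (s : Finset ι) {f : ι → E n → ℝ} {x}
    (hf : ∀ k ∈ s, DifferentiableAt ℝ (f k) x)
    (i : Fin n) : pd i (fun y => ∑ k ∈ s, f k y) x = ∑ k ∈ s, pd i (f k) x := by
  simp only [pd]
  rw [fderiv_fun_sum hf]
  simp

lemma pd_coord (i j : Fin n) (x : E n) : pd i (fun y : E n => y j) x = if i = j then 1 else 0 := by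
  have : (fun y : E n => y j) = fun y => (EuclideanSpace.proj j : E n →L[ℝ] ℝ) y := rfl
  simp only [pd]
  rw [this, ContinuousLinearMap.fderiv]
  simp [Pi.single_apply, eq_comm]

lemma smooth_coord (j : Fin n) : ContDiff ℝ ∞ (fun y : E n => y j) := by fun_prop

lemma pd_comp {g : E n → ℝ} {ψ : ℝ → ℝ} {d : ℝ} {x : E n} (hg : DifferentiableAt ℝ g x)
    (hψ : HasDerivAt ψ d (g x)) (i : Fin n) : pd i (fun y => ψ (g y)) x = d * pd i g x := by
  simp only [pd]
  have h : HasFDerivAt (fun y => ψ (g y)) (d • fderiv ℝ g x) x := hψ.comp_hasFDerivAt x hg.hasFDerivAt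
  rw [h.fderiv]
  simp

lemma pd_compE {g : E n → ℝ} {X : E n → E n} {y : E n} (hg : DifferentiableAt ℝ g (X y))
    (hX : DifferentiableAt ℝ X y) (i : Fin n) :
    pd i (fun y => g (X y)) y = ∑ j, pd j g (X y) * pd i (fun y => X y j) y := by
  have h1 : HasFDerivAt (fun y => g (X y)) _ y := hg.hasFDerivAt.comp y hX.hasFDerivAt
  simp only [pd]
  rw [h1.fderiv, ContinuousLinearMap.comp_apply, fderiv_eq_sum]
  refine Finset.sum_congr rfl fun j _ => ?_
  have : HasFDerivAt (fun y => X y j) ((EuclideanSpace.proj j : E n →L[ℝ] ℝ).comp (fderiv ℝ X y)) y :=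
    (EuclideanSpace.proj j : E n →L[ℝ] ℝ).hasFDerivAt.comp y hX.hasFDerivAt
  rw [this.fderiv]
  simp [pd, mul_comm]

lemma smooth_comp_coord {X : E n → E n} (hX : ContDiff ℝ ∞ X) (j : Fin n) :
    ContDiff ℝ ∞ (fun y => X y j) := by
  exact (contDiff_piLp_apply (p := 2)).comp hX

lemma hess_chain {g : E n → ℝ} (hg : ContDiff ℝ ∞ g) {ψ ψ' : ℝ → ℝ} {d : ℝ} {x : E n}
    (h1 : ∀ y, HasDerivAt ψ (ψ' (g y)) (g y)) (h2 : HasDerivAt ψ' d (g x)) :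
    hess (fun y => ψ (g y)) x = ψ' (g x) • hess g x + d • Matrix.vecMulVec (gr g x) (gr g x) := by
  ext i j
  have e : pd j (fun y => ψ (g y)) = fun y => ψ' (g y) * pd j g y := by
    funext y; exact pd_comp (hg.dif y) (h1 y) j
  have hd : DifferentiableAt ℝ (fun y => ψ' (g y)) x := DifferentiableAt.comp x h2.differentiableAt (hg.dif x)
  rw [hess_apply, e, pd_mul hd ((smooth_pd hg j).dif x), pd_comp (hg.dif x) h2]
  simp [hess_apply, Matrix.vecMulVec_apply, gr]
  ring

lemma trace_mul_vecMulVec (a : Mt n) (v w : Fin n → ℝ) :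
    (a * Matrix.vecMulVec v w).trace = w ⬝ᵥ a *ᵥ v := by
  rw [Matrix.mul_vecMulVec, Matrix.trace_vecMulVec, dotProduct_comm]

lemma hess_add {f g : E n → ℝ} (hf : ContDiff ℝ ∞ f) (hg : ContDiff ℝ ∞ g) (x) :
    hess (fun y => f y + g y) x = hess f x + hess g x := by
  ext i j
  have : pd j (fun y => f y + g y) = fun y => pd j f y + pd j g y := by
    funext y; exact pd_add (hf.dif y) (hg.dif y) j
  rw [hess_apply, this, pd_add ((smooth_pd hf j).dif x) ((smooth_pd hg j).dif x)]; rfl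

lemma hess_const_mul {f : E n → ℝ} (hf : ContDiff ℝ ∞ f) (c : ℝ) (x) :
    hess (fun y => c * f y) x = c • hess f x := by
  ext i j
  have : pd j (fun y => c * f y) = fun y => c * pd j f y := by
    funext y; exact pd_const_mul (hf.dif y) c j
  rw [hess_apply, this, pd_const_mul ((smooth_pd hf j).dif x)]; rfl

lemma hess_sub {f g : E n → ℝ} (hf : ContDiff ℝ ∞ f) (hg : ContDiff ℝ ∞ g) (x) :
    hess (fun y => f y - g y) x = hess f x - hess g x := by
  ext i j
  have : pd j (fun y => f y - g y) = fun y => pd j f y - pd j g y := by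
    funext y; exact pd_sub (hf.dif y) (hg.dif y) j
  rw [hess_apply, this, pd_sub ((smooth_pd hf j).dif x) ((smooth_pd hg j).dif x)]; rfl

lemma hess_const (c : ℝ) (x : E n) : hess (fun _ => c) x = 0 := by
  ext i j
  have : pd j (fun _ : E n => c) = fun _ => 0 := by funext y; exact pd_const c y j
  rw [hess_apply, this, pd_const]; rfl

lemma hess_coord (k : Fin n) (x : E n) : hess (fun y => y k) x = 0 := by
  ext i j
  have : pd j (fun y : E n => y k) = fun _ => if j = k then 1 else 0 := by
    funext y; exact pd_coord j k y
  rw [hess_apply, this, pd_const]; rfl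

lemma hess_sum {ι : Type*} (s : Finset ι) {f : ι → E n → ℝ} (hf : ∀ k, ContDiff ℝ ∞ (f k)) (x) :
    hess (fun y => ∑ k ∈ s, f k y) x = ∑ k ∈ s, hess (f k) x := by
  ext i j
  have : pd j (fun y => ∑ k ∈ s, f k y) = fun y => ∑ k ∈ s, pd j (f k) y := by
    funext y; exact pd_sum s (fun k _ => (hf k).dif y) j
  rw [hess_apply, this, pd_sum s (fun k _ => (smooth_pd (hf k) j).dif x), Matrix.sum_apply]; rfl

lemma pd_scale {g : E n → ℝ} (hg : ContDiff ℝ ∞ g) (c : ℝ) (b : E n) (i : Fin n) (x) :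
    pd i (fun y => g (b + c • y)) x = c * pd i g (b + c • x) := by
  have h : HasFDerivAt (fun y : E n => b + c • y) (c • ContinuousLinearMap.id ℝ (E n)) x :=
    ((hasFDerivAt_id x).const_smul c).const_add b
  simp only [pd]
  have h2 : HasFDerivAt (fun y => g (b + c • y)) _ x := (hg.dif (b + c • x)).hasFDerivAt.comp x h
  rw [h2.fderiv]
  simp

lemma hess_scale {g : E n → ℝ} (hg : ContDiff ℝ ∞ g) (c : ℝ) (b : E n) (x) :
    hess (fun y => g (b + c • y)) x = c ^ 2 • hess g (b + c • x) := by
  ext i j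
  have : pd j (fun y => g (b + c • y)) = fun y => c * pd j g (b + c • y) := by
    funext y; exact pd_scale hg c b j y
  have hs : ContDiff ℝ ∞ (fun y => pd j g (b + c • y)) := (smooth_pd hg j).comp (by fun_prop)
  rw [hess_apply, this, pd_const_mul (hs.dif x), pd_scale (smooth_pd hg j)]
  simp [hess_apply]; ring

lemma hess_symm {g : E n → ℝ} (hg : ContDiff ℝ ∞ g) (x : E n) (i j : Fin n) :
    pd i (pd j g) x = pd j (pd i g) x := by
  have h := (hg.contDiffAt (x := x)).isSymmSndFDerivAt (by simp only [minSmoothness_of_isRCLikeNormedField]; exact ENat.LEInfty.out)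
  have e : ∀ (i j : Fin n), pd i (pd j g) x =
      fderiv ℝ (fderiv ℝ g) x (EuclideanSpace.single i 1) (EuclideanSpace.single j 1) := by
    intro i j
    have hd : DifferentiableAt ℝ (fderiv ℝ g) x :=
      ((hg.fderiv_right (m := ∞) (by simp)).differentiable (by simp)).differentiableAt
    have : HasFDerivAt (pd j g) _ x := hd.hasFDerivAt.clm_apply (hasFDerivAt_const _ x)
    simp only [pd] at this ⊢
    rw [this.fderiv]; simp
  rw [e, e]; exact h _ _

lemma ibp_pd {f g : E n → ℝ} (hf : ContDiff ℝ ∞ f) (hg : ContDiff ℝ ∞ g)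
    (hc : HasCompactSupport f) (i : Fin n) :
    ∫ x, f x * pd i g x = - ∫ x, pd i f x * g x := by
  have hcd : HasCompactSupport (pd i f) := hc.fderiv_apply (𝕜 := ℝ) _
  have := integral_mul_fderiv_eq_neg_fderiv_mul_of_integrable (μ := (volume : Measure (E n)))
    (f := f) (g := g) (v := EuclideanSpace.single i 1)
    (((smooth_pd hf i).continuous.mul hg.continuous).integrable_of_hasCompactSupport hcd.mul_right)
    ((hf.continuous.mul (smooth_pd hg i).continuous).integrable_of_hasCompactSupport hc.mul_right)
    ((hf.continuous.mul hg.continuous).integrable_of_hasCompactSupport hc.mul_right)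
    (fun x _ => hf.dif x) (fun x _ => hg.dif x)
  simpa [pd] using this

open Metric

lemma norm_sq_eq (v : E n) : ‖v‖ ^ 2 = ∑ i, v i ^ 2 := by
  rw [EuclideanSpace.norm_sq_eq]; simp

lemma smooth_gr_cont {g : E n → ℝ} (hg : ContDiff ℝ ∞ g) : Continuous (gr g) :=
  continuous_pi fun i => (smooth_pd hg i).continuous

lemma dot_self_nonneg (v : Fin n → ℝ) : 0 ≤ v ⬝ᵥ v :=
  Finset.sum_nonneg fun i _ => mul_self_nonneg _

lemma fderiv_sq_le (g : E n → ℝ) (x v : E n) :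
    (fderiv ℝ g x v) ^ 2 ≤ ‖v‖ ^ 2 * (gr g x ⬝ᵥ gr g x) := by
  rw [fderiv_eq_sum, norm_sq_eq]
  have := Finset.sum_mul_sq_le_sq_mul_sq Finset.univ (fun i => v i) (fun i => pd i g x)
  simpa [dotProduct, gr, sq] using this

lemma fderiv_norm_le (g : E n → ℝ) (x : E n) :
    ‖fderiv ℝ g x‖ ≤ √ (gr g x ⬝ᵥ gr g x) := by
  refine ContinuousLinearMap.opNorm_le_bound _ (Real.sqrt_nonneg _) fun v => ?_
  rw [Real.norm_eq_abs]
  apply abs_le_of_sq_le_sq _ (by positivity)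
  rw [mul_pow, Real.sq_sqrt (dot_self_nonneg _)]
  linarith [fderiv_sq_le g x v, mul_comm (‖v‖^2) (gr g x ⬝ᵥ gr g x)]

lemma st_deriv_bdd : ∃ C : ℝ, 0 < C ∧ ∀ t, |deriv Real.smoothTransition t| ≤ C := by
  have hc : Continuous (deriv Real.smoothTransition) :=
    (Real.smoothTransition.contDiff (n := 1)).continuous_deriv le_rfl
  obtain ⟨C, hC⟩ := isCompact_Icc.exists_bound_of_continuousOn (s := Icc (0:ℝ) 1) hc.continuousOn
  refine ⟨max C 1, by positivity, fun t => ?_⟩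
  rcases lt_or_ge t 0 with h | h
  · have : Real.smoothTransition =ᶠ[𝓝 t] fun _ => 0 := by
      filter_upwards [Iio_mem_nhds h] with s hs using Real.smoothTransition.zero_of_nonpos (le_of_lt hs)
    rw [this.deriv_eq]; simp
  rcases lt_or_ge 1 t with h' | h'
  · have : Real.smoothTransition =ᶠ[𝓝 t] fun _ => 1 := by
      filter_upwards [Ioi_mem_nhds h'] with s hs using Real.smoothTransition.one_of_one_le (le_of_lt hs)
    rw [this.deriv_eq]; simp
  · exact (hC t ⟨h, h'⟩).trans (le_max_left _ _)

structure IsCut (C r R : ℝ) (φ : E n → ℝ) : Prop where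
  smooth : ContDiff ℝ ∞ φ
  cpt : HasCompactSupport φ
  one : ∀ x, ‖x‖ ≤ r → φ x = 1
  zero : ∀ x, R ≤ ‖x‖ → φ x = 0
  nonneg : ∀ x, 0 ≤ φ x
  le_one : ∀ x, φ x ≤ 1
  grad : ∀ x, gr φ x ⬝ᵥ gr φ x ≤ C / (R - r) ^ 2
  gzero : ∀ x, R ≤ ‖x‖ → gr φ x = 0

lemma exists_cut (n : ℕ) : ∃ C : ℝ, 0 < C ∧ ∀ r R : ℝ, 0 < r → r < R → ∃ φ : E n → ℝ, IsCut C r R φ := by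
  obtain ⟨C, hC0, hC⟩ := st_deriv_bdd
  refine ⟨4 * C ^ 2, by positivity, fun r R hr hR => ?_⟩
  have hd : 0 < R ^ 2 - r ^ 2 := by nlinarith
  let q : E n → ℝ := fun x => (R ^ 2 - ‖x‖ ^ 2) / (R ^ 2 - r ^ 2)
  have hq : ContDiff ℝ ∞ q := by
    have : ContDiff ℝ ∞ (fun x : E n => ‖x‖ ^ 2) := contDiff_norm_sq ℝ
    exact (contDiff_const.sub this).div_const _
  have hqd : ∀ x i, pd i q x = - (2 * x i) / (R ^ 2 - r ^ 2) := by
    intro x i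
    have e : q = fun x => (R ^ 2 - r ^ 2)⁻¹ * (R ^ 2 - ∑ j, x j * x j) := by
      funext x; simp only [q]; rw [norm_sq_eq]; simp only [sq]; field_simp
    have hs : ContDiff ℝ ∞ (fun x : E n => ∑ j, x j * x j) := by fun_prop
    rw [e, pd_const_mul (by exact ((contDiff_const.sub hs).dif x)), pd_sub (contDiff_const.dif x) (hs.dif x),
      pd_const, pd_sum _ (fun j _ => ((smooth_coord j).mul (smooth_coord j)).dif x)]
    have : ∀ j, pd i (fun y : E n => y j * y j) x = if i = j then 2 * x j else 0 := by
      intro j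
      rw [pd_mul ((smooth_coord j).dif x) ((smooth_coord j).dif x), pd_coord]
      split_ifs <;> ring
    simp only [this]
    simp; field_simp
  have hz : ∀ x : E n, R ≤ ‖x‖ → Real.smoothTransition (q x) = 0 := by
    intro x hx
    apply Real.smoothTransition.zero_of_nonpos
    apply div_nonpos_of_nonpos_of_nonneg _ hd.le
    nlinarith [norm_nonneg x]
  have hgr : ∀ x : E n, gr (fun x => Real.smoothTransition (q x)) x =
      fun i => deriv Real.smoothTransition (q x) * (- (2 * x i) / (R ^ 2 - r ^ 2)) := by
    intro x; funext i
    have hdd : HasDerivAt Real.smoothTransition (deriv Real.smoothTransition (q x)) (q x) :=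
      ((Real.smoothTransition.contDiff (n := 1)).differentiable (by simp) _).hasDerivAt
    simp only [gr]
    rw [pd_comp (hq.dif x) hdd, hqd]
  have hdz : ∀ t : ℝ, t ≤ 0 → deriv Real.smoothTransition t = 0 := by
    intro t ht
    have hm : IsLocalMin Real.smoothTransition t := by
      filter_upwards with s
      rw [Real.smoothTransition.zero_of_nonpos ht]; exact Real.smoothTransition.nonneg s
    exact hm.deriv_eq_zero
  have hgz : ∀ x : E n, R ≤ ‖x‖ → gr (fun x => Real.smoothTransition (q x)) x = 0 := by
    intro x hx
    rw [hgr]; funext i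
    rw [hdz, zero_mul]; rfl
    apply div_nonpos_of_nonpos_of_nonneg _ hd.le
    nlinarith [norm_nonneg x]
  refine ⟨fun x => Real.smoothTransition (q x), ⟨Real.smoothTransition.contDiff.comp hq, ?_, ?_, hz,
    fun x => Real.smoothTransition.nonneg _, fun x => Real.smoothTransition.le_one _, ?_, hgz⟩⟩
  · refine HasCompactSupport.intro (isCompact_closedBall (0 : E n) R) fun x hx => hz x ?_
    simp at hx; exact hx.le
  · intro x hx
    apply Real.smoothTransition.one_of_one_le
    rw [le_div_iff₀ hd]; nlinarith [norm_nonneg x]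
  · intro x
    rcases le_or_gt R ‖x‖ with h | h
    · rw [hgz x h]; simp; positivity
    rw [hgr]
    have e : ((fun i => deriv Real.smoothTransition (q x) * (- (2 * x i) / (R ^ 2 - r ^ 2))) ⬝ᵥ
      (fun i => deriv Real.smoothTransition (q x) * (- (2 * x i) / (R ^ 2 - r ^ 2)))) =
      (deriv Real.smoothTransition (q x)) ^ 2 * (4 / (R^2 - r^2) ^ 2) * ‖x‖ ^ 2 := by
      rw [norm_sq_eq, Finset.mul_sum]; simp only [dotProduct]
      refine Finset.sum_congr rfl fun i _ => ?_
      have := hd.ne'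
      field_simp
      ring
    rw [e]
    have h1 : (deriv Real.smoothTransition (q x)) ^ 2 ≤ C ^ 2 := sq_le_sq' (by linarith [abs_le.1 (hC (q x))]) (abs_le.1 (hC (q x))).2
    have h2 : ‖x‖ ^ 2 ≤ (R + r) ^ 2 := by nlinarith [norm_nonneg x]
    have h3 : (R ^ 2 - r ^ 2) ^ 2 = (R - r) ^ 2 * (R + r) ^ 2 := by ring
    have h4 : 0 < R - r := by linarith
    have h5 : 0 < R + r := by linarith
    calc _ ≤ C ^ 2 * (4 / (R^2 - r^2) ^ 2) * (R + r) ^ 2 := by gcongr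
      _ = _ := by rw [h3]; field_simp

lemma intb {F : Type*} [NormedAddCommGroup F] {f : E n → F} (hf : Continuous f) (x : E n) (r : ℝ) : IntegrableOn f (ball x r) :=
  (hf.continuousOn.integrableOn_compact (isCompact_closedBall x r)).mono_set ball_subset_closedBall

lemma int_mul_cs {f g : E n → ℝ} (hf : Continuous f) (hc : HasCompactSupport f) (hg : Continuous g) :
    Integrable (fun x => f x * g x) :=
  (hf.mul hg).integrable_of_hasCompactSupport hc.mul_right

structure Coef (a : E n → Mt n) (l L : ℝ) : Prop where
  hl : 0 < l
  hL : 0 < L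
  cont : Continuous a
  symm : ∀ x, (a x)ᵀ = a x
  lower : ∀ x v, l * (v ⬝ᵥ v) ≤ v ⬝ᵥ a x *ᵥ v
  upper : ∀ x v, v ⬝ᵥ a x *ᵥ v ≤ L * (v ⬝ᵥ v)
  ibp : ∀ φ g : E n → ℝ, ContDiff ℝ ∞ φ → ContDiff ℝ ∞ g → HasCompactSupport φ →
    ∫ x, φ x * (a x * hess g x).trace = - ∫ x, gr φ x ⬝ᵥ a x *ᵥ gr g x

lemma hess_cont {g : E n → ℝ} (hg : ContDiff ℝ ∞ g) : Continuous (hess g) :=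
  continuous_matrix fun i j => (smooth_pd (smooth_pd hg j) i).continuous

lemma gr_cs {φ : E n → ℝ} (hc : HasCompactSupport φ) : HasCompactSupport (gr φ) := by
  have := hc.fderiv (𝕜 := ℝ)
  refine this.comp_left (g := fun L : E n →L[ℝ] ℝ => fun i => L (EuclideanSpace.single i 1)) ?_
  funext i; simp

lemma symm_bil {a : Mt n} (h : aᵀ = a) (v w : Fin n → ℝ) : v ⬝ᵥ a *ᵥ w = w ⬝ᵥ a *ᵥ v := by
  rw [Matrix.dotProduct_mulVec, dotProduct_comm, ← Matrix.mulVec_transpose, h]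

lemma Coef.nonneg {a : E n → Mt n} {l L : ℝ} (h : Coef a l L) (x v) : 0 ≤ v ⬝ᵥ a x *ᵥ v :=
  (mul_nonneg h.hl.le (dot_self_nonneg v)).trans (h.lower x v)

lemma Coef.young {a : E n → Mt n} {l L : ℝ} (h : Coef a l L) (x v w) (s t : ℝ) :
    s ^ 2 * (v ⬝ᵥ a x *ᵥ v) / 2 - 2 * t ^ 2 * (w ⬝ᵥ a x *ᵥ w) ≤
     s ^ 2 * (v ⬝ᵥ a x *ᵥ v) + 2 * s * t * (w ⬝ᵥ a x *ᵥ v) := by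
  have := h.nonneg x (s • v + (2 * t) • w)
  simp only [Matrix.mulVec_add, Matrix.mulVec_smul, add_dotProduct, dotProduct_add, smul_dotProduct,
    dotProduct_smul, smul_eq_mul] at this
  rw [symm_bil (h.symm x) v w] at this
  nlinarith

lemma int_scale (b : E n) {c : ℝ} (hc : 0 < c) (f : E n → ℝ) :
    ∫ y, f (b + c • y) = (c ^ n)⁻¹ * ∫ x, f x := by
  have h1 := Measure.integral_comp_smul (volume : Measure (E n)) (fun z => f (b + z)) c
  have h2 : ∫ z, f (b + z) = ∫ z, f z := integral_add_left_eq_self f b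
  rw [h1, h2]; simp [abs_of_pos (pow_pos hc n)]

lemma Coef.scale {a : E n → Mt n} {l L : ℝ} (h : Coef a l L) (b : E n) {c : ℝ} (hc : 0 < c) :
    Coef (fun y => a (b + c • y)) l L := by
  refine ⟨h.hl, h.hL, h.cont.comp (by fun_prop), fun x => h.symm _, fun x => h.lower _, fun x => h.upper _, ?_⟩
  intro φ g hφ hg hcs
  let φ' : E n → ℝ := fun x => φ (-(c⁻¹ • b) + c⁻¹ • x)
  let g' : E n → ℝ := fun x => g (-(c⁻¹ • b) + c⁻¹ • x)
  have e : ∀ y : E n, -(c⁻¹ • b) + c⁻¹ • (b + c • y) = y := by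
    intro y; rw [smul_add, smul_smul, inv_mul_cancel₀ hc.ne']; simp
  have hφ' : ContDiff ℝ ∞ φ' := hφ.comp (by fun_prop)
  have hg' : ContDiff ℝ ∞ g' := hg.comp (by fun_prop)
  have hcs' : HasCompactSupport φ' := by
    have : φ' = φ ∘ ((Homeomorph.smulOfNeZero c⁻¹ (inv_ne_zero hc.ne')).trans (Homeomorph.addLeft (-(c⁻¹ • b)))) := rfl
    rw [this]; exact hcs.comp_homeomorph _
  have key := h.ibp φ' g' hφ' hg' hcs'
  have hp : ∀ y, gr φ y = c • gr φ' (b + c • y) := by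
    intro y; funext i
    have := pd_scale hφ' c b i y
    simp only [φ', e] at this
    simpa [gr] using this
  have hgg : ∀ y, gr g y = c • gr g' (b + c • y) := by
    intro y; funext i
    have := pd_scale hg' c b i y
    simp only [g', e] at this
    simpa [gr] using this
  have hh : ∀ y, hess g y = c ^ 2 • hess g' (b + c • y) := by
    intro y
    have := hess_scale hg' c b y
    simp only [g', e] at this
    exact this
  have e1 : ∫ x, φ x * (a (b + c • x) * hess g x).trace =
      ∫ y, (fun x => c ^ 2 * (φ' x * (a x * hess g' x).trace)) (b + c • y) := by
    congr 1; funext y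
    simp only [hh, φ', e, Matrix.mul_smul, Matrix.trace_smul, smul_eq_mul]; ring
  have e2 : ∫ x, gr φ x ⬝ᵥ a (b + c • x) *ᵥ gr g x =
      ∫ y, (fun x => c ^ 2 * (gr φ' x ⬝ᵥ a x *ᵥ gr g' x)) (b + c • y) := by
    congr 1; funext y
    simp only [hp, hgg, Matrix.mulVec_smul, smul_dotProduct, dotProduct_smul, smul_eq_mul]; ring
  rw [e1, e2, int_scale b hc (fun x => c ^ 2 * (φ' x * (a x * hess g' x).trace)),
    int_scale b hc (fun x => c ^ 2 * (gr φ' x ⬝ᵥ a x *ᵥ gr g' x)), integral_const_mul, integral_const_mul, key]; ring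

lemma bil_cont {a : E n → Mt n} (ha : Continuous a) {v w : E n → Fin n → ℝ} (hv : Continuous v)
    (hw : Continuous w) : Continuous (fun x => v x ⬝ᵥ a x *ᵥ w x) :=
  hv.dotProduct (ha.matrix_mulVec hw)

lemma grsq_cont {g : E n → ℝ} (hg : ContDiff ℝ ∞ g) : Continuous (fun x => gr g x ⬝ᵥ gr g x) :=
  (smooth_gr_cont hg).dotProduct (smooth_gr_cont hg)

lemma tr_cont {a : E n → Mt n} (ha : Continuous a) {g : E n → ℝ} (hg : ContDiff ℝ ∞ g) :
    Continuous (fun x => (a x * hess g x).trace) :=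
  (ha.matrix_mul (hess_cont hg)).matrix_trace

lemma int_of_zero {f : E n → ℝ} (hf : Continuous f) (R : ℝ) (hz : ∀ x, R < ‖x‖ → f x = 0) :
    Integrable f := by
  refine hf.integrable_of_hasCompactSupport (HasCompactSupport.intro (isCompact_closedBall (0 : E n) R) fun x hx => hz x ?_)
  simpa using hx

lemma Coef.energy {a : E n → Mt n} {l L : ℝ} (h : Coef a l L) {φ : E n → ℝ} {G : E n → Fin n → ℝ}
    {s : E n → ℝ} (hφ : ContDiff ℝ ∞ φ) (hc : HasCompactSupport φ) (hG : Continuous G) (hs : Continuous s)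
    (hint : ∫ x, (φ x ^ 2 * (G x ⬝ᵥ a x *ᵥ G x) + 2 * φ x * s x * (gr φ x ⬝ᵥ a x *ᵥ G x)) ≤ 0) :
    ∫ x, φ x ^ 2 * (G x ⬝ᵥ G x) ≤ 4 * L / l * ∫ x, s x ^ 2 * (gr φ x ⬝ᵥ gr φ x) := by
  have hφc := hφ.continuous
  have hgc := smooth_gr_cont hφ
  have c1 : HasCompactSupport (fun x => φ x ^ 2) := by
    simp only [sq]; exact hc.mul_right (f' := φ)
  have hgcs : HasCompactSupport (fun x => gr φ x ⬝ᵥ gr φ x) :=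
    (gr_cs hc).comp_left (g := fun v => v ⬝ᵥ v) (by simp)
  have i1 : Integrable (fun x => φ x ^ 2 * (G x ⬝ᵥ G x)) :=
    int_mul_cs (hφc.pow 2) c1 (hG.dotProduct hG)
  have i2 : Integrable (fun x => s x ^ 2 * (gr φ x ⬝ᵥ gr φ x)) := by
    have := int_mul_cs (hgc.dotProduct hgc) hgcs (hs.pow 2)
    simpa [mul_comm] using this
  have i3 : Integrable (fun x => φ x ^ 2 * (G x ⬝ᵥ a x *ᵥ G x) + 2 * φ x * s x * (gr φ x ⬝ᵥ a x *ᵥ G x)) := by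
    refine Integrable.add (int_mul_cs (hφc.pow 2) c1 (bil_cont h.cont hG hG)) ?_
    have := int_mul_cs hφc hc ((continuous_const (y := (2:ℝ))).mul (hs.mul (bil_cont h.cont hgc hG)))
    refine this.congr (Eventually.of_forall fun x => ?_)
    simp only [Pi.mul_apply]; ring
  have key : ∫ x, (l / 2 * (φ x ^ 2 * (G x ⬝ᵥ G x)) - 2 * L * (s x ^ 2 * (gr φ x ⬝ᵥ gr φ x))) ≤ 0 := by
    refine le_trans (integral_mono ((i1.const_mul _).sub (i2.const_mul _)) i3 fun x => ?_) hint
    have y := h.young x (G x) (gr φ x) (φ x) (s x)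
    have e1 := mul_le_mul_of_nonneg_left (h.lower x (G x)) (sq_nonneg (φ x))
    have e2 := mul_le_mul_of_nonneg_left (h.upper x (gr φ x)) (sq_nonneg (s x))
    simp only []
    nlinarith
  rw [integral_sub (i1.const_mul _) (i2.const_mul _), integral_const_mul, integral_const_mul] at key
  rw [div_mul_eq_mul_div, le_div_iff₀ h.hl]
  nlinarith

lemma Coef.cacc0 {a : E n → Mt n} {l L : ℝ} (h : Coef a l L) {φ g : E n → ℝ}
    (hφ : ContDiff ℝ ∞ φ) (hc : HasCompactSupport φ) (hg : ContDiff ℝ ∞ g)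
    (hsub : ∀ x, 0 ≤ g x * (a x * hess g x).trace) :
    ∫ x, φ x ^ 2 * (gr g x ⬝ᵥ gr g x) ≤ 4 * L / l * ∫ x, g x ^ 2 * (gr φ x ⬝ᵥ gr φ x) := by
  refine h.energy hφ hc (smooth_gr_cont hg) hg.continuous ?_
  have hφ2 : ContDiff ℝ ∞ (fun x => φ x * φ x) := hφ.mul hφ
  have key := h.ibp (fun x => φ x * φ x * g x) g (hφ2.mul hg) hg ((hc.mul_right).mul_right)
  have h0 : 0 ≤ ∫ x, φ x * φ x * g x * (a x * hess g x).trace := integral_nonneg fun x => by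
    simp only [Pi.zero_apply]
    rw [mul_assoc]; exact mul_nonneg (mul_self_nonneg _) (hsub x)
  rw [key] at h0
  refine le_trans (le_of_eq ?_) (neg_nonneg.1 h0)
  congr 1; funext x
  have : gr (fun x => φ x * φ x * g x) x = (φ x ^ 2) • gr g x + (2 * φ x * g x) • gr φ x := by
    funext i
    simp only [gr]
    rw [pd_mul (hφ2.dif x) (hg.dif x), pd_mul (hφ.dif x) (hφ.dif x)]
    simp [gr]; ring
  rw [this]; simp [add_dotProduct, smul_dotProduct]

lemma Coef.log0 {a : E n → Mt n} {l L : ℝ} (h : Coef a l L) {φ g : E n → ℝ}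
    (hφ : ContDiff ℝ ∞ φ) (hc : HasCompactSupport φ) (hg : ContDiff ℝ ∞ g)
    (hsub : ∀ x, gr g x ⬝ᵥ a x *ᵥ gr g x ≤ (a x * hess g x).trace) :
    ∫ x, φ x ^ 2 * (gr g x ⬝ᵥ gr g x) ≤ 4 * L / l * ∫ x, (gr φ x ⬝ᵥ gr φ x) := by
  have := h.energy hφ hc (smooth_gr_cont hg) (continuous_const (y := (1:ℝ))) ?_
  · simpa using this
  have hφ2 : ContDiff ℝ ∞ (fun x => φ x * φ x) := hφ.mul hφ
  have key := h.ibp (fun x => φ x * φ x) g hφ2 hg hc.mul_right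
  have i1 : Integrable (fun x => φ x * φ x * (gr g x ⬝ᵥ a x *ᵥ gr g x)) :=
    int_mul_cs hφ2.continuous hc.mul_right (bil_cont h.cont (smooth_gr_cont hg) (smooth_gr_cont hg))
  have i3 : Integrable (fun x => 2 * φ x * 1 * (gr φ x ⬝ᵥ a x *ᵥ gr g x)) := by
    have := int_mul_cs hφ.continuous hc ((continuous_const (y := (2:ℝ))).mul (bil_cont h.cont (smooth_gr_cont hφ) (smooth_gr_cont hg)))
    refine this.congr (Eventually.of_forall fun x => ?_)
    simp only [Pi.mul_apply]; ring
  have h0 : ∫ x, φ x * φ x * (gr g x ⬝ᵥ a x *ᵥ gr g x) ≤ ∫ x, φ x * φ x * (a x * hess g x).trace := by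
    refine integral_mono i1 (int_mul_cs hφ2.continuous hc.mul_right (tr_cont h.cont hg)) fun x => ?_
    exact mul_le_mul_of_nonneg_left (hsub x) (mul_self_nonneg _)
  rw [key] at h0
  have e : ∫ x, gr (fun x => φ x * φ x) x ⬝ᵥ a x *ᵥ gr g x = ∫ x, 2 * φ x * 1 * (gr φ x ⬝ᵥ a x *ᵥ gr g x) := by
    congr 1; funext x
    have : gr (fun x => φ x * φ x) x = (2 * φ x) • gr φ x := by
      funext i
      simp only [gr]
      rw [pd_mul (hφ.dif x) (hφ.dif x)]
      simp [gr]; ring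
    rw [this]; simp [smul_dotProduct]
  rw [e] at h0
  simp only [sq]
  rw [integral_add i1 i3]; linarith

lemma IsCut.int_le {C r R : ℝ} {φ : E n → ℝ} (h : IsCut C r R φ) {f : E n → ℝ} (hf : Continuous f)
    (h0 : ∀ x, 0 ≤ f x) : ∫ x in ball 0 r, f x ≤ ∫ x, φ x ^ 2 * f x := by
  have i : Integrable (fun x => φ x ^ 2 * f x) := by
    refine int_of_zero ((h.smooth.continuous.pow 2).mul hf) R fun x hx => ?_
    rw [h.zero x hx.le]; simp
  calc ∫ x in ball 0 r, f x = ∫ x in ball 0 r, φ x ^ 2 * f x := by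
        refine setIntegral_congr_fun measurableSet_ball fun x hx => ?_
        simp only [mem_ball_zero_iff] at hx
        rw [h.one x hx.le]; simp
    _ ≤ _ := setIntegral_le_integral i (Eventually.of_forall fun x => mul_nonneg (sq_nonneg _) (h0 x))

lemma IsCut.int_ge {C r R : ℝ} {φ : E n → ℝ} (h : IsCut C r R φ) {f : E n → ℝ} (hf : Continuous f)
    (h0 : ∀ x, 0 ≤ f x) : ∫ x, f x * (gr φ x ⬝ᵥ gr φ x) ≤ C / (R - r) ^ 2 * ∫ x in ball 0 R, f x := by
  have e : ∫ x, f x * (gr φ x ⬝ᵥ gr φ x) = ∫ x in ball 0 R, f x * (gr φ x ⬝ᵥ gr φ x) := by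
    rw [setIntegral_eq_integral_of_forall_compl_eq_zero]
    intro x hx
    simp at hx
    rw [h.gzero x hx]; simp
  rw [e, ← integral_const_mul]
  refine setIntegral_mono (intb (hf.mul (grsq_cont h.smooth)) 0 R) ((intb hf 0 R).const_mul _) fun x => ?_
  simp only []
  rw [mul_comm]
  exact mul_le_mul_of_nonneg_right (h.grad x) (h0 x)

lemma cacc_ball (n : ℕ) (l L : ℝ) (hl : 0 < l) (hL : 0 < L) : ∃ C : ℝ, 0 < C ∧ ∀ (a : E n → Mt n) (g : E n → ℝ) (r R : ℝ),
    Coef a l L → ContDiff ℝ ∞ g → (∀ x, 0 ≤ g x * (a x * hess g x).trace) → 0 < r → r < R →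
    ∫ x in ball 0 r, (gr g x ⬝ᵥ gr g x) ≤ C / (R - r) ^ 2 * ∫ x in ball 0 R, g x ^ 2 := by
  obtain ⟨C, hC, H⟩ := exists_cut n
  refine ⟨4 * L / l * C, by positivity, fun a g r R h hg hs hr hR => ?_⟩
  obtain ⟨φ, hφ⟩ := H r R hr hR
  calc _ ≤ ∫ x, φ x ^ 2 * (gr g x ⬝ᵥ gr g x) := hφ.int_le (grsq_cont hg) fun x => dot_self_nonneg _
    _ ≤ _ := h.cacc0 hφ.smooth hφ.cpt hg hs
    _ ≤ 4 * L / l * (C / (R - r) ^ 2 * ∫ x in ball 0 R, g x ^ 2) := by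
        gcongr
        exact hφ.int_ge (hg.continuous.pow 2) fun x => sq_nonneg _
    _ = _ := by ring

lemma log_ball (n : ℕ) (l L : ℝ) (hl : 0 < l) (hL : 0 < L) : ∃ C : ℝ, 0 < C ∧ ∀ (a : E n → Mt n) (g : E n → ℝ),
    Coef a l L → ContDiff ℝ ∞ g → (∀ x, gr g x ⬝ᵥ a x *ᵥ gr g x ≤ (a x * hess g x).trace) →
    ∫ x in ball 0 1, (gr g x ⬝ᵥ gr g x) ≤ C := by
  obtain ⟨C, hC, H⟩ := exists_cut n
  refine ⟨4 * L / l * (C * ∫ x in ball (0 : E n) 2, 1) + 1, ?_, fun a g h hg hs => ?_⟩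
  · have : 0 ≤ ∫ x in ball (0 : E n) 2, (1:ℝ) := integral_nonneg fun _ => zero_le_one
    positivity
  obtain ⟨φ, hφ⟩ := H 1 2 one_pos (by norm_num)
  have e := hφ.int_ge (f := fun _ => 1) continuous_const fun x => zero_le_one
  norm_num at e
  calc _ ≤ ∫ x, φ x ^ 2 * (gr g x ⬝ᵥ gr g x) := hφ.int_le (grsq_cont hg) fun x => dot_self_nonneg _
    _ ≤ _ := h.log0 hφ.smooth hφ.cpt hg hs
    _ ≤ 4 * L / l * (C * ∫ x in ball (0 : E n) 2, 1) := by
        have := h.hl; have := h.hL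
        gcongr
        simpa using e
    _ ≤ _ := by linarith

lemma sob (n : ℕ) (hn : 2 ≤ n) : ∃ C : ℝ, 1 ≤ C ∧ ∀ (w h : E n → ℝ), ContDiff ℝ ∞ w → HasCompactSupport w →
    Continuous h → Integrable h → (∀ x, ‖fderiv ℝ w x‖ ≤ h x) →
    ∫ x, |w x| ^ ((n:ℝ) / (n - 1)) ≤ C * (∫ x, h x) ^ ((n:ℝ) / (n - 1)) := by
  have hn' : (2:ℝ) ≤ n := by exact_mod_cast hn
  set χ : ℝ := (n:ℝ) / (n - 1) with hχ
  have hχ0 : 0 < χ := div_pos (by linarith) (by linarith)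
  have hp : Real.HolderConjugate (Module.finrank ℝ (E n)) χ := by
    rw [finrank_euclideanSpace_fin]
    have := Real.HolderConjugate.conjExponent (p := (n:ℝ)) (by linarith)
    simpa [Real.conjExponent] using this
  let C0 := lintegralPowLePowLIntegralFDerivConst (volume : Measure (E n)) χ
  refine ⟨C0 + 1, by simp, fun w h hw hc hh hi hle => ?_⟩
  have key := lintegral_pow_le_pow_lintegral_fderiv (volume : Measure (E n)) (hw.of_le (by simp : (1:WithTop ℕ∞) ≤ ∞)) hc hp
  have h0 : ∀ x, 0 ≤ h x := fun x => (norm_nonneg _).trans (hle x)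
  have e1 : ∫⁻ x, ‖fderiv ℝ w x‖ₑ ≤ ENNReal.ofReal (∫ x, h x) := by
    rw [ofReal_integral_eq_lintegral_ofReal hi (Eventually.of_forall h0)]
    refine lintegral_mono fun x => ?_
    rw [← ofReal_norm_eq_enorm]
    exact ENNReal.ofReal_le_ofReal (hle x)
  have hcw : HasCompactSupport (fun x => |w x| ^ χ) :=
    hc.comp_left (g := fun t => |t| ^ χ) (by simp [hχ0.ne'])
  have hcont : Continuous (fun x => |w x| ^ χ) :=
    (hw.continuous.abs).rpow_const fun x => Or.inr hχ0.le
  have e2 : ∫⁻ x, ‖w x‖ₑ ^ χ = ENNReal.ofReal (∫ x, |w x| ^ χ) := by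
    rw [ofReal_integral_eq_lintegral_ofReal (hcont.integrable_of_hasCompactSupport hcw)
      (Eventually.of_forall fun x => by positivity)]
    refine lintegral_congr fun x => ?_
    rw [← ofReal_norm_eq_enorm, Real.norm_eq_abs, ENNReal.ofReal_rpow_of_nonneg (abs_nonneg _) hχ0.le]
  have hI : 0 ≤ ∫ x, h x := integral_nonneg h0
  rw [e2] at key
  have key2 : ENNReal.ofReal (∫ x, |w x| ^ χ) ≤ ENNReal.ofReal (C0 * (∫ x, h x) ^ χ) := by
    refine key.trans ?_
    rw [ENNReal.ofReal_mul (by positivity), ENNReal.ofReal_coe_nnreal,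
      ← ENNReal.ofReal_rpow_of_nonneg hI hχ0.le]
    gcongr
  rw [ENNReal.ofReal_le_ofReal_iff (by positivity)] at key2
  refine key2.trans ?_
  gcongr
  simp

lemma moser_step (n : ℕ) (hn : 2 ≤ n) (l L : ℝ) (hl : 0 < l) (hL : 0 < L) : ∃ C : ℝ, 1 ≤ C ∧
    ∀ (a : E n → Mt n) (g : E n → ℝ) (r R : ℝ),
    Coef a l L → ContDiff ℝ ∞ g → (∀ x, 0 ≤ g x * (a x * hess g x).trace) → 0 < r → r < R → R ≤ 1 →
    ∫ x in ball 0 r, (g x ^ 2) ^ ((n:ℝ) / (n - 1)) ≤ (C / (R - r) ^ 2 * ∫ x in ball 0 R, g x ^ 2) ^ ((n:ℝ) / (n - 1)) := by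
  obtain ⟨Cs, hCs, hsob⟩ := sob n hn
  obtain ⟨C, hC, H⟩ := exists_cut n
  have hn' : (2:ℝ) ≤ n := by exact_mod_cast hn
  set χ : ℝ := (n:ℝ) / (n - 1) with hχ
  have hχ1 : 1 ≤ χ := by rw [hχ, le_div_iff₀ (by linarith)]; linarith
  refine ⟨Cs * (1 + 2 * (4 * L / l + 1) * C), ?_, fun a g r R h hg hs hr hR hR1 => ?_⟩
  · have : 0 ≤ 2 * (4 * L / l + 1) * C := by positivity
    nlinarith
  obtain ⟨φ, hφ⟩ := H r R hr hR
  let p : E n → ℝ := fun x => φ x * g x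
  have hp : ContDiff ℝ ∞ p := hφ.smooth.mul hg
  have hpc : HasCompactSupport p := hφ.cpt.mul_right
  have hgp : ∀ x, gr p x = φ x • gr g x + g x • gr φ x := by
    intro x; funext i
    simp only [gr, p]
    rw [pd_mul (hφ.smooth.dif x) (hg.dif x)]
    simp [gr]; ring
  let w : E n → ℝ := fun x => p x * p x
  have hw : ContDiff ℝ ∞ w := hp.mul hp
  have hgw : ∀ x, gr w x = (2 * p x) • gr p x := by
    intro x; funext i
    simp only [gr, w]
    rw [pd_mul (hp.dif x) (hp.dif x)]
    simp [gr]; ring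
  have hih : Integrable (fun x => p x ^ 2 + gr p x ⬝ᵥ gr p x) := by
    refine int_of_zero ((hp.continuous.pow 2).add (grsq_cont hp)) R fun x hx => ?_
    rw [hgp]; simp [p, hφ.zero x hx.le, hφ.gzero x hx.le]
  have key := hsob w (fun x => p x ^ 2 + gr p x ⬝ᵥ gr p x) hw hpc.mul_right
    ((hp.continuous.pow 2).add (grsq_cont hp)) hih ?_
  swap
  · intro x
    refine (fderiv_norm_le w x).trans ?_
    rw [hgw]
    have h0 := dot_self_nonneg (gr p x)
    apply Real.sqrt_le_iff.2 ⟨by positivity, ?_⟩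
    simp only [smul_dotProduct, dotProduct_smul, smul_eq_mul]
    nlinarith [sq_nonneg (p x ^ 2 - gr p x ⬝ᵥ gr p x)]
  have i1 : Integrable (fun x => φ x ^ 2 * g x ^ 2) := by
    refine int_of_zero ((hφ.smooth.continuous.pow 2).mul (hg.continuous.pow 2)) R fun x hx => ?_
    simp [hφ.zero x hx.le]
  have i2 : Integrable (fun x => φ x ^ 2 * (gr g x ⬝ᵥ gr g x)) := by
    refine int_of_zero ((hφ.smooth.continuous.pow 2).mul (grsq_cont hg)) R fun x hx => ?_
    simp [hφ.zero x hx.le]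
  have i3 : Integrable (fun x => g x ^ 2 * (gr φ x ⬝ᵥ gr φ x)) := by
    refine int_of_zero ((hg.continuous.pow 2).mul (grsq_cont hφ.smooth)) R fun x hx => ?_
    simp [hφ.gzero x hx.le]
  have hI0 : 0 ≤ ∫ x in ball 0 R, g x ^ 2 := integral_nonneg fun x => sq_nonneg _
  have b1 : ∫ x, φ x ^ 2 * g x ^ 2 ≤ ∫ x in ball 0 R, g x ^ 2 := by
    have e : ∫ x, φ x ^ 2 * g x ^ 2 = ∫ x in ball 0 R, φ x ^ 2 * g x ^ 2 := by
      rw [setIntegral_eq_integral_of_forall_compl_eq_zero]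
      intro x hx
      simp at hx
      rw [hφ.zero x hx]; simp
    rw [e]
    refine setIntegral_mono i1.integrableOn (intb (hg.continuous.pow 2) 0 R) fun x => ?_
    have : φ x ^ 2 ≤ 1 := pow_le_one₀ (hφ.nonneg x) (hφ.le_one x)
    simp only []
    nlinarith [sq_nonneg (g x)]
  have b2 := h.cacc0 hφ.smooth hφ.cpt hg hs
  have b3 := hφ.int_ge (f := fun x => g x ^ 2) (hg.continuous.pow 2) fun x => sq_nonneg _
  have hd : 0 < R - r := by linarith
  have hd1 : 1 ≤ 1 / (R - r) ^ 2 := by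
    rw [le_div_iff₀ (by positivity)]; nlinarith
  have b4 : ∫ x, (p x ^ 2 + gr p x ⬝ᵥ gr p x) ≤
      (1 + 2 * (4 * L / l + 1) * C) / (R - r) ^ 2 * ∫ x in ball 0 R, g x ^ 2 := by
    calc _ ≤ ∫ x, (φ x ^ 2 * g x ^ 2 + (2 * (φ x ^ 2 * (gr g x ⬝ᵥ gr g x)) + 2 * (g x ^ 2 * (gr φ x ⬝ᵥ gr φ x)))) := by
          refine integral_mono hih (i1.add ((i2.const_mul _).add (i3.const_mul _))) fun x => ?_
          have := dot_self_nonneg (φ x • gr g x - g x • gr φ x)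
          simp only [hgp, p]
          simp only [sub_dotProduct, dotProduct_sub, add_dotProduct, dotProduct_add, smul_dotProduct, dotProduct_smul, smul_eq_mul] at this ⊢
          nlinarith
      _ = (∫ x, φ x ^ 2 * g x ^ 2) + (2 * ∫ x, φ x ^ 2 * (gr g x ⬝ᵥ gr g x)) + 2 * ∫ x, (g x ^ 2 * (gr φ x ⬝ᵥ gr φ x)) := by
          have j2 := i2.const_mul 2
          have j3 := i3.const_mul 2
          have j4 : Integrable (fun x => 2 * (φ x ^ 2 * (gr g x ⬝ᵥ gr g x)) + 2 * (g x ^ 2 * (gr φ x ⬝ᵥ gr φ x))) := j2.add j3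
          rw [integral_add i1 j4, integral_add j2 j3, integral_const_mul, integral_const_mul]; ring
      _ ≤ (∫ x in ball 0 R, g x ^ 2) + 2 * (4 * L / l + 1) * (C / (R - r) ^ 2 * ∫ x in ball 0 R, g x ^ 2) := by
          have : 0 ≤ 4 * L / l := by positivity
          nlinarith
      _ ≤ (1 / (R - r) ^ 2 * ∫ x in ball 0 R, g x ^ 2) + 2 * (4 * L / l + 1) * (C / (R - r) ^ 2 * ∫ x in ball 0 R, g x ^ 2) := by
          nlinarith
      _ = _ := by ring
  have c1 : Continuous (fun x => |w x| ^ χ) := (hw.continuous.abs).rpow_const fun x => Or.inr (by linarith)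
  have iw : Integrable (fun x => |w x| ^ χ) := by
    refine int_of_zero c1 R fun x hx => ?_
    simp only [w, p, hφ.zero x hx.le, zero_mul, abs_zero]; exact Real.zero_rpow (by linarith)
  calc ∫ x in ball 0 r, (g x ^ 2) ^ χ = ∫ x in ball 0 r, |w x| ^ χ := by
        refine setIntegral_congr_fun measurableSet_ball fun x hx => ?_
        simp only [mem_ball_zero_iff] at hx
        simp only [w, p, hφ.one x hx.le]
        rw [abs_of_nonneg (by nlinarith [mul_self_nonneg (g x)])]; ring_nf
    _ ≤ ∫ x, |w x| ^ χ := setIntegral_le_integral iw (Eventually.of_forall fun x => by positivity)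
    _ ≤ _ := key
    _ ≤ Cs * ((1 + 2 * (4 * L / l + 1) * C) / (R - r) ^ 2 * ∫ x in ball 0 R, g x ^ 2) ^ χ := by
        gcongr
        exact integral_nonneg fun x => add_nonneg (sq_nonneg _) (dot_self_nonneg _)
    _ ≤ Cs ^ χ * ((1 + 2 * (4 * L / l + 1) * C) / (R - r) ^ 2 * ∫ x in ball 0 R, g x ^ 2) ^ χ := by
        gcongr
        exact Real.self_le_rpow_of_one_le hCs hχ1
    _ = _ := by
        rw [← Real.mul_rpow (by linarith) (by positivity)]; ring_nf

lemma moser_seq (n : ℕ) (hn : 2 ≤ n) (C : ℝ) (hC : 1 ≤ C) (I : ℕ → ℝ) (h0 : ∀ k, 0 ≤ I k)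
    (h : ∀ k, I (k+1) ≤ (C * 4 ^ k * I k) ^ ((n:ℝ) / (n - 1))) (k : ℕ) :
    I k ≤ (C ^ n * 4 ^ (n * (n - 1)) * I 0) ^ (((n:ℝ) / (n - 1)) ^ k) := by
  have hn' : (2:ℝ) ≤ n := by exact_mod_cast hn
  set χ : ℝ := (n:ℝ) / (n - 1) with hχ
  have hχ0 : 0 < χ := div_pos (by linarith) (by linarith)
  have e1 : χ * (n - 1) = n := by rw [hχ]; field_simp [show (n:ℝ) - 1 ≠ 0 by linarith]
  have key : ∀ k : ℕ, C ^ (n:ℝ) * 4 ^ ((n:ℝ) * k + n * (n - 1)) * I k ≤ (C ^ n * 4 ^ (n * (n - 1)) * I 0) ^ (χ ^ k) := by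
    intro k
    induction k with
    | zero =>
      simp only [pow_zero, Real.rpow_one, CharP.cast_eq_zero, mul_zero, zero_add, Real.rpow_natCast]
      have : (4:ℝ) ^ ((n:ℝ) * (n - 1)) = 4 ^ (n * (n - 1)) := by
        rw [← Real.rpow_natCast]; congr 1; push_cast [Nat.cast_sub (by omega : 1 ≤ n)]; ring
      rw [this]
    | succ k ih =>
      have hI := h0 k
      calc _ ≤ C ^ (n:ℝ) * 4 ^ ((n:ℝ) * (k+1:ℕ) + n * (n - 1)) * (C * 4 ^ k * I k) ^ χ := by gcongr; exact h k
        _ = (C ^ (n:ℝ) * 4 ^ ((n:ℝ) * k + n * (n - 1)) * I k) ^ χ := by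
            have hC0 : 0 < C := by linarith
            rw [Real.mul_rpow (by positivity) hI, Real.mul_rpow (by positivity) (by positivity),
             Real.mul_rpow (by positivity) hI, Real.mul_rpow (by positivity) (by positivity),
             ← Real.rpow_mul hC0.le, ← Real.rpow_mul (by norm_num), ← Real.rpow_natCast 4 k, ← Real.rpow_mul (by norm_num)]
            have a1 : (C:ℝ) ^ ((n:ℝ) * χ) = C ^ (n:ℝ) * C ^ χ := by
              rw [← Real.rpow_add hC0]; congr 1; nlinarith
            have a2 : (4:ℝ) ^ (((n:ℝ) * k + n * (n - 1)) * χ) = 4 ^ ((n:ℝ) * (k+1:ℕ) + n * (n - 1)) * 4 ^ ((k:ℝ) * χ) := by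
              rw [← Real.rpow_add (by norm_num)]; congr 1; push_cast
              linear_combination (n + k : ℝ) * e1
            rw [a1, a2]; ring
        _ ≤ ((C ^ n * 4 ^ (n * (n - 1)) * I 0) ^ (χ ^ k)) ^ χ := by gcongr
        _ = _ := by
            have := h0 0
            rw [← Real.rpow_mul (by positivity), pow_succ]
  refine le_trans ?_ (key k)
  have h1 : 1 ≤ C ^ (n:ℝ) := Real.one_le_rpow hC (by linarith)
  have h2 : 1 ≤ (4:ℝ) ^ ((n:ℝ) * k + n * (n - 1)) := Real.one_le_rpow (by norm_num) (by
    have : (0:ℝ) ≤ k := by positivity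
    nlinarith)
  nlinarith [h0 k, mul_le_mul h1 h2 (by norm_num) (by linarith)]

lemma moser (n : ℕ) (hn : 2 ≤ n) (l L : ℝ) (hl : 0 < l) (hL : 0 < L) : ∃ C : ℝ, 0 < C ∧
    ∀ (a : E n → Mt n) (g : E n → ℝ),
    Coef a l L → ContDiff ℝ ∞ g → (∀ x, 0 < g x) → (∀ x, 0 ≤ (a x * hess g x).trace) →
    ∀ x ∈ ball (0 : E n) (1/2), g x ^ 2 ≤ C * ∫ x in ball 0 1, g x ^ 2 := by
  obtain ⟨C, hC, H⟩ := moser_step n hn l L hl hL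
  have hn' : (2:ℝ) ≤ n := by exact_mod_cast hn
  set χ : ℝ := (n:ℝ) / (n - 1) with hχ
  have hχ1 : 1 < χ := by rw [hχ, lt_div_iff₀ (by linarith)]; linarith
  refine ⟨(C * 16) ^ n * 4 ^ (n * (n - 1)), by positivity, fun a g h hg hpos hs x₀ hx₀ => ?_⟩
  let r : ℕ → ℝ := fun k => 1 / 2 + (1/2) * (1/2) ^ k
  have hr : ∀ k, 1/2 < r k := fun k => by
    have : (0:ℝ) < (1/2) ^ k := by positivity
    simp only [r]; linarith
  have hr1 : ∀ k, r k ≤ 1 := fun k => by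
    have : (1/2:ℝ) ^ k ≤ 1 := pow_le_one₀ (by norm_num) (by norm_num)
    simp only [r]; linarith
  let G : ℕ → E n → ℝ := fun k x => g x ^ (χ ^ k)
  have hG : ∀ k, ContDiff ℝ ∞ (G k) := fun k => hg.rpow_const_of_ne fun x => (hpos x).ne'
  have hGs : ∀ k x, 0 ≤ G k x * (a x * hess (G k) x).trace := by
    intro k x
    have hc : 1 ≤ χ ^ k := one_le_pow₀ hχ1.le
    refine mul_nonneg (Real.rpow_nonneg (hpos x).le _) ?_
    have e := hess_chain hg (x := x) (ψ := fun t => t ^ (χ ^ k)) (ψ' := fun t => χ ^ k * t ^ (χ ^ k - 1))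
      (d := χ ^ k * ((χ ^ k - 1) * g x ^ (χ ^ k - 1 - 1)))
      (fun y => Real.hasDerivAt_rpow_const (Or.inl (hpos y).ne'))
      ((Real.hasDerivAt_rpow_const (Or.inl (hpos x).ne')).const_mul _)
    simp only [G]
    rw [e, Matrix.mul_add, Matrix.trace_add, Matrix.mul_smul, Matrix.mul_smul, Matrix.trace_smul, Matrix.trace_smul,
      trace_mul_vecMulVec, smul_eq_mul, smul_eq_mul]
    have := hpos x
    have h3 : 0 ≤ χ ^ k - 1 := by linarith
    exact add_nonneg (mul_nonneg (by positivity) (hs x)) (mul_nonneg (by positivity) (h.nonneg x _))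
  let I : ℕ → ℝ := fun k => ∫ x in ball 0 (r k), G k x ^ 2
  have hI0 : ∀ k, 0 ≤ I k := fun k => integral_nonneg fun x => sq_nonneg _
  have hI : ∀ k, I (k+1) ≤ (C * 16 * 4 ^ k * I k) ^ χ := by
    intro k
    have hlt : r (k+1) < r k := by
      have : (0:ℝ) < (1/2) ^ k := by positivity
      simp only [r, pow_succ]; linarith
    have key := H a (G k) (r (k+1)) (r k) h (hG k) (hGs k) (by linarith [hr (k+1)]) hlt (hr1 k)
    have e1 : C / (r k - r (k+1)) ^ 2 = C * 16 * 4 ^ k := by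
      have : r k - r (k+1) = 1 / (4 * 2 ^ k) := by
        simp only [r, pow_succ, div_pow, one_pow]; field_simp; ring
      rw [this, show (4:ℝ) ^ k = (2 ^ k) ^ 2 by rw [← pow_mul, mul_comm, pow_mul]; norm_num]
      field_simp; ring
    rw [e1] at key
    refine le_trans (le_of_eq ?_) key
    refine setIntegral_congr_fun measurableSet_ball fun x hx => ?_
    have hp := hpos x
    simp only [G]
    rw [← Real.rpow_natCast (_) 2, ← Real.rpow_natCast (_) 2, ← Real.rpow_mul hp.le, ← Real.rpow_mul hp.le,
      ← Real.rpow_mul hp.le, pow_succ]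
    congr 1; ring
  have bound := moser_seq n hn (C * 16) (by linarith) I hI0 hI
  rw [← hχ] at bound
  have hI00 : I 0 = ∫ x in ball 0 1, g x ^ 2 := by
    simp only [I, G, r]; norm_num
  rw [← hI00]
  set M := (C * 16) ^ n * 4 ^ (n * (n - 1)) * I 0 with hM
  have hM0 : 0 ≤ M := by have := hI0 0; positivity
  by_contra hcon
  push Not at hcon
  obtain ⟨q, hq1, hq2⟩ := exists_between hcon
  have hq0 : 0 < q := lt_of_le_of_lt hM0 hq1
  have hopen : IsOpen (ball (0 : E n) (1/2) ∩ {x | q < g x ^ 2}) :=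
    isOpen_ball.inter (isOpen_lt continuous_const (hg.continuous.pow 2))
  set N := ball (0 : E n) (1/2) ∩ {x | q < g x ^ 2} with hN
  have hv : 0 < volume N := hopen.measure_pos volume ⟨x₀, hx₀, hq2⟩
  have hvt : volume N ≠ ⊤ := ((measure_mono inter_subset_left).trans_lt measure_ball_lt_top).ne
  have hv' : 0 < volume.real N := ENNReal.toReal_pos hv.ne' hvt
  have low : ∀ k, volume.real N * q ^ (χ ^ k) ≤ I k := by
    intro k
    calc volume.real N * q ^ (χ ^ k) = ∫ x in N, q ^ (χ ^ k) := by simp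
      _ ≤ ∫ x in N, G k x ^ 2 := by
        refine setIntegral_mono_on (integrableOn_const hvt) ?_ hopen.measurableSet fun x hx => ?_
        · exact (intb ((hG k).continuous.pow 2) 0 (1/2)).mono_set inter_subset_left
        · have h1 : G k x ^ 2 = (g x ^ 2) ^ (χ ^ k) := by
            have hp := hpos x
            simp only [G]
            rw [← Real.rpow_natCast (_) 2, ← Real.rpow_natCast (_) 2, ← Real.rpow_mul hp.le, ← Real.rpow_mul hp.le,
              mul_comm]
          rw [h1]
          exact Real.rpow_le_rpow hq0.le hx.2.le (by positivity)
      _ ≤ I k := by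
        refine setIntegral_mono_set (intb ((hG k).continuous.pow 2) 0 (r k)) (Eventually.of_forall fun x => sq_nonneg _)
          (HasSubset.Subset.eventuallyLE ?_)
        exact inter_subset_left.trans (ball_subset_ball (hr k).le)
  have comp : ∀ k, volume.real N ≤ (M / q) ^ (χ ^ k) := by
    intro k
    rw [Real.div_rpow hM0 hq0.le, le_div_iff₀ (Real.rpow_pos_of_pos hq0 _)]
    exact (low k).trans (bound k)
  have lim : Tendsto (fun k : ℕ => (M / q) ^ (χ ^ k)) atTop (𝓝 0) :=
    (tendsto_rpow_atTop_of_base_lt_one (M / q) (by have : 0 ≤ M / q := by positivity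
                                                   linarith) (by rw [div_lt_one hq0]; exact hq1)).comp
      (tendsto_pow_atTop_atTop_of_one_lt hχ1)
  have := ge_of_tendsto' lim comp
  linarith

lemma sq_int_le {f : ℝ → ℝ} (hf : Continuous f) : (∫ t in (0:ℝ)..1, f t) ^ 2 ≤ ∫ t in (0:ℝ)..1, f t ^ 2 := by
  set c := ∫ t in (0:ℝ)..1, f t with hc
  have h0 : 0 ≤ ∫ t in (0:ℝ)..1, (f t - c) ^ 2 :=
    intervalIntegral.integral_nonneg (by norm_num) fun t _ => sq_nonneg _
  have e : (fun t => (f t - c) ^ 2) = fun t => (f t ^ 2 - (2 * c) * f t) + c ^ 2 := by funext t; ring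
  have i1 : IntervalIntegrable (fun t => f t ^ 2) volume 0 1 := (hf.pow 2).intervalIntegrable _ _
  have i2 : IntervalIntegrable (fun t => (2 * c) * f t) volume 0 1 := (hf.const_mul (2 * c)).intervalIntegrable _ _
  rw [e, intervalIntegral.integral_add (i1.sub i2) (by simp), intervalIntegral.integral_sub i1 i2,
    intervalIntegral.integral_const_mul, ← hc] at h0
  simp at h0
  nlinarith

lemma line_ftc {g : E n → ℝ} (hg : ContDiff ℝ ∞ g) (y h : E n) :
    g (y + h) - g y = ∫ t in (0:ℝ)..1, fderiv ℝ g (y + t • h) h := by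
  have hd : ∀ t : ℝ, HasDerivAt (fun t : ℝ => g (y + t • h)) (fderiv ℝ g (y + t • h) h) t := by
    intro t
    have h1 : HasDerivAt (fun t : ℝ => y + t • h) h t := by
      simpa using ((hasDerivAt_id t).smul_const h).const_add y
    exact (hg.dif _).hasFDerivAt.comp_hasDerivAt t h1
  have hc : Continuous (fun t : ℝ => fderiv ℝ g (y + t • h) h) := by
    have : Continuous (fderiv ℝ g) := hg.continuous_fderiv (by simp)
    exact (this.comp (by fun_prop)).clm_apply continuous_const
  rw [intervalIntegral.integral_eq_sub_of_hasDerivAt (fun t _ => hd t) (hc.intervalIntegrable _ _)]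
  simp

lemma line_sq {g : E n → ℝ} (hg : ContDiff ℝ ∞ g) (y h : E n) :
    (g (y + h) - g y) ^ 2 ≤ ‖h‖ ^ 2 * ∫ t in (0:ℝ)..1, gr g (y + t • h) ⬝ᵥ gr g (y + t • h) := by
  have hc : Continuous (fun t : ℝ => fderiv ℝ g (y + t • h) h) := by
    have : Continuous (fderiv ℝ g) := hg.continuous_fderiv (by simp)
    exact (this.comp (by fun_prop)).clm_apply continuous_const
  have hc2 : Continuous (fun t : ℝ => gr g (y + t • h) ⬝ᵥ gr g (y + t • h)) :=
    (grsq_cont hg).comp (by fun_prop)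
  rw [line_ftc hg, ← intervalIntegral.integral_const_mul]
  refine (sq_int_le hc).trans ?_
  refine intervalIntegral.integral_mono_on (by norm_num) ((hc.pow 2).intervalIntegrable _ _)
    ((hc2.const_mul _).intervalIntegrable _ _) fun t _ => ?_
  exact fderiv_sq_le g _ h

lemma tonelli_shift {H : E n → ENNReal} (hH : Measurable H) (S : Set (E n)) (hS : MeasurableSet S) :
    ∫⁻ y, ∫⁻ h in S, ∫⁻ t in Ioc (0:ℝ) 1, H (y + t • h) = volume S * ∫⁻ y, H y := by
  have m1 : Measurable (fun p : (E n × E n) × ℝ => H (p.1.1 + p.2 • p.1.2)) := hH.comp (by fun_prop)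
  rw [lintegral_lintegral_swap]
  · have : ∀ h : E n, ∫⁻ y, ∫⁻ t in Ioc (0:ℝ) 1, H (y + t • h) = ∫⁻ y, H y := by
      intro h
      rw [lintegral_lintegral_swap]
      · have : ∀ t : ℝ, ∫⁻ y, H (y + t • h) = ∫⁻ y, H y := fun t => lintegral_add_right_eq_self H (t • h)
        simp [this]
      · exact (hH.comp (by fun_prop)).aemeasurable
    simp [this, mul_comm]
  · exact (m1.lintegral_prod_right').aemeasurable

lemma poinc {g : E n → ℝ} (hg : ContDiff ℝ ∞ g) :
    ∫⁻ y in ball (0 : E n) 1, ∫⁻ x in ball (0 : E n) 1, ENNReal.ofReal ((g x - g y) ^ 2) ≤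
      4 * volume (ball (0 : E n) 2) * ∫⁻ x in ball (0 : E n) 1, ENNReal.ofReal (gr g x ⬝ᵥ gr g x) := by
  set B := ball (0 : E n) 1 with hB
  let H : E n → ENNReal := fun x => 4 * B.indicator (fun x => ENNReal.ofReal (gr g x ⬝ᵥ gr g x)) x
  have mG : Measurable (fun x => ENNReal.ofReal (gr g x ⬝ᵥ gr g x)) := (grsq_cont hg).measurable.ennreal_ofReal
  have mH : Measurable H := (mG.indicator measurableSet_ball).const_mul 4
  have key := tonelli_shift mH (ball (0 : E n) 2) measurableSet_ball
  have e1 : ∫⁻ y, H y = 4 * ∫⁻ x in B, ENNReal.ofReal (gr g x ⬝ᵥ gr g x) := by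
    simp only [H]
    rw [lintegral_const_mul _ (mG.indicator measurableSet_ball), lintegral_indicator measurableSet_ball]
  rw [e1] at key
  calc _ ≤ ∫⁻ y, ∫⁻ h in ball (0 : E n) 2, ∫⁻ t in Ioc (0:ℝ) 1, H (y + t • h) := ?_
    _ = _ := by rw [key]; ring
  rw [← lintegral_indicator measurableSet_ball]
  refine lintegral_mono fun y => ?_
  by_cases hy : y ∈ B
  swap
  · rw [indicator_of_notMem hy]; exact zero_le
  rw [indicator_of_mem hy, ← lintegral_indicator measurableSet_ball, ← lintegral_indicator measurableSet_ball,
    ← lintegral_add_left_eq_self _ y]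
  refine lintegral_mono fun h => ?_
  simp only []
  by_cases hh : y + h ∈ B
  swap
  · rw [indicator_of_notMem hh]; exact zero_le
  rw [indicator_of_mem hh]
  have hh2 : ‖h‖ < 2 := by
    have h1 : ‖y + h‖ < 1 := by simpa [hB] using hh
    have h2 : ‖y‖ < 1 := by simpa [hB] using hy
    calc ‖h‖ = ‖(y + h) - y‖ := by congr 1; abel
      _ ≤ ‖y + h‖ + ‖y‖ := norm_sub_le _ _
      _ < 2 := by linarith
  rw [indicator_of_mem (by simpa using hh2)]
  have hc2 : Continuous (fun t : ℝ => 4 * (gr g (y + t • h) ⬝ᵥ gr g (y + t • h))) :=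
    ((grsq_cont hg).comp (by fun_prop)).const_mul 4
  calc ENNReal.ofReal ((g (y + h) - g y) ^ 2) ≤
        ENNReal.ofReal (∫ t in (0:ℝ)..1, 4 * (gr g (y + t • h) ⬝ᵥ gr g (y + t • h))) := by
        apply ENNReal.ofReal_le_ofReal
        refine (line_sq hg y h).trans ?_
        rw [intervalIntegral.integral_const_mul]
        gcongr
        · exact intervalIntegral.integral_nonneg (by norm_num) fun t _ => dot_self_nonneg _
        · nlinarith [norm_nonneg h]
    _ = ∫⁻ t in Ioc (0:ℝ) 1, ENNReal.ofReal (4 * (gr g (y + t • h) ⬝ᵥ gr g (y + t • h))) := by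
        rw [intervalIntegral.integral_of_le (by norm_num), ofReal_integral_eq_lintegral_ofReal]
        · exact (hc2.integrableOn_Icc).mono_set Ioc_subset_Icc_self
        · exact Eventually.of_forall fun t => mul_nonneg (by norm_num) (dot_self_nonneg _)
    _ ≤ _ := by
        refine setLIntegral_mono (mH.comp (by fun_prop)) fun t ht => ?_
        have hm : y + t • h ∈ B := by
          have := (convex_ball (0 : E n) 1).add_smul_mem hy hh ⟨ht.1.le, ht.2⟩
          exact this
        simp only [H]
        rw [indicator_of_mem hm, ENNReal.ofReal_mul (by norm_num)]
        simp

lemma dbl_lint {g : E n → ℝ} (hg : Continuous g) (B : Set (E n)) (c : ENNReal) :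
    ∫⁻ y in B, ∫⁻ x in B, (2 * ENNReal.ofReal ((g x - g y) ^ 2) + c)
      = 2 * (∫⁻ y in B, ∫⁻ x in B, ENNReal.ofReal ((g x - g y) ^ 2)) + c * volume B * volume B := by
  have m : Measurable (fun p : E n × E n => ENNReal.ofReal ((g p.2 - g p.1) ^ 2)) := by
    apply Measurable.ennreal_ofReal
    exact Continuous.measurable (by fun_prop)
  have m1 : ∀ y, Measurable (fun x => ENNReal.ofReal ((g x - g y) ^ 2)) := fun y => by
    apply Measurable.ennreal_ofReal
    exact Continuous.measurable (by fun_prop)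
  have e : ∀ y, ∫⁻ x in B, (2 * ENNReal.ofReal ((g x - g y) ^ 2) + c)
      = 2 * (∫⁻ x in B, ENNReal.ofReal ((g x - g y) ^ 2)) + c * volume B := by
    intro y
    rw [lintegral_add_right _ measurable_const, lintegral_const_mul _ (m1 y), setLIntegral_const]
  rw [lintegral_congr e, lintegral_add_right _ measurable_const, setLIntegral_const,
    lintegral_const_mul _ (m.lintegral_prod_right')]

set_option maxHeartbeats 1600000 in
lemma weak_harnack (n : ℕ) (hn : 2 ≤ n) (l L ε : ℝ) (hl : 0 < l) (hL : 0 < L) (hε : 0 < ε) : ∃ c : ℝ, 0 < c ∧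
    ∀ (a : E n → Mt n) (z : E n → ℝ),
    Coef a l L → ContDiff ℝ ∞ z → (∀ x, 0 ≤ z x) → (∀ x, z x ≤ 1) → (∀ x, (a x * hess z x).trace ≤ 0) →
    ε ≤ ∫ x in ball 0 1, z x → ∀ x ∈ ball (0 : E n) (1/2), c ≤ z x := by
  obtain ⟨C1, hC1, Hlog⟩ := log_ball n l L hl hL
  obtain ⟨Cm, hCm, Hmos⟩ := moser n hn l L hl hL
  set B := ball (0 : E n) 1 with hB
  set V := volume.real B with hV
  have hBt : volume B ≠ ⊤ := measure_ball_lt_top.ne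
  have hV0 : 0 < V := ENNReal.toReal_pos (measure_ball_pos volume _ one_pos).ne' hBt
  set V2 := volume.real (ball (0 : E n) 2) with hV2
  have hV2n : 0 ≤ V2 := measureReal_nonneg
  set M := 1 + Real.log 2 - Real.log (ε / (2 * V)) with hM
  set K := 2 * (4 * V2 * C1) + 2 * M ^ 2 * V * V with hK
  set Q := Cm * (2 * K / ε) with hQ
  refine ⟨Real.exp (- √ Q), Real.exp_pos _, fun a z h hz hz0 hz1 hsup hint x hx => ?_⟩
  refine le_of_forall_pos_lt_add fun s' hs' => ?_
  obtain ⟨s, hs0, hs1⟩ := exists_between (lt_min hs' one_pos)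
  have hss : s < s' := hs1.trans_le (min_le_left _ _)
  have hs1 : s < 1 := hs1.trans_le (min_le_right _ _)
  have hzs : ∀ y, 0 < z y + s := fun y => by linarith [hz0 y]
  let g : E n → ℝ := fun y => 1 + Real.log 2 - Real.log (z y + s)
  have hg : ContDiff ℝ ∞ g :=
    contDiff_const.sub ((hz.add contDiff_const).log fun y => (hzs y).ne')
  have d1 : ∀ y, HasDerivAt (fun t => 1 + Real.log 2 - Real.log (t + s)) (- (1 / (z y + s))) (z y) := by
    intro y
    have := ((hasDerivAt_id (z y)).add_const s).log (hzs y).ne'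
    simpa using this.const_sub (1 + Real.log 2)
  have d2 : ∀ y, HasDerivAt (fun t => - (1 / (t + s))) (1 / (z y + s) ^ 2) (z y) := by
    intro y
    have h0 : HasDerivAt (fun t : ℝ => t + s) 1 (z y) := (hasDerivAt_id (z y)).add_const s
    have h1 : HasDerivAt (fun t : ℝ => - (t + s)⁻¹) _ (z y) := (h0.fun_inv (hzs y).ne').neg
    simp only [one_div]
    refine h1.congr_deriv ?_
    rw [neg_div, neg_neg, one_div]
  have hgr : ∀ y, gr g y = (- (1 / (z y + s))) • gr z y := by
    intro y; funext i
    exact pd_comp (hz.dif y) (d1 y) i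
  have hsub : ∀ y, gr g y ⬝ᵥ a y *ᵥ gr g y ≤ (a y * hess g y).trace := by
    intro y
    have e := hess_chain hz (x := y) (ψ' := fun t => - (1 / (t + s))) d1 (d2 y)
    simp only [g]
    rw [e, Matrix.mul_add, Matrix.trace_add, Matrix.mul_smul, Matrix.mul_smul, Matrix.trace_smul, Matrix.trace_smul,
      trace_mul_vecMulVec, smul_eq_mul, smul_eq_mul]
    have e2 := hgr y
    simp only [g] at e2
    rw [e2]
    simp only [Matrix.mulVec_smul, smul_dotProduct, dotProduct_smul, smul_eq_mul]
    have h1 : 0 ≤ 1 / (z y + s) := (one_div_pos.2 (hzs y)).le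
    have h2 := mul_nonneg h1 (sub_nonneg.2 (hsup y))
    have h3 : 1 / (z y + s) ^ 2 = (1 / (z y + s)) * (1 / (z y + s)) := by rw [sq, one_div_mul_one_div]
    rw [h3]
    nlinarith
  have hg1 : ∀ y, 1 ≤ g y := by
    intro y
    have : Real.log (z y + s) ≤ Real.log 2 := Real.log_le_log (hzs y) (by linarith [hz1 y])
    simp only [g]; linarith
  have hlog := Hlog a g h hg hsub
  have hp := poinc hg
  rw [← ofReal_integral_eq_lintegral_ofReal (intb (grsq_cont hg) 0 1) (Eventually.of_forall fun y => dot_self_nonneg _)] at hp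
  -- the good set
  set A := B ∩ {y | ε / (2 * V) ≤ z y} with hA
  have mA : MeasurableSet A := measurableSet_ball.inter (isClosed_le continuous_const hz.continuous).measurableSet
  have hAt : volume A ≠ ⊤ := ((measure_mono inter_subset_left).trans_lt measure_ball_lt_top).ne
  have hAv : ε / 2 ≤ volume.real A := by
    have h1 : ∫ y in B, z y ≤ ∫ y in B, (A.indicator (fun _ => (1:ℝ)) y + ε / (2 * V)) := by
      have i1 : IntegrableOn (fun y => A.indicator (fun _ => (1:ℝ)) y) B :=
        (integrableOn_const hBt).indicator mA
      refine setIntegral_mono_on (intb hz.continuous 0 1) (i1.add (integrableOn_const hBt)) measurableSet_ball fun y hy => ?_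
      by_cases hyA : y ∈ A
      · rw [indicator_of_mem hyA]
        have : 0 ≤ ε / (2 * V) := by positivity
        linarith [hz1 y]
      · rw [indicator_of_notMem hyA]
        have : ¬ (ε / (2 * V) ≤ z y) := fun hc => hyA ⟨hy, hc⟩
        linarith
    have i1 : IntegrableOn (fun y => A.indicator (fun _ => (1:ℝ)) y) B :=
        (integrableOn_const hBt).indicator mA
    rw [integral_add i1 (integrableOn_const hBt), setIntegral_indicator mA] at h1
    have e : B ∩ A = A := inter_eq_right.2 inter_subset_left
    rw [e] at h1
    simp only [setIntegral_const, smul_eq_mul, mul_one, ← hV] at h1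
    have e2 : V * (ε / (2 * V)) = ε / 2 := by field_simp
    rw [e2] at h1
    linarith
  have hgM : ∀ y ∈ A, g y ≤ M := by
    intro y hy
    have : Real.log (ε / (2 * V)) ≤ Real.log (z y + s) := Real.log_le_log (by positivity) (by
      have := hy.2; simp only [mem_setOf_eq] at this; linarith)
    simp only [g, hM]; linarith
  have hG2 : ∫⁻ x in B, ENNReal.ofReal (g x ^ 2) = ENNReal.ofReal (∫ x in B, g x ^ 2) :=
    (ofReal_integral_eq_lintegral_ofReal (intb (hg.continuous.pow 2) 0 1) (Eventually.of_forall fun y => sq_nonneg _)).symm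
  have hV2' : volume (ball (0 : E n) 2) = ENNReal.ofReal V2 := (ENNReal.ofReal_toReal measure_ball_lt_top.ne).symm
  have hVB : volume B = ENNReal.ofReal V := (ENNReal.ofReal_toReal hBt).symm
  have hVA : volume A = ENNReal.ofReal (volume.real A) := (ENNReal.ofReal_toReal hAt).symm
  have big : volume A * ENNReal.ofReal (∫ x in B, g x ^ 2) ≤ ENNReal.ofReal K := by
    calc volume A * ENNReal.ofReal (∫ x in B, g x ^ 2) = ∫⁻ y in A, ∫⁻ x in B, ENNReal.ofReal (g x ^ 2) := by
          rw [hG2]; simp [mul_comm]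
      _ ≤ ∫⁻ y in A, ∫⁻ x in B, (2 * ENNReal.ofReal ((g x - g y) ^ 2) + ENNReal.ofReal (2 * M ^ 2)) := by
          refine setLIntegral_mono' mA fun y hy => lintegral_mono fun x => ?_
          rw [← ENNReal.ofReal_ofNat 2, ← ENNReal.ofReal_mul (by norm_num), ← ENNReal.ofReal_add (by positivity) (by positivity)]
          apply ENNReal.ofReal_le_ofReal
          have h1 := hgM y hy
          have h2 := hg1 y
          nlinarith [sq_nonneg (g x - 2 * g y)]
      _ ≤ ∫⁻ y in B, ∫⁻ x in B, (2 * ENNReal.ofReal ((g x - g y) ^ 2) + ENNReal.ofReal (2 * M ^ 2)) :=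
          lintegral_mono_set inter_subset_left
      _ = 2 * (∫⁻ y in B, ∫⁻ x in B, ENNReal.ofReal ((g x - g y) ^ 2)) + ENNReal.ofReal (2 * M ^ 2) * volume B * volume B := by
          exact dbl_lint hg.continuous _ _
      _ ≤ 2 * (4 * ENNReal.ofReal V2 * ENNReal.ofReal C1) + ENNReal.ofReal (2 * M ^ 2) * volume B * volume B := by
          gcongr
          refine hp.trans ?_
          rw [hV2']
          gcongr
      _ = ENNReal.ofReal K := by
          have hV20 : 0 ≤ V2 := measureReal_nonneg
          have e4 : (4 : ENNReal) = ENNReal.ofReal 4 := by simp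
          have e2 : (2 : ENNReal) = ENNReal.ofReal 2 := by simp
          rw [hVB, hK, e4, e2, ← ENNReal.ofReal_mul (by positivity), ← ENNReal.ofReal_mul (by positivity),
            ← ENNReal.ofReal_mul (by positivity), ← ENNReal.ofReal_mul (by positivity), ← ENNReal.ofReal_mul (by positivity),
            ← ENNReal.ofReal_add (by positivity) (by positivity)]
  have hI0 : 0 ≤ ∫ x in B, g x ^ 2 := integral_nonneg fun x => sq_nonneg _
  have hK0 : 0 ≤ K := by positivity
  rw [hVA, ← ENNReal.ofReal_mul (by positivity), ENNReal.ofReal_le_ofReal_iff hK0] at big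
  have hI : ∫ x in B, g x ^ 2 ≤ 2 * K / ε := by
    rw [le_div_iff₀ hε]; nlinarith
  have hm := Hmos a g h hg (fun y => by linarith [hg1 y]) (fun y => (h.nonneg y _).trans (hsub y)) x hx
  have hgQ : g x ^ 2 ≤ Q := hm.trans (by rw [hQ]; gcongr)
  have hgs : g x ≤ √ Q := Real.le_sqrt_of_sq_le hgQ
  have hl : - √ Q ≤ Real.log (z x + s) := by
    have : 0 < Real.log 2 := Real.log_pos (by norm_num)
    simp only [g] at hgs; linarith
  rw [Real.le_log_iff_exp_le (hzs x)] at hl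
  linarith

lemma wh_infty (n : ℕ) (hn : 2 ≤ n) {l L : ℝ} {a : E n → Mt n} {z : E n → ℝ} (h : Coef a l L) (hz : ContDiff ℝ ∞ z)
    (hz0 : ∀ x, 0 ≤ z x) (Mz : ℝ) (hM : 0 < Mz) (hzM : ∀ x, z x ≤ Mz) (hsup : ∀ x, (a x * hess z x).trace ≤ 0)
    (hinf : ∀ c > 0, ∃ x, z x < c) (ε : ℝ) (hε : 0 < ε) :
    ∃ R0 : ℝ, 0 < R0 ∧ ∀ R ≥ R0, ∫ x in ball (0 : E n) 1, z (R • x) ≤ ε := by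
  obtain ⟨c, hc, H⟩ := weak_harnack n hn l L (ε / Mz) h.hl h.hL (by positivity)
  obtain ⟨x0, hx0⟩ := hinf (c * Mz) (by positivity)
  refine ⟨2 * ‖x0‖ + 1, by positivity, fun R hR => ?_⟩
  have hR0 : 0 < R := lt_of_lt_of_le (by positivity) hR
  by_contra hcon
  push Not at hcon
  have hz' : ContDiff ℝ ∞ (fun y : E n => z (0 + R • y)) := hz.comp (by fun_prop)
  have key := H (fun y => a (0 + R • y)) (fun y => (1 / Mz) * z (0 + R • y)) (h.scale 0 hR0) (contDiff_const.mul hz')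
    (fun x => mul_nonneg (by positivity) (hz0 _)) (fun x => by
      rw [one_div, inv_mul_le_iff₀ hM, mul_one]; exact hzM _) (fun x => by
      rw [hess_const_mul hz', hess_scale hz, Matrix.mul_smul, Matrix.mul_smul, Matrix.trace_smul, Matrix.trace_smul]
      have := hsup (0 + R • x)
      simp only [smul_eq_mul]
      have h1 : 0 ≤ 1 / Mz * R ^ 2 := by positivity
      nlinarith) (by
      rw [integral_const_mul]
      simp only [zero_add]
      rw [div_eq_mul_one_div, mul_comm]
      gcongr) (R⁻¹ • x0) (by
      rw [mem_ball_zero_iff, norm_smul, norm_inv, Real.norm_eq_abs, abs_of_pos hR0, inv_mul_lt_iff₀ hR0]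
      linarith)
  rw [smul_smul, mul_inv_cancel₀ hR0.ne', one_smul, zero_add] at key
  rw [one_div, le_inv_mul_iff₀ hM] at key
  linarith

structure Eta (C : ℝ) (η Φ : E n → ℝ) : Prop where
  hC : 0 < C
  sm : ContDiff ℝ ∞ η
  smΦ : ContDiff ℝ ∞ Φ
  cptΦ : HasCompactSupport Φ
  nonneg : ∀ z, 0 ≤ η z
  bd : ∀ z, η z ≤ C
  zero : ∀ z, 1 ≤ ‖z‖ → η z = 0
  int : ∫ z, η z = 1
  pdΦ : ∀ i z, pd i Φ z = - (η z * z i)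
  lip : ∀ x y, |η x - η y| ≤ C * ‖x - y‖

lemma exists_eta (n : ℕ) (hn : 2 ≤ n) : ∃ (C : ℝ) (η Φ : E n → ℝ), Eta C η Φ := by
  let st := Real.smoothTransition
  have hst : ContDiff ℝ ∞ st := Real.smoothTransition.contDiff (n := ⊤)
  have hst' : ContDiff ℝ ∞ (deriv st) := (contDiff_infty_iff_deriv.1 hst).2
  have hdd : ∀ t, HasDerivAt st (deriv st t) t := fun t => (hst.differentiable (by simp) t).hasDerivAt
  have hd0 : ∀ t, 0 ≤ deriv st t := fun t => Real.smoothTransition.monotone.deriv_nonneg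
  have hdz : ∀ t : ℝ, t ≤ 0 → deriv st t = 0 := by
    intro t ht
    have hm : IsLocalMin st t := by
      filter_upwards with s
      simp only [st]
      rw [Real.smoothTransition.zero_of_nonpos ht]; exact Real.smoothTransition.nonneg _
    exact hm.deriv_eq_zero
  let q : E n → ℝ := fun x => 1 - ‖x‖ ^ 2
  have hq : ContDiff ℝ ∞ q := contDiff_const.sub (contDiff_norm_sq ℝ)
  have hqd : ∀ x i, pd i q x = - (2 * x i) := by
    intro x i
    have e : q = fun x => 1 - ∑ j, x j * x j := by
      funext x; simp only [q]; rw [norm_sq_eq]; simp only [sq]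
    have hs : ContDiff ℝ ∞ (fun x : E n => ∑ j, x j * x j) := by fun_prop
    rw [e, pd_sub (contDiff_const.dif x) (hs.dif x),
      pd_const, pd_sum _ (fun j _ => ((smooth_coord j).mul (smooth_coord j)).dif x)]
    have : ∀ j, pd i (fun y : E n => y j * y j) x = if i = j then 2 * x j else 0 := by
      intro j
      rw [pd_mul ((smooth_coord j).dif x) ((smooth_coord j).dif x), pd_coord]
      split_ifs <;> ring
    simp [this]
  have hqn : ∀ x : E n, 1 ≤ ‖x‖ → q x ≤ 0 := fun x hx => by simp only [q]; nlinarith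
  let e0 : E n → ℝ := fun x => 2 * deriv st (q x)
  have se0 : ContDiff ℝ ∞ e0 := contDiff_const.mul (hst'.comp hq)
  have ze0 : ∀ x : E n, 1 ≤ ‖x‖ → e0 x = 0 := fun x hx => by simp only [e0]; rw [hdz _ (hqn x hx)]; simp
  have ce0 : HasCompactSupport e0 := HasCompactSupport.intro (isCompact_closedBall (0 : E n) 1) fun x hx => ze0 x (by
    simp at hx; exact hx.le)
  have ne0 : 0 ≤ e0 := fun x => mul_nonneg (by norm_num) (hd0 _)
  have pos : 0 < ∫ x, e0 x := by
    obtain ⟨t, ht, h⟩ := exists_deriv_eq_slope st (zero_lt_one) hst.continuous.continuousOn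
      (hst.differentiable (by simp)).differentiableOn
    have h1 : deriv st t = 1 := by rw [h]; simp [st]
    let x0 : E n := EuclideanSpace.single ⟨0, by omega⟩ (√ (1 - t))
    have hx0 : q x0 = t := by
      simp only [q, x0]
      rw [EuclideanSpace.norm_single, Real.norm_eq_abs, sq_abs, Real.sq_sqrt (by linarith [ht.2])]; ring
    refine se0.continuous.integral_pos_of_hasCompactSupport_nonneg_nonzero (x := x0) ce0 ne0 ?_
    simp only [e0]; rw [hx0, h1]; norm_num
  set c := (∫ x, e0 x)⁻¹ with hc
  have hc0 : 0 < c := inv_pos.2 pos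
  let η : E n → ℝ := fun x => c * e0 x
  have sη : ContDiff ℝ ∞ η := contDiff_const.mul se0
  have cη : HasCompactSupport η := ce0.mul_left
  obtain ⟨C1, hC1⟩ := cη.exists_bound_of_continuous sη.continuous
  obtain ⟨C2, hC2⟩ := sη.lipschitzWith_of_hasCompactSupport cη (by simp)
  refine ⟨|C1| + C2 + 1, η, fun x => c * st (q x), ⟨by positivity, sη, contDiff_const.mul (hst.comp hq), ?_, fun z => mul_nonneg hc0.le (ne0 z),
    fun z => ?_, fun z hz => by simp only [η]; rw [ze0 z hz, mul_zero], ?_, fun i z => ?_, fun x y => ?_⟩⟩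
  · refine HasCompactSupport.intro (isCompact_closedBall (0 : E n) 1) fun x hx => ?_
    simp at hx
    simp only [st]
    rw [Real.smoothTransition.zero_of_nonpos (hqn x hx.le), mul_zero]
  · have := hC1 z
    rw [Real.norm_eq_abs] at this
    have h2 : (0:ℝ) ≤ C2 := C2.2
    linarith [le_abs_self (η z), le_abs_self C1]
  · simp only [η]; rw [integral_const_mul, hc, inv_mul_cancel₀ pos.ne']
  · have hs : ContDiff ℝ ∞ (fun x => st (q x)) := hst.comp hq
    rw [pd_const_mul (hs.dif z), pd_comp (hq.dif z) (hdd _), hqd]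
    simp only [η, e0]; ring
  · have := hC2.dist_le_mul x y
    rw [Real.dist_eq, dist_eq_norm] at this
    nlinarith [norm_nonneg (x - y), abs_nonneg C1]

noncomputable def mol (η : E n → ℝ) (s : ℝ) (g : E n → ℝ) (x : E n) : ℝ :=
  ∫ z in closedBall (0 : E n) 1, η z * g (x + s • z)

lemma icb {f : E n → ℝ} (hf : Continuous f) : IntegrableOn f (closedBall 0 1) :=
  hf.continuousOn.integrableOn_compact (isCompact_closedBall _ _)

lemma Eta.full {C : ℝ} {η Φ : E n → ℝ} (h : Eta C η Φ) (f : E n → ℝ) :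
    ∫ z in closedBall (0 : E n) 1, η z * f z = ∫ z, η z * f z := by
  apply setIntegral_eq_integral_of_forall_compl_eq_zero
  intro z hz
  simp at hz
  rw [h.zero z hz.le, zero_mul]

lemma Eta.mono {C : ℝ} {η Φ : E n → ℝ} (h : Eta C η Φ) {f g : E n → ℝ} (hf : Continuous f) (hg : Continuous g)
   (hfg : ∀ z, ‖z‖ < 1 → f z ≤ g z) :
    ∫ z in closedBall (0 : E n) 1, η z * f z ≤ ∫ z in closedBall (0 : E n) 1, η z * g z := by
  refine integral_mono (icb (h.sm.continuous.mul hf)) (icb (h.sm.continuous.mul hg)) fun z => ?_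
  rcases lt_or_ge ‖z‖ 1 with h1 | h1
  · exact mul_le_mul_of_nonneg_left (hfg z h1) (h.nonneg z)
  · simp [h.zero z h1]

lemma Eta.one {C : ℝ} {η Φ : E n → ℝ} (h : Eta C η Φ) (c : ℝ) :
    ∫ z in closedBall (0 : E n) 1, η z * c = c := by
  rw [h.full (fun _ => c), integral_mul_const, h.int, one_mul]

lemma mol_cont {η g : E n → ℝ} (hη : Continuous η) (hg : Continuous g) (s : ℝ) : Continuous (mol η s g) := by
  refine continuous_parametric_integral_of_continuous (f := fun x z => η z * g (x + s • z)) ?_ (isCompact_closedBall 0 1)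
  simp only [Function.uncurry_def]; fun_prop

lemma fub {ρ : ℝ} {f : E n → ℝ → ℝ} (hf : Continuous f.uncurry) :
    ∫ z in closedBall (0 : E n) ρ, ∫ t in (0:ℝ)..1, f z t = ∫ t in (0:ℝ)..1, ∫ z in closedBall (0 : E n) ρ, f z t := by
  simp only [intervalIntegral.integral_of_le (zero_le_one (α := ℝ))]
  apply integral_integral_swap
  rw [Measure.prod_restrict]
  exact (hf.continuousOn.integrableOn_compact ((isCompact_closedBall _ _).prod isCompact_Icc)).mono_set
    (prod_mono_right Ioc_subset_Icc_self)

lemma int_abs_le {f : ℝ → ℝ} {M : ℝ} (h : ∀ t, 0 < t → t ≤ 1 → |f t| ≤ M) : |∫ t in (0:ℝ)..1, f t| ≤ M := by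
  have := intervalIntegral.norm_integral_le_of_norm_le_const (a := (0:ℝ)) (b := 1) (f := f) (C := M) (fun t ht => by
    rw [uIoc_of_le zero_le_one] at ht; exact h t ht.1 ht.2)
  simpa using this

lemma scale_le {h : E n → ℝ} (hh : Continuous h) (h0 : ∀ x, 0 ≤ h x) {r R ρ : ℝ} (hr : 0 < r) (x : E n) (hx : ‖x‖ + r * ρ < R) :
    ∫ z in closedBall (0 : E n) ρ, h (x + r • z) ≤ (r ^ n)⁻¹ * ∫ z in ball (0 : E n) R, h z := by
  rw [← integral_indicator measurableSet_ball, ← int_scale x hr, ← integral_indicator measurableSet_closedBall]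
  have hi : IntegrableOn h (ball 0 R) := intb hh 0 R
  refine integral_mono ?_ ?_ fun z => ?_
  · rw [integrable_indicator_iff measurableSet_closedBall]
    exact (Continuous.continuousOn (by fun_prop)).integrableOn_compact (isCompact_closedBall _ _)
  · have h1 := hi.integrable_indicator measurableSet_ball
    have h2 := (h1.comp_add_left x)
    exact (integrable_comp_smul_iff volume (fun z => (ball (0 : E n) R).indicator h (x + z)) hr.ne').2 h2
  · by_cases hz : z ∈ closedBall (0 : E n) ρ
    · have h1 : x + r • z ∈ ball (0 : E n) R := by
        rw [mem_ball_zero_iff]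
        rw [mem_closedBall_zero_iff] at hz
        calc ‖x + r • z‖ ≤ ‖x‖ + ‖r • z‖ := norm_add_le _ _
          _ ≤ ‖x‖ + r * ρ := by rw [norm_smul, Real.norm_eq_abs, abs_of_pos hr]; gcongr
          _ < R := hx
      simp only []
      rw [indicator_of_mem hz, indicator_of_mem h1]
    · rw [indicator_of_notMem hz]
      exact indicator_nonneg (fun _ _ => h0 _) _

lemma fd_cont {g : E n → ℝ} (hg : ContDiff ℝ ∞ g) : Continuous (fderiv ℝ g) := hg.continuous_fderiv (by simp)

lemma Eta.ident {C : ℝ} {η Φ : E n → ℝ} (h : Eta C η Φ) {U : Fin n → E n → ℝ} (hU : ∀ i, ContDiff ℝ ∞ (U i))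
    (hs : ∀ i j x, pd i (U j) x = pd j (U i) x) (k : Fin n) (x : E n) {r : ℝ} (hr : 0 < r) :
    ∫ z in closedBall (0 : E n) 1, η z * fderiv ℝ (U k) (x + r • z) z =
    ∫ z in closedBall (0 : E n) 1, η z * (z k * ∑ j, pd j (U j) (x + r • z)) := by
  rw [h.full (fun z => fderiv ℝ (U k) (x + r • z) z), h.full (fun z => z k * ∑ j, pd j (U j) (x + r • z))]
  let g : Fin n → E n → ℝ := fun j z => U j (x + r • z)
  have hg : ∀ j, ContDiff ℝ ∞ (g j) := fun j => (hU j).comp (by fun_prop)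
  have hgp : ∀ i j z, pd i (g j) z = r * pd i (U j) (x + r • z) := fun i j z => pd_scale (hU j) r x i z
  have key : ∀ j, ∫ z, pd j Φ z * pd k (g j) z = ∫ z, pd k Φ z * pd j (g j) z := by
    intro j
    have h1 := ibp_pd h.smΦ (smooth_pd (hg j) k) h.cptΦ j
    have h2 := ibp_pd h.smΦ (smooth_pd (hg j) j) h.cptΦ k
    have h3 : ∀ z, pd j (pd k (g j)) z = pd k (pd j (g j)) z := fun z => hess_symm (hg j) z j k
    simp only [h3] at h1
    linarith
  have ci : ∀ i j k, Integrable (fun z => pd i Φ z * pd j (g k) z) := fun i j k =>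
    int_mul_cs (smooth_pd h.smΦ i).continuous (h.cptΦ.fderiv_apply (𝕜 := ℝ) _) (smooth_pd (hg k) j).continuous
  have e1 : ∀ z, η z * fderiv ℝ (U k) (x + r • z) z = - r⁻¹ * ∑ j, pd j Φ z * pd k (g j) z := by
    intro z
    rw [fderiv_eq_sum, Finset.mul_sum, Finset.mul_sum]
    refine Finset.sum_congr rfl fun j _ => ?_
    rw [h.pdΦ, hgp, hs k j]; field_simp
  have e2 : ∀ z, η z * (z k * ∑ j, pd j (U j) (x + r • z)) = - r⁻¹ * ∑ j, pd k Φ z * pd j (g j) z := by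
    intro z
    rw [Finset.mul_sum, Finset.mul_sum, Finset.mul_sum]
    refine Finset.sum_congr rfl fun j _ => ?_
    rw [h.pdΦ, hgp]; field_simp
  simp only [e1, e2]
  rw [integral_const_mul, integral_const_mul, integral_finset_sum _ (fun j _ => ci _ _ _), integral_finset_sum _ (fun j _ => ci _ _ _)]
  simp only [key]

lemma Eta.ident_le {C : ℝ} {η Φ : E n → ℝ} (h : Eta C η Φ) {U : Fin n → E n → ℝ} (hU : ∀ i, ContDiff ℝ ∞ (U i))
    (hs : ∀ i j x, pd i (U j) x = pd j (U i) x) (k : Fin n) (x : E n) {r : ℝ} (hr : 0 < r) (hx : ‖x‖ + r < 1) :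
    |∫ z in closedBall (0 : E n) 1, η z * fderiv ℝ (U k) (x + r • z) z| ≤
      C * ((r ^ n)⁻¹ * ∫ z in ball (0 : E n) 1, |∑ j, pd j (U j) z|) := by
  have cf : Continuous (fun z => ∑ j, pd j (U j) z) := continuous_finset_sum _ fun j _ => (smooth_pd (hU j) j).continuous
  rw [h.ident hU hs k x hr]
  have hC := h.hC
  calc _ ≤ ∫ z in closedBall (0 : E n) 1, |η z * (z k * ∑ j, pd j (U j) (x + r • z))| := abs_integral_le_integral_abs
    _ ≤ ∫ z in closedBall (0 : E n) 1, C * |∑ j, pd j (U j) (x + r • z)| := by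
      have cη := h.sm.continuous
      refine setIntegral_mono_on (icb ?_) (icb ?_) measurableSet_closedBall fun z hz => ?_
      · have := cf.comp (f := fun z : E n => x + r • z) (by fun_prop)
        simp only [Function.comp_def] at this
        fun_prop
      · have := cf.comp (f := fun z : E n => x + r • z) (by fun_prop)
        simp only [Function.comp_def] at this
        fun_prop
      · rw [abs_mul, abs_mul, abs_of_nonneg (h.nonneg z), ← mul_assoc]
        rw [mem_closedBall_zero_iff] at hz
        have h1 : |z k| ≤ 1 := (PiLp.norm_apply_le z k).trans hz
        have h2 : η z * |z k| ≤ C * 1 := mul_le_mul (h.bd z) h1 (abs_nonneg _) hC.le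
        exact mul_le_mul_of_nonneg_right (by linarith) (abs_nonneg _)
    _ = C * ∫ z in closedBall (0 : E n) 1, |∑ j, pd j (U j) (x + r • z)| := integral_const_mul _ _
    _ ≤ _ := by
      gcongr
      exact scale_le cf.abs (fun _ => abs_nonneg _) hr x (by linarith)

lemma Eta.two_scale {C : ℝ} {η Φ : E n → ℝ} (h : Eta C η Φ) {U : Fin n → E n → ℝ} (hU : ∀ i, ContDiff ℝ ∞ (U i))
    (hs : ∀ i j x, pd i (U j) x = pd j (U i) x) (k : Fin n) (x : E n) {s t : ℝ} (hs0 : 0 < s) (hst : s ≤ t) (ht : t ≤ 1) (hx : ‖x‖ + t < 1) :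
    |mol η t (U k) x - mol η s (U k) x| ≤ C * ((s ^ n)⁻¹ * ∫ z in ball (0 : E n) 1, |∑ j, pd j (U j) z|) := by
  have cU := (hU k).continuous
  have cη := h.sm.continuous
  have cd := fd_cont (hU k)
  have e : mol η t (U k) x - mol η s (U k) x =
      ∫ σ in (0:ℝ)..1, (t - s) * ∫ z in closedBall (0 : E n) 1, η z * fderiv ℝ (U k) (x + (s + σ * (t - s)) • z) z := by
    simp only [mol, ← integral_const_mul]
    rw [← integral_sub (icb (by fun_prop)) (icb (by fun_prop)), ← fub]
    · refine integral_congr_ae (Eventually.of_forall fun z => ?_)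
      simp only []
      have := line_ftc (hU k) (x + s • z) ((t - s) • z)
      have e1 : x + s • z + (t - s) • z = x + t • z := by module
      rw [e1] at this
      rw [← mul_sub, this, ← intervalIntegral.integral_const_mul]
      refine intervalIntegral.integral_congr fun σ _ => ?_
      have e2 : x + s • z + σ • (t - s) • z = x + (s + σ * (t - s)) • z := by module
      rw [e2, map_smul, smul_eq_mul]; ring
    · simp only [Function.uncurry_def]
      refine continuous_const.mul ((cη.comp continuous_fst).mul ?_)
      exact (cd.comp (by fun_prop)).clm_apply continuous_fst
  rw [e]
  refine int_abs_le fun σ h0 h1 => ?_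
  have hr : s ≤ s + σ * (t - s) := by nlinarith
  have hr' : s + σ * (t - s) ≤ t := by nlinarith
  have hC := h.hC
  have hI : 0 ≤ ∫ z in ball (0 : E n) 1, |∑ j, pd j (U j) z| := integral_nonneg fun _ => abs_nonneg _
  rw [abs_mul]
  calc _ ≤ 1 * (C * (((s + σ * (t - s)) ^ n)⁻¹ * ∫ z in ball (0 : E n) 1, |∑ j, pd j (U j) z|)) := by
        gcongr
        · rw [abs_of_nonneg (by linarith)]; linarith
        · exact h.ident_le hU hs k x (by linarith) (by linarith)
    _ ≤ _ := by
        rw [one_mul]; gcongr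

lemma Eta.shift {C : ℝ} {η Φ : E n → ℝ} (h : Eta C η Φ) {f : E n → ℝ} (hf : Continuous f) (y : E n) (hy : ‖y‖ < 1/4) :
    |∫ z in closedBall (0 : E n) 1, η z * (f (y + (1/2 : ℝ) • z) - f ((1/2 : ℝ) • z))| ≤
      2 * C * ‖y‖ * (((1/2) ^ n)⁻¹ * ∫ z in ball (0 : E n) 1, |f z|) := by
  have cη := h.sm.continuous
  have hcs : HasCompactSupport η := HasCompactSupport.intro (isCompact_closedBall (0 : E n) 1) fun x hx => h.zero x (by
    simp at hx; exact hx.le)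
  have hC := h.hC
  have e : ∫ z in closedBall (0 : E n) 1, η z * (f (y + (1/2 : ℝ) • z) - f ((1/2 : ℝ) • z)) =
      ∫ z, (η (z - (2:ℝ) • y) - η z) * f (0 + (1/2 : ℝ) • z) := by
    rw [h.full (fun z => f (y + (1/2 : ℝ) • z) - f ((1/2 : ℝ) • z))]
    simp only [mul_sub, sub_mul, zero_add]
    have c2 : HasCompactSupport (fun z : E n => η (z - (2:ℝ) • y)) := hcs.comp_homeomorph (Homeomorph.subRight ((2:ℝ) • y))
    rw [integral_sub (int_mul_cs cη hcs (by fun_prop)) (int_mul_cs cη hcs (by fun_prop)),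
      integral_sub (int_mul_cs (by fun_prop) c2 (by fun_prop)) (int_mul_cs cη hcs (by fun_prop))]
    congr 1
    rw [← integral_add_right_eq_self (fun z => η (z - (2:ℝ) • y) * f ((1/2 : ℝ) • z)) ((2:ℝ) • y)]
    refine integral_congr_ae (Eventually.of_forall fun z => ?_)
    simp only [add_sub_cancel_right]
    congr 2
    module
  rw [e]
  have e2 : ∫ z, (η (z - (2:ℝ) • y) - η z) * f (0 + (1/2 : ℝ) • z) =
     ∫ z in closedBall (0 : E n) (3/2), (η (z - (2:ℝ) • y) - η z) * f (0 + (1/2 : ℝ) • z) := by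
    symm
    apply setIntegral_eq_integral_of_forall_compl_eq_zero
    intro z hz
    simp at hz
    have : 1 ≤ ‖z - (2:ℝ) • y‖ := by
      have h1 := norm_sub_norm_le z ((2:ℝ) • y)
      rw [norm_smul] at h1; norm_num at h1; linarith
    rw [h.zero z (by linarith), h.zero _ this]; simp
  rw [e2]
  calc _ ≤ ∫ z in closedBall (0 : E n) (3/2), |(η (z - (2:ℝ) • y) - η z) * f (0 + (1/2 : ℝ) • z)| := abs_integral_le_integral_abs
    _ ≤ ∫ z in closedBall (0 : E n) (3/2), (2 * C * ‖y‖) * |f (0 + (1/2 : ℝ) • z)| := by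
      refine setIntegral_mono_on ?_ ?_ measurableSet_closedBall fun z hz => ?_
      · exact (Continuous.continuousOn (by fun_prop)).integrableOn_compact (isCompact_closedBall _ _)
      · exact (Continuous.continuousOn (by fun_prop)).integrableOn_compact (isCompact_closedBall _ _)
      · rw [abs_mul]
        gcongr
        refine (h.lip _ _).trans ?_
        rw [sub_sub_cancel_left, norm_neg, norm_smul]; norm_num; linarith
    _ = (2 * C * ‖y‖) * ∫ z in closedBall (0 : E n) (3/2), |f (0 + (1/2 : ℝ) • z)| := integral_const_mul _ _
    _ ≤ _ := by
      gcongr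
      exact scale_le hf.abs (fun _ => abs_nonneg _) (by norm_num) 0 (by norm_num)

lemma Eta.affine {C : ℝ} {η Φ : E n → ℝ} (h : Eta C η Φ) {g : E n → ℝ} (hg : ContDiff ℝ ∞ g) (x : E n) (hx : ‖x‖ < 1/4) :
    |mol η (1/2) g x - (mol η (1/2) g 0 + ∑ j, mol η (1/2) (pd j g) 0 * x j)| ≤
      2 * C * ‖x‖ ^ 2 * (((1/2) ^ n)⁻¹ * ∫ z in ball (0 : E n) 1, (n * √ (gr g z ⬝ᵥ gr g z))) := by
  have cg := hg.continuous
  have cη := h.sm.continuous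
  have cp := fun j => (smooth_pd hg j).continuous
  have cd := fd_cont hg
  have hC := h.hC
  have e : mol η (1/2) g x - (mol η (1/2) g 0 + ∑ j, mol η (1/2) (pd j g) 0 * x j) =
      ∫ σ in (0:ℝ)..1, ∑ j, x j * ∫ z in closedBall (0 : E n) 1, η z * (pd j g (σ • x + (1/2:ℝ) • z) - pd j g ((1/2:ℝ) • z)) := by
    have e1 : ∑ j, mol η (1/2) (pd j g) 0 * x j = ∫ z in closedBall (0 : E n) 1, ∑ j, η z * pd j g ((1/2:ℝ) • z) * x j := by
      rw [integral_finset_sum _ (fun j _ => icb (by fun_prop))]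
      refine Finset.sum_congr rfl fun j _ => ?_
      rw [integral_mul_const]; simp only [mol, zero_add]
    have e2 : ∀ σ : ℝ, ∑ j, x j * ∫ z in closedBall (0 : E n) 1, η z * (pd j g (σ • x + (1/2:ℝ) • z) - pd j g ((1/2:ℝ) • z)) =
        ∫ z in closedBall (0 : E n) 1, ∑ j, x j * (η z * (pd j g (σ • x + (1/2:ℝ) • z) - pd j g ((1/2:ℝ) • z))) := by
      intro σ
      rw [integral_finset_sum _ (fun j _ => icb (by fun_prop))]
      simp only [integral_const_mul]
    simp only [e2]
    rw [e1, ← fub (by simp only [Function.uncurry_def]; fun_prop)]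
    simp only [mol, zero_add]
    rw [← integral_add (icb (by fun_prop)) (icb (by fun_prop)), ← integral_sub (icb (by fun_prop)) (icb (by fun_prop))]
    refine integral_congr_ae (Eventually.of_forall fun z => ?_)
    simp only []
    have := line_ftc hg ((1/2:ℝ) • z) x
    rw [add_comm ((1/2:ℝ) • z)] at this
    rw [eq_add_of_sub_eq this]
    have hi : IntervalIntegrable (fun t : ℝ => ∑ j, x j * (η z * (pd j g (t • x + (1/2:ℝ) • z)))) volume 0 1 :=
      Continuous.intervalIntegrable (by fun_prop) _ _
    have e3 : ∀ t : ℝ, ∑ j, x j * (η z * (pd j g (t • x + (1/2:ℝ) • z) - pd j g ((1/2:ℝ) • z))) =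
      ∑ j, x j * (η z * (pd j g (t • x + (1/2:ℝ) • z))) - ∑ j, x j * (η z * pd j g ((1/2:ℝ) • z)) := by
      intro t; rw [← Finset.sum_sub_distrib]; exact Finset.sum_congr rfl fun j _ => by ring
    simp only [e3]
    rw [intervalIntegral.integral_sub hi (by simp)]
    simp only [fderiv_eq_sum, intervalIntegral.integral_const, sub_zero, one_smul]
    have e4 : ∀ t : ℝ, ∑ j, x j * (η z * (pd j g (t • x + (1/2:ℝ) • z))) = η z * ∑ j, x j * pd j g ((1/2:ℝ) • z + t • x) := by
      intro t; rw [Finset.mul_sum]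
      refine Finset.sum_congr rfl fun j _ => ?_
      rw [add_comm (t • x)]; ring
    simp only [e4]
    rw [intervalIntegral.integral_const_mul]
    have e5 : ∑ j, x j * (η z * pd j g ((1/2:ℝ) • z)) = ∑ j, η z * pd j g ((1/2:ℝ) • z) * x j :=
      Finset.sum_congr rfl fun j _ => by ring
    rw [e5]; ring
  rw [e]
  refine int_abs_le fun σ h0 h1 => ?_
  have hxn : ‖σ • x‖ ≤ ‖x‖ := by
    rw [norm_smul, Real.norm_eq_abs, abs_of_pos h0]; nlinarith [norm_nonneg x]
  have cG : Continuous (fun z => √ (gr g z ⬝ᵥ gr g z)) := (grsq_cont hg).sqrt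
  have hG0 : 0 ≤ ∫ z in ball (0 : E n) 1, √ (gr g z ⬝ᵥ gr g z) := integral_nonneg fun _ => Real.sqrt_nonneg _
  calc _ ≤ ∑ j, |x j * ∫ z in closedBall (0 : E n) 1, η z * (pd j g (σ • x + (1/2:ℝ) • z) - pd j g ((1/2:ℝ) • z))| := Finset.abs_sum_le_sum_abs _ _
    _ ≤ ∑ j : Fin n, ‖x‖ * (2 * C * ‖x‖ * (((1/2) ^ n)⁻¹ * ∫ z in ball (0 : E n) 1, √ (gr g z ⬝ᵥ gr g z))) := by
      refine Finset.sum_le_sum fun j _ => ?_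
      rw [abs_mul]
      have hxj : |x j| ≤ ‖x‖ := PiLp.norm_apply_le x j
      refine mul_le_mul hxj ((h.shift (cp j) (σ • x) (by linarith)).trans ?_) (abs_nonneg _) (norm_nonneg _)
      have : ∫ z in ball (0 : E n) 1, |pd j g z| ≤ ∫ z in ball (0 : E n) 1, √ (gr g z ⬝ᵥ gr g z) := by
        refine integral_mono (intb (cp j).abs 0 1) (intb cG 0 1) fun z => ?_
        refine Real.abs_le_sqrt ?_
        rw [sq]
        exact Finset.single_le_sum (f := fun i => gr g z i * gr g z i) (fun i _ => mul_self_nonneg _) (Finset.mem_univ j)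
      gcongr
    _ = _ := by
      rw [Finset.sum_const, Finset.card_univ, Fintype.card_fin, integral_const_mul]; simp only [nsmul_eq_mul]; ring

lemma line_abs {g : E n → ℝ} (hg : ContDiff ℝ ∞ g) (y h : E n) :
    |g (y + h) - g y| ≤ ‖h‖ * ∫ t in (0:ℝ)..1, √ (gr g (y + t • h) ⬝ᵥ gr g (y + t • h)) := by
  have hc : Continuous (fun t : ℝ => fderiv ℝ g (y + t • h) h) :=
    ((fd_cont hg).comp (by fun_prop)).clm_apply continuous_const
  have hc2 : Continuous (fun t : ℝ => √ (gr g (y + t • h) ⬝ᵥ gr g (y + t • h))) :=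
    ((grsq_cont hg).comp (by fun_prop)).sqrt
  rw [line_ftc hg, ← intervalIntegral.integral_const_mul]
  refine (intervalIntegral.abs_integral_le_integral_abs (by norm_num)).trans ?_
  refine intervalIntegral.integral_mono_on (by norm_num) (hc.abs.intervalIntegrable _ _)
    ((hc2.const_mul _).intervalIntegrable _ _) fun t _ => ?_
  apply abs_le_of_sq_le_sq _ (by positivity)
  rw [mul_pow, Real.sq_sqrt (dot_self_nonneg _)]
  exact fderiv_sq_le g _ h

lemma close_of {w H : E n → ℝ} (cw : Continuous w) (cH : Continuous H) (hH : ∀ x, 0 ≤ H x) {C s θ : ℝ} (hC : 0 ≤ C)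
    (hs : 0 ≤ s) (hθ : θ + s < 1)
    (hw : ∀ x, w x ≤ C * ∫ z in closedBall (0 : E n) 1, ∫ t in (0:ℝ)..1, H (x + t • s • z)) :
    ∫ x in closedBall (0 : E n) θ, w x ≤ C * (volume.real (closedBall (0 : E n) 1) * ∫ x in ball (0 : E n) 1, H x) := by
  have cK : Continuous (fun p : E n × E n => ∫ t in (0:ℝ)..1, H (p.1 + t • s • p.2)) :=
    intervalIntegral.continuous_parametric_intervalIntegral_of_continuous' (f := fun (p : E n × E n) t => H (p.1 + t • s • p.2))
      (by simp only [Function.uncurry_def]; fun_prop) 0 1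
  have icθ : ∀ {f : E n → ℝ}, Continuous f → IntegrableOn f (closedBall 0 θ) := fun hf =>
    hf.continuousOn.integrableOn_compact (isCompact_closedBall _ _)
  have c1 : Continuous (fun x => ∫ z in closedBall (0 : E n) 1, ∫ t in (0:ℝ)..1, H (x + t • s • z)) :=
    continuous_parametric_integral_of_continuous (f := fun x z => ∫ t in (0:ℝ)..1, H (x + t • s • z)) cK (isCompact_closedBall _ _)
  have c2 : Continuous (fun z => ∫ x in closedBall (0 : E n) θ, ∫ t in (0:ℝ)..1, H (x + t • s • z)) :=
    continuous_parametric_integral_of_continuous (f := fun z x => ∫ t in (0:ℝ)..1, H (x + t • s • z)) (cK.comp continuous_swap) (isCompact_closedBall _ _)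
  calc _ ≤ ∫ x in closedBall (0 : E n) θ, C * ∫ z in closedBall (0 : E n) 1, ∫ t in (0:ℝ)..1, H (x + t • s • z) :=
        integral_mono (icθ cw) (icθ (c1.const_mul C)) hw
    _ = C * ∫ x in closedBall (0 : E n) θ, ∫ z in closedBall (0 : E n) 1, ∫ t in (0:ℝ)..1, H (x + t • s • z) := integral_const_mul _ _
    _ = C * ∫ z in closedBall (0 : E n) 1, ∫ x in closedBall (0 : E n) θ, ∫ t in (0:ℝ)..1, H (x + t • s • z) := by
        congr 1
        apply integral_integral_swap
        rw [Measure.prod_restrict]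
        exact cK.continuousOn.integrableOn_compact ((isCompact_closedBall _ _).prod (isCompact_closedBall _ _))
    _ ≤ C * ∫ z in closedBall (0 : E n) 1, ∫ x in ball (0 : E n) 1, H x := by
        refine mul_le_mul_of_nonneg_left (setIntegral_mono_on (icb c2) (icb continuous_const) measurableSet_closedBall fun z hz => ?_) hC
        rw [fub (by simp only [Function.uncurry_def]; fun_prop)]
        refine (le_abs_self _).trans (int_abs_le fun t h0 h1 => ?_)
        rw [abs_of_nonneg (integral_nonneg fun x => hH _)]
        rw [mem_closedBall_zero_iff] at hz
        have hn : ‖t • s • z‖ ≤ s := by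
          rw [norm_smul, norm_smul, Real.norm_eq_abs, Real.norm_eq_abs, abs_of_pos h0, abs_of_nonneg hs]
          have : s * ‖z‖ ≤ s * 1 := by gcongr
          have h3 : 0 ≤ s * ‖z‖ := by positivity
          nlinarith
        have := scale_le cH hH (r := 1) (R := 1) (ρ := θ) one_pos (t • s • z) (by linarith)
        simp only [one_smul, one_pow, inv_one, one_mul] at this
        simpa only [add_comm] using this
    _ = _ := by simp

lemma Eta.jensen {C : ℝ} {η Φ : E n → ℝ} (h : Eta C η Φ) {f : E n → ℝ} (hf : Continuous f) :
    (∫ z in closedBall (0 : E n) 1, η z * f z) ^ 2 ≤ ∫ z in closedBall (0 : E n) 1, η z * f z ^ 2 := by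
  have cη := h.sm.continuous
  set c := ∫ z in closedBall (0 : E n) 1, η z * f z with hc
  have h0 : 0 ≤ ∫ z in closedBall (0 : E n) 1, η z * (f z - c) ^ 2 :=
    integral_nonneg fun z => mul_nonneg (h.nonneg z) (sq_nonneg _)
  have e : ∀ z, η z * (f z - c) ^ 2 = (η z * f z ^ 2 - (2 * c) * (η z * f z)) + η z * c ^ 2 := fun z => by ring
  simp only [e] at h0
  rw [integral_add (icb (by fun_prop)) (icb (by fun_prop)), integral_sub (icb (by fun_prop)) (icb (by fun_prop)), h.one,
    integral_const_mul, ← hc] at h0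
  nlinarith

lemma Eta.close1 {C : ℝ} {η Φ : E n → ℝ} (h : Eta C η Φ) {g : E n → ℝ} (hg : ContDiff ℝ ∞ g) {s θ : ℝ} (hs : 0 ≤ s)
    (hθ : θ + s < 1) : ∫ x in closedBall (0 : E n) θ, |mol η s g x - g x| ≤
      (C * s) * (volume.real (closedBall (0 : E n) 1) * ∫ x in ball (0 : E n) 1, √ (gr g x ⬝ᵥ gr g x)) ∧
    ∫ x in closedBall (0 : E n) θ, (mol η s g x - g x) ^ 2 ≤
      (C * s ^ 2) * (volume.real (closedBall (0 : E n) 1) * ∫ x in ball (0 : E n) 1, gr g x ⬝ᵥ gr g x) := by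
  have cη := h.sm.continuous
  have cg := hg.continuous
  have cm := mol_cont cη cg s
  have cG := grsq_cont hg
  have hC := h.hC
  have e : ∀ x, mol η s g x - g x = ∫ z in closedBall (0 : E n) 1, η z * (g (x + s • z) - g x) := by
    intro x
    simp only [mul_sub]
    rw [integral_sub (icb (by fun_prop)) (icb (by fun_prop)), h.one]; rfl
  have cI : ∀ (H : E n → ℝ), Continuous H → ∀ x, Continuous (fun z : E n => ∫ t in (0:ℝ)..1, H (x + t • s • z)) := fun H hH x =>
    intervalIntegral.continuous_parametric_intervalIntegral_of_continuous' (f := fun (z : E n) t => H (x + t • s • z))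
      (by simp only [Function.uncurry_def]; fun_prop) 0 1
  constructor
  · refine close_of (w := fun x => |mol η s g x - g x|) (cm.sub cg).abs cG.sqrt (fun x => Real.sqrt_nonneg _) (by positivity) hs hθ fun x => ?_
    rw [e]
    refine abs_integral_le_integral_abs.trans ?_
    rw [← integral_const_mul]
    refine setIntegral_mono_on (icb (by fun_prop)) (icb ((cI _ cG.sqrt x).const_mul _)) measurableSet_closedBall fun z hz => ?_
    rw [mem_closedBall_zero_iff] at hz
    rw [abs_mul, abs_of_nonneg (h.nonneg z), mul_assoc]
    have h1 := line_abs hg x (s • z)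
    have h2 : ‖s • z‖ ≤ s := by rw [norm_smul, Real.norm_eq_abs, abs_of_nonneg hs]; nlinarith
    have h3 : 0 ≤ ∫ t in (0:ℝ)..1, √ (gr g (x + t • s • z) ⬝ᵥ gr g (x + t • s • z)) :=
      intervalIntegral.integral_nonneg (by norm_num) fun t _ => Real.sqrt_nonneg _
    exact mul_le_mul (h.bd z) (h1.trans (by gcongr)) (abs_nonneg _) hC.le
  · refine close_of (w := fun x => (mol η s g x - g x) ^ 2) ((cm.sub cg).pow 2) cG (fun x => dot_self_nonneg _) (by positivity) hs hθ fun x => ?_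
    rw [e]
    refine (h.jensen (f := fun z => g (x + s • z) - g x) (by fun_prop)).trans ?_
    rw [← integral_const_mul]
    refine setIntegral_mono_on (icb (by fun_prop)) (icb ((cI _ cG x).const_mul _)) measurableSet_closedBall fun z hz => ?_
    rw [mem_closedBall_zero_iff] at hz
    rw [mul_assoc]
    have h1 := line_sq hg x (s • z)
    have h2 : ‖s • z‖ ≤ s := by rw [norm_smul, Real.norm_eq_abs, abs_of_nonneg hs]; nlinarith
    have h3 : 0 ≤ ∫ t in (0:ℝ)..1, (gr g (x + t • s • z) ⬝ᵥ gr g (x + t • s • z)) :=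
      intervalIntegral.integral_nonneg (by norm_num) fun t _ => dot_self_nonneg _
    exact mul_le_mul (h.bd z) (h1.trans (by gcongr)) (sq_nonneg _) hC.le

lemma vol_cb {θ : ℝ} (hθ : 0 ≤ θ) : volume.real (closedBall (0 : E n) θ) = θ ^ n * volume.real (closedBall (0 : E n) 1) := by
  have := Measure.addHaar_real_closedBall' (volume : Measure (E n)) 0 hθ
  simpa using this

set_option maxHeartbeats 2000000 in
lemma lemmaH (n : ℕ) (hn : 2 ≤ n) : ∃ C : ℝ, 0 < C ∧ ∀ (U : Fin n → E n → ℝ), (∀ i, ContDiff ℝ ∞ (U i)) →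
    (∀ i j x, pd i (U j) x = pd j (U i) x) → ∃ (b : Fin n → ℝ) (M : Mt n), Mᵀ = M ∧
    (∀ (c : ℝ) (v : Fin n → ℝ), (∀ x ∈ ball (0 : E n) 1, c ≤ ∑ i, ∑ j, v i * v j * pd j (U i) x) → c ≤ v ⬝ᵥ M *ᵥ v) ∧
    ∀ (s θ : ℝ), 0 < s → s ≤ 1/4 → 0 < θ → θ < 1/4 → ∀ k,
    ∫ x in closedBall (0 : E n) θ, |U k x - (b k + ∑ j, M k j * x j)| ≤
      C * (s * (∫ x in ball (0 : E n) 1, √ (gr (U k) x ⬝ᵥ gr (U k) x)) +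
       θ ^ n * ((s ^ n)⁻¹ * ∫ x in ball (0 : E n) 1, |∑ j, pd j (U j) x|) +
       θ ^ n * (θ ^ 2 * (∫ x in ball (0 : E n) 1, √ (gr (U k) x ⬝ᵥ gr (U k) x)))) ∧
    ∫ x in closedBall (0 : E n) θ, (U k x - (b k + ∑ j, M k j * x j)) ^ 2 ≤
      C * (s ^ 2 * (∫ x in ball (0 : E n) 1, gr (U k) x ⬝ᵥ gr (U k) x) +
       θ ^ n * ((s ^ n)⁻¹ * ∫ x in ball (0 : E n) 1, |∑ j, pd j (U j) x|) ^ 2 +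
       θ ^ n * (θ ^ 2 * (∫ x in ball (0 : E n) 1, √ (gr (U k) x ⬝ᵥ gr (U k) x))) ^ 2) := by
  obtain ⟨C, η, Φ, h⟩ := exists_eta n hn
  have hC := h.hC
  set V := volume.real (closedBall (0 : E n) 1) with hV
  have hV0 : 0 ≤ V := measureReal_nonneg
  set C2 := C + 2 * C * (((1/2) ^ n)⁻¹ * n) with hC2
  have hC2' : 0 < C2 := by positivity
  refine ⟨(C + C2 + 3 * C2 ^ 2 + 3 * C) * V + 1, by positivity, fun U hU hs => ⟨fun k => mol η (1/2) (U k) 0,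
    Matrix.of fun k j => mol η (1/2) (pd j (U k)) 0, ?_, ?_, ?_⟩⟩
  · ext i j
    simp only [Matrix.transpose_apply, Matrix.of_apply]
    congr 1; funext x; exact hs i j x
  · intro c v hc
    have cp := fun i j => (smooth_pd (hU i) j).continuous
    have cη := h.sm.continuous
    have e : v ⬝ᵥ (Matrix.of fun k j => mol η (1/2) (pd j (U k)) 0) *ᵥ v =
        ∫ z in closedBall (0 : E n) 1, η z * ∑ i, ∑ j, v i * v j * pd j (U i) ((1/2:ℝ) • z) := by
      simp only [Finset.mul_sum]
      rw [integral_finset_sum _ (fun i _ => icb (by fun_prop))]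
      simp only [dotProduct, Matrix.mulVec, Finset.mul_sum]
      refine Finset.sum_congr rfl fun i _ => ?_
      rw [integral_finset_sum _ (fun i _ => icb (by fun_prop))]
      refine Finset.sum_congr rfl fun j _ => ?_
      simp only [Matrix.of_apply, mol, zero_add]
      rw [← integral_mul_const, ← integral_const_mul]
      exact integral_congr_ae (Eventually.of_forall fun z => by simp only []; ring)
    rw [e, ← h.one c]
    refine h.mono continuous_const (by fun_prop) fun z hz => hc _ ?_
    rw [mem_ball_zero_iff, norm_smul]; norm_num; linarith
  · intro s θ hs0 hs1 hθ0 hθ1 k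
    set f := ∫ x in ball (0 : E n) 1, |∑ j, pd j (U j) x| with hf
    have hf0 : 0 ≤ f := integral_nonneg fun _ => abs_nonneg _
    set G := ∫ x in ball (0 : E n) 1, √ (gr (U k) x ⬝ᵥ gr (U k) x) with hG
    have hG0 : 0 ≤ G := integral_nonneg fun _ => Real.sqrt_nonneg _
    set G2 := ∫ x in ball (0 : E n) 1, (gr (U k) x ⬝ᵥ gr (U k) x) with hG2
    have hG20 : 0 ≤ G2 := integral_nonneg fun _ => dot_self_nonneg _
    set p := (s ^ n)⁻¹ * f with hp
    have hp0 : 0 ≤ p := by positivity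
    set q := θ ^ 2 * G with hq
    have hq0 : 0 ≤ q := by positivity
    have pt : ∀ x ∈ closedBall (0 : E n) θ, |U k x - (mol η (1/2) (U k) 0 + ∑ j, mol η (1/2) (pd j (U k)) 0 * x j)| ≤
        |mol η s (U k) x - U k x| + C2 * (p + q) := by
      intro x hx
      rw [mem_closedBall_zero_iff] at hx
      have h1 := h.two_scale hU hs k x (t := 1/2) hs0 (by linarith) (by norm_num) (by linarith)
      have h2 := h.affine (hU k) x (by linarith)
      have h3 : 2 * C * ‖x‖ ^ 2 * (((1/2) ^ n)⁻¹ * ∫ z in ball (0 : E n) 1, (n * √ (gr (U k) z ⬝ᵥ gr (U k) z))) ≤ (C2 - C) * q := by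
        rw [integral_const_mul, ← hG, hC2, hq]
        have : ‖x‖ ^ 2 ≤ θ ^ 2 := by gcongr
        calc _ ≤ 2 * C * θ ^ 2 * (((1/2) ^ n)⁻¹ * (n * G)) := by gcongr
          _ = _ := by ring
      rw [← hf, ← hp] at h1
      have h4 : C * p + (C2 - C) * q ≤ C2 * (p + q) := by
        have : C ≤ C2 := by rw [hC2]; have : 0 ≤ 2 * C * (((1/2) ^ n)⁻¹ * n) := by positivity
                            linarith
        nlinarith
      rw [abs_le] at h1 h2 ⊢
      constructor <;> linarith [neg_abs_le (mol η s (U k) x - U k x), le_abs_self (mol η s (U k) x - U k x)]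
    obtain ⟨cl1, cl2⟩ := h.close1 (hU k) (s := s) (θ := θ) hs0.le (by linarith)
    rw [← hV, ← hG] at cl1
    rw [← hV, ← hG2] at cl2
    have cη := h.sm.continuous
    have cU := (hU k).continuous
    have cm := mol_cont cη cU s
    have icθ : ∀ {f : E n → ℝ}, Continuous f → IntegrableOn f (closedBall 0 θ) := fun hf =>
      hf.continuousOn.integrableOn_compact (isCompact_closedBall _ _)
    have hv := vol_cb (n := n) hθ0.le
    rw [← hV] at hv
    have hθn : 0 < θ ^ n := by positivity
    simp only [Matrix.of_apply]
    constructor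
    · calc _ ≤ ∫ x in closedBall (0 : E n) θ, (|mol η s (U k) x - U k x| + C2 * (p + q)) :=
            setIntegral_mono_on (icθ (by fun_prop)) (icθ (by fun_prop)) measurableSet_closedBall pt
        _ = (∫ x in closedBall (0 : E n) θ, |mol η s (U k) x - U k x|) + θ ^ n * V * (C2 * (p + q)) := by
            rw [integral_add (icθ (by fun_prop)) (icθ (by fun_prop)), setIntegral_const, smul_eq_mul, hv]
        _ ≤ (C * s) * (V * G) + θ ^ n * V * (C2 * (p + q)) := by gcongr
        _ = C * V * (s * G) + C2 * V * (θ ^ n * p) + C2 * V * (θ ^ n * q) := by ring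
        _ ≤ ((C + C2 + 3 * C2 ^ 2 + 3 * C) * V + 1) * (s * G) + ((C + C2 + 3 * C2 ^ 2 + 3 * C) * V + 1) * (θ ^ n * p) +
              ((C + C2 + 3 * C2 ^ 2 + 3 * C) * V + 1) * (θ ^ n * q) := by
            have i1 : C * V ≤ (C + C2 + 3 * C2 ^ 2 + 3 * C) * V + 1 := by linarith only [mul_nonneg hC.le hV0, mul_nonneg hC2'.le hV0, mul_nonneg (sq_nonneg C2) hV0]
            have i2 : C2 * V ≤ (C + C2 + 3 * C2 ^ 2 + 3 * C) * V + 1 := by linarith only [mul_nonneg hC.le hV0, mul_nonneg hC2'.le hV0, mul_nonneg (sq_nonneg C2) hV0]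
            gcongr
        _ = _ := by ring
    · calc _ ≤ ∫ x in closedBall (0 : E n) θ, (3 * (mol η s (U k) x - U k x) ^ 2 + 3 * C2 ^ 2 * (p ^ 2 + q ^ 2)) := by
            refine setIntegral_mono_on (icθ (by fun_prop)) (icθ (by fun_prop)) measurableSet_closedBall fun x hx => ?_
            have h1 := pt x hx
            rw [← sq_abs, ← sq_abs (mol η s (U k) x - U k x)]
            have h2 := pow_le_pow_left₀ (abs_nonneg _) h1 2
            refine h2.trans ?_
            linarith only [sq_nonneg (|mol η s (U k) x - U k x| - C2 * p), sq_nonneg (|mol η s (U k) x - U k x| - C2 * q),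
              sq_nonneg (C2 * p - C2 * q)]
        _ = 3 * (∫ x in closedBall (0 : E n) θ, (mol η s (U k) x - U k x) ^ 2) + θ ^ n * V * (3 * C2 ^ 2 * (p ^ 2 + q ^ 2)) := by
            rw [integral_add (icθ (by fun_prop)) (icθ (by fun_prop)), setIntegral_const, smul_eq_mul, hv, integral_const_mul]
        _ ≤ 3 * ((C * s ^ 2) * (V * G2)) + θ ^ n * V * (3 * C2 ^ 2 * (p ^ 2 + q ^ 2)) := by gcongr
        _ = 3 * C * V * (s ^ 2 * G2) + 3 * C2 ^ 2 * V * (θ ^ n * p ^ 2) + 3 * C2 ^ 2 * V * (θ ^ n * q ^ 2) := by ring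
        _ ≤ ((C + C2 + 3 * C2 ^ 2 + 3 * C) * V + 1) * (s ^ 2 * G2) + ((C + C2 + 3 * C2 ^ 2 + 3 * C) * V + 1) * (θ ^ n * p ^ 2) +
              ((C + C2 + 3 * C2 ^ 2 + 3 * C) * V + 1) * (θ ^ n * q ^ 2) := by
            have i1 : 3 * C * V ≤ (C + C2 + 3 * C2 ^ 2 + 3 * C) * V + 1 := by linarith only [mul_nonneg hC.le hV0, mul_nonneg hC2'.le hV0, mul_nonneg (sq_nonneg C2) hV0]
            have i2 : 3 * C2 ^ 2 * V ≤ (C + C2 + 3 * C2 ^ 2 + 3 * C) * V + 1 := by linarith only [mul_nonneg hC.le hV0, mul_nonneg hC2'.le hV0, mul_nonneg (sq_nonneg C2) hV0]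
            gcongr
        _ = _ := by ring

noncomputable def Dv (S : Mt n) : ℝ := S.trace - 1

noncomputable def Fm (S : Mt n) : Mt n := Dv S • 1 - S

structure Adm (k : ℝ) (S : Mt n) : Prop where
  symm : Sᵀ = S
  pos : ∀ v, v ⬝ᵥ v ≤ v ⬝ᵥ (S + k • 1) *ᵥ v
  hD : 0 < Dv S
  eq : Dv S ^ 2 = 1 + (S * S).trace

structure AdmL (k : ℝ) (lam : Fin n → ℝ) : Prop where
  pos : ∀ i, 1 ≤ lam i + k
  hD : 0 < ∑ i, lam i - 1
  eq : (∑ i, lam i - 1) ^ 2 = 1 + ∑ i, lam i ^ 2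

lemma diagz {S : Mt n} (h : Sᵀ = S) : ∃ (O : Mt n) (q : Fin n → ℝ), O * Oᵀ = 1 ∧ Oᵀ * O = 1 ∧
    S = O * Matrix.diagonal q * Oᵀ := by
  have hS : S.IsHermitian := h
  have h1 := hS.spectral_theorem
  rw [Unitary.conjStarAlgAut_apply] at h1
  refine ⟨hS.eigenvectorUnitary, hS.eigenvalues, ?_, ?_, ?_⟩
  · exact Unitary.mul_star_self_of_mem hS.eigenvectorUnitary.2
  · exact Unitary.star_mul_self_of_mem hS.eigenvectorUnitary.2
  · exact h1

lemma cj_mul {O : Mt n} (h : Oᵀ * O = 1) (p q : Fin n → ℝ) :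
    (O * Matrix.diagonal p * Oᵀ) * (O * Matrix.diagonal q * Oᵀ) = O * Matrix.diagonal (fun i => p i * q i) * Oᵀ := by
  rw [← Matrix.diagonal_mul_diagonal]
  calc _ = O * Matrix.diagonal p * (Oᵀ * O) * Matrix.diagonal q * Oᵀ := by simp only [Matrix.mul_assoc]
    _ = _ := by rw [h, Matrix.mul_one]; simp only [Matrix.mul_assoc]

lemma cj_quad (O : Mt n) (q v : Fin n → ℝ) :
    v ⬝ᵥ (O * Matrix.diagonal q * Oᵀ) *ᵥ v = ∑ i, q i * (Oᵀ *ᵥ v) i ^ 2 := by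
  rw [← Matrix.mulVec_mulVec, ← Matrix.mulVec_mulVec, Matrix.dotProduct_mulVec, ← Matrix.mulVec_transpose]
  simp only [dotProduct, Matrix.mulVec_diagonal]
  exact Finset.sum_congr rfl fun i _ => by ring

lemma cj_one {O : Mt n} (h : O * Oᵀ = 1) (c : ℝ) : O * Matrix.diagonal (fun _ => c) * Oᵀ = c • (1 : Mt n) := by
  rw [show (Matrix.diagonal (fun _ => c) : Mt n) = c • 1 by rw [Matrix.smul_one_eq_diagonal]]
  simp [h]

lemma cj_norm {O : Mt n} (h : O * Oᵀ = 1) (v : Fin n → ℝ) : ∑ i, (Oᵀ *ᵥ v) i ^ 2 = v ⬝ᵥ v := by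
  have := cj_quad O (fun _ => 1) v
  rw [cj_one h] at this
  simpa using this.symm

lemma cj_trace {O : Mt n} (h : Oᵀ * O = 1) (q : Fin n → ℝ) : (O * Matrix.diagonal q * Oᵀ).trace = ∑ i, q i := by
  rw [Matrix.trace_mul_cycle, h, Matrix.one_mul, Matrix.trace_diagonal]

lemma cj_det {O : Mt n} (h : Oᵀ * O = 1) (q : Fin n → ℝ) : (O * Matrix.diagonal q * Oᵀ).det = ∏ i, q i := by
  rw [Matrix.det_mul_right_comm, Matrix.det_mul, Matrix.det_mul, ← mul_comm Oᵀ.det, ← Matrix.det_mul, h]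
  simp

lemma cj_add (O : Mt n) (p q : Fin n → ℝ) :
    O * Matrix.diagonal p * Oᵀ + O * Matrix.diagonal q * Oᵀ = O * Matrix.diagonal (fun i => p i + q i) * Oᵀ := by
  rw [show (Matrix.diagonal (fun i => p i + q i) : Mt n) = Matrix.diagonal p + Matrix.diagonal q by rw [Matrix.diagonal_add], Matrix.mul_add, Matrix.add_mul]

lemma cj_smul (O : Mt n) (c : ℝ) (q : Fin n → ℝ) :
    c • (O * Matrix.diagonal q * Oᵀ) = O * Matrix.diagonal (fun i => c * q i) * Oᵀ := by
  rw [show (Matrix.diagonal (fun i => c * q i) : Mt n) = c • Matrix.diagonal q by rw [← Matrix.diagonal_smul]; rfl]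
  simp

lemma Adm.diag {k : ℝ} {S : Mt n} (h : Adm k S) : ∃ (O : Mt n) (q : Fin n → ℝ), O * Oᵀ = 1 ∧ Oᵀ * O = 1 ∧
    S = O * Matrix.diagonal q * Oᵀ ∧ AdmL k q ∧ Dv S = ∑ i, q i - 1 ∧
    Fm S = O * Matrix.diagonal (fun i => ∑ i, q i - 1 - q i) * Oᵀ ∧
    S + k • 1 = O * Matrix.diagonal (fun i => q i + k) * Oᵀ := by
  obtain ⟨O, q, h1, h2, rfl⟩ := diagz h.symm
  have hD : Dv (O * Matrix.diagonal q * Oᵀ) = ∑ i, q i - 1 := by rw [Dv, cj_trace h2]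
  have hP : O * Matrix.diagonal q * Oᵀ + k • 1 = O * Matrix.diagonal (fun i => q i + k) * Oᵀ := by
    rw [← cj_one h1, cj_add]
  refine ⟨O, q, h1, h2, rfl, ⟨fun i => ?_, hD ▸ h.hD, ?_⟩, hD, ?_, hP⟩
  · have := h.pos (O *ᵥ Pi.single i 1)
    rw [hP, cj_quad, ← cj_norm h1, Matrix.mulVec_mulVec, h2, Matrix.one_mulVec] at this
    simpa [Pi.single_apply] using this
  · rw [← hD, h.eq, cj_mul h2, cj_trace h2]; simp [sq]
  · rw [Fm, hD, ← cj_one h1, sub_eq_add_neg, ← neg_one_smul ℝ (O * _ * _), cj_smul, cj_add]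
    simp [sub_eq_add_neg]

set_option maxHeartbeats 1000000 in
lemma admL_bd (n : ℕ) (k : ℝ) (hk : 1 ≤ k) : ∃ C : ℝ, 1 ≤ C ∧ ∀ q : Fin n → ℝ, AdmL k q → ∃ m, (∀ i, i ≠ m → q i + k ≤ C) ∧
    (q m + k) * (∑ i, q i - 1 - q m) ≤ C ∧ 1 ≤ C * ((q m + k) * (∑ i, q i - 1 - q m)) ∧
    (∀ i, i ≠ m → ∑ i, q i - 1 - q i ≤ C * (q m + k) ∧ q m + k ≤ C * (∑ i, q i - 1 - q i)) ∧ ∑ i, q i - 1 ≤ C * (q m + k) ∧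
    ∑ i, q i - 1 - q m ≤ C ∧ 0 < ∑ i, q i - 1 - q m := by
  set c := 1 + n * k with hc
  have hc1 : 1 ≤ c := by have : 0 ≤ n * k := by positivity
                         linarith
  set C1 := c + 1 + k + n * k with hC1
  have hnk : 0 ≤ n * k := by positivity
  set C2 := 9 * C1 ^ 2 * (2 + c) + (1 + n * C1 ^ 2) + k * c with hC2
  have hkc : 0 ≤ k * c := by positivity
  have hnC : 0 ≤ n * C1 ^ 2 := by positivity
  have hC11 : 1 ≤ C1 := by linarith
  have b4 : 9 * C1 ^ 2 * (2 + c) ≤ C2 := by linarith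
  have b5 : C1 ^ 2 ≤ C1 ^ 2 * (2 + c) := le_mul_of_one_le_right (sq_nonneg _) (by linarith)
  have b6 : 2 + c ≤ C1 ^ 2 * (2 + c) := le_mul_of_one_le_left (by linarith) (one_le_pow₀ hC11)
  have b7 : C1 ≤ C1 ^ 2 := le_self_pow₀ hC11 (by norm_num)
  have b1 : C1 ≤ C2 := by linarith
  have b2 : 1 ≤ C2 := by linarith
  have b3 : 2 + c ≤ C2 := by linarith
  refine ⟨C2, b2, fun q h => ?_⟩
  have hne : (Finset.univ : Finset (Fin n)).Nonempty := by
    by_contra hh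
    rw [Finset.not_nonempty_iff_eq_empty] at hh
    have := h.hD; rw [hh] at this; simp at this; linarith
  obtain ⟨m, -, hm⟩ := Finset.exists_max_image Finset.univ q hne
  set D := ∑ i, q i - 1 with hD
  set f := D - q m with hf
  set Q := ∑ i ∈ Finset.univ.erase m, q i ^ 2 with hQ
  set T := ∑ i ∈ Finset.univ.erase m, q i with hT
  have e1 : q m + T = D + 1 := by rw [hD, hT, Finset.add_sum_erase _ _ (Finset.mem_univ m)]; ring
  have e2 : q m ^ 2 + Q = D ^ 2 - 1 := by rw [h.eq, hQ, Finset.add_sum_erase _ (fun i => q i ^ 2) (Finset.mem_univ m)]; ring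
  have hcard : ((Finset.univ.erase m).card : ℝ) ≤ n := by
    exact_mod_cast (Finset.card_le_univ _).trans (by simp)
  have e3 : 0 ≤ q m * T + (n * k) * q m - k * T - Q := by
    have h1 : 0 ≤ ∑ i ∈ Finset.univ.erase m, (q i + k) * (q m - q i) :=
      Finset.sum_nonneg fun i _ => mul_nonneg (by linarith [h.pos i]) (by linarith [hm i (Finset.mem_univ i)])
    have h2 : ∑ i ∈ Finset.univ.erase m, (q i + k) * (q m - q i) = q m * T + ((Finset.univ.erase m).card * k) * q m - k * T - Q := by
      rw [hT, hQ, Finset.mul_sum, Finset.mul_sum, ← nsmul_eq_mul, smul_mul_assoc, ← Finset.sum_const, ← Finset.sum_add_distrib,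
        ← Finset.sum_sub_distrib, ← Finset.sum_sub_distrib]
      exact Finset.sum_congr rfl fun i _ => by ring
    have h3 : 0 < q m := by
      by_contra hh
      have : ∑ i, q i ≤ 0 := Finset.sum_nonpos fun i hi => (hm i hi).trans (not_lt.1 hh)
      linarith [h.hD]
    have : (((Finset.univ.erase m).card : ℝ) * k) * q m ≤ (n * k) * q m := by gcongr
    linarith
  have h3 : 0 < q m := by
    by_contra hh
    have : ∑ i, q i ≤ 0 := Finset.sum_nonpos fun i hi => (hm i hi).trans (not_lt.1 hh)
    linarith [h.hD]
  have hQ0 : 0 ≤ Q := Finset.sum_nonneg fun i _ => sq_nonneg _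
  have hD0 : 0 < D := h.hD
  have e4 : f * (2 * q m + f) = 1 + Q := by rw [hf]; linear_combination -e2
  have hf0 : 0 < f := by
    by_contra hh
    have : 0 ≤ 2 * q m + f := by rw [hf]; linarith
    linarith [mul_nonneg (neg_nonneg.2 (not_lt.1 hh)) this]
  have hfc : f ≤ c := by
    have hT' : T = f + 1 := by rw [hf]; linarith
    rw [hT'] at e3
    by_contra hh
    have : c * q m < f * q m := by rw [not_le] at hh; gcongr
    have h5 : 0 ≤ k * f := by positivity
    have h6 : 0 ≤ f * f := by positivity
    rw [hc] at this
    linarith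
  have hp : ∀ i, i ≠ m → q i + k ≤ C1 := by
    intro i hi
    have h1 : q i + k ≤ ∑ i ∈ Finset.univ.erase m, (q i + k) :=
      Finset.single_le_sum (f := fun i => q i + k) (fun j _ => by linarith [h.pos j]) (Finset.mem_erase.2 ⟨hi, Finset.mem_univ i⟩)
    rw [Finset.sum_add_distrib, ← hT, Finset.sum_const, nsmul_eq_mul] at h1
    have : ((Finset.univ.erase m).card : ℝ) * k ≤ n * k := by gcongr
    linarith
  have hQb : Q ≤ n * C1 ^ 2 := by
    have h1 : Q ≤ ∑ i ∈ Finset.univ.erase m, C1 ^ 2 := by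
      refine Finset.sum_le_sum fun i hi => ?_
      have := hp i (Finset.ne_of_mem_erase hi)
      exact sq_le_sq' (by linarith [h.pos i]) (by linarith)
    rw [Finset.sum_const, nsmul_eq_mul] at h1
    exact h1.trans (by gcongr)
  have hpm := h.pos m
  have g1 : 1 ≤ (2 + c) * ((q m + k) * f) := by
    have h5 : c ≤ c * (q m + k) := le_mul_of_one_le_right (by linarith) hpm
    have : 2 * q m + f ≤ (2 + c) * (q m + k) := by rw [add_mul]; linarith
    have := mul_le_mul_of_nonneg_left this hf0.le
    linarith
  have hcp : c ≤ c * (q m + k) := le_mul_of_one_le_right (by linarith) hpm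
  refine ⟨m, fun i hi => (hp i hi).trans b1, ?_, g1.trans (by gcongr), fun i hi => ⟨?_, ?_⟩, ?_, by linarith, hf0⟩
  · have : k * f ≤ k * c := by gcongr
    have h5 : 0 ≤ 9 * C1 ^ 2 * (2 + c) := by positivity
    linarith [mul_pos hf0 h3, mul_pos hf0 hf0]
  · have := h.pos i
    have : D - q i ≤ (2 + c) * (q m + k) := by rw [add_mul]; linarith
    exact this.trans (by gcongr)
  · have hi' := hp i hi
    have hmi := hm i (Finset.mem_univ i)
    have h6 : f ≤ D - q i := by linarith
    by_cases hbig : 3 * C1 ≤ q m + k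
    · have : q m + k ≤ 2 * (D - q i) := by linarith
      exact this.trans (mul_le_mul_of_nonneg_right (by linarith) (by linarith))
    · push Not at hbig
      have h7 : q m + k ≤ (9 * C1 ^ 2 * (2 + c)) * f := by
        have : (q m + k) ^ 2 ≤ (3 * C1) ^ 2 := by gcongr
        have h8 : (q m + k) * 1 ≤ (q m + k) * ((2 + c) * ((q m + k) * f)) := by gcongr
        have h9 : (q m + k) ^ 2 * ((2 + c) * f) ≤ (3 * C1) ^ 2 * ((2 + c) * f) := by gcongr
        linarith
      calc q m + k ≤ (9 * C1 ^ 2 * (2 + c)) * f := h7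
        _ ≤ C2 * (D - q i) := by gcongr
  · have : D ≤ (2 + c) * (q m + k) := by rw [add_mul]; linarith
    exact this.trans (by gcongr)

lemma ell (n : ℕ) (k : ℝ) (hk : 1 ≤ k) : ∃ l L : ℝ, 0 < l ∧ 0 < L ∧ ∀ S : Mt n, Adm k S →
    (∀ v, l * (v ⬝ᵥ v) ≤ v ⬝ᵥ ((S + k • 1).det⁻¹ • ((S + k • 1) * Fm S * (S + k • 1))) *ᵥ v) ∧
    (∀ v, v ⬝ᵥ ((S + k • 1).det⁻¹ • ((S + k • 1) * Fm S * (S + k • 1))) *ᵥ v ≤ L * (v ⬝ᵥ v)) ∧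
    1 ≤ (S + k • 1).det ∧ Dv S ≤ L * (S + k • 1).det := by
  obtain ⟨C, hC, H⟩ := admL_bd n k hk
  have hC0 : 0 < C := by linarith
  refine ⟨(C ^ (n + 1))⁻¹, C ^ 3, by positivity, by positivity, fun S hS => ?_⟩
  obtain ⟨O, q, h1, h2, -, hq, hD, hF, hP⟩ := hS.diag
  obtain ⟨m, g1, g2, g3, g4, g5, g6, g7⟩ := H q hq
  set D := ∑ i, q i - 1
  set R := ∏ i ∈ Finset.univ.erase m, (q i + k) with hR
  have hp0 : ∀ i, 0 < q i + k := fun i => by linarith [hq.pos i]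
  have eR : (q m + k) * R = ∏ i, (q i + k) := Finset.mul_prod_erase _ (fun i => q i + k) (Finset.mem_univ m)
  have hR1 : 1 ≤ R := by
    have := Finset.prod_le_prod (s := Finset.univ.erase m) (f := fun _ => (1:ℝ)) (g := fun i => q i + k) (fun _ _ => zero_le_one) fun i _ => hq.pos i
    simpa using this
  have hR0 : 0 < R := by linarith
  have hRC : R ≤ C ^ n := by
    have h3 := Finset.prod_le_prod (s := Finset.univ.erase m) (f := fun i => q i + k) (g := fun _ => C) (fun i _ => (hp0 i).le)
      fun i hi => g1 i (Finset.ne_of_mem_erase hi)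
    rw [Finset.prod_const] at h3
    exact h3.trans (pow_le_pow_right₀ hC ((Finset.card_le_univ _).trans (by simp)))
  have bd : ∀ i, (C ^ (n + 1))⁻¹ ≤ (∏ i, (q i + k))⁻¹ * ((q i + k) * (D - q i) * (q i + k)) ∧
      (∏ i, (q i + k))⁻¹ * ((q i + k) * (D - q i) * (q i + k)) ≤ C ^ 3 := by
    intro i
    rw [← eR, mul_comm _⁻¹, ← div_eq_mul_inv, inv_eq_one_div, div_le_div_iff₀ (by positivity) (mul_pos (hp0 m) hR0),
      div_le_iff₀ (mul_pos (hp0 m) hR0)]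
    have hpm := hp0 m
    by_cases hi : i = m
    · subst hi
      set p := q i + k
      have i1 : R * 1 ≤ C ^ n * (C * (p * (D - q i))) := by gcongr
      have i2 : p * (D - q i) * p ≤ C * p := by gcongr
      have hCC : C ≤ C ^ 3 := le_self_pow₀ hC (by norm_num)
      constructor
      · calc 1 * (p * R) = p * (R * 1) := by ring
          _ ≤ p * (C ^ n * (C * (p * (D - q i)))) := by gcongr
          _ = _ := by ring
      · calc p * (D - q i) * p ≤ C * p := i2
          _ ≤ C ^ 3 * (p * R) := by
            have : p * 1 ≤ p * R := by gcongr
            nlinarith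
    · obtain ⟨j1, j2⟩ := g4 i hi
      have hpi := g1 i hi
      have hp1 := hq.pos i
      set p := q i + k
      set pm := q m + k
      have hf0 : 0 < D - q i := by by_contra hh; nlinarith
      constructor
      · calc 1 * (pm * R) ≤ (C * (D - q i)) * C ^ n := by rw [one_mul]; gcongr
          _ = 1 * (D - q i) * 1 * C ^ (n + 1) := by ring
          _ ≤ p * (D - q i) * p * C ^ (n + 1) := by gcongr
      · calc p * (D - q i) * p ≤ C * (C * pm) * C := by gcongr
          _ = C ^ 3 * (pm * 1) := by ring
          _ ≤ C ^ 3 * (pm * R) := by gcongr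
  have hdet : (S + k • 1).det = ∏ i, (q i + k) := by rw [hP, cj_det h2]
  have hpm1 := hq.pos m
  rw [hdet, hF, hP, cj_mul h2, cj_mul h2, cj_smul, ← eR, hD]
  rw [← eR] at bd
  refine ⟨fun v => ?_, fun v => ?_, by nlinarith, ?_⟩
  · rw [cj_quad, ← cj_norm h1, Finset.mul_sum]
    exact Finset.sum_le_sum fun i _ => by gcongr; exact (bd i).1
  · rw [cj_quad, ← cj_norm h1, Finset.mul_sum]
    exact Finset.sum_le_sum fun i _ => by gcongr; exact (bd i).2
  · have hCC : C ≤ C ^ 3 := le_self_pow₀ hC (by norm_num)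
    calc D ≤ C * ((q m + k) * 1) := by linarith
      _ ≤ C ^ 3 * ((q m + k) * R) := by gcongr

lemma frob_cs (A B : Mt n) : (∑ i, ∑ j, A i j * B i j) ^ 2 ≤ (∑ i, ∑ j, A i j ^ 2) * (∑ i, ∑ j, B i j ^ 2) := by
  have := Finset.sum_mul_sq_le_sq_mul_sq Finset.univ (fun p : Fin n × Fin n => A p.1 p.2) (fun p => B p.1 p.2)
  simpa only [← Finset.univ_product_univ, Finset.sum_product] using this

lemma tr_mul {A B : Mt n} (hB : Bᵀ = B) : (A * B).trace = ∑ i, ∑ j, A i j * B i j := by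
  simp only [Matrix.trace, Matrix.diag, Matrix.mul_apply]
  refine Finset.sum_congr rfl fun i _ => Finset.sum_congr rfl fun j _ => ?_
  rw [← Matrix.transpose_apply B, hB]

lemma Adm.frob {k : ℝ} {S : Mt n} (h : Adm k S) : Dv S ^ 2 = 1 + ∑ i, ∑ j, S i j ^ 2 := by
  rw [h.eq, tr_mul h.symm]; simp only [sq]

lemma jac_scalar {k D t J : ℝ} (hk : 1 ≤ k) (hD : 1 ≤ D) (h1 : -k ≤ t) (h2 : t ^ 2 ≤ D ^ 2 - 1) (hJ : J = 200 * k ^ 3) :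
    (1/3 * ((D ^ 2 - 1) / D ^ 2) + 2/3 * (t / D) ^ 2) * (1 + 4/3 * (D - t) / (D + J)) ≤ 1 := by
  have hJ0 : 0 < J := by rw [hJ]; positivity
  have hD0 : 0 < D := by linarith
  have htD : |t| ≤ D := abs_le_of_sq_le_sq (by linarith) hD0.le
  rw [abs_le] at htD
  by_cases hc : 4 * k ≤ D
  · set s := t / D with hs
    have hs1 : s ≤ 1 := by rw [hs, div_le_one hD0]; linarith
    have hs2 : -(1/4) ≤ s := by rw [hs, le_div_iff₀ hD0]; linarith
    have e1 : (D ^ 2 - 1) / D ^ 2 ≤ 1 := by rw [div_le_one (by positivity)]; linarith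
    have e2 : 4/3 * (D - t) / (D + J) ≤ 4/3 * (1 - s) := by
      rw [div_le_iff₀ (by linarith)]
      have : t = s * D := by rw [hs]; field_simp
      rw [this]
      nlinarith [mul_nonneg (sub_nonneg.2 hs1) hJ0.le]
    have e3 : 0 ≤ 4/3 * (D - t) / (D + J) := div_nonneg (by linarith) (by linarith)
    calc _ ≤ (1/3 * 1 + 2/3 * s ^ 2) * (1 + 4/3 * (1 - s)) := by gcongr
      _ ≤ 1 := by nlinarith [mul_nonneg (sub_nonneg.2 hs1) (by linarith : 0 ≤ 4 * s + 1), mul_nonneg (mul_nonneg (sub_nonneg.2 hs1) (by linarith : 0 ≤ 4 * s + 1)) (sub_nonneg.2 hs1)]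
  · push Not at hc
    have e1 : 1/3 * ((D ^ 2 - 1) / D ^ 2) + 2/3 * (t / D) ^ 2 ≤ (D ^ 2 - 1) / D ^ 2 := by
      have : (t / D) ^ 2 ≤ (D ^ 2 - 1) / D ^ 2 := by rw [div_pow]; gcongr
      linarith
    have e2 : 4/3 * (D - t) / (D + J) ≤ 1 / D ^ 2 := by
      rw [div_le_div_iff₀ (by linarith) (by positivity)]
      have : D ^ 3 ≤ (4 * k) ^ 3 := by gcongr
      have h5 : 4/3 * (D - t) * D ^ 2 ≤ 8/3 * D ^ 3 := by nlinarith [sq_nonneg D]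
      nlinarith [pow_pos (by linarith : 0 < k) 3]
    have e3 : 0 ≤ 4/3 * (D - t) / (D + J) := div_nonneg (by linarith) (by linarith)
    have e4 : 0 ≤ (D ^ 2 - 1) / D ^ 2 := div_nonneg (by nlinarith) (by positivity)
    calc _ ≤ ((D ^ 2 - 1) / D ^ 2) * (1 + 1 / D ^ 2) := by gcongr
      _ ≤ 1 := by
        have : (D ^ 2 - 1) / D ^ 2 = 1 - 1 / D ^ 2 := by field_simp
        rw [this]; nlinarith [sq_nonneg (1 / D ^ 2)]

lemma Adm.one_le {k : ℝ} {S : Mt n} (h : Adm k S) : 1 ≤ Dv S := by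
  have h1 := h.frob
  have : 0 ≤ ∑ i, ∑ j, S i j ^ 2 := Finset.sum_nonneg fun _ _ => Finset.sum_nonneg fun _ _ => sq_nonneg _
  nlinarith [h.hD]

lemma sym3 (T : Fin n → Mt n) (A : Mt n) (x : Fin n → ℝ) (hT1 : ∀ a i j, T a i j = T a j i) (hT2 : ∀ a i j, T a i j = T i a j)
    (hA : Aᵀ = A) : 2 * ∑ a, x a * ∑ i, ∑ j, T a i j * A i j - (1/3 * ((x ⬝ᵥ x) * ∑ i, ∑ j, A i j ^ 2) + 2/3 * (A *ᵥ x ⬝ᵥ A *ᵥ x)) ≤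
      ∑ a, ∑ i, ∑ j, T a i j ^ 2 := by
  have hA' : ∀ i j, A i j = A j i := fun i j => by rw [← Matrix.transpose_apply A, hA]
  have h0 : 0 ≤ ∑ a, ∑ i, ∑ j, (T a i j - 1/3 * (x a * A i j + x i * A a j + x j * A i a)) ^ 2 :=
    Finset.sum_nonneg fun _ _ => Finset.sum_nonneg fun _ _ => Finset.sum_nonneg fun _ _ => sq_nonneg _
  have e : ∀ a i j, (T a i j - 1/3 * (x a * A i j + x i * A a j + x j * A i a)) ^ 2 =
    T a i j ^ 2 - 2/3 * (T a i j * A i j * x a) - 2/3 * (T a i j * A a j * x i) - 2/3 * (T a i j * A i a * x j) +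
    1/9 * (A i j ^ 2 * (x a * x a)) + 1/9 * (A a j ^ 2 * (x i * x i)) + 1/9 * (x j * x j * A i a ^ 2) +
    2/9 * ((A i j * x i) * (A a j * x a)) + 2/9 * ((A i j * x j) * (A i a * x a)) + 2/9 * ((A a j * x j) * (A i a * x i)) := fun a i j => by ring
  simp only [e, Finset.sum_add_distrib, Finset.sum_sub_distrib, ← Finset.mul_sum] at h0
  have t1 : ∑ a, ∑ i, ∑ j, T a i j * A i j * x a = ∑ a, x a * ∑ i, ∑ j, T a i j * A i j := by
    simp only [Finset.mul_sum, mul_comm]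
  have t2 : ∑ a, ∑ i, ∑ j, T a i j * A a j * x i = ∑ a, x a * ∑ i, ∑ j, T a i j * A i j := by
    rw [← t1, Finset.sum_comm]
    refine Finset.sum_congr rfl fun a _ => Finset.sum_congr rfl fun i _ => Finset.sum_congr rfl fun j _ => ?_
    rw [hT2]
  have t3 : ∑ a, ∑ i, ∑ j, T a i j * A i a * x j = ∑ a, x a * ∑ i, ∑ j, T a i j * A i j := by
    rw [← t2]
    refine Finset.sum_congr rfl fun a _ => ?_
    rw [Finset.sum_comm]
    refine Finset.sum_congr rfl fun i _ => Finset.sum_congr rfl fun j _ => ?_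
    rw [hT1, hA']
  have s1 : ∑ a, ∑ i, ∑ j, A i j ^ 2 * (x a * x a) = (x ⬝ᵥ x) * ∑ i, ∑ j, A i j ^ 2 := by
    simp only [← Finset.sum_mul, ← Finset.mul_sum, dotProduct, mul_comm]
  have s2 : ∑ a, ∑ i, ∑ j, A a j ^ 2 * (x i * x i) = (x ⬝ᵥ x) * ∑ i, ∑ j, A i j ^ 2 := by rw [Finset.sum_comm, s1]
  have s3 : ∑ a, ∑ i, ∑ j, x j * x j * A i a ^ 2 = (x ⬝ᵥ x) * ∑ i, ∑ j, A i j ^ 2 := by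
    rw [← s2]
    refine Finset.sum_congr rfl fun a _ => ?_
    rw [Finset.sum_comm]
    refine Finset.sum_congr rfl fun i _ => Finset.sum_congr rfl fun j _ => ?_
    rw [hA' j a, mul_comm]
  have v : ∀ i, (A *ᵥ x) i = ∑ j, A i j * x j := fun i => rfl
  have r1 : ∑ a, ∑ i, ∑ j, (A i j * x j) * (A i a * x a) = A *ᵥ x ⬝ᵥ A *ᵥ x := by
    simp only [dotProduct, v, Finset.sum_mul_sum]
    rw [Finset.sum_comm]
    refine Finset.sum_congr rfl fun a _ => ?_
    rw [Finset.sum_comm]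
  have r2 : ∑ a, ∑ i, ∑ j, (A a j * x j) * (A i a * x i) = A *ᵥ x ⬝ᵥ A *ᵥ x := by
    rw [← r1, Finset.sum_comm]
    refine Finset.sum_congr rfl fun a _ => Finset.sum_congr rfl fun i _ => Finset.sum_congr rfl fun j _ => ?_
    rw [hA' a i]
  have r3 : ∑ a, ∑ i, ∑ j, (A i j * x i) * (A a j * x a) = A *ᵥ x ⬝ᵥ A *ᵥ x := by
    rw [← r1]
    refine Finset.sum_congr rfl fun a _ => ?_
    rw [Finset.sum_comm]
    refine Finset.sum_congr rfl fun i _ => Finset.sum_congr rfl fun j _ => ?_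
    rw [hA' j i, hA' a i]
  rw [t1, t2, t3, s1, s2, s3, r1, r2, r3] at h0
  linarith

lemma jacobi {k : ℝ} (hk : 1 ≤ k) {S : Mt n} (hS : Adm k S) (T : Fin n → Mt n) (hT1 : ∀ a i j, T a i j = T a j i)
    (hT2 : ∀ a i j, T a i j = T i a j) (ξ : Fin n → ℝ) (hξ : ∀ a, ∑ i, ∑ j, T a i j * S i j = Dv S * ξ a) :
    ξ ⬝ᵥ ξ + 4/3 * (ξ ⬝ᵥ Fm S *ᵥ ξ) / (Dv S + 200 * k ^ 3) ≤ ∑ a, ∑ i, ∑ j, T a i j ^ 2 := by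
  have hD1 := hS.one_le
  have hfr := hS.frob
  have hS' := hS.symm
  have hpp := hS.pos
  obtain ⟨O, q, h1, h2, e, hq, hD, hF, hP⟩ := hS.diag
  set D := Dv S with hDD
  set J := 200 * k ^ 3 with hJ
  have hJ0 : 0 < J := by positivity
  set r : Fin n → ℝ := fun i => 1 + 4/3 * (D - q i) / (D + J) with hr
  set η := Oᵀ *ᵥ ξ with hη
  set x : Fin n → ℝ := (O * Matrix.diagonal r * Oᵀ) *ᵥ ξ with hx
  have hOx : Oᵀ *ᵥ x = fun i => r i * η i := by
    rw [hx, Matrix.mulVec_mulVec, ← Matrix.mul_assoc, ← Matrix.mul_assoc, h2, Matrix.one_mul, ← Matrix.mulVec_mulVec]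
    funext i; rw [Matrix.mulVec_diagonal]
  have hD0 : 0 < D := by linarith
  have m0 := sym3 T (D⁻¹ • S) x hT1 hT2 (by rw [Matrix.transpose_smul, hS'])
  have m1 : ∑ a, x a * ∑ i, ∑ j, T a i j * (D⁻¹ • S) i j = ∑ i, r i * η i ^ 2 := by
    rw [← cj_quad, dotProduct_comm, dotProduct]
    refine Finset.sum_congr rfl fun a _ => ?_
    congr 1
    calc _ = D⁻¹ * ∑ i, ∑ j, T a i j * S i j := by
          simp only [Matrix.smul_apply, smul_eq_mul, Finset.mul_sum]
          exact Finset.sum_congr rfl fun i _ => Finset.sum_congr rfl fun j _ => by ring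
      _ = ξ a := by rw [hξ]; field_simp
  have m2 : ∑ i, ∑ j, (D⁻¹ • S) i j ^ 2 = (D ^ 2 - 1) / D ^ 2 := by
    calc _ = D⁻¹ ^ 2 * ∑ i, ∑ j, S i j ^ 2 := by
          simp only [Matrix.smul_apply, smul_eq_mul, Finset.mul_sum, mul_pow]
      _ = _ := by rw [show ∑ i, ∑ j, S i j ^ 2 = D ^ 2 - 1 by linarith, inv_pow, mul_comm, div_eq_mul_inv]
  have m3 : x ⬝ᵥ x = ∑ i, r i ^ 2 * η i ^ 2 := by
    rw [← cj_norm h1, hOx]; simp only [mul_pow]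
  have m4 : (D⁻¹ • S) *ᵥ x ⬝ᵥ (D⁻¹ • S) *ᵥ x = ∑ i, (q i / D) ^ 2 * (r i ^ 2 * η i ^ 2) := by
    have : (D⁻¹ • S) *ᵥ x ⬝ᵥ (D⁻¹ • S) *ᵥ x = x ⬝ᵥ ((D⁻¹ • S) * (D⁻¹ • S)) *ᵥ x := by
      rw [← Matrix.mulVec_mulVec, symm_bil (by rw [Matrix.transpose_smul, hS'])]
    rw [this, e, cj_smul, cj_mul h2, cj_quad, hOx]
    exact Finset.sum_congr rfl fun i _ => by field_simp
  have m5 : ξ ⬝ᵥ ξ + 4/3 * (ξ ⬝ᵥ Fm S *ᵥ ξ) / (D + J) = ∑ i, r i * η i ^ 2 := by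
    rw [hF, cj_quad, ← cj_norm h1, ← hη, ← hD, Finset.mul_sum, Finset.sum_div, ← Finset.sum_add_distrib]
    exact Finset.sum_congr rfl fun i _ => by rw [hr]; ring
  rw [m1, m2, m3, m4] at m0
  rw [m5]
  refine le_trans ?_ m0
  rw [Finset.sum_mul, Finset.mul_sum, Finset.mul_sum, Finset.mul_sum, ← Finset.sum_add_distrib, ← Finset.sum_sub_distrib]
  refine Finset.sum_le_sum fun i _ => ?_
  have hqi : q i ^ 2 ≤ D ^ 2 - 1 := by
    have := hq.eq
    rw [← hD] at this
    have h3 := Finset.single_le_sum (f := fun i => q i ^ 2) (fun _ _ => sq_nonneg _) (Finset.mem_univ i)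
    linarith
  have hs := jac_scalar hk hD1 (by linarith [hq.pos i]) hqi hJ
  have hr0 : 0 ≤ r i := by
    have htD : |q i| ≤ D := abs_le_of_sq_le_sq (by linarith) hD0.le
    rw [abs_le] at htD
    have : 0 ≤ 4/3 * (D - q i) / (D + J) := div_nonneg (by linarith) (by linarith)
    rw [hr]; linarith
  have := mul_le_mul_of_nonneg_right hs (mul_nonneg hr0 (sq_nonneg (η i)))
  have e5 : (1 + 4/3 * (D - q i) / (D + J)) = r i := rfl
  rw [e5] at this
  nlinarith

noncomputable def jac (T : E n → E n) (x : E n) : Mt n := Matrix.of fun i j => pd j (fun z => T z i) x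

lemma difE {T : E n → E n} (hT : ContDiff ℝ ∞ T) (x) : DifferentiableAt ℝ T x :=
  (hT.differentiable (by simp)).differentiableAt

lemma fderiv_jac {T : E n → E n} (hT : ContDiff ℝ ∞ T) (x v : E n) (i) : fderiv ℝ T x v i = (jac T x *ᵥ v) i := by
  have h : HasFDerivAt (fun y => T y i) ((EuclideanSpace.proj i : E n →L[ℝ] ℝ).comp (fderiv ℝ T x)) x :=
    (EuclideanSpace.proj i : E n →L[ℝ] ℝ).hasFDerivAt.comp x (difE hT x).hasFDerivAt
  have h2 := fderiv_eq_sum (fun y => T y i) x v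
  rw [h.fderiv] at h2
  simp only [Matrix.mulVec, dotProduct, jac, Matrix.of_apply]
  simpa [mul_comm] using h2

lemma det_jac {T : E n → E n} (hT : ContDiff ℝ ∞ T) (x : E n) : (fderiv ℝ T x).det = (jac T x).det := by
  rw [ContinuousLinearMap.det, ← LinearMap.det_toMatrix (EuclideanSpace.basisFun (Fin n) ℝ).toBasis]
  congr 1
  ext i j
  rw [LinearMap.toMatrix_apply]
  simp only [OrthonormalBasis.coe_toBasis, EuclideanSpace.basisFun_apply, OrthonormalBasis.coe_toBasis_repr_apply,
    EuclideanSpace.basisFun_repr, ContinuousLinearMap.coe_coe]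
  rw [fderiv_jac hT]; simp [Matrix.mulVec, dotProduct, Pi.single_apply]

lemma cov {T : E n → E n} (hT : ContDiff ℝ ∞ T) {s : Set (E n)} (hs : MeasurableSet s) (hi : Function.Injective T) (f : E n → ℝ) :
    ∫ y in T '' s, f y = ∫ x in s, |(jac T x).det| * f (T x) := by
  rw [integral_image_eq_integral_abs_det_fderiv_smul volume hs (fun x _ => (difE hT x).hasFDerivAt.hasFDerivWithinAt) hi.injOn]
  simp only [det_jac hT, smul_eq_mul]

lemma jac_cont {T : E n → E n} (hT : ContDiff ℝ ∞ T) : Continuous (jac T) :=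
  continuous_matrix fun i j => (smooth_pd (smooth_comp_coord hT i) j).continuous

lemma inv_smooth {T : E n → E n} (hT : ContDiff ℝ ∞ T) (hb : Function.Bijective T) (hd : ∀ x, (jac T x).det ≠ 0) :
    ∃ V : E n → E n, ContDiff ℝ ∞ V ∧ (∀ x, V (T x) = x) ∧ ∀ y, T (V y) = y := by
  let T' : E n → (E n ≃L[ℝ] E n) := fun x => ContinuousLinearMap.toContinuousLinearEquivOfDetNeZero (fderiv ℝ T x) (by rw [det_jac hT]; exact hd x)
  have hT' : ∀ x, HasFDerivAt T (T' x : E n →L[ℝ] E n) x := fun x => by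
    rw [ContinuousLinearMap.coe_toContinuousLinearEquivOfDetNeZero]; exact (difE hT x).hasFDerivAt
  have ho : IsOpenMap T := isOpenMap_of_hasStrictFDerivAt_equiv (f' := T') fun x =>
    (hT.contDiffAt.hasStrictFDerivAt' (hT' x) (by simp))
  let e := (Equiv.ofBijective T hb).toHomeomorphOfContinuousOpen hT.continuous ho
  refine ⟨e.symm, e.contDiff_symm hT' hT, fun x => e.symm_apply_apply x, fun y => e.apply_symm_apply y⟩

lemma jac_inv {T V : E n → E n} (hT : ContDiff ℝ ∞ T) (hV : ContDiff ℝ ∞ V) (h : ∀ x, V (T x) = x) (x) :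
    jac V (T x) * jac T x = 1 := by
  ext i j
  have h1 := pd_compE (g := fun z => V z i) (X := T) (y := x) ((smooth_comp_coord hV i).dif _) (difE hT x) j
  simp only [h] at h1
  rw [Matrix.mul_apply]
  simp only [jac, Matrix.of_apply]
  rw [← h1, pd_coord, Matrix.one_apply]; simp only [eq_comm]

lemma mono_line {T : E n → E n} (hT : ContDiff ℝ ∞ T) {c : ℝ} (h : ∀ x v, c * (v ⬝ᵥ v) ≤ v ⬝ᵥ jac T x *ᵥ v) (y y' : E n) :
    c * ‖y' - y‖ ^ 2 ≤ ∑ i, (y' - y) i * (T y' - T y) i := by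
  set d := y' - y with hd
  let g : E n → ℝ := fun z => ∑ i, d i * T z i
  have hs : ∀ i, ContDiff ℝ ∞ (fun z => T z i) := fun i => smooth_comp_coord hT i
  have hg : ContDiff ℝ ∞ g := ContDiff.sum fun i _ => contDiff_const.mul (hs i)
  have h1 := line_ftc hg y d
  have e1 : g (y + d) - g y = ∑ i, d i * (T y' - T y) i := by
    simp only [g, hd, add_sub_cancel, ← Finset.sum_sub_distrib, PiLp.sub_apply, mul_sub]
  have e2 : ∀ x, fderiv ℝ g x d = (d : Fin n → ℝ) ⬝ᵥ jac T x *ᵥ d := by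
    intro x
    rw [fderiv_eq_sum]
    have : ∀ j, pd j g x = ∑ i, d i * pd j (fun z => T z i) x := fun j => by
      simp only [g]
      rw [pd_sum _ (fun i _ => (contDiff_const.mul (hs i)).dif x)]
      exact Finset.sum_congr rfl fun i _ => pd_const_mul ((hs i).dif x) _ _
    simp only [this, dotProduct, Matrix.mulVec, jac, Matrix.of_apply, Finset.mul_sum]
    rw [Finset.sum_comm]
    exact Finset.sum_congr rfl fun i _ => Finset.sum_congr rfl fun j _ => by ring
  rw [← e1, h1]
  have e3 : ‖d‖ ^ 2 = (d : Fin n → ℝ) ⬝ᵥ d := by rw [norm_sq_eq]; simp [dotProduct, sq]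
  have := intervalIntegral.integral_mono_on (a := 0) (b := 1) (f := fun _ => c * ‖d‖ ^ 2) (g := fun t : ℝ => fderiv ℝ g (y + t • d) d) (μ := volume) (by norm_num)
    (by simp) ((((fd_cont hg).comp (by fun_prop : Continuous fun t : ℝ => y + t • d)).clm_apply continuous_const).intervalIntegrable _ _)
    (fun t _ => by rw [e2, e3]; exact h _ _)
  simpa using this

section
structure Sol (k : ℝ) (u : E n → ℝ) : Prop where
  hk : 1 ≤ k
  sm : ContDiff ℝ ∞ u
  adm : ∀ x, Adm k (hess u x)

lemma pd_comm {g : E n → ℝ} (hg : ContDiff ℝ ∞ g) (i j : Fin n) : pd i (pd j g) = pd j (pd i g) :=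
  funext fun x => hess_symm hg x i j

lemma hess_tr {g : E n → ℝ} (hg : ContDiff ℝ ∞ g) (x) : (hess g x)ᵀ = hess g x := by
  ext i j; exact hess_symm hg x j i

lemma trF {S H : Mt n} (hH : Hᵀ = H) : (Fm S * H).trace = Dv S * ∑ i, H i i - ∑ i, ∑ j, S i j * H i j := by
  rw [Fm, Matrix.sub_mul, Matrix.trace_sub, Matrix.smul_mul, Matrix.trace_smul, Matrix.one_mul, tr_mul hH]; rfl

lemma lee_alg (T : Fin n → Fin n → Fin n → ℝ) (S : Mt n) (e ξ : Fin n → ℝ) (D : ℝ)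
    (h1 : ∀ a, ∑ i, ∑ j, T a i j * S i j = D * ξ a) (h2 : D ^ 2 = 1 + ∑ i, ∑ j, S i j ^ 2) (h3 : 1 ≤ D) :
    0 ≤ ∑ a, ∑ b, e a * e b * (∑ i, ∑ j, T a i j * T b i j - ξ b * ξ a) := by
  let W : Mt n := Matrix.of fun i j => ∑ a, e a * T a i j
  have w1 : ∑ i, ∑ j, W i j ^ 2 = ∑ a, ∑ b, e a * e b * (∑ i, ∑ j, T a i j * T b i j) := by
    have : ∀ i j, W i j ^ 2 = ∑ a, ∑ b, (e a * T a i j) * (e b * T b i j) := fun i j => by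
      rw [sq, ← Finset.sum_mul_sum]; rfl
    simp only [this, Finset.mul_sum]
    rw [Finset.sum_congr rfl fun i _ => Finset.sum_comm, Finset.sum_comm]
    refine Finset.sum_congr rfl fun a _ => ?_
    rw [Finset.sum_congr rfl fun i _ => Finset.sum_comm, Finset.sum_comm]
    refine Finset.sum_congr rfl fun b _ => Finset.sum_congr rfl fun i _ => Finset.sum_congr rfl fun j _ => by ring
  have w2 : (∑ a, e a * ξ a) ^ 2 = ∑ a, ∑ b, e a * e b * (ξ b * ξ a) := by
    rw [sq, Finset.sum_mul_sum]
    exact Finset.sum_congr rfl fun a _ => Finset.sum_congr rfl fun b _ => by ring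
  simp only [mul_sub, Finset.sum_sub_distrib]
  rw [← w1, ← w2]
  have e2 : ∑ i, ∑ j, W i j * S i j = D * ∑ a, e a * ξ a := by
    have : ∑ a, e a * (∑ i, ∑ j, T a i j * S i j) = D * ∑ a, e a * ξ a := by
      rw [Finset.mul_sum]
      exact Finset.sum_congr rfl fun a _ => by rw [h1]; ring
    rw [← this]
    simp only [W, Matrix.of_apply, Finset.sum_mul, Finset.mul_sum]
    rw [Finset.sum_congr rfl fun i _ => Finset.sum_comm, Finset.sum_comm]
    exact Finset.sum_congr rfl fun a _ => Finset.sum_congr rfl fun i _ => Finset.sum_congr rfl fun j _ => by ring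
  have e3 := frob_cs W S
  rw [e2, show ∑ i, ∑ j, S i j ^ 2 = D ^ 2 - 1 by linarith] at e3
  have e6 : 0 ≤ ∑ i, ∑ j, W i j ^ 2 := Finset.sum_nonneg fun _ _ => Finset.sum_nonneg fun _ _ => sq_nonneg _
  generalize ∑ i, ∑ j, W i j ^ 2 = w at *
  generalize ∑ a, e a * ξ a = z at *
  have e7 : D ^ 2 * z ^ 2 ≤ D ^ 2 * w := by nlinarith
  have := le_of_mul_le_mul_left e7 (by positivity)
  linarith

namespace Sol
variable {k : ℝ} {u : E n → ℝ}

lemma smD (h : Sol k u) : ContDiff ℝ ∞ (fun x => Dv (hess u x)) := by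
  have : ∀ i, ContDiff ℝ ∞ (fun x => hess u x i i) := fun i => smooth_pd (smooth_pd h.sm i) i
  simp only [Dv, Matrix.trace, Matrix.diag]
  exact (ContDiff.sum fun i _ => this i).sub contDiff_const

lemma pdD (h : Sol k u) (a : Fin n) : pd a (fun x => Dv (hess u x)) = fun x => ∑ i, pd a (pd i (pd i u)) x := by
  funext x
  have h2 : ∀ i, ContDiff ℝ ∞ (fun x => hess u x i i) := fun i => smooth_pd (smooth_pd h.sm i) i
  simp only [Dv, Matrix.trace, Matrix.diag]
  rw [pd_sub ((ContDiff.sum fun i _ => h2 i).dif x) (contDiff_const.dif x), pd_const, sub_zero, pd_sum _ (fun i _ => (h2 i).dif x)]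
  rfl

lemma d1 (h : Sol k u) (a : Fin n) (x : E n) : ∑ i, ∑ j, pd a (pd i (pd j u)) x * pd i (pd j u) x =
    Dv (hess u x) * pd a (fun x => Dv (hess u x)) x := by
  have h2 : ∀ i j, ContDiff ℝ ∞ (pd i (pd j u)) := fun i j => smooth_pd (smooth_pd h.sm j) i
  have e : (fun x => Dv (hess u x) * Dv (hess u x)) = fun x => 1 + ∑ i, ∑ j, pd i (pd j u) x * pd i (pd j u) x := by
    funext x; rw [← sq, (h.adm x).frob]; simp only [sq]; rfl
  have e2 := congrArg (fun g => pd a g x) e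
  beta_reduce at e2
  rw [pd_mul (h.smD.dif x) (h.smD.dif x), pd_add (contDiff_const.dif x) ((ContDiff.sum fun i _ => ContDiff.sum fun j _ => (h2 i j).mul (h2 i j)).dif x),
    pd_const, pd_sum _ (fun i _ => (ContDiff.sum fun j _ => (h2 i j).mul (h2 i j)).dif x)] at e2
  have e3 : ∀ i, pd a (fun x => ∑ j, pd i (pd j u) x * pd i (pd j u) x) x = 2 * ∑ j, pd a (pd i (pd j u)) x * pd i (pd j u) x := by
    intro i
    rw [pd_sum _ (fun j _ => ((h2 i j).mul (h2 i j)).dif x), Finset.mul_sum]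
    refine Finset.sum_congr rfl fun j _ => ?_
    rw [pd_mul ((h2 i j).dif x) ((h2 i j).dif x)]; ring
  simp only [e3, ← Finset.mul_sum] at e2
  linarith

lemma d2 (h : Sol k u) (a b : Fin n) (x : E n) : ∑ i, ∑ j, pd i (pd j u) x * pd b (pd a (pd i (pd j u))) x +
     ∑ i, ∑ j, pd a (pd i (pd j u)) x * pd b (pd i (pd j u)) x =
    Dv (hess u x) * ∑ i, pd b (pd a (pd i (pd i u))) x + pd b (fun x => Dv (hess u x)) x * pd a (fun x => Dv (hess u x)) x := by
  have h2 : ∀ i j, ContDiff ℝ ∞ (pd i (pd j u)) := fun i j => smooth_pd (smooth_pd h.sm j) i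
  have h3 : ∀ i j, ContDiff ℝ ∞ (pd a (pd i (pd j u))) := fun i j => smooth_pd (h2 i j) a
  have e2 := congrArg (fun g => pd b g x) (funext (h.d1 a))
  beta_reduce at e2
  rw [pd_mul (h.smD.dif x) ((smooth_pd h.smD a).dif x),
    pd_sum _ (fun i _ => (ContDiff.sum fun j _ => (h3 i j).mul (h2 i j)).dif x)] at e2
  have e3 : ∀ i, pd b (fun x => ∑ j, pd a (pd i (pd j u)) x * pd i (pd j u) x) x =
      (∑ j, pd i (pd j u) x * pd b (pd a (pd i (pd j u))) x) + ∑ j, pd a (pd i (pd j u)) x * pd b (pd i (pd j u)) x := by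
    intro i
    rw [pd_sum _ (fun j _ => ((h3 i j).mul (h2 i j)).dif x), ← Finset.sum_add_distrib]
    refine Finset.sum_congr rfl fun j _ => ?_
    rw [pd_mul ((h3 i j).dif x) ((h2 i j).dif x)]; ring
  simp only [e3, Finset.sum_add_distrib] at e2
  rw [e2]
  congr 2
  rw [h.pdD, pd_sum _ (fun i _ => (h3 i i).dif x)]

lemma Lab (h : Sol k u) (a b : Fin n) (x : E n) : (Fm (hess u x) * hess (pd a (pd b u)) x).trace =
    ∑ i, ∑ j, pd a (pd i (pd j u)) x * pd b (pd i (pd j u)) x -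
    pd b (fun x => Dv (hess u x)) x * pd a (fun x => Dv (hess u x)) x := by
  have s1 := fun i => smooth_pd h.sm i
  have e : ∀ i j, pd i (pd j (pd a (pd b u))) = pd b (pd a (pd i (pd j u))) := by
    intro i j
    rw [pd_comm (s1 b) j a, pd_comm h.sm j b, pd_comm (smooth_pd (s1 j) b) i a, pd_comm (s1 j) i b,
      pd_comm (smooth_pd (s1 j) i) a b]
  rw [trF (hess_tr (smooth_pd (s1 b) a) x)]
  simp only [hess_apply, e]
  linarith [h.d2 a b x]

lemma Lee (h : Sol k u) (e : Fin n → ℝ) (x : E n) :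
    ContDiff ℝ ∞ (fun x => e ⬝ᵥ hess u x *ᵥ e) ∧ 0 ≤ (Fm (hess u x) * hess (fun x => e ⬝ᵥ hess u x *ᵥ e) x).trace := by
  have h2 : ∀ i j, ContDiff ℝ ∞ (pd i (pd j u)) := fun i j => smooth_pd (smooth_pd h.sm j) i
  have e0 : (fun x => e ⬝ᵥ hess u x *ᵥ e) = fun x => ∑ p : Fin n × Fin n, (e p.1 * e p.2) * pd p.1 (pd p.2 u) x := by
    funext x
    rw [← Finset.univ_product_univ, Finset.sum_product]
    simp only [dotProduct, Matrix.mulVec, Finset.mul_sum, hess_apply]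
    exact Finset.sum_congr rfl fun i _ => Finset.sum_congr rfl fun j _ => by ring
  rw [e0]
  refine ⟨ContDiff.sum fun p _ => contDiff_const.mul (h2 _ _), ?_⟩
  rw [hess_sum (f := fun (p : Fin n × Fin n) x => (e p.1 * e p.2) * pd p.1 (pd p.2 u) x) _ (fun p => contDiff_const.mul (h2 _ _))]
  have e1 : ∀ p : Fin n × Fin n, (Fm (hess u x) * hess (fun x => (e p.1 * e p.2) * pd p.1 (pd p.2 u) x) x).trace = e p.1 * e p.2 *
    (∑ i, ∑ j, pd p.1 (pd i (pd j u)) x * pd p.2 (pd i (pd j u)) x -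
    pd p.2 (fun x => Dv (hess u x)) x * pd p.1 (fun x => Dv (hess u x)) x) := fun p => by
    rw [hess_const_mul (h2 p.1 p.2) _ x, Matrix.mul_smul, Matrix.trace_smul, h.Lab, smul_eq_mul]
  rw [Matrix.mul_sum, Matrix.trace_sum, Finset.sum_congr rfl fun p _ => e1 p]
  rw [← Finset.univ_product_univ, Finset.sum_product]
  have := lee_alg (fun a i j => pd a (pd i (pd j u)) x) (hess u x) e (fun a => pd a (fun x => Dv (hess u x)) x) (Dv (hess u x)) (fun a => h.d1 a x) (h.adm x).frob (h.adm x).one_le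
  exact this

lemma Ltau (h : Sol k u) (x : E n) : ContDiff ℝ ∞ (fun x => (Dv (hess u x) + 200 * k ^ 3) ^ (-(1/3:ℝ))) ∧
    (Fm (hess u x) * hess (fun x => (Dv (hess u x) + 200 * k ^ 3) ^ (-(1/3:ℝ))) x).trace ≤ 0 := by
  have hk := h.hk
  have hJ : 0 < 200 * k ^ 3 := by positivity
  set J := 200 * k ^ 3 with hJJ
  have hy : ∀ x, 0 < Dv (hess u x) + J := fun x => by linarith [(h.adm x).one_le]
  have h2 : ∀ i j, ContDiff ℝ ∞ (pd i (pd j u)) := fun i j => smooth_pd (smooth_pd h.sm j) i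
  refine ⟨(h.smD.add contDiff_const).rpow_const_of_ne fun x => (hy x).ne', ?_⟩
  rw [hess_chain (g := fun x => Dv (hess u x)) (ψ := fun t => (t + J) ^ (-(1/3:ℝ))) (ψ' := fun t => -(1/3) * (t + J) ^ (-(4/3:ℝ)))
    (d := 4/9 * (Dv (hess u x) + J) ^ (-(7/3:ℝ))) h.smD]
  rotate_left
  · intro y
    have := ((hasDerivAt_id (Dv (hess u y))).add_const J).rpow_const (p := -(1/3:ℝ)) (Or.inl (hy y).ne')
    exact this.congr_deriv (by rw [show (-(1/3:ℝ)-1) = -(4/3) by norm_num]; simp)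
  · have := (((hasDerivAt_id (Dv (hess u x))).add_const J).rpow_const (p := -(4/3:ℝ)) (Or.inl (hy x).ne')).const_mul (-(1/3:ℝ))
    exact this.congr_deriv (by rw [show (-(4/3:ℝ)-1) = -(7/3) by norm_num, id]; ring)
  have eD : hess (fun x => Dv (hess u x)) x = ∑ a, hess (pd a (pd a u)) x := by
    have : (fun x => Dv (hess u x)) = fun x => (∑ a, pd a (pd a u) x) + (-1) := rfl
    rw [this, hess_add (ContDiff.sum fun i _ => h2 i i) contDiff_const, hess_const, add_zero, hess_sum _ (fun i => h2 i i)]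
  set ξ := gr (fun x => Dv (hess u x)) x with hξ
  have e1 : (Fm (hess u x) * hess (fun x => Dv (hess u x)) x).trace = ∑ a, ∑ i, ∑ j, pd a (pd i (pd j u)) x ^ 2 - ξ ⬝ᵥ ξ := by
    rw [eD, Matrix.mul_sum, Matrix.trace_sum]
    simp only [h.Lab, dotProduct, Finset.sum_sub_distrib, sq]; rfl
  have e2 := jacobi hk (h.adm x) (fun a => Matrix.of fun i j => pd a (pd i (pd j u)) x)
    (fun a i j => by simp only [Matrix.of_apply]; rw [pd_comm h.sm])
    (fun a i j => by simp only [Matrix.of_apply]; rw [pd_comm (smooth_pd h.sm j)]) ξ (fun a => h.d1 a x)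
  simp only [Matrix.of_apply] at e2
  rw [Matrix.mul_add, Matrix.trace_add, Matrix.mul_smul, Matrix.mul_smul, Matrix.trace_smul, Matrix.trace_smul, e1, trace_mul_vecMulVec]
  simp only [smul_eq_mul]
  set y := Dv (hess u x) + J with hyy
  have hy0 : 0 < y := hy x
  have e3 : y ^ (-(4/3:ℝ)) = y ^ (-(7/3:ℝ)) * y := by
    rw [← Real.rpow_add_one hy0.ne']; norm_num
  have e4 : 0 < y ^ (-(7/3:ℝ)) := Real.rpow_pos_of_pos hy0 _
  rw [e3]
  set w := y ^ (-(7/3:ℝ))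
  set B := ∑ a, ∑ i, ∑ j, pd a (pd i (pd j u)) x ^ 2
  set q := ξ ⬝ᵥ Fm (hess u x) *ᵥ ξ
  have e5 : 4/3 * q ≤ (B - ξ ⬝ᵥ ξ) * y := by
    rw [← div_le_iff₀ hy0]; linarith
  nlinarith

end Sol
end

section
noncomputable def aM (k : ℝ) (m : Mt n) : Mt n := m.det • (m⁻¹ * Fm (m⁻¹ - k • 1) * m⁻¹)

lemma inv_of {m P : Mt n} (h : m * P = 1) : m⁻¹ = P ∧ m.det = P.det⁻¹ := by
  refine ⟨Matrix.inv_eq_right_inv h, ?_⟩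
  have := congrArg Matrix.det h
  rw [Matrix.det_mul, Matrix.det_one] at this
  exact eq_inv_of_mul_eq_one_left this

lemma aM_eq {k : ℝ} {m S : Mt n} (h : m * (S + k • 1) = 1) : aM k m = (S + k • 1).det⁻¹ • ((S + k • 1) * Fm S * (S + k • 1)) := by
  rw [aM, (inv_of h).1, (inv_of h).2, add_sub_cancel_right]

lemma surj_of {T : E n → E n} (hT : ContDiff ℝ ∞ T) (hd : ∀ x, (jac T x).det ≠ 0) (ha : AntilipschitzWith 1 T) : Function.Surjective T := by
  have ho : IsOpenMap T := by
    apply isOpenMap_iff_nhds_le.2 fun x => ?_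
    have h1 : HasStrictFDerivAt T (fderiv ℝ T x) x := hT.contDiffAt.hasStrictFDerivAt (by simp)
    have h2 : HasStrictFDerivAt T (((fderiv ℝ T x).toContinuousLinearEquivOfDetNeZero (by rw [det_jac hT]; exact hd x) : E n ≃L[ℝ] E n) : E n →L[ℝ] E n) x := by
      rwa [ContinuousLinearMap.coe_toContinuousLinearEquivOfDetNeZero]
    exact h2.map_nhds_eq_of_equiv.ge
  have hcl : IsClosedMap T := by
    apply IsProperMap.isClosedMap
    rw [isProperMap_iff_tendsto_cocompact]
    refine ⟨hT.continuous, ?_⟩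
    rw [← Metric.cobounded_eq_cocompact]
    exact ha.tendsto_cobounded
  rw [← range_eq_univ]
  exact (IsClopen.eq_univ ⟨hcl.isClosed_range, ho.isOpen_range⟩ (range_nonempty T))

lemma antil {T : E n → E n} (h : ∀ y y', ‖y' - y‖ ^ 2 ≤ ∑ i, (y' - y) i * (T y' - T y) i) : AntilipschitzWith 1 T := by
  refine AntilipschitzWith.of_le_mul_dist fun y' y => ?_
  have h1 := h y y'
  have h2 : ∑ i, (y' - y) i * (T y' - T y) i ≤ ‖y' - y‖ * ‖T y' - T y‖ := by
    refine le_trans (le_of_eq ?_) (real_inner_le_norm (y' - y) (T y' - T y))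
    simp [PiLp.inner_apply, mul_comm]
  rw [dist_eq_norm, dist_eq_norm, NNReal.coe_one, one_mul]
  rcases (norm_nonneg (y' - y)).eq_or_lt with h0 | h0
  · rw [← h0]; exact norm_nonneg _
  · nlinarith

lemma int_pd {f : E n → ℝ} (hf : ContDiff ℝ ∞ f) (hc : HasCompactSupport f) (i : Fin n) : ∫ x, pd i f x = 0 := by
  have := ibp_pd hf (contDiff_const (c := (1:ℝ))) hc i
  simp only [pd_const, mul_zero, integral_zero, mul_one] at this
  linarith

structure Good (k l L : ℝ) (X : E n → E n) : Prop where
  hk : 1 ≤ k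
  sm : ContDiff ℝ ∞ X
  bij : Function.Bijective X
  mono : ∀ y y', ‖X y' - X y‖ ^ 2 ≤ ∑ i, (X y' - X y) i * (y' - y) i
  adm : ∀ y, ∃ S, Adm k S ∧ jac X y * (S + k • 1) = 1
  coef : Coef (fun y => aM k (jac X y)) l L
  harm : ∀ i y, (aM k (jac X y) * hess (fun z => X z i) y).trace = 0

namespace Sol
variable {k : ℝ} {u : E n → ℝ}

lemma smF (h : Sol k u) (i j : Fin n) : ContDiff ℝ ∞ (fun x => Fm (hess u x) i j) := by
  have : (fun x => Fm (hess u x) i j) = fun x => Dv (hess u x) * (1 : Mt n) i j - pd i (pd j u) x := rfl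
  rw [this]
  exact (h.smD.mul contDiff_const).sub (smooth_pd (smooth_pd h.sm j) i)

lemma divF (h : Sol k u) (j : Fin n) (x : E n) : ∑ i, pd i (fun x => Fm (hess u x) i j) x = 0 := by
  have e : ∀ i, pd i (fun x => Fm (hess u x) i j) x = pd i (fun x => Dv (hess u x)) x * (1 : Mt n) i j - pd i (pd i (pd j u)) x := by
    intro i
    have : (fun x => Fm (hess u x) i j) = fun x => Dv (hess u x) * (1 : Mt n) i j - pd i (pd j u) x := rfl
    rw [this, pd_sub ((h.smD.mul contDiff_const).dif x) ((smooth_pd (smooth_pd h.sm j) i).dif x), pd_mul (h.smD.dif x) (contDiff_const.dif x), pd_const]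
    ring
  simp only [e, Finset.sum_sub_distrib, Matrix.one_apply, mul_ite, mul_one, mul_zero, Finset.sum_ite_eq', Finset.mem_univ, if_true]
  rw [h.pdD, sub_eq_zero]
  exact Finset.sum_congr rfl fun i _ => by rw [pd_comm h.sm i j, pd_comm (smooth_pd h.sm i) i j]

lemma symF (h : Sol k u) (x) : (Fm (hess u x))ᵀ = Fm (hess u x) := by
  simp [Fm, Matrix.transpose_sub, hess_tr h.sm x]

lemma ibpF (h : Sol k u) {φ g : E n → ℝ} (hφ : ContDiff ℝ ∞ φ) (hg : ContDiff ℝ ∞ g) (hc : HasCompactSupport φ) :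
    ∫ x, φ x * (Fm (hess u x) * hess g x).trace = - ∫ x, gr φ x ⬝ᵥ Fm (hess u x) *ᵥ gr g x := by
  have hF : ∀ i, ContDiff ℝ ∞ (fun x => ∑ j, Fm (hess u x) i j * pd j g x) := fun i => ContDiff.sum fun j _ => (h.smF i j).mul (smooth_pd hg j)
  have key : ∀ x, φ x * (Fm (hess u x) * hess g x).trace + gr φ x ⬝ᵥ Fm (hess u x) *ᵥ gr g x = ∑ i, pd i (fun x => φ x * ∑ j, Fm (hess u x) i j * pd j g x) x := by
    intro x
    have e : ∀ i, pd i (fun x => φ x * ∑ j, Fm (hess u x) i j * pd j g x) x = φ x * (∑ j, Fm (hess u x) i j * hess g x i j) +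
       φ x * (∑ j, pd i (fun x => Fm (hess u x) i j) x * pd j g x) + pd i φ x * ∑ j, Fm (hess u x) i j * pd j g x := by
      intro i
      rw [pd_mul (hφ.dif x) ((hF i).dif x), pd_sum _ (fun j _ => ((h.smF i j).mul (smooth_pd hg j)).dif x)]
      simp only [pd_mul ((h.smF i _).dif x) ((smooth_pd hg _).dif x), Finset.sum_add_distrib, hess_apply]
      ring
    simp only [e, Finset.sum_add_distrib, ← Finset.mul_sum]
    rw [tr_mul (hess_tr hg x), Finset.sum_comm (f := fun i j => pd i (fun x => Fm (hess u x) i j) x * pd j g x)]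
    simp only [← Finset.sum_mul, h.divF, zero_mul, Finset.sum_const_zero, mul_zero, add_zero]
    rfl
  have hcg : HasCompactSupport (gr φ) := by
    refine (hc.fderiv (𝕜 := ℝ)).comp_left (g := fun L : E n →L[ℝ] ℝ => fun i => L (EuclideanSpace.single i 1)) ?_
    ext i; simp
  have i1 : Integrable fun x => φ x * (Fm (hess u x) * hess g x).trace := by
    apply Continuous.integrable_of_hasCompactSupport _ hc.mul_right
    exact hφ.continuous.mul (tr_cont (continuous_matrix fun i j => (h.smF i j).continuous) hg)
  have i2 : Integrable fun x => gr φ x ⬝ᵥ Fm (hess u x) *ᵥ gr g x := by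
    apply Continuous.integrable_of_hasCompactSupport
    · exact bil_cont (continuous_matrix fun i j => (h.smF i j).continuous) (smooth_gr_cont hφ) (smooth_gr_cont hg)
    · exact hcg.mono (fun x hx => by
        simp only [Function.mem_support] at hx ⊢
        intro h0; apply hx; rw [h0, zero_dotProduct])
  have e0 := integral_congr_ae (μ := volume) (Eventually.of_forall key)
  rw [integral_add i1 i2, integral_finset_sum] at e0
  · rw [Finset.sum_eq_zero fun i _ => int_pd (hφ.mul (hF i)) hc.mul_right i] at e0
    linarith
  · intro i _
    exact (smooth_pd (hφ.mul (hF i)) i).continuous.integrable_of_hasCompactSupport (HasCompactSupport.fderiv_apply (𝕜 := ℝ) hc.mul_right _)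

noncomputable def _root_.Ym (k : ℝ) (u : E n → ℝ) (x : E n) : E n := WithLp.toLp 2 fun i => pd i u x + k * x i

lemma smY (h : Sol k u) : ContDiff ℝ ∞ (Ym k u) := by
  rw [contDiff_euclidean]
  intro i
  exact (smooth_pd h.sm i).add (contDiff_const.mul (smooth_coord i))

lemma pdY (h : Sol k u) (i j : Fin n) : pd j (fun z => Ym k u z i) = fun x => (hess u x + k • 1) i j := by
  funext x
  have : (fun z => Ym k u z i) = fun x => pd i u x + k * x i := rfl
  rw [this, pd_add ((smooth_pd h.sm i).dif x) ((contDiff_const.mul (smooth_coord i)).dif x), pd_const_mul ((smooth_coord i).dif x), pd_coord,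
    pd_comm h.sm]
  simp [Matrix.one_apply, eq_comm, hess_apply]

lemma jacY (h : Sol k u) (x) : jac (Ym k u) x = hess u x + k • 1 := by
  ext i j
  exact congrFun (h.pdY i j) x

lemma transport (h : Sol k u) {g : E n → ℝ} (hg : ContDiff ℝ ∞ g) (x : E n) :
    gr (fun x => g (Ym k u x)) x = (hess u x + k • 1) *ᵥ gr g (Ym k u x) ∧
    (Fm (hess u x) * hess (fun x => g (Ym k u x)) x).trace =
      (((hess u x + k • 1) * Fm (hess u x) * (hess u x + k • 1)) * hess g (Ym k u x)).trace := by
  have sP : ∀ x, (hess u x + k • 1)ᵀ = hess u x + k • 1 := fun x => by simp [Matrix.transpose_add, hess_tr h.sm x]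
  have p1 : ∀ j, pd j (fun x => g (Ym k u x)) = fun x => ∑ a, pd a g (Ym k u x) * (hess u x + k • 1) a j := by
    intro j; funext x
    rw [pd_compE (hg.dif _) (difE h.smY x)]
    exact Finset.sum_congr rfl fun a _ => by rw [h.pdY]
  have gY : ∀ a, ContDiff ℝ ∞ (fun x => pd a g (Ym k u x)) := fun a => (smooth_pd hg a).comp h.smY
  have smP : ∀ a j, ContDiff ℝ ∞ (fun x => (hess u x + k • 1) a j) := fun a j => by
    rw [← h.pdY]; exact smooth_pd (smooth_comp_coord h.smY a) j
  have pP : ∀ i a j, pd i (fun x => (hess u x + k • 1) a j) x = pd a (pd i (pd j u)) x := by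
    intro i a j
    have : (fun x => (hess u x + k • 1) a j) = fun x => pd a (pd j u) x + (k • (1 : Mt n)) a j := rfl
    rw [this, pd_add ((smooth_pd (smooth_pd h.sm j) a).dif x) (contDiff_const.dif x), pd_const, add_zero, pd_comm (smooth_pd h.sm j)]
  have p2 : hess (fun x => g (Ym k u x)) x = (hess u x + k • 1) * hess g (Ym k u x) * (hess u x + k • 1) +
      ∑ a, pd a g (Ym k u x) • (Matrix.of fun i j => pd a (pd i (pd j u)) x) := by
    ext i j
    rw [hess_apply, p1, pd_sum _ (fun a _ => ((gY a).mul (smP a j)).dif x)]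
    simp only [pd_mul ((gY _).dif x) ((smP _ j).dif x), Finset.sum_add_distrib, pP]
    rw [add_comm, Matrix.add_apply, Matrix.sum_apply]
    congr 1
    · rw [Matrix.mul_apply]
      refine Finset.sum_congr rfl fun a _ => ?_
      congr 1
      rw [pd_compE ((smooth_pd hg a).dif _) (difE h.smY x), Matrix.mul_apply]
      refine Finset.sum_congr rfl fun b _ => ?_
      rw [h.pdY, mul_comm, hess_apply]; beta_reduce; rw [← congrFun (congrFun (sP x) b) i, Matrix.transpose_apply]
  refine ⟨?_, ?_⟩
  · ext j
    simp only [gr, p1, Matrix.mulVec, dotProduct]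
    exact Finset.sum_congr rfl fun a _ => by rw [← congrFun (congrFun (sP x) a) j, Matrix.transpose_apply, mul_comm]
  · have z : ∀ a, (Fm (hess u x) * (Matrix.of fun i j => pd a (pd i (pd j u)) x)).trace = 0 := by
      intro a
      rw [trF]
      · have := h.d1 a x
        rw [h.pdD] at this
        simp only [Matrix.of_apply, hess_apply]
        rw [← this, sub_eq_zero]
        exact Finset.sum_congr rfl fun i _ => Finset.sum_congr rfl fun j _ => by ring
      · ext i j; simp only [Matrix.transpose_apply, Matrix.of_apply]; rw [pd_comm h.sm]
    rw [p2, Matrix.mul_add, Matrix.trace_add, Matrix.mul_sum, Matrix.trace_sum, Finset.sum_eq_zero, add_zero]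
    · rw [← Matrix.mul_assoc, Matrix.trace_mul_comm, ← Matrix.mul_assoc, ← Matrix.mul_assoc]
    · intro a _
      rw [Matrix.mul_smul, Matrix.trace_smul, z, smul_zero]

lemma good (h : Sol k u) {l L : ℝ} (hl : 0 < l) (hL : 0 < L) (hell : ∀ S : Mt n, Adm k S →
    (∀ v, l * (v ⬝ᵥ v) ≤ v ⬝ᵥ ((S + k • 1).det⁻¹ • ((S + k • 1) * Fm S * (S + k • 1))) *ᵥ v) ∧
    (∀ v, v ⬝ᵥ ((S + k • 1).det⁻¹ • ((S + k • 1) * Fm S * (S + k • 1))) *ᵥ v ≤ L * (v ⬝ᵥ v)) ∧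
    1 ≤ (S + k • 1).det ∧ Dv S ≤ L * (S + k • 1).det) : ∃ X : E n → E n, Good k l L X ∧ (∀ x, X (Ym k u x) = x) ∧ (∀ y, Ym k u (X y) = y) ∧
    ∀ y, jac X y * (hess u (X y) + k • 1) = 1 := by
  have hdet : ∀ x, 1 ≤ (jac (Ym k u) x).det := fun x => by rw [h.jacY]; exact (hell _ (h.adm x)).2.2.1
  have hd0 : ∀ x, (jac (Ym k u) x).det ≠ 0 := fun x => by linarith [hdet x]
  have hm : ∀ y y', ‖y' - y‖ ^ 2 ≤ ∑ i, (y' - y) i * (Ym k u y' - Ym k u y) i := fun y y' => by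
    have := mono_line (c := 1) h.smY (fun x v => by rw [h.jacY, one_mul]; exact (h.adm x).pos v) y y'
    rwa [one_mul] at this
  have hal := antil hm
  have hbij : Function.Bijective (Ym k u) := ⟨hal.injective, surj_of h.smY hd0 hal⟩
  obtain ⟨X, hX, hXY, hYX⟩ := inv_smooth h.smY hbij hd0
  have hj : ∀ y, jac X y * (hess u (X y) + k • 1) = 1 := fun y => by
    have := jac_inv h.smY hX hXY (X y)
    rwa [hYX, h.jacY] at this
  have ha : ∀ x, aM k (jac X (Ym k u x)) = (hess u x + k • 1).det⁻¹ • ((hess u x + k • 1) * Fm (hess u x) * (hess u x + k • 1)) := fun x => by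
    rw [aM_eq (hj _), hXY]
  have hdp : ∀ x, 0 < (hess u x + k • 1).det := fun x => by rw [← h.jacY]; linarith [hdet x]
  have sP : ∀ x, (hess u x + k • 1)ᵀ = hess u x + k • 1 := fun x => by simp [Matrix.transpose_add, hess_tr h.sm x]
  have htr : ∀ {g : E n → ℝ}, ContDiff ℝ ∞ g → ∀ x, (hess u x + k • 1).det * (aM k (jac X (Ym k u x)) * hess g (Ym k u x)).trace =
      (Fm (hess u x) * hess (fun x => g (Ym k u x)) x).trace := fun hg x => by
    rw [(h.transport hg x).2, ha, Matrix.smul_mul, Matrix.trace_smul, smul_eq_mul, ← mul_assoc, mul_inv_cancel₀ (hdp x).ne', one_mul]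
  have hcov : ∀ f : E n → ℝ, ∫ y, f y = ∫ x, (hess u x + k • 1).det * f (Ym k u x) := fun f => by
    have := cov h.smY MeasurableSet.univ hbij.1 f
    rw [image_univ, hbij.2.range_eq, Measure.restrict_univ] at this
    rw [this]
    exact integral_congr_ae (Eventually.of_forall fun x => by simp only [h.jacY, abs_of_pos (hdp x)])
  refine ⟨X, ⟨h.hk, hX, ⟨fun y y' e => by rw [← hYX y, ← hYX y', e], fun x => ⟨_, hXY x⟩⟩, fun y y' => by simpa only [hYX] using hm (X y) (X y'), fun y => ⟨_, h.adm _, hj y⟩, ?_, ?_⟩, hXY, hYX, hj⟩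
  · refine ⟨hl, hL, ?_, ?_, ?_, ?_, ?_⟩
    · have e : (fun y => aM k (jac X y)) = fun y => (hess u (X y) + k • 1).det⁻¹ • ((hess u (X y) + k • 1) * Fm (hess u (X y)) * (hess u (X y) + k • 1)) := by
        funext y; rw [← ha, hYX]
      rw [e]
      have c1 : Continuous fun y => hess u (X y) + k • (1 : Mt n) := ((hess_cont h.sm).comp hX.continuous).add continuous_const
      have c2 : Continuous fun y => Fm (hess u (X y)) := continuous_matrix fun i j => (h.smF i j).continuous.comp hX.continuous
      exact (c1.matrix_det.inv₀ fun y => (hdp _).ne').smul ((c1.matrix_mul c2).matrix_mul c1)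
    · intro y
      rw [← hYX y, ha, Matrix.transpose_smul, Matrix.transpose_mul, Matrix.transpose_mul, sP, h.symF, Matrix.mul_assoc]
    · intro y; rw [← hYX y, ha]; exact (hell _ (h.adm _)).1
    · intro y; rw [← hYX y, ha]; exact (hell _ (h.adm _)).2.1
    · intro φ g hφ hg hc
      have hφ' : ContDiff ℝ ∞ (fun x => φ (Ym k u x)) := hφ.comp h.smY
      have hg' : ContDiff ℝ ∞ (fun x => g (Ym k u x)) := hg.comp h.smY
      have hc' : HasCompactSupport (fun x => φ (Ym k u x)) := by
        refine HasCompactSupport.intro (hc.image hX.continuous) fun x hx => ?_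
        by_contra h0
        exact hx ⟨Ym k u x, subset_closure h0, hXY x⟩
      have := h.ibpF hφ' hg' hc'
      rw [hcov fun x => φ x * (aM k (jac X x) * hess g x).trace, hcov fun x => gr φ x ⬝ᵥ aM k (jac X x) *ᵥ gr g x]
      convert this using 2
      · funext x
        rw [← htr hg]; ring
      · congr 1; funext x
        rw [(h.transport hφ x).1, (h.transport hg x).1, ha, Matrix.smul_mulVec, dotProduct_smul, smul_eq_mul, ← mul_assoc, mul_inv_cancel₀ (hdp x).ne', one_mul,
          ← Matrix.mulVec_mulVec, ← Matrix.mulVec_mulVec, Matrix.dotProduct_mulVec, ← Matrix.mulVec_transpose, sP]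
  · intro i y
    have := htr (smooth_comp_coord hX i) (X y)
    simp only [hXY, hess_coord, Matrix.mul_zero, Matrix.trace_zero, hYX] at this
    exact (mul_eq_zero.1 this).resolve_left (hdp _).ne'

lemma sup (h : Sol k u) {X : E n → E n} (hX : ContDiff ℝ ∞ X) (hXY : ∀ x, X (Ym k u x) = x) (hYX : ∀ y, Ym k u (X y) = y)
    (hj : ∀ y, jac X y * (hess u (X y) + k • 1) = 1) (hd : ∀ x, 1 ≤ (hess u x + k • 1).det) {z : E n → ℝ} (hz : ContDiff ℝ ∞ z)
    (hs : ∀ x, (Fm (hess u x) * hess z x).trace ≤ 0) (y) : (aM k (jac X y) * hess (fun y => z (X y)) y).trace ≤ 0 := by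
  have h1 := (h.transport (hz.comp hX) (X y)).2
  simp only [Function.comp_def, hXY, hYX] at h1
  have h2 := hs (X y)
  rw [h1] at h2
  rw [aM_eq (hj y), Matrix.smul_mul, Matrix.trace_smul, smul_eq_mul]
  exact mul_nonpos_of_nonneg_of_nonpos (inv_nonneg.2 (by linarith [hd (X y)])) h2

end Sol
end

lemma psd_frob {N : Mt n} (hs : Nᵀ = N) (h : ∀ v, 0 ≤ v ⬝ᵥ N *ᵥ v) : 0 ≤ N.trace ∧ ∑ i, ∑ j, N i j ^ 2 ≤ N.trace ^ 2 := by
  have hq : ∀ i j (s : ℝ), (Pi.single i 1 + s • Pi.single j 1 : Fin n → ℝ) ⬝ᵥ N *ᵥ (Pi.single i 1 + s • Pi.single j 1) = N j j * (s * s) + 2 * N i j * s + N i i := by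
    intro i j s
    have := congrFun (congrFun hs i) j
    rw [Matrix.transpose_apply] at this
    simp only [Matrix.mulVec_add, Matrix.mulVec_smul, add_dotProduct, dotProduct_add, smul_dotProduct, dotProduct_smul, single_one_dotProduct, Matrix.mulVec_single_one, Matrix.col_apply, smul_eq_mul, this]
    ring
  have h1 : ∀ i j, N i j ^ 2 ≤ N i i * N j j := fun i j => by
    have := discrim_le_zero (a := N j j) (b := 2 * N i j) (c := N i i) fun s => by rw [← hq]; exact h _
    rw [discrim] at this
    linarith
  refine ⟨?_, ?_⟩
  · refine Finset.sum_nonneg fun i _ => ?_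
    have := h (Pi.single i 1)
    simpa using this
  · rw [sq, Matrix.trace, Finset.sum_mul_sum]
    exact Finset.sum_le_sum fun i _ => Finset.sum_le_sum fun j _ => h1 i j

lemma rigid {k : ℝ} {S M : Mt n} (hS : Adm k S) (hMs : Mᵀ = M) (hM : Dv M ^ 2 = 1 + ∑ i, ∑ j, M i j ^ 2)
    (h : ∀ v, v ⬝ᵥ S *ᵥ v ≤ v ⬝ᵥ M *ᵥ v) : S = M := by
  obtain ⟨h1, h2⟩ := psd_frob (N := M - S) (by rw [Matrix.transpose_sub, hMs, hS.symm]) (fun v => by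
    rw [Matrix.sub_mulVec, dotProduct_sub]; linarith [h v])
  have h3 := hS.frob
  have h5 := hS.one_le
  have h4 := frob_cs (M - S) S
  have h6 : ∑ i, ∑ j, M i j ^ 2 = ∑ i, ∑ j, S i j ^ 2 + 2 * ∑ i, ∑ j, (M - S) i j * S i j + ∑ i, ∑ j, (M - S) i j ^ 2 := by
    simp only [Finset.mul_sum, ← Finset.sum_add_distrib, Matrix.sub_apply]
    exact Finset.sum_congr rfl fun i _ => Finset.sum_congr rfl fun j _ => by ring
  have h7 : Dv M = Dv S + (M - S).trace := by simp only [Dv, Matrix.trace_sub]; ring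
  have h8 : 0 ≤ ∑ i, ∑ j, (M - S) i j ^ 2 := Finset.sum_nonneg fun _ _ => Finset.sum_nonneg fun _ _ => sq_nonneg _
  rw [h7, h6] at hM
  have h9 : ∑ i, ∑ j, (M - S) i j ^ 2 = 0 := by
    generalize ∑ i, ∑ j, (M - S) i j ^ 2 = N at *
    generalize ∑ i, ∑ j, (M - S) i j * S i j = c at *
    generalize ∑ i, ∑ j, S i j ^ 2 = s at *
    generalize (M - S).trace = t at *
    generalize Dv S = D at *
    have a1 : D * t ≤ c := by nlinarith
    have a2 : (D * t) ^ 2 ≤ c ^ 2 := pow_le_pow_left₀ (by positivity) a1 2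
    have a3 : N * s ≤ t ^ 2 * (D ^ 2 - 1) := by
      rw [show s = D ^ 2 - 1 by linarith]; exact mul_le_mul_of_nonneg_right h2 (by nlinarith)
    nlinarith
  ext i j
  have := (Finset.sum_eq_zero_iff_of_nonneg fun j _ => sq_nonneg _).1
    ((Finset.sum_eq_zero_iff_of_nonneg fun i _ => Finset.sum_nonneg fun j _ => sq_nonneg ((M - S) i j)).1 h9 i (Finset.mem_univ _)) j (Finset.mem_univ _)
  have := pow_eq_zero_iff (two_ne_zero) |>.1 this
  rw [Matrix.sub_apply] at this
  linarith

lemma case1 (hn : 2 ≤ n) {k : ℝ} {u : E n → ℝ} (h : Sol k u) {B : ℝ} (hB : ∀ x, Dv (hess u x) ≤ B) : ∃ M, ∀ x, hess u x = M := by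
  obtain ⟨l, L, hl, hL, hell⟩ := ell n k h.hk
  obtain ⟨X, hG, hXY, hYX, hj⟩ := h.good hl hL hell
  have hd : ∀ x, 1 ≤ (hess u x + k • 1).det := fun x => (hell _ (h.adm x)).2.2.1
  set q : (Fin n → ℝ) → E n → ℝ := fun e x => e ⬝ᵥ hess u x *ᵥ e with hq
  have hSB : ∀ x i j, |hess u x i j| ≤ B := fun x i j => by
    refine le_trans (abs_le_of_sq_le_sq ?_ (h.adm x).hD.le) (hB x)
    rw [(h.adm x).frob]
    have a1 := Finset.single_le_sum (f := fun i => ∑ j, hess u x i j ^ 2) (fun i _ => Finset.sum_nonneg fun j _ => sq_nonneg _) (Finset.mem_univ i)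
    have a2 := Finset.single_le_sum (f := fun j => hess u x i j ^ 2) (fun j _ => sq_nonneg _) (Finset.mem_univ j)
    linarith
  have hqb : ∀ e x, |q e x| ≤ ∑ i, ∑ j, |e i| * (B * |e j|) := fun e x => by
    simp only [hq, dotProduct, Matrix.mulVec, Finset.mul_sum]
    refine (Finset.abs_sum_le_sum_abs _ _).trans (Finset.sum_le_sum fun i _ => (Finset.abs_sum_le_sum_abs _ _).trans (Finset.sum_le_sum fun j _ => ?_))
    rw [abs_mul, abs_mul]
    have := hSB x i j
    gcongr
  set s : (Fin n → ℝ) → ℝ := fun e => ⨆ x, q e x with hs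
  have hbd : ∀ e, BddAbove (range (q e)) := fun e => ⟨_, by rintro _ ⟨x, rfl⟩; exact (le_abs_self _).trans (hqb e x)⟩
  have hqs : ∀ e x, q e x ≤ s e := fun e x => le_ciSup (hbd e) x
  have hwh : ∀ e, ∀ ε > 0, ∃ R0 : ℝ, 0 < R0 ∧ ∀ R ≥ R0, ∫ y in ball (0 : E n) 1, (s e - q e (X (R • y))) ≤ ε := by
    intro e ε hε
    have hsm := (h.Lee e 0).1
    have hz : ContDiff ℝ ∞ (fun x => s e - q e x) := contDiff_const.sub hsm
    refine wh_infty n hn (z := fun y => s e - q e (X y)) hG.coef (hz.comp hG.sm) (fun y => sub_nonneg.2 (hqs e _))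
      (|s e| + ∑ i, ∑ j, |e i| * (B * |e j|) + 1) ?_ ?_ ?_ ?_ ε hε
    · have := (abs_nonneg _).trans (hqb e 0); positivity
    · intro y; linarith [le_abs_self (s e), neg_abs_le (q e (X y)), hqb e (X y)]
    · refine fun y => h.sup hG.sm hXY hYX hj hd hz (fun x => ?_) y
      rw [hess_sub contDiff_const hsm, hess_const, zero_sub, Matrix.mul_neg, Matrix.trace_neg]
      linarith [(h.Lee e x).2]
    · intro c hc
      obtain ⟨x, hx⟩ := exists_lt_of_lt_ciSup (show s e - c < ⨆ x, q e x by show s e - c < s e; linarith)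
      exact ⟨Ym k u x, by rw [hXY]; linarith⟩
  have hfam : ∀ (w : Option (Fin n × Fin n) → Fin n → ℝ), ∀ ε > 0, ∃ x, ∀ i, s (w i) - ε ≤ q (w i) x := by
    intro w ε hε
    have hv : 0 < volume.real (ball (0 : E n) 1) := by
      have := measure_ball_pos volume (0 : E n) one_pos
      exact ENNReal.toReal_pos this.ne' measure_ball_lt_top.ne
    set N : ℝ := Fintype.card (Option (Fin n × Fin n)) + 1 with hN
    have hN0 : 0 < N := by positivity
    choose R hR0 hR using fun i => hwh (w i) (ε * volume.real (ball (0 : E n) 1) / N) (by positivity)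
    set R1 := ∑ i, R i
    have hR1 : ∀ i, R i ≤ R1 := fun i => Finset.single_le_sum (f := R) (fun i _ => (hR0 i).le) (Finset.mem_univ i)
    by_contra hcon
    push Not at hcon
    have hc : ∀ i, Continuous fun y : E n => s (w i) - q (w i) (X (R1 • y)) := fun i =>
      continuous_const.sub (((h.Lee (w i) 0).1.continuous).comp (hG.sm.continuous.comp (by fun_prop)))
    have hint : ∀ i, IntegrableOn (fun y : E n => s (w i) - q (w i) (X (R1 • y))) (ball 0 1) := fun i => intb (hc i) 0 1
    have h1 : ∫ y in ball (0 : E n) 1, ε ≤ ∫ y in ball (0 : E n) 1, ∑ i, (s (w i) - q (w i) (X (R1 • y))) := by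
      refine integral_mono (intb continuous_const 0 1) (integrable_finset_sum _ fun i _ => hint i) fun y => ?_
      obtain ⟨i, hi⟩ := hcon (X (R1 • y))
      have := Finset.single_le_sum (f := fun i => s (w i) - q (w i) (X (R1 • y))) (fun i _ => sub_nonneg.2 (hqs _ _)) (Finset.mem_univ i)
      simp only at this ⊢
      linarith
    rw [integral_finset_sum _ fun i _ => hint i, setIntegral_const, smul_eq_mul] at h1
    have h2 := Finset.sum_le_sum fun i (_ : i ∈ Finset.univ) => hR i R1 (hR1 i)
    rw [Finset.sum_const, nsmul_eq_mul, Finset.card_univ] at h2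
    have h3 : (Fintype.card (Option (Fin n × Fin n)) : ℝ) * (ε * volume.real (ball (0 : E n) 1) / N) < volume.real (ball (0 : E n) 1) * ε := by
      rw [← mul_div_assoc, div_lt_iff₀ hN0, hN]
      nlinarith [mul_pos hε hv]
    linarith
  let w0 : Fin n × Fin n → Fin n → ℝ := fun p => Pi.single p.1 1 + Pi.single p.2 1
  have hsy : ∀ x i j, hess u x j i = hess u x i j := fun x i j => congrFun (congrFun (h.adm x).symm i) j
  have hw0 : ∀ x i j, q (w0 (i, j)) x = hess u x i i + hess u x j j + 2 * hess u x i j := fun x i j => by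
    simp only [hq, w0, Matrix.mulVec_add, add_dotProduct, dotProduct_add, single_one_dotProduct, Matrix.mulVec_single_one, Matrix.col_apply, hsy x i j]
    ring
  let M : Mt n := Matrix.of fun i j => (s (w0 (i, j)) - s (w0 (i, i)) / 4 - s (w0 (j, j)) / 4) / 2
  have hseq : ∀ e, ∃ x : ℕ → E n, Tendsto (fun p => hess u (x p)) atTop (𝓝 M) ∧ Tendsto (fun p => q e (x p)) atTop (𝓝 (s e)) := by
    intro e
    choose x hx using fun p : ℕ => hfam (fun o => o.elim e w0) (1 / ((p : ℝ) + 1)) (by positivity)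
    have ht : ∀ o : Option (Fin n × Fin n), Tendsto (fun p => q (o.elim e w0) (x p)) atTop (𝓝 (s (o.elim e w0))) := fun o => by
      refine tendsto_of_tendsto_of_tendsto_of_le_of_le (g := fun p : ℕ => s (o.elim e w0) - 1 / ((p : ℝ) + 1)) ?_ tendsto_const_nhds (fun p => hx p o) (fun p => hqs _ _)
      simpa using tendsto_const_nhds.sub (tendsto_one_div_add_atTop_nhds_zero_nat (𝕜 := ℝ))
    refine ⟨x, ?_, ht none⟩
    refine tendsto_pi_nhds.2 fun i => tendsto_pi_nhds.2 fun j => ?_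
    refine (((ht (some (i, j))).sub ((ht (some (i, i))).div_const 4)).sub ((ht (some (j, j))).div_const 4)).div_const 2 |>.congr fun p => ?_
    simp only [Option.elim, hw0]; ring
  refine ⟨M, fun x => ?_⟩
  obtain ⟨x0, hx0, -⟩ := hseq 0
  have hfr : Dv M ^ 2 = 1 + ∑ i, ∑ j, M i j ^ 2 := by
    have c1 : Continuous fun S : Mt n => Dv S ^ 2 := by unfold Dv; exact ((continuous_id.matrix_trace).sub continuous_const).pow 2
    have c2 : Continuous fun S : Mt n => 1 + ∑ i, ∑ j, S i j ^ 2 := by fun_prop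
    refine tendsto_nhds_unique ((c1.tendsto M).comp hx0) (((c2.tendsto M).comp hx0).congr fun p => ?_)
    exact (h.adm (x0 p)).frob.symm
  have hMs : Mᵀ = M := by
    refine tendsto_nhds_unique ((continuous_id.matrix_transpose.tendsto M).comp hx0) (hx0.congr fun p => ?_)
    exact (h.adm _).symm.symm
  refine rigid (h.adm x) hMs hfr fun v => ?_
  obtain ⟨xv, h1, h2⟩ := hseq v
  have c3 : Continuous fun S : Mt n => v ⬝ᵥ S *ᵥ v := by
    exact continuous_const.dotProduct (continuous_id.matrix_mulVec continuous_const)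
  have := tendsto_nhds_unique h2 ((c3.tendsto M).comp h1)
  rw [← this]
  exact hqs v x

section
lemma dot_le (a b : E n) : |∑ i, a i * b i| ≤ ‖a‖ * ‖b‖ := by
  have := abs_real_inner_le_norm a b
  rwa [show inner ℝ a b = ∑ i, a i * b i by simp [PiLp.inner_apply, mul_comm]] at this

lemma unit_norm {e : Fin n → ℝ} (he : e ⬝ᵥ e = 1) : ‖(WithLp.toLp 2 e : E n)‖ = 1 := by
  have h := norm_sq_eq (WithLp.toLp 2 e : E n)
  have : ∑ i, (WithLp.toLp 2 e : E n) i ^ 2 = 1 := by rw [← he]; simp [dotProduct, sq]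
  rw [this] at h
  nlinarith [norm_nonneg (WithLp.toLp 2 e : E n)]

lemma trap {T : E n → E n} (hT : ∀ y y', 0 ≤ ∑ i, (T y' - T y) i * (y' - y) i) {c : E n} {r ρ Kb : ℝ} (hr : 0 < r) (hρ : 0 ≤ ρ)
    (hK : 0 ≤ Kb) (h : ∀ e : Fin n → ℝ, e ⬝ᵥ e = 1 → ∃ y, ‖y‖ ≤ ρ ∧ ‖T y - c‖ ≤ Kb ∧ r ≤ ∑ i, e i * (T y - c) i) (y : E n) (hy : ‖T y - c‖ ≤ r / 2) :
    ‖y‖ ≤ 2 * ρ * (Kb + r / 2) / r := by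
  rcases eq_or_ne y 0 with h0 | h0
  · rw [h0, norm_zero]; positivity
  have hp : 0 < ‖y‖ := norm_pos_iff.2 h0
  set e : Fin n → ℝ := fun i => ‖y‖⁻¹ * y i with he
  have hee : e ⬝ᵥ e = 1 := by
    have := norm_sq_eq y
    have h2 : e ⬝ᵥ e = (‖y‖⁻¹) ^ 2 * ∑ i, y i ^ 2 := by
      rw [Finset.mul_sum]; simp only [dotProduct, he]; exact Finset.sum_congr rfl fun i _ => by ring
    rw [h2, ← this]; field_simp
  obtain ⟨z, hz1, hz2, hz3⟩ := h e hee
  have hm := hT y z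
  have e1 : ∑ i, e i * (T y - c) i ≤ r / 2 := by
    have := (abs_le.1 (dot_le (WithLp.toLp 2 e : E n) (T y - c))).2
    rw [unit_norm hee, one_mul] at this
    exact this.trans hy
  have e2 : ∑ i, (T z - T y) i * z i ≤ (Kb + r / 2) * ρ := by
    refine (le_abs_self _).trans ((dot_le _ _).trans (mul_le_mul ?_ hz1 (norm_nonneg _) (by positivity)))
    calc ‖T z - T y‖ = ‖(T z - c) - (T y - c)‖ := by congr 1; abel
      _ ≤ _ := (norm_sub_le _ _).trans (by linarith)
  have e3 : ∑ i, (T z - T y) i * (z - y) i = ∑ i, (T z - T y) i * z i - ‖y‖ * (∑ i, e i * (T z - c) i - ∑ i, e i * (T y - c) i) := by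
    rw [← Finset.sum_sub_distrib, Finset.mul_sum, ← Finset.sum_sub_distrib]
    refine Finset.sum_congr rfl fun i _ => ?_
    simp only [he, PiLp.sub_apply]
    field_simp
    ring
  rw [e3] at hm
  rw [le_div_iff₀ hr]
  nlinarith [mul_le_mul_of_nonneg_left (show r / 2 ≤ ∑ i, e i * (T z - c) i - ∑ i, e i * (T y - c) i by linarith) hp.le]

namespace Good
variable {k l L : ℝ} {X : E n → E n}

lemma lip (h : Good k l L X) (y y') : ‖X y' - X y‖ ≤ ‖y' - y‖ := by
  have h1 := h.mono y y'
  have h2 := (abs_le.1 (dot_le (X y' - X y) (y' - y))).2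
  by_contra hc
  push Not at hc
  nlinarith [norm_nonneg (y' - y)]

lemma mo (h : Good k l L X) (y y') : 0 ≤ ∑ i, (X y' - X y) i * (y' - y) i := (sq_nonneg _).trans (h.mono y y')

lemma symj (h : Good k l L X) (y) : (jac X y)ᵀ = jac X y := by
  obtain ⟨S, hS, hm⟩ := h.adm y
  rw [← Matrix.inv_eq_left_inv hm, Matrix.transpose_nonsing_inv]
  simp [Matrix.transpose_add, hS.symm]

lemma smlin (h : Good k l L X) (e : Fin n → ℝ) (c : E n) : ContDiff ℝ ∞ (fun y => ∑ i, e i * (X y - c) i) :=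
  ContDiff.sum fun i _ => contDiff_const.mul ((smooth_comp_coord h.sm i).sub contDiff_const)

lemma grlin (h : Good k l L X) (e : Fin n → ℝ) (c : E n) (y) : gr (fun y => ∑ i, e i * (X y - c) i) y = jac X y *ᵥ e := by
  rw [← h.symj]
  funext j
  show pd j _ y = _
  have hs : ∀ i, ContDiff ℝ ∞ (fun y => e i * (X y - c) i) := fun i => contDiff_const.mul ((smooth_comp_coord h.sm i).sub contDiff_const)
  have := pd_sum Finset.univ (i := j) (x := y) (fun i _ => (hs i).dif y)
  rw [this]
  rw [Matrix.mulVec_transpose, Matrix.vecMul, dotProduct]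
  refine Finset.sum_congr rfl fun i _ => ?_
  have hs0 : ContDiff ℝ ∞ (fun y => (X y - c) i) := (smooth_comp_coord h.sm i).sub contDiff_const
  rw [pd_const_mul (hs0.dif y)]
  have : pd j (fun y => (X y - c) i) y = pd j (fun y => X y i) y - pd j (fun _ => c i) y := pd_sub ((smooth_comp_coord h.sm i).dif y) (contDiff_const.dif y) j
  rw [this, pd_const, sub_zero]; rfl

lemma hlin (h : Good k l L X) (e : Fin n → ℝ) (c : E n) (y) : (aM k (jac X y) * hess (fun y => ∑ i, e i * (X y - c) i) y).trace = 0 := by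
  have hs0 : ∀ i, ContDiff ℝ ∞ (fun y => (X y - c) i) := fun i => (smooth_comp_coord h.sm i).sub contDiff_const
  have hs : ∀ i, ContDiff ℝ ∞ (fun y => e i * (X y - c) i) := fun i => contDiff_const.mul (hs0 i)
  rw [hess_sum Finset.univ hs, Matrix.mul_sum, Matrix.trace_sum]
  refine Finset.sum_eq_zero fun i _ => ?_
  rw [hess_const_mul (hs0 i)]
  have : hess (fun y => (X y - c) i) y = hess (fun y => X y i) y - hess (fun _ => c i) y := hess_sub (smooth_comp_coord h.sm i) contDiff_const y
  rw [this, hess_const, sub_zero, Matrix.mul_smul, Matrix.trace_smul, h.harm, smul_zero]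

lemma mean (hX : Good k l L X) : ∃ c : E n, (∀ e : Fin n → ℝ, ∫ y in ball (0 : E n) 2, ∑ i, e i * (X y - c) i = 0) ∧
    ∀ (w : E n) (y : E n), y ∈ ball (0 : E n) 2 → |∑ i, w i * (X y - c) i| ≤ 4 * ‖w‖ := by
  set v : ℝ := volume.real (ball (0 : E n) 2) with hv
  have v0 : 0 < v := ENNReal.toReal_pos (measure_ball_pos _ _ (by norm_num)).ne' measure_ball_lt_top.ne
  have ic : ∀ f : E n → ℝ, Continuous f → IntegrableOn f (ball 0 2) := fun f hf => intb hf 0 2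
  have hci : ∀ i, Continuous fun y => X y i := fun i => (smooth_comp_coord hX.sm i).continuous
  have hconst : ∀ a : ℝ, ∫ _ in ball (0 : E n) 2, a = v * a := fun a => by
    rw [setIntegral_const, smul_eq_mul]
  let c : E n := WithLp.toLp 2 (fun i => v⁻¹ * ∫ y in ball (0 : E n) 2, X y i)
  have hc : ∀ i, v * c i = ∫ y in ball (0 : E n) 2, X y i := fun i => mul_inv_cancel_left₀ v0.ne' _
  have h1 : ∀ e : Fin n → ℝ, ∫ y in ball (0 : E n) 2, ∑ i, e i * (X y - c) i = 0 := by
    intro e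
    have hs : ∀ i, Continuous (fun y => e i * (X y - c) i) := fun i => continuous_const.mul ((hci i).sub continuous_const)
    rw [integral_finset_sum _ (fun i _ => ic _ (hs i))]
    refine Finset.sum_eq_zero fun i _ => ?_
    rw [integral_const_mul]
    have : ∫ z in ball (0 : E n) 2, (X z - c) i = (∫ z in ball (0 : E n) 2, X z i) - v * c i := by
      rw [← hconst, ← integral_sub (ic _ (hci i)) (ic _ continuous_const)]; rfl
    rw [this, hc, sub_self, mul_zero]
  refine ⟨c, h1, fun w y hy => ?_⟩
  have hs : Continuous fun z => ∑ i, w i * (X z - c) i := (hX.smlin w c).continuous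
  have h2 : v * ∑ i, w i * (X y - c) i = ∫ z in ball (0 : E n) 2, (∑ i, w i * (X y - c) i - ∑ i, w i * (X z - c) i) := by
    rw [integral_sub (ic _ continuous_const) (ic _ hs), h1, hconst, sub_zero]
  have h3 : |v * ∑ i, w i * (X y - c) i| ≤ v * (4 * ‖w‖) := by
    rw [h2, ← hconst]
    refine (abs_integral_le_integral_abs).trans (setIntegral_mono_on (ic _ (continuous_const.sub hs).abs) (ic _ continuous_const) measurableSet_ball ?_)
    intro z hz
    have e : ∑ i, w i * (X y - c) i - ∑ i, w i * (X z - c) i = ∑ i, w i * (X y - X z) i := by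
      rw [← Finset.sum_sub_distrib]; exact Finset.sum_congr rfl fun i _ => by simp only [PiLp.sub_apply]; ring
    rw [e]
    refine (dot_le w (X y - X z)).trans ?_
    rw [mem_ball_zero_iff] at hy hz
    have := (hX.lip z y).trans (norm_sub_le _ _)
    nlinarith [norm_nonneg w]
  rw [abs_mul, abs_of_pos v0] at h3
  exact le_of_mul_le_mul_left h3 v0
end Good

lemma slab (n : ℕ) (k l L : ℝ) (hl : 0 < l) (hL : 0 < L) {ε : ℝ} (hε : 0 < ε) : ∃ Λ δ : ℝ, 0 < Λ ∧ 0 < δ ∧ ∀ X : E n → E n, Good k l L X →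
    ∫ y in ball (0 : E n) Λ, (jac X y).det < δ → (∀ y, 0 ≤ (jac X y).det) → ∃ e : Fin n → ℝ, e ⬝ᵥ e = 1 ∧ ∫ y in ball (0 : E n) 1, (jac X y *ᵥ e) ⬝ᵥ (jac X y *ᵥ e) ≤ ε := by
  obtain ⟨C, hC, hcac⟩ := cacc_ball n l L hl hL
  set v : ℝ := volume.real (ball (0 : E n) 2) with hv
  have v0 : 0 < v := ENNReal.toReal_pos (measure_ball_pos _ _ (by norm_num)).ne' measure_ball_lt_top.ne
  set r : ℝ := ε / (8 * v * C) with hr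
  have r0 : 0 < r := by positivity
  refine ⟨2 * 2 * (4 + r / 2) / r + 1, volume.real (ball (0 : E n) (r / 2)), by positivity, ENNReal.toReal_pos (measure_ball_pos _ _ (by positivity)).ne' measure_ball_lt_top.ne, ?_⟩
  intro X hX hδ hdet
  by_contra hno
  push Not at hno
  have ic : ∀ f : E n → ℝ, Continuous f → IntegrableOn f (ball 0 2) := fun f hf => intb hf 0 2
  have hconst : ∀ a : ℝ, ∫ _ in ball (0 : E n) 2, a = v * a := fun a => by
    rw [setIntegral_const, smul_eq_mul]
  obtain ⟨c, hmean, hg4⟩ := hX.mean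
  have hK : ∀ y ∈ ball (0 : E n) 2, ‖X y - c‖ ≤ 4 := by
    intro y hy
    have h1 := (le_abs_self _).trans (hg4 (X y - c) y hy)
    have h2 := norm_sq_eq (X y - c)
    simp only [← sq] at h1
    rw [← h2] at h1
    by_contra hc
    push Not at hc
    nlinarith
  have key : ∀ e : Fin n → ℝ, e ⬝ᵥ e = 1 → ∃ y, ‖y‖ ≤ 2 ∧ ‖X y - c‖ ≤ 4 ∧ r ≤ ∑ i, e i * (X y - c) i := by
    intro e he
    by_contra hcon
    push Not at hcon
    have hs := hX.smlin e c
    set g : E n → ℝ := fun y => ∑ i, e i * (X y - c) i with hgd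
    have hgr : ∀ y ∈ ball (0 : E n) 2, g y < r := fun y hy => hcon y (mem_ball_zero_iff.1 hy).le (hK y hy)
    have h1 := hcac _ g 1 2 hX.coef hs (fun y => by rw [hX.hlin e c y, mul_zero]) one_pos (by norm_num)
    simp only [hgd, hX.grlin] at h1
    have h2 : ∫ y in ball (0 : E n) 2, g y = 0 := hmean e
    have h3 : ∫ y in ball (0 : E n) 2, g y ^ 2 ≤ ∫ y in ball (0 : E n) 2, (8 * r - 4 * g y) := by
      refine setIntegral_mono_on (ic _ (hs.continuous.pow 2)) (ic _ (continuous_const.sub (continuous_const.mul hs.continuous))) measurableSet_ball fun y hy => ?_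
      have a1 := hg4 (WithLp.toLp 2 e) y hy
      rw [unit_norm he] at a1
      have a2 : |g y| ≤ 4 := by rw [mul_one] at a1; exact a1
      have a3 := hgr y hy
      have a4 := sq_abs (g y)
      rcases abs_cases (g y) with ⟨q, _⟩ | ⟨q, _⟩ <;> nlinarith [abs_nonneg (g y)]
    rw [integral_sub (ic _ continuous_const) ((ic _ hs.continuous).const_mul 4), integral_const_mul, integral_const_mul, h2, hconst] at h3
    have h4 := hno e he
    have h5 : C / (2 - 1) ^ 2 * ∫ y in ball (0 : E n) 2, g y ^ 2 ≤ C * (v * (8 * r)) := by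
      rw [show C / (2 - 1) ^ 2 = C by norm_num]
      exact mul_le_mul_of_nonneg_left (by linarith) hC.le
    have h6 : C * (v * (8 * r)) = ε := by rw [hr]; field_simp
    rw [h6] at h5
    exact absurd (h1.trans h5) (not_le.2 h4)
  have htr := trap (T := X) (fun y y' => hX.mo y y') r0 (by norm_num) (by norm_num) key
  have hsub : ball c (r / 2) ⊆ X '' ball 0 (2 * 2 * (4 + r / 2) / r + 1) := by
    intro x hx
    obtain ⟨y, rfl⟩ := hX.bij.2 x
    refine ⟨y, ?_, rfl⟩
    rw [mem_ball_zero_iff]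
    have := htr y (by rw [← dist_eq_norm]; exact (mem_ball.1 hx).le)
    linarith
  have hfin : volume (X '' ball 0 (2 * 2 * (4 + r / 2) / r + 1)) ≠ ⊤ := by
    refine (lt_of_le_of_lt (measure_mono (image_mono ball_subset_closedBall)) ?_).ne
    exact ((isCompact_closedBall _ _).image hX.sm.continuous).measure_lt_top
  have h1 := cov hX.sm (measurableSet_ball (x := (0 : E n)) (ε := 2 * 2 * (4 + r / 2) / r + 1)) hX.bij.1 (fun _ => 1)
  simp only [mul_one, setIntegral_const, smul_eq_mul, abs_of_nonneg (hdet _)] at h1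
  have h2 := measureReal_mono hsub hfin
  rw [h1] at h2
  have h3 : volume.real (ball c (r / 2)) = volume.real (ball (0 : E n) (r / 2)) := by
    simp only [Measure.real, Measure.addHaar_ball_center]
  rw [h3] at h2
  linarith
end

lemma hat_real {C T F β γ d r pm : ℝ} (hC : 1 ≤ C) (hT0 : 0 ≤ T) (hT1 : T ≤ 1) (hTr : T ≤ C ^ 2 * r) (hF : 0 < F) (hF2 : F ≤ C) (hFd : F ≤ C * d)
    (b0 : 0 ≤ β) (g0 : 0 ≤ γ) (b1 : β ≤ C * T) (g1 : γ ≤ C ^ 2 * T) (d0 : 0 < d) (hpd : pm * d = 1) (hdr : d ≤ 2 * C * r) :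
    d * |(1 + ((1 - T) * pm + β)) * (pm + F - 1) - ((1 - T) * pm ^ 2 + γ)| ≤ ((1 + C) * C ^ 2 + 2 * C * (C + (1 + C) ^ 2 + C ^ 2)) * r := by
  rw [show ∀ x : ℝ, d * |x| = |d * x| from fun x => by rw [abs_mul, abs_of_pos d0]]
  have e : d * ((1 + ((1 - T) * pm + β)) * (pm + F - 1) - ((1 - T) * pm ^ 2 + γ)) = (T + (1 - T) * F + β) + d * ((1 + β) * (F - 1) - γ) := by
    have : d * ((1 + ((1 - T) * pm + β)) * (pm + F - 1) - ((1 - T) * pm ^ 2 + γ)) = (pm * d) * (T + (1 - T) * F + β) + d * ((1 + β) * (F - 1) - γ) := by ring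
    rw [this, hpd, one_mul]
  rw [e]
  have hbC : β ≤ C := b1.trans (mul_le_of_le_one_right (by linarith) hT1)
  have hgC : γ ≤ C ^ 2 := g1.trans (mul_le_of_le_one_right (by positivity) hT1)
  have q0 : (1 + β) * |F - 1| ≤ (1 + C) * (1 + C) :=
    mul_le_mul (by linarith) (abs_le.2 ⟨by linarith, by linarith⟩) (abs_nonneg _) (by linarith)
  have q1 : |(1 + β) * (F - 1) - γ| ≤ (1 + C) ^ 2 + C ^ 2 := by
    refine (abs_sub _ _).trans ?_
    rw [abs_mul, abs_of_nonneg g0, abs_of_nonneg (show (0:ℝ) ≤ 1 + β by linarith), sq (1 + C)]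
    linarith
  have q2 : |T + (1 - T) * F + β| ≤ (1 + C) * (C ^ 2 * r) + C * d := by
    have h1 : 0 ≤ (1 - T) * F := mul_nonneg (by linarith) hF.le
    have h2 : (1 - T) * F ≤ F := mul_le_of_le_one_left hF.le (by linarith)
    have h3 : (1 + C) * T ≤ (1 + C) * (C ^ 2 * r) := mul_le_mul_of_nonneg_left hTr (by linarith)
    rw [abs_of_nonneg (by linarith)]
    linarith
  refine (abs_add_le _ _).trans ?_
  rw [abs_mul, abs_of_pos d0]
  have q3 : d * |(1 + β) * (F - 1) - γ| ≤ d * ((1 + C) ^ 2 + C ^ 2) := mul_le_mul_of_nonneg_left q1 d0.le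
  have q4 : d * (C + (1 + C) ^ 2 + C ^ 2) ≤ (2 * C * r) * (C + (1 + C) ^ 2 + C ^ 2) := mul_le_mul_of_nonneg_right hdr (by positivity)
  linarith

lemma hat_diag (n : ℕ) {C : ℝ} (hC : 1 ≤ C) (p f : Fin n → ℝ) (m : Fin n) (F : ℝ) (hp : ∀ i, 1 ≤ p i) (hpm : ∀ i, i ≠ m → p i ≤ C) (hF : 0 < F)
    (hF2 : F ≤ C) (hpF : p m * F ≤ C) (hf : ∑ i, f i ^ 2 = 1) (c0 : ℝ) (htr : ∑ i, p i - c0 = p m + F - 1) :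
    (∀ w : Fin n → ℝ, ∑ i, w i ^ 2 = 1 → (2 * C)⁻¹ - 2 * C ^ 2 * ∑ i, f i ^ 2 / p i ^ 2 ≤ ∑ i, w i ^ 2 / p i + (∑ i, f i * w i) ^ 2) ∧
    (C ^ n)⁻¹ - C ^ 2 * ∑ i, f i ^ 2 / p i ^ 2 ≤ (∏ i, p i)⁻¹ * (1 + ∑ i, f i ^ 2 * p i) ∧
    |(∏ i, p i)⁻¹ * ((1 + ∑ i, f i ^ 2 * p i) * (∑ i, p i - c0) - ∑ i, f i ^ 2 * p i ^ 2)| ≤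
      ((1 + C) * C ^ 2 + 2 * C * (C + (1 + C) ^ 2 + C ^ 2)) * √(∑ i, f i ^ 2 / p i ^ 2) := by
  have sp : ∀ g : Fin n → ℝ, ∑ i, g i = g m + ∑ i ∈ Finset.univ.erase m, g i := fun g => (Finset.add_sum_erase _ _ (Finset.mem_univ m)).symm
  have hne : ∀ i ∈ Finset.univ.erase m, p i ≤ C := fun i hi => hpm i (Finset.ne_of_mem_erase hi)
  have hpp : ∀ i, 0 < p i := fun i => one_pos.trans_le (hp i)
  set η := ∑ i, f i ^ 2 / p i ^ 2 with hη
  set T := ∑ i ∈ Finset.univ.erase m, f i ^ 2 with hT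
  have hT0 : 0 ≤ T := Finset.sum_nonneg fun i _ => sq_nonneg _
  have ht : f m ^ 2 = 1 - T := by have := sp (fun i => f i ^ 2); linarith
  have hT1 : T ≤ 1 := by linarith [sq_nonneg (f m)]
  have hT2 : T ≤ C ^ 2 * ∑ i ∈ Finset.univ.erase m, f i ^ 2 / p i ^ 2 := by
    rw [Finset.mul_sum]
    refine Finset.sum_le_sum fun i hi => ?_
    rw [← mul_div_assoc, le_div_iff₀ (by have := hpp i; positivity), mul_comm]
    exact mul_le_mul_of_nonneg_right (pow_le_pow_left₀ (hpp i).le (hne i hi) 2) (sq_nonneg _)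
  have hηs := sp (fun i => f i ^ 2 / p i ^ 2)
  have hm0 : 0 ≤ f m ^ 2 / p m ^ 2 := by positivity
  have her : ∑ i ∈ Finset.univ.erase m, f i ^ 2 / p i ^ 2 ≤ η := by linarith
  have hTη : T ≤ C ^ 2 * η := hT2.trans (mul_le_mul_of_nonneg_left her (by positivity))
  have hη0 : 0 ≤ η := Finset.sum_nonneg fun i _ => by positivity
  refine ⟨fun w hw => ?_, ?_, ?_⟩
  · set s := ∑ i ∈ Finset.univ.erase m, w i ^ 2 with hs
    have hs0 : 0 ≤ s := Finset.sum_nonneg fun i _ => sq_nonneg _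
    have hwm : w m ^ 2 = 1 - s := by have := sp (fun i => w i ^ 2); linarith
    have hs1 : s ≤ 1 := by linarith [sq_nonneg (w m)]
    have e1 : s / C ≤ ∑ i, w i ^ 2 / p i := by
      rw [sp, hs, Finset.sum_div]
      have : 0 ≤ w m ^ 2 / p m := div_nonneg (sq_nonneg _) (hpp m).le
      refine le_add_of_nonneg_of_le this (Finset.sum_le_sum fun i hi => ?_)
      exact div_le_div_of_nonneg_left (sq_nonneg _) (hpp i) (hne i hi)
    rw [sp (fun i => f i * w i)]
    set z := ∑ i ∈ Finset.univ.erase m, f i * w i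
    have hz : z ^ 2 ≤ T * s := Finset.sum_mul_sq_le_sq_mul_sq _ _ _
    have hz' : z ^ 2 ≤ T := hz.trans (mul_le_of_le_one_right hT0 hs1)
    have e2 : (1 / 2) * ((1 - T) * (1 - s)) - T ≤ (f m * w m + z) ^ 2 := by
      have : (f m * w m) ^ 2 = (1 - T) * (1 - s) := by rw [mul_pow, ht, hwm]
      linarith [sq_nonneg (f m * w m + 2 * z)]
    have e3 : (2 * C)⁻¹ = s / (2 * C) + (1 - s) / (2 * C) := by field_simp; ring
    have e4 : s / (2 * C) ≤ s / C := div_le_div_of_nonneg_left hs0 (by positivity) (by linarith)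
    have e5 : (1 - s) / (2 * C) ≤ (1 - s) / 2 := div_le_div_of_nonneg_left (by linarith) (by norm_num) (by linarith)
    linarith [mul_nonneg hT0 hs0]
  · have hprod : ∏ i, p i ≤ C ^ n * p m := by
      rw [← Finset.mul_prod_erase _ _ (Finset.mem_univ m), mul_comm]
      refine mul_le_mul_of_nonneg_right ((Finset.prod_le_prod (fun i _ => (hpp i).le) hne).trans ?_) (hpp m).le
      rw [Finset.prod_const]
      exact pow_le_pow_right₀ hC (by simp)
    have hP0 : 0 < ∏ i, p i := Finset.prod_pos fun i _ => hpp i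
    have h1 : (1 - T) * p m ≤ 1 + ∑ i, f i ^ 2 * p i := by
      rw [sp (fun i => f i ^ 2 * p i), ht]
      have : 0 ≤ ∑ i ∈ Finset.univ.erase m, f i ^ 2 * p i := Finset.sum_nonneg fun i _ => mul_nonneg (sq_nonneg _) (hpp i).le
      linarith
    have h2 : (C ^ n * p m)⁻¹ * ((1 - T) * p m) ≤ (∏ i, p i)⁻¹ * (1 + ∑ i, f i ^ 2 * p i) :=
      mul_le_mul (inv_anti₀ hP0 hprod) h1 (mul_nonneg (by linarith) (hpp m).le) (inv_nonneg.2 hP0.le)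
    refine le_trans ?_ h2
    have h3 : (C ^ n * p m)⁻¹ * ((1 - T) * p m) = (C ^ n)⁻¹ - (C ^ n)⁻¹ * T := by have := (hpp m).ne'; field_simp
    have h4 : (C ^ n)⁻¹ ≤ 1 := inv_le_one_of_one_le₀ (one_le_pow₀ hC)
    linarith [mul_le_mul_of_nonneg_right h4 hT0]
  · set d := (p m)⁻¹ with hd
    have d0 : 0 < d := inv_pos.2 (hpp m)
    have hpd : p m * d = 1 := mul_inv_cancel₀ (hpp m).ne'
    have hP : (∏ i, p i)⁻¹ ≤ d := by
      refine inv_anti₀ (hpp m) ?_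
      rw [← Finset.mul_prod_erase _ _ (Finset.mem_univ m)]
      exact le_mul_of_one_le_right (hpp m).le (Finset.prod_induction _ (fun x => 1 ≤ x) (fun a b ha hb => one_le_mul_of_one_le_of_one_le ha hb) le_rfl fun i _ => hp i)
    have hP0 : 0 < (∏ i, p i)⁻¹ := inv_pos.2 (Finset.prod_pos fun i _ => hpp i)
    set β := ∑ i ∈ Finset.univ.erase m, f i ^ 2 * p i with hβ
    set γ := ∑ i ∈ Finset.univ.erase m, f i ^ 2 * p i ^ 2 with hγ
    have b0 : 0 ≤ β := Finset.sum_nonneg fun i _ => mul_nonneg (sq_nonneg _) (hpp i).le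
    have g0 : 0 ≤ γ := Finset.sum_nonneg fun i _ => by positivity
    have b1 : β ≤ C * T := by
      rw [hT, Finset.mul_sum]; exact Finset.sum_le_sum fun i hi => by rw [mul_comm]; exact mul_le_mul_of_nonneg_right (hne i hi) (sq_nonneg _)
    have g1 : γ ≤ C ^ 2 * T := by
      rw [hT, Finset.mul_sum]; exact Finset.sum_le_sum fun i hi => by
        rw [mul_comm]; exact mul_le_mul_of_nonneg_right (pow_le_pow_left₀ (hpp i).le (hne i hi) 2) (sq_nonneg _)
    set r := √η with hr
    have r0 : 0 ≤ r := Real.sqrt_nonneg _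
    have rr : r ^ 2 = η := Real.sq_sqrt hη0
    have hη1 : η ≤ 1 := by
      rw [← hf]; exact Finset.sum_le_sum fun i _ => div_le_self (sq_nonneg _) (one_le_pow₀ (hp i))
    have r1 : r ≤ 1 := Real.sqrt_le_one.2 hη1
    have hTr : T ≤ C ^ 2 * r := hTη.trans (mul_le_mul_of_nonneg_left (by rw [← rr, sq]; exact mul_le_of_le_one_left r0 r1) (by positivity))
    have d1 : d ≤ 1 := inv_le_one_of_one_le₀ (hp m)
    have hdr : d ≤ 2 * C * r := by
      have : d ^ 2 ≤ (2 * C * r) ^ 2 := by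
        have e : f m ^ 2 / p m ^ 2 = (1 - T) * d ^ 2 := by rw [ht, hd, inv_pow, div_eq_mul_inv]
        have e3 : 0 ≤ ∑ i ∈ Finset.univ.erase m, f i ^ 2 / p i ^ 2 := Finset.sum_nonneg fun i _ => by positivity
        have e2 : T * d ^ 2 ≤ C ^ 2 * η := (mul_le_of_le_one_right hT0 (pow_le_one₀ d0.le d1)).trans hTη
        have e4 : η ≤ C ^ 2 * η := le_mul_of_one_le_left hη0 (one_le_pow₀ hC)
        rw [mul_pow, mul_pow, rr]
        linarith
      exact (sq_le_sq₀ d0.le (by positivity)).1 this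
    have hFd : F ≤ C * d := by rw [hd, ← div_eq_mul_inv, le_div_iff₀ (hpp m), mul_comm]; exact hpF
    rw [htr, sp (fun i => f i ^ 2 * p i), sp (fun i => f i ^ 2 * p i ^ 2), ht, abs_mul, abs_of_pos hP0]
    refine (mul_le_mul_of_nonneg_right hP (abs_nonneg _)).trans ?_
    exact hat_real hC hT0 hT1 hTr hF hF2 hFd b0 g0 b1 g1 d0 hpd hdr

lemma hatm (n : ℕ) (k : ℝ) (hk : 1 ≤ k) : ∃ c K : ℝ, 0 < c ∧ c ≤ 1 ∧ 0 < K ∧ ∀ (S m : Mt n) (e : Fin n → ℝ), Adm k S → m * (S + k • 1) = 1 → e ⬝ᵥ e = 1 →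
    (∀ v, v ⬝ᵥ v = 1 → c - K * (m *ᵥ e ⬝ᵥ m *ᵥ e) ≤ v ⬝ᵥ (m + Matrix.vecMulVec e e) *ᵥ v) ∧ c - K * (m *ᵥ e ⬝ᵥ m *ᵥ e) ≤ (m + Matrix.vecMulVec e e).det ∧
    |(m + Matrix.vecMulVec e e).det * ((m + Matrix.vecMulVec e e)⁻¹.trace - (2 + (n - 1) * k))| ≤ K * √(m *ᵥ e ⬝ᵥ m *ᵥ e) ∧ 0 < (m + Matrix.vecMulVec e e).det := by
  obtain ⟨C, hC, hb⟩ := admL_bd n k hk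
  refine ⟨(2 * C ^ (n + 1))⁻¹, (1 + C) * C ^ 2 + 2 * C * (C + (1 + C) ^ 2 + C ^ 2), by positivity, ?_, by positivity, ?_⟩
  · exact inv_le_one_of_one_le₀ (by nlinarith [one_le_pow₀ hC (n := n + 1)])
  intro S m e hS hm he
  obtain ⟨O, q, o1, o2, -, hq, -, -, hP⟩ := hS.diag
  obtain ⟨i0, b1, b2, -, -, -, b3, b4⟩ := hb q hq
  rw [hP] at hm
  set p : Fin n → ℝ := fun i => q i + k with hpd
  have hp1 : ∀ i, 1 ≤ p i := hq.pos
  have hp0 : ∀ i, p i ≠ 0 := fun i => by linarith [hp1 i]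
  set P := O * Matrix.diagonal p * Oᵀ with hPd
  set f := Oᵀ *ᵥ e with hf
  have hmO : m = O * Matrix.diagonal (fun i => (p i)⁻¹) * Oᵀ := by
    have h1 : P * (O * Matrix.diagonal (fun i => (p i)⁻¹) * Oᵀ) = 1 := by
      rw [cj_mul o2]; simp only [mul_inv_cancel₀ (hp0 _)]; rw [cj_one o1, one_smul]
    calc m = m * (P * (O * Matrix.diagonal (fun i => (p i)⁻¹) * Oᵀ)) := by rw [h1, Matrix.mul_one]
      _ = _ := by rw [← Matrix.mul_assoc, hm, Matrix.one_mul]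
  have hnorm : ∀ g : Fin n → ℝ, (O * Matrix.diagonal g * Oᵀ) *ᵥ e ⬝ᵥ (O * Matrix.diagonal g * Oᵀ) *ᵥ e = ∑ i, f i ^ 2 * g i ^ 2 := by
    intro g
    have ht : (O * Matrix.diagonal g * Oᵀ)ᵀ = O * Matrix.diagonal g * Oᵀ := by simp [Matrix.mul_assoc]
    rw [Matrix.dotProduct_mulVec, ← Matrix.mulVec_transpose, ht, Matrix.mulVec_mulVec, cj_mul o2, dotProduct_comm, cj_quad]
    exact Finset.sum_congr rfl fun i _ => by ring
  have hη : m *ᵥ e ⬝ᵥ m *ᵥ e = ∑ i, f i ^ 2 / p i ^ 2 := by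
    rw [hmO, hnorm]; exact Finset.sum_congr rfl fun i _ => by rw [inv_pow, div_eq_mul_inv]
  have hPe : e ⬝ᵥ P *ᵥ e = ∑ i, f i ^ 2 * p i := by rw [hPd, cj_quad]; exact Finset.sum_congr rfl fun i _ => by ring
  have hPP : P *ᵥ e ⬝ᵥ P *ᵥ e = ∑ i, f i ^ 2 * p i ^ 2 := hnorm p
  have hPs : Pᵀ = P := by simp [hPd, Matrix.mul_assoc]
  have hPm : P * m = 1 := mul_eq_one_comm.1 hm
  obtain ⟨r1, r2, r3⟩ := hat_diag n hC p f i0 (∑ i, q i - 1 - q i0) hp1 b1 b4 b3 b2 (by rw [hf, cj_norm o1, he]) (2 + (n - 1) * k) (by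
    simp only [hpd, Finset.sum_add_distrib, Finset.sum_const, Finset.card_univ, Fintype.card_fin, nsmul_eq_mul]; ring)
  rw [← hη] at r1 r2 r3
  have hsum0 : 0 ≤ ∑ i, f i ^ 2 * p i := Finset.sum_nonneg fun i _ => mul_nonneg (sq_nonneg _) (by linarith [hp1 i])
  have hdm : m.det = (∏ i, p i)⁻¹ := by rw [(inv_of hm).2, hPd, cj_det o2]
  have hdet : (m + Matrix.vecMulVec e e).det = (∏ i, p i)⁻¹ * (1 + ∑ i, f i ^ 2 * p i) := by
    have : m + Matrix.vecMulVec e e = m * (1 + Matrix.replicateCol Unit (P *ᵥ e) * Matrix.replicateRow Unit e) := by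
      rw [Matrix.mul_add, Matrix.mul_one, ← Matrix.vecMulVec_eq, Matrix.mul_vecMulVec, Matrix.mulVec_mulVec, hm, Matrix.one_mulVec]
    rw [this, Matrix.det_mul, Matrix.det_one_add_replicateCol_mul_replicateRow, hPe, hdm]
  have hpos : 0 < (m + Matrix.vecMulVec e e).det := by
    rw [hdet]; exact mul_pos (inv_pos.2 (Finset.prod_pos fun i _ => one_pos.trans_le (hp1 i))) (by linarith)
  have hinv : (m + Matrix.vecMulVec e e)⁻¹ = P - (1 + ∑ i, f i ^ 2 * p i)⁻¹ • Matrix.vecMulVec (P *ᵥ e) (P *ᵥ e) := by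
    refine Matrix.inv_eq_left_inv ?_
    have e1 : Matrix.vecMulVec (P *ᵥ e) (P *ᵥ e) * m = Matrix.vecMulVec (P *ᵥ e) e := by
      rw [Matrix.vecMulVec_mul, ← Matrix.mulVec_transpose, ← hPs, Matrix.mulVec_mulVec, ← Matrix.transpose_mul, hPs, hPm, Matrix.transpose_one, Matrix.one_mulVec]
    have e2 : Matrix.vecMulVec (P *ᵥ e) (P *ᵥ e) * Matrix.vecMulVec e e = (∑ i, f i ^ 2 * p i) • Matrix.vecMulVec (P *ᵥ e) e := by
      rw [Matrix.vecMulVec_mul_vecMulVec, dotProduct_comm, hPe, Matrix.vecMulVec_smul]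
    rw [Matrix.sub_mul, Matrix.mul_add, hPm, Matrix.mul_vecMulVec, Matrix.smul_mul, Matrix.mul_add, e1, e2]
    have : (1 + ∑ i, f i ^ 2 * p i) ≠ 0 := by linarith
    rw [show ∀ M : Mt n, M + (∑ i, f i ^ 2 * p i) • M = (1 + ∑ i, f i ^ 2 * p i) • M from fun M => by rw [add_smul, one_smul], smul_smul, inv_mul_cancel₀ this, one_smul, add_sub_cancel_right]
  have hη0 : 0 ≤ m *ᵥ e ⬝ᵥ m *ᵥ e := dot_self_nonneg _
  have hKm : 2 * C ^ 2 ≤ (1 + C) * C ^ 2 + 2 * C * (C + (1 + C) ^ 2 + C ^ 2) := by nlinarith [sq_nonneg C, pow_pos (one_pos.trans_le hC) 3]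
  have hc1 : (2 * C ^ (n + 1))⁻¹ ≤ (2 * C)⁻¹ := inv_anti₀ (by positivity) (by rw [pow_succ]; nlinarith [one_le_pow₀ hC (n := n)])
  have hc2 : (2 * C ^ (n + 1))⁻¹ ≤ (C ^ n)⁻¹ := inv_anti₀ (by positivity) (by rw [pow_succ]; nlinarith [one_le_pow₀ hC (n := n)])
  have hKη := mul_le_mul_of_nonneg_right hKm hη0
  refine ⟨fun v hv => ?_, ?_, ?_, hpos⟩
  · have h1 := r1 (Oᵀ *ᵥ v) (by rw [cj_norm o1, hv])
    have h2 : v ⬝ᵥ (m + Matrix.vecMulVec e e) *ᵥ v = ∑ i, (Oᵀ *ᵥ v) i ^ 2 / p i + (∑ i, f i * (Oᵀ *ᵥ v) i) ^ 2 := by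
      have e3 : ∑ i, f i * (Oᵀ *ᵥ v) i = e ⬝ᵥ v := by
        show Oᵀ *ᵥ e ⬝ᵥ Oᵀ *ᵥ v = _
        rw [Matrix.mulVec_transpose, ← Matrix.dotProduct_mulVec, Matrix.mulVec_mulVec, o1, Matrix.one_mulVec]
      rw [Matrix.add_mulVec, dotProduct_add, hmO, cj_quad, e3, Matrix.vecMulVec_mulVec]
      congr 1
      · exact Finset.sum_congr rfl fun i _ => by rw [div_eq_mul_inv, mul_comm]
      · rw [op_smul_eq_smul, dotProduct_smul, dotProduct_comm v e, smul_eq_mul, sq]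
    rw [h2]; linarith
  · rw [hdet]; nlinarith
  · refine le_trans (le_of_eq ?_) r3
    congr 1
    rw [hdet, hinv, Matrix.trace_sub, Matrix.trace_smul, Matrix.trace_vecMulVec, hPP, hPd, cj_trace o2, smul_eq_mul]
    have : (1 + ∑ i, f i ^ 2 * p i) ≠ 0 := by linarith
    field_simp
    ring

section
def Xh (e : Fin n → ℝ) (X : E n → E n) (y : E n) : E n := X y + (∑ j, e j * y j) • WithLp.toLp 2 e

namespace Good
variable {k l L : ℝ} {X : E n → E n}

lemma smh (h : Good k l L X) (e : Fin n → ℝ) : ContDiff ℝ ∞ (Xh e X) :=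
  h.sm.add ((ContDiff.sum fun j _ => contDiff_const.mul (smooth_coord j)).smul contDiff_const)

lemma jach (h : Good k l L X) (e : Fin n → ℝ) (y) : jac (Xh e X) y = jac X y + Matrix.vecMulVec e e := by
  ext i j
  have hs : ∀ k, ContDiff ℝ ∞ (fun y : E n => e k * y k) := fun k => contDiff_const.mul (smooth_coord k)
  have hs2 : ContDiff ℝ ∞ (fun y : E n => ∑ k, e k * y k) := ContDiff.sum fun k _ => hs k
  have e1 : (fun z => Xh e X z i) = fun z => X z i + e i * ∑ k, e k * z k := by funext z; simp [Xh, mul_comm]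
  show pd j (fun z => Xh e X z i) y = _
  rw [e1, pd_add ((smooth_comp_coord h.sm i).dif y) ((contDiff_const.mul hs2).dif y), pd_const_mul (hs2.dif y), pd_sum _ (fun k _ => (hs k).dif y)]
  simp only [pd_const_mul ((smooth_coord _).dif y), pd_coord]
  simp [jac, Matrix.vecMulVec_apply]

lemma diffh (e : Fin n → ℝ) (X : E n → E n) (y y' : E n) : Xh e X y' - Xh e X y = (X y' - X y) + (∑ j, e j * (y' - y) j) • WithLp.toLp 2 e := by
  simp only [Xh, PiLp.sub_apply, mul_sub, Finset.sum_sub_distrib, sub_smul]; abel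

lemma mono1 (e : Fin n → ℝ) (X : E n → E n) (y y' : E n) :
    ∑ i, (Xh e X y' - Xh e X y) i * (y' - y) i = ∑ i, (X y' - X y) i * (y' - y) i + (∑ j, e j * (y' - y) j) ^ 2 := by
  rw [diffh, sq]
  conv_rhs => rw [Finset.sum_mul]
  rw [← Finset.sum_add_distrib]
  refine Finset.sum_congr rfl fun i _ => ?_
  simp only [PiLp.add_apply, PiLp.smul_apply, smul_eq_mul]; ring

lemma nsq (e : Fin n → ℝ) (he : e ⬝ᵥ e = 1) (a : E n) (s : ℝ) : ‖a + s • (WithLp.toLp 2 e : E n)‖ ^ 2 ≤ 2 * ‖a‖ ^ 2 + 2 * s ^ 2 := by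
  have h1 := norm_add_le a (s • (WithLp.toLp 2 e : E n))
  rw [norm_smul, unit_norm he, mul_one, Real.norm_eq_abs] at h1
  have := pow_le_pow_left₀ (norm_nonneg _) h1 2
  nlinarith [sq_nonneg (‖a‖ - |s|), sq_abs s]

lemma mono2 (h : Good k l L X) {e : Fin n → ℝ} (he : e ⬝ᵥ e = 1) (y y' : E n) :
    (1 / 2) * ‖Xh e X y' - Xh e X y‖ ^ 2 ≤ ∑ i, (Xh e X y' - Xh e X y) i * (y' - y) i := by
  rw [mono1, diffh]
  linarith [h.mono y y', nsq e he (X y' - X y) (∑ j, e j * (y' - y) j)]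

lemma lip2 (h : Good k l L X) {e : Fin n → ℝ} (he : e ⬝ᵥ e = 1) (y y' : E n) : ‖Xh e X y' - Xh e X y‖ ≤ 2 * ‖y' - y‖ := by
  have h1 := h.mono2 he y y'
  have h2 := (abs_le.1 (dot_le (Xh e X y' - Xh e X y) (y' - y))).2
  by_contra hc
  push Not at hc
  nlinarith [norm_nonneg (y' - y)]

lemma detj (h : Good k l L X) (y) : (jac X y).det ≠ 0 := by
  obtain ⟨S, -, hm⟩ := h.adm y
  have := congrArg Matrix.det hm
  rw [Matrix.det_mul, Matrix.det_one] at this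
  exact left_ne_zero_of_mul_eq_one this

lemma bijh (h : Good k l L X) {e : Fin n → ℝ} (he : e ⬝ᵥ e = 1) : Function.Bijective (Xh e X) := by
  constructor
  · intro y' y hyy
    have h1 := mono1 e X y y'
    rw [hyy, sub_self] at h1
    simp only [PiLp.zero_apply, zero_mul, Finset.sum_const_zero] at h1
    have h2 := h.mono y y'
    have h3 : ‖X y' - X y‖ ^ 2 ≤ 0 := by nlinarith [sq_nonneg (∑ j, e j * (y' - y) j)]
    have h4 : ‖X y' - X y‖ = 0 := by nlinarith [norm_nonneg (X y' - X y)]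
    exact h.bij.1 (sub_eq_zero.1 (norm_eq_zero.1 h4))
  · intro w
    obtain ⟨Y, hY, hYX, hXY⟩ := inv_smooth h.sm h.bij h.detj
    set φ : ℝ → ℝ := fun τ => τ - ∑ j, e j * Y (w - τ • WithLp.toLp 2 e) j with hφ
    have hc : Continuous φ := by
      have : Continuous fun τ : ℝ => Y (w - τ • WithLp.toLp 2 e) := hY.continuous.comp (by fun_prop)
      exact continuous_id.sub (continuous_finset_sum _ fun j _ => continuous_const.mul ((EuclideanSpace.proj (𝕜 := ℝ) j).continuous.comp this))
    set α := ∑ j, e j * Y w j with hα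
    have key : ∀ τ : ℝ, 0 ≤ -τ * (∑ j, e j * Y (w - τ • WithLp.toLp 2 e) j - α) := by
      intro τ
      have h1 := h.mo (Y w) (Y (w - τ • WithLp.toLp 2 e))
      rw [hXY, hXY] at h1
      refine h1.trans (le_of_eq ?_)
      rw [hα, ← Finset.sum_sub_distrib, Finset.mul_sum]
      refine Finset.sum_congr rfl fun j _ => ?_
      simp only [PiLp.sub_apply, PiLp.smul_apply, smul_eq_mul]; ring
    have hle : -(|α| + 1) ≤ |α| + 1 := by linarith [abs_nonneg α]
    have h0 : (0 : ℝ) ∈ Icc (φ (-(|α| + 1))) (φ (|α| + 1)) := by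
      have k1 := key (-(|α| + 1))
      have k2 := key (|α| + 1)
      have a0 : 0 < |α| + 1 := by positivity
      have k1' : 0 ≤ ∑ j, e j * Y (w - (-(|α| + 1)) • WithLp.toLp 2 e) j - α := by
        rw [neg_neg] at k1; exact nonneg_of_mul_nonneg_right k1 a0
      have k2' : ∑ j, e j * Y (w - (|α| + 1) • WithLp.toLp 2 e) j - α ≤ 0 := by
        by_contra hh; push Not at hh; nlinarith [mul_pos a0 hh]
      constructor <;> simp only [hφ] <;> linarith [neg_abs_le α, le_abs_self α]
    obtain ⟨τ, -, hτ⟩ := intermediate_value_Icc hle hc.continuousOn h0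
    refine ⟨Y (w - τ • WithLp.toLp 2 e), ?_⟩
    simp only [hφ] at hτ
    rw [Xh, hXY, ← sub_eq_zero.1 hτ, sub_add_cancel]

lemma inv_half (h : Good k l L X) {e : Fin n → ℝ} (y) {Ph : Mt n} (hP : (jac X y + Matrix.vecMulVec e e) * Ph = 1) (he : e ⬝ᵥ e = 1) (v : Fin n → ℝ) :
    (1 / 2) * (v ⬝ᵥ v) ≤ v ⬝ᵥ Ph *ᵥ v := by
  obtain ⟨S, hS, hm⟩ := h.adm y
  set m := jac X y
  obtain ⟨w, hw⟩ : ∃ w, w = Ph *ᵥ v := ⟨_, rfl⟩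
  have hv : v = (m + Matrix.vecMulVec e e) *ᵥ w := by rw [hw, Matrix.mulVec_mulVec, hP, Matrix.one_mulVec]
  have hP' : (S + k • 1) * m = 1 := mul_eq_one_comm.1 hm
  have h1 : m *ᵥ w ⬝ᵥ m *ᵥ w ≤ w ⬝ᵥ m *ᵥ w := by
    have := hS.pos (m *ᵥ w)
    rwa [Matrix.mulVec_mulVec, hP', Matrix.one_mulVec, dotProduct_comm (m *ᵥ w) w] at this
  have e1 : v = m *ᵥ w + (e ⬝ᵥ w) • e := by rw [hv, Matrix.add_mulVec, Matrix.vecMulVec_mulVec, op_smul_eq_smul]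
  have h2 : v ⬝ᵥ v ≤ 2 * (m *ᵥ w ⬝ᵥ m *ᵥ w) + 2 * (e ⬝ᵥ w) ^ 2 := by
    have h3 := dot_self_nonneg (m *ᵥ w - (e ⬝ᵥ w) • e)
    rw [e1]
    simp only [add_dotProduct, dotProduct_add, sub_dotProduct, dotProduct_sub, smul_dotProduct, dotProduct_smul, smul_eq_mul, he] at h3 ⊢
    linarith
  have h3 : v ⬝ᵥ w = w ⬝ᵥ m *ᵥ w + (e ⬝ᵥ w) ^ 2 := by
    rw [e1, add_dotProduct, smul_dotProduct, dotProduct_comm (m *ᵥ w), smul_eq_mul, sq]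
  rw [← hw, h3]; linarith

lemma cent (h : Good k l L X) {e : Fin n → ℝ} (he : e ⬝ᵥ e = 1) {c K ε : ℝ} (hc : 0 < c) (hc1 : c ≤ 1) (hK : 0 < K)
    (hh : ∀ y v, v ⬝ᵥ v = 1 → c - K * (jac X y *ᵥ e ⬝ᵥ jac X y *ᵥ e) ≤ v ⬝ᵥ (jac X y + Matrix.vecMulVec e e) *ᵥ v)
    (hε : ∫ y in ball (0 : E n) 2, jac X y *ᵥ e ⬝ᵥ jac X y *ᵥ e ≤ ε) (hKε : K * ε ≤ c / 4 * volume.real (closedBall (0 : E n) (c / 16)))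
    (f : Fin n → ℝ) (hf : f ⬝ᵥ f = 1) : ∃ y, ‖y‖ ≤ 1 ∧ ‖Xh e X y - Xh e X 0‖ ≤ 2 ∧ c / 16 ≤ ∑ i, f i * (Xh e X y - Xh e X 0) i := by
  by_contra hcon
  push Not at hcon
  have hlt : ∀ y, ‖y‖ ≤ 1 → ∑ i, f i * (Xh e X y - Xh e X 0) i < c / 16 := fun y hy => hcon y hy (by
    have := h.lip2 he 0 y; rw [sub_zero] at this; linarith)
  have hs : ContDiff ℝ ∞ (Xh e X) := h.smh e
  set g : E n → ℝ := fun y => ∑ i, f i * Xh e X y i with hg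
  have hgs : ContDiff ℝ ∞ g := ContDiff.sum fun i _ => contDiff_const.mul (smooth_comp_coord hs i)
  set q : E n → ℝ := fun y => jac X y *ᵥ e ⬝ᵥ jac X y *ᵥ e with hq
  have hqc : Continuous q := by
    have : Continuous fun y => jac X y *ᵥ e := (jac_cont h.sm).matrix_mulVec continuous_const
    exact this.dotProduct this
  have hq0 : ∀ y, 0 ≤ q y := fun y => dot_self_nonneg _
  set d : E n := (1 / 2 : ℝ) • WithLp.toLp 2 f with hd
  have hdn : ‖d‖ = 1 / 2 := by rw [hd, norm_smul, unit_norm hf]; norm_num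
  have hfd : ∀ y, (1 / 2) * (c - K * q y) ≤ fderiv ℝ g y d := by
    intro y
    have e1 : fderiv ℝ g y d = (1 / 2) * (f ⬝ᵥ (jac X y + Matrix.vecMulVec e e) *ᵥ f) := by
      rw [fderiv_eq_sum, ← h.jach e y, Matrix.dotProduct_mulVec, dotProduct, Finset.mul_sum]
      refine Finset.sum_congr rfl fun j _ => ?_
      have : pd j g y = ∑ i, f i * pd j (fun y => Xh e X y i) y := by
        rw [hg, pd_sum _ (fun i _ => (contDiff_const.mul (smooth_comp_coord hs i)).dif y)]
        exact Finset.sum_congr rfl fun i _ => pd_const_mul ((smooth_comp_coord hs i).dif y) _ _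
      rw [this]
      show _ = 1 / 2 * ((∑ i, f i * pd j (fun y => Xh e X y i) y) * f j)
      simp only [hd, PiLp.smul_apply, smul_eq_mul]; ring
    rw [e1]; linarith [hh y f hf]
  set σ := c / 16 with hσ
  set wv := volume.real (closedBall (0 : E n) σ) with hw
  have w0 : 0 < wv := ENNReal.toReal_pos (measure_closedBall_pos _ _ (by positivity)).ne' (measure_closedBall_lt_top).ne
  have ic : ∀ f : E n → ℝ, Continuous f → IntegrableOn f (closedBall 0 σ) := fun f hf => hf.continuousOn.integrableOn_compact (isCompact_closedBall _ _)
  have hcq : Continuous (fun z : E n × ℝ => q (z.1 + z.2 • d)) := hqc.comp (by fun_prop)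
  have up : ∀ z ∈ closedBall (0 : E n) σ, c / 2 - K / 2 * ∫ t in (0:ℝ)..1, q (z + t • d) ≤ 3 * σ := by
    intro z hz
    have hz1 : ‖z‖ ≤ σ := mem_closedBall_zero_iff.1 hz
    have hσ1 : σ ≤ 1 / 16 := by rw [hσ]; linarith
    have h1 := line_ftc hgs z d
    have h2 : ∫ t in (0:ℝ)..1, (1 / 2) * (c - K * q (z + t • d)) ≤ g (z + d) - g z := by
      rw [h1]
      refine intervalIntegral.integral_mono_on zero_le_one ?_ ?_ fun t _ => hfd _
      · exact Continuous.intervalIntegrable (continuous_const.mul (continuous_const.sub (continuous_const.mul (hqc.comp (by fun_prop))))) _ _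
      · refine Continuous.intervalIntegrable ?_ _ _
        have : Continuous fun y => fderiv ℝ g y d := (hgs.continuous_fderiv (by simp)).clm_apply continuous_const
        exact this.comp (by fun_prop)
    have h3 : ∫ t in (0:ℝ)..1, (1 / 2) * (c - K * q (z + t • d)) = c / 2 - K / 2 * ∫ t in (0:ℝ)..1, q (z + t • d) := by
      have hi : Continuous fun t : ℝ => q (z + t • d) := hqc.comp (by fun_prop)
      rw [intervalIntegral.integral_const_mul, intervalIntegral.integral_sub intervalIntegrable_const ((hi.intervalIntegrable _ _).const_mul K),
        intervalIntegral.integral_const_mul, intervalIntegral.integral_const]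
      simp; ring
    rw [h3] at h2
    have h4 := hlt (z + d) ((norm_add_le _ _).trans (by linarith))
    have h5 := (abs_le.1 (dot_le (WithLp.toLp 2 f) (Xh e X z - Xh e X 0))).1
    rw [unit_norm hf, one_mul] at h5
    have h6 := h.lip2 he 0 z
    rw [sub_zero] at h6
    have h7 : g (z + d) - g z = ∑ i, f i * (Xh e X (z + d) - Xh e X 0) i - ∑ i, f i * (Xh e X z - Xh e X 0) i := by
      rw [hg, ← Finset.sum_sub_distrib, ← Finset.sum_sub_distrib]
      refine Finset.sum_congr rfl fun i _ => ?_
      simp only [PiLp.sub_apply]; ring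
    have h8 : -(2 * σ) ≤ ∑ i, f i * (Xh e X z - Xh e X 0) i := by
      refine le_trans ?_ h5
      linarith
    rw [h7] at h2
    linarith
  have hfc : Continuous fun z : E n => ∫ t in (0:ℝ)..1, q (z + t • d) := intervalIntegral.continuous_parametric_intervalIntegral_of_continuous' (f := fun z t => q (z + t • d)) hcq 0 1
  have h1 := setIntegral_mono_on (ic _ (continuous_const.sub (continuous_const.mul hfc))) (ic _ continuous_const) measurableSet_closedBall up
  simp only [Pi.sub_apply, Pi.mul_apply] at h1
  rw [integral_sub (ic _ continuous_const) ((ic _ hfc).const_mul _), integral_const_mul, fub (f := fun z t => q (z + t • d)) hcq, setIntegral_const, setIntegral_const, smul_eq_mul, smul_eq_mul] at h1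
  have h2 : |∫ t in (0:ℝ)..1, ∫ z in closedBall (0 : E n) σ, q (z + t • d)| ≤ ε := by
    refine int_abs_le fun t t0 t1 => ?_
    rw [abs_of_nonneg (integral_nonneg fun z => hq0 _)]
    have h3 := scale_le hqc hq0 one_pos (t • d) (ρ := σ) (R := 2) (by
      rw [norm_smul, hdn, Real.norm_eq_abs, abs_of_pos t0]; linarith)
    simp only [one_smul, one_pow, inv_one, one_mul] at h3
    refine le_trans (le_of_eq ?_) (h3.trans hε)
    simp only [add_comm]
  have h3 := (le_abs_self _).trans h2
  have h4 := mul_le_mul_of_nonneg_left h3 (by positivity : (0:ℝ) ≤ K / 2)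
  change wv * (c / 2) - _ ≤ wv * (3 * σ) at h1
  have : wv * (3 * σ) = 3 * c / 16 * wv := by rw [hσ]; ring
  nlinarith
end Good
end

lemma pd_affine {g : E n → ℝ} (hg : ContDiff ℝ ∞ g) (r c : ℝ) (i j : Fin n) (x) :
    pd j (fun y => r * g y - c * y i) x = r * pd j g x - c * (if i = j then 1 else 0) := by
  rw [pd_sub ((contDiff_const.mul hg).dif x) ((contDiff_const.mul (smooth_coord i)).dif x), pd_const_mul (hg.dif x), pd_const_mul ((smooth_coord i).dif x), pd_coord]; simp only [eq_comm]

lemma frob_real {P : Mt n} (hs : Pᵀ = P) (h : ∀ v, 0 ≤ v ⬝ᵥ P *ᵥ v) {c0 c1 : ℝ} (h0 : 0 ≤ c1) (h1 : c1 ≤ c0) (k : Fin n) :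
    √(∑ j, (P k j - c1 * (if k = j then 1 else 0)) ^ 2) ≤ 2 * |P.trace - c0| + 4 * c0 := by
  obtain ⟨p0, p1⟩ := psd_frob hs h
  have p2 : ∑ j, P k j ^ 2 ≤ P.trace ^ 2 := (Finset.single_le_sum (f := fun i => ∑ j, P i j ^ 2) (fun i _ => Finset.sum_nonneg fun j _ => sq_nonneg _) (Finset.mem_univ k)).trans p1
  have p3 : ∑ j, (P k j - c1 * (if k = j then 1 else 0)) ^ 2 ≤ 2 * P.trace ^ 2 + 2 * c1 ^ 2 := by
    have : ∑ j, (P k j - c1 * (if k = j then 1 else 0)) ^ 2 ≤ ∑ j, (2 * P k j ^ 2 + 2 * c1 ^ 2 * (if k = j then 1 else 0)) := by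
      refine Finset.sum_le_sum fun j _ => ?_
      split_ifs <;> nlinarith [sq_nonneg (P k j + c1), sq_nonneg (P k j)]
    refine this.trans ?_
    rw [Finset.sum_add_distrib, ← Finset.mul_sum, ← Finset.mul_sum]
    simp only [Finset.sum_ite_eq, Finset.mem_univ, if_true]
    linarith
  have p4 := le_abs_self (P.trace - c0)
  have : √(∑ j, (P k j - c1 * (if k = j then 1 else 0)) ^ 2) ≤ 2 * (P.trace + c1) := by
    refine Real.sqrt_le_iff.2 ⟨by linarith, p3.trans ?_⟩
    nlinarith [mul_nonneg p0 h0, sq_nonneg P.trace, sq_nonneg c1]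
  linarith

lemma st2a (n : ℕ) (hn : 2 ≤ n) (k l L : ℝ) (hk : 1 ≤ k) : ∃ c K Λ C w0 t0 : ℝ, 0 < c ∧ 0 < K ∧ 2 ≤ Λ ∧ 0 < C ∧ 0 < w0 ∧ 0 < t0 ∧ t0 ≤ 1 ∧ ∀ (X : E n → E n) (e : Fin n → ℝ) (w : ℝ),
    Good k l L X → e ⬝ᵥ e = 1 → 0 < w → w ≤ w0 → ∫ y in ball (0 : E n) Λ, jac X y *ᵥ e ⬝ᵥ jac X y *ᵥ e ≤ w ^ 2 →
    (∀ y, c - K * (jac X y *ᵥ e ⬝ᵥ jac X y *ᵥ e) ≤ (jac X y + Matrix.vecMulVec e e).det) ∧ (∀ y, 0 < (jac X y + Matrix.vecMulVec e e).det) ∧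
    ∃ (b : Fin n → ℝ) (B : Mt n), Bᵀ = B ∧ (∀ v, (1 / 2) * (v ⬝ᵥ v) ≤ v ⬝ᵥ B *ᵥ v) ∧ ∀ s t, 0 < s → s ≤ 1/4 → 0 < t → t < t0 → ∀ i,
    ∫ y in ball (0 : E n) t, (jac X y + Matrix.vecMulVec e e).det * |y i - b i - ∑ j, B i j * (Xh e X y - Xh e X 0) j| ≤ C * (s + t ^ n * ((s ^ n)⁻¹ * w) + t ^ n * t ^ 2) := by
  obtain ⟨c, K, hc, hc1, hK, hh⟩ := hatm n k hk
  obtain ⟨C, hC, hH⟩ := lemmaH n hn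
  set vv := volume.real (closedBall (0 : E n) (c / 16)) with hvv
  have v0 : 0 < vv := ENNReal.toReal_pos (measure_closedBall_pos _ _ (by positivity)).ne' (measure_closedBall_lt_top).ne
  obtain ⟨r, hr⟩ : ∃ r, r = c / 32 := ⟨_, rfl⟩
  have r0 : 0 < r := by rw [hr]; positivity
  have r1 : r ≤ 1 / 32 := by rw [hr]; linarith
  obtain ⟨Λ, hΛ⟩ : ∃ Λ, Λ = 2 * 1 * (2 + c / 16 / 2) / (c / 16) + 2 := ⟨_, rfl⟩
  have hΛ2 : 2 ≤ Λ := by rw [hΛ]; have : 0 ≤ 2 * 1 * (2 + c / 16 / 2) / (c / 16) := by positivity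
                         linarith
  obtain ⟨c0, hc0⟩ : ∃ c0 : ℝ, c0 = 2 + (n - 1) * k := ⟨_, rfl⟩
  have n2 : (2 : ℝ) ≤ n := by exact_mod_cast hn
  have c00 : 0 ≤ c0 := by rw [hc0]; nlinarith
  have c01 : c0 / n ≤ c0 := div_le_self c00 (by linarith)
  obtain ⟨C1, hC1⟩ : ∃ C1, C1 = (r⁻¹) ^ n * (K * (1 + volume.real (ball (0 : E n) Λ))) := ⟨_, rfl⟩
  have C10 : 0 < C1 := by rw [hC1]; have : 0 ≤ volume.real (ball (0 : E n) Λ) := measureReal_nonneg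
                          positivity
  obtain ⟨C2, hC2⟩ : ∃ C2, C2 = 2 * C1 + 4 * c0 * volume.real (ball (0 : E n) 1) := ⟨_, rfl⟩
  have C20 : 0 < C2 := by rw [hC2]; have : 0 ≤ volume.real (ball (0 : E n) 1) := measureReal_nonneg
                          positivity
  refine ⟨c, K, Λ, r * (r ^ n * (C * (C2 + (2 / r) ^ n * C1 + (2 / r) ^ n * (2 / r) ^ 2 * C2))), min 1 (c / 4 * vv / K), r / 8, hc, hK, hΛ2, by positivity, by positivity, by positivity, by linarith, ?_⟩
  intro X e w hX he w0 hw hq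
  have hw1 : w ≤ 1 := hw.trans (min_le_left _ _)
  set q : E n → ℝ := fun y => jac X y *ᵥ e ⬝ᵥ jac X y *ᵥ e with hqd
  have hqc : Continuous q := by
    have : Continuous fun y => jac X y *ᵥ e := (jac_cont hX.sm).matrix_mulVec continuous_const
    exact this.dotProduct this
  have hq0 : ∀ y, 0 ≤ q y := fun y => dot_self_nonneg _
  have hhy : ∀ y, _ := fun y => (hX.adm y).elim fun S hS => hh S (jac X y) e hS.1 hS.2 he
  have hd0 : ∀ y, 0 < (jac X y + Matrix.vecMulVec e e).det := fun y => (hhy y).2.2.2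
  refine ⟨fun y => (hhy y).2.1, hd0, ?_⟩
  set T : E n → E n := fun y => r⁻¹ • (Xh e X y - Xh e X 0) with hT
  have hsm := hX.smh e
  have hTs : ContDiff ℝ ∞ T := by
    have : ContDiff ℝ ∞ fun y => Xh e X y - Xh e X 0 := hsm.sub contDiff_const
    exact this.const_smul r⁻¹
  have hjT : ∀ y, jac T y = r⁻¹ • (jac X y + Matrix.vecMulVec e e) := by
    intro y
    rw [← hX.jach e y]
    ext i j
    have h1 := smooth_comp_coord hsm i
    show pd j (fun z => r⁻¹ * (Xh e X z i - Xh e X 0 i)) y = _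
    rw [pd_const_mul ((h1.sub contDiff_const).dif y), pd_sub (h1.dif y) (contDiff_const.dif y), pd_const, sub_zero]; rfl
  have hdT : ∀ y, (jac T y).det = r⁻¹ ^ n * (jac X y + Matrix.vecMulVec e e).det := fun y => by
    rw [hjT, Matrix.det_smul, Fintype.card_fin]
  have hTp : ∀ y, 0 < (jac T y).det := fun y => by rw [hdT]; exact mul_pos (by positivity) (hd0 y)
  have hTb : Function.Bijective T := by
    have h1 := hX.bijh he
    have : T = (fun z => r⁻¹ • (z - Xh e X 0)) ∘ Xh e X := rfl
    rw [this]
    refine Function.Bijective.comp ⟨fun a b hab => ?_, fun z => ⟨r • z + Xh e X 0, ?_⟩⟩ h1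
    · exact sub_left_injective (smul_right_injective (E n) (inv_ne_zero r0.ne') hab)
    · simp [smul_smul, inv_mul_cancel₀ r0.ne']
  obtain ⟨W, hWs, hWT, hTW⟩ := inv_smooth hTs hTb (fun y => (hTp y).ne')
  have hjW : ∀ y, r⁻¹ • jac W (T y) = (jac X y + Matrix.vecMulVec e e)⁻¹ := by
    intro y
    have h1 := jac_inv hTs hWs hWT y
    rw [hjT, Matrix.mul_smul, ← Matrix.smul_mul] at h1
    exact (Matrix.inv_eq_left_inv h1).symm
  have hPs : ∀ y, ((jac X y + Matrix.vecMulVec e e)⁻¹)ᵀ = (jac X y + Matrix.vecMulVec e e)⁻¹ := by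
    intro y
    rw [Matrix.transpose_nonsing_inv, Matrix.transpose_add, hX.symj, Matrix.transpose_vecMulVec]
  have hPh : ∀ y v, (1 / 2) * (v ⬝ᵥ v) ≤ v ⬝ᵥ (jac X y + Matrix.vecMulVec e e)⁻¹ *ᵥ v := fun y v =>
    hX.inv_half y (Matrix.mul_nonsing_inv _ (isUnit_iff_ne_zero.2 (hd0 y).ne')) he v
  set U : Fin n → E n → ℝ := fun i x => r⁻¹ * W x i - c0 / n * x i with hU
  have hUs : ∀ i, ContDiff ℝ ∞ (U i) := fun i => (contDiff_const.mul (smooth_comp_coord hWs i)).sub (contDiff_const.mul (smooth_coord i))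
  have hUp : ∀ i j y, pd j (U i) (T y) = (jac X y + Matrix.vecMulVec e e)⁻¹ i j - c0 / n * (if i = j then 1 else 0) := by
    intro i j y
    rw [hU, pd_affine (smooth_comp_coord hWs i), ← hjW]; rfl
  have hUd : ∀ y, ∑ j, pd j (U j) (T y) = (jac X y + Matrix.vecMulVec e e)⁻¹.trace - c0 := by
    intro y
    simp only [hUp, if_true, Finset.sum_sub_distrib, mul_one, Finset.sum_const, Finset.card_univ, Fintype.card_fin, nsmul_eq_mul]
    rw [mul_div_cancel₀ _ (by linarith : (n : ℝ) ≠ 0)]; rfl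
  have hsurj : ∀ x, ∃ y, x = T y := fun x => ⟨W x, (hTW x).symm⟩
  obtain ⟨b, M, hMs, hM, hL⟩ := hH U hUs (fun i j x => by
    obtain ⟨y, rfl⟩ := hsurj x
    rw [hUp, hUp]
    have := congrFun (congrFun (hPs y) i) j
    rw [Matrix.transpose_apply] at this
    rw [this]; simp only [eq_comm])
  have htrap : ∀ y, T y ∈ ball (0 : E n) 1 → y ∈ ball (0 : E n) Λ := by
    intro y hy
    rw [mem_ball_zero_iff] at hy ⊢
    have h1 : ‖Xh e X y - Xh e X 0‖ ≤ c / 16 / 2 := by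
      rw [hT, norm_smul, Real.norm_eq_abs, abs_of_pos (by positivity), inv_mul_lt_iff₀ r0] at hy
      rw [hr] at hy; linarith
    have h2 := trap (T := Xh e X) (fun y y' => le_trans (by positivity) (hX.mono2 he y y')) (c := Xh e X 0) (r := c / 16) (ρ := 1) (Kb := 2) (by positivity) zero_le_one zero_le_two
      (fun f hf => hX.cent he hc hc1 hK (fun y => (hhy y).1) ((setIntegral_mono_set (intb hqc 0 Λ) (ae_of_all _ hq0) (ball_subset_ball hΛ2).eventuallyLE).trans hq) (by
        have := hw.trans (min_le_right _ _)
        rw [le_div_iff₀ hK] at this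
        have h3 : w ^ 2 ≤ w := by nlinarith
        nlinarith) f hf) y h1
    rw [hΛ]; linarith
  have hdiv : ∫ x in ball (0 : E n) 1, |∑ j, pd j (U j) x| ≤ C1 * w := by
    have e1 : ball (0 : E n) 1 = T '' (T ⁻¹' ball 0 1) := (image_preimage_eq _ hTb.2).symm
    have ms : MeasurableSet (T ⁻¹' ball (0 : E n) 1) := measurableSet_ball.preimage hTs.continuous.measurable
    rw [e1, cov hTs ms hTb.1, hC1]
    have e2 : ∀ y, |(jac T y).det| * |∑ j, pd j (U j) (T y)| ≤ r⁻¹ ^ n * (K * ((2 * w)⁻¹ * q y + w / 2)) := by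
      intro y
      rw [hUd, ← abs_mul, hdT, mul_assoc, abs_mul, abs_of_pos (by positivity : 0 < r⁻¹ ^ n)]
      refine mul_le_mul_of_nonneg_left ?_ (by positivity)
      have h1 := (hhy y).2.2.1
      rw [← hc0] at h1
      refine h1.trans (mul_le_mul_of_nonneg_left ?_ hK.le)
      have h2 := Real.sq_sqrt (hq0 y)
      have h3 : (2 * w)⁻¹ * q y + w / 2 - √(q y) = (2 * w)⁻¹ * (√(q y) - w) ^ 2 := by
        rw [← h2]; simp only [Real.sqrt_sq (Real.sqrt_nonneg _)]; field_simp; ring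
      have : 0 ≤ (2 * w)⁻¹ * (√(q y) - w) ^ 2 := by positivity
      show √(q y) ≤ _
      linarith
    have hgc : Continuous fun y => r⁻¹ ^ n * (K * ((2 * w)⁻¹ * q y + w / 2)) := by fun_prop
    have hle : ∫ y in T ⁻¹' ball (0 : E n) 1, |(jac T y).det| * |∑ j, pd j (U j) (T y)| ≤ ∫ y in ball (0 : E n) Λ, r⁻¹ ^ n * (K * ((2 * w)⁻¹ * q y + w / 2)) := by
      have i1 : IntegrableOn (fun y => |(jac T y).det| * |∑ j, pd j (U j) (T y)|) (ball 0 Λ) := by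
        refine intb (((jac_cont hTs).matrix_det.abs).mul (Continuous.abs (continuous_finset_sum _ fun j _ => ?_))) 0 Λ
        exact (smooth_pd (hUs j) j).continuous.comp hTs.continuous
      refine (setIntegral_mono_set i1 (ae_of_all _ fun y => by positivity) (HasSubset.Subset.eventuallyLE htrap)).trans ?_
      exact setIntegral_mono i1 (intb hgc 0 Λ) e2
    refine hle.trans ?_
    rw [integral_const_mul, integral_const_mul, integral_add ((intb hqc 0 Λ).const_mul _) (intb continuous_const 0 Λ), integral_const_mul, setIntegral_const, smul_eq_mul, mul_assoc (r⁻¹ ^ n), mul_assoc K]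
    refine mul_le_mul_of_nonneg_left (mul_le_mul_of_nonneg_left ?_ hK.le) (by positivity)
    have h1 := mul_le_mul_of_nonneg_left hq (by positivity : 0 ≤ (2 * w)⁻¹)
    have h2 : (2 * w)⁻¹ * w ^ 2 = w / 2 := by field_simp
    have h3 : 0 ≤ volume.real (ball (0 : E n) Λ) * w := mul_nonneg measureReal_nonneg w0.le
    linarith
  have hgr : ∀ i, ∫ x in ball (0 : E n) 1, √(gr (U i) x ⬝ᵥ gr (U i) x) ≤ C2 := by
    intro i
    have hdc : Continuous fun x => |∑ j, pd j (U j) x| := Continuous.abs (continuous_finset_sum _ fun j _ => (smooth_pd (hUs j) j).continuous)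
    have h1 : ∀ x, √(gr (U i) x ⬝ᵥ gr (U i) x) ≤ 2 * |∑ j, pd j (U j) x| + 4 * c0 := by
      intro x
      obtain ⟨y, rfl⟩ := hsurj x
      rw [hUd]
      refine le_trans (le_of_eq ?_) (frob_real (hPs y) (fun v => le_trans (by have := dot_self_nonneg v; positivity) (hPh y v)) (c1 := c0 / n) (by positivity) c01 i)
      congr 1
      exact Finset.sum_congr rfl fun j _ => by rw [← hUp, sq]; rfl
    refine (setIntegral_mono (intb (grsq_cont (hUs i)).sqrt 0 1) (intb ((hdc.const_mul 2).add continuous_const) 0 1) h1).trans ?_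
    simp only [Pi.add_apply]
    rw [integral_add ((intb hdc 0 1).const_mul 2) (intb continuous_const 0 1), integral_const_mul, setIntegral_const, smul_eq_mul, hC2]
    nlinarith
  refine ⟨fun i => r * b i, M + (c0 / n) • 1, by simp [hMs], ?_, ?_⟩
  · intro v
    have h1 := hM ((1 / 2) * (v ⬝ᵥ v) - c0 / n * (v ⬝ᵥ v)) v (fun x _ => by
      obtain ⟨y, rfl⟩ := hsurj x
      have h2 := hPh y v
      have h3 : ∑ i, ∑ j, v i * v j * pd j (U i) (T y) = v ⬝ᵥ (jac X y + Matrix.vecMulVec e e)⁻¹ *ᵥ v - c0 / n * (v ⬝ᵥ v) := by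
        simp only [hUp, dotProduct, Matrix.mulVec, Finset.mul_sum, ← Finset.sum_sub_distrib, mul_sub]
        refine Finset.sum_congr rfl fun i _ => ?_
        rw [Finset.sum_sub_distrib]
        congr 1
        · exact Finset.sum_congr rfl fun j _ => by ring
        · simp; ring
      linarith)
    rw [Matrix.add_mulVec, dotProduct_add, Matrix.smul_mulVec, Matrix.one_mulVec, dotProduct_smul, smul_eq_mul]
    linarith
  intro s t s0 s1 t0 t1 i
  have h1 := (hL s (2 / r * t) s0 s1 (by positivity) (by rw [div_mul_eq_mul_div, div_lt_iff₀ r0]; linarith) i).1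
  have hsub : T '' ball 0 t ⊆ closedBall (0 : E n) (2 / r * t) := by
    rintro _ ⟨y, hy, rfl⟩
    rw [mem_ball_zero_iff] at hy
    rw [mem_closedBall_zero_iff, hT, norm_smul, Real.norm_eq_abs, abs_of_pos (by positivity), div_mul_eq_mul_div, inv_mul_le_iff₀ r0, mul_div_cancel₀ _ r0.ne']
    have := hX.lip2 he 0 y
    rw [sub_zero] at this; linarith
  have hzc : Continuous fun x => |U i x - (b i + ∑ j, M i j * x j)| :=
    Continuous.abs ((hUs i).continuous.sub (continuous_const.add (continuous_finset_sum _ fun j _ => continuous_const.mul (smooth_coord j).continuous)))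
  have hzi : IntegrableOn (fun x => |U i x - (b i + ∑ j, M i j * x j)|) (closedBall 0 (2 / r * t)) := hzc.continuousOn.integrableOn_compact (isCompact_closedBall _ _)
  have h2 := setIntegral_mono_set hzi (ae_of_all _ fun x => abs_nonneg _) hsub.eventuallyLE
  rw [cov hTs measurableSet_ball hTb.1] at h2
  have h3 : ∀ y, |(jac T y).det| * |U i (T y) - (b i + ∑ j, M i j * T y j)| = (r⁻¹ * r⁻¹ ^ n) * ((jac X y + Matrix.vecMulVec e e).det * |y i - r * b i - ∑ j, (M + (c0 / n) • (1 : Mt n)) i j * (Xh e X y - Xh e X 0) j|) := by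
    intro y
    rw [abs_of_pos (hTp y), hdT]
    have e1 : U i (T y) - (b i + ∑ j, M i j * T y j) = r⁻¹ * (y i - r * b i - ∑ j, (M + (c0 / n) • (1 : Mt n)) i j * (Xh e X y - Xh e X 0) j) := by
      have e2 : ∑ j, (M + (c0 / n) • (1 : Mt n)) i j * (Xh e X y - Xh e X 0) j = ∑ j, M i j * (Xh e X y - Xh e X 0) j + c0 / n * (Xh e X y - Xh e X 0) i := by
        simp only [Matrix.add_apply, add_mul, Finset.sum_add_distrib]
        congr 1
        simp [Matrix.one_apply]
      have e3 : ∑ j, M i j * T y j = r⁻¹ * ∑ j, M i j * (Xh e X y - Xh e X 0) j := by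
        rw [Finset.mul_sum]; exact Finset.sum_congr rfl fun j _ => by simp only [hT, PiLp.smul_apply, smul_eq_mul]; ring
      rw [e2, e3]
      simp only [hU, hWT]
      have : T y i = r⁻¹ * (Xh e X y - Xh e X 0) i := rfl
      rw [this]; field_simp; ring
    rw [e1, abs_mul, abs_of_pos (by positivity : 0 < r⁻¹)]; ring
  simp only [h3] at h2
  rw [integral_const_mul] at h2
  have h4 : C * (s * (∫ x in ball (0 : E n) 1, √ (gr (U i) x ⬝ᵥ gr (U i) x)) +
       (2 / r * t) ^ n * ((s ^ n)⁻¹ * ∫ x in ball (0 : E n) 1, |∑ j, pd j (U j) x|) +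
       (2 / r * t) ^ n * ((2 / r * t) ^ 2 * (∫ x in ball (0 : E n) 1, √ (gr (U i) x ⬝ᵥ gr (U i) x)))) ≤
      C * (s * C2 + (2 / r * t) ^ n * ((s ^ n)⁻¹ * (C1 * w)) + (2 / r * t) ^ n * ((2 / r * t) ^ 2 * C2)) := by
    gcongr <;> exact hgr i
  have h5 := (h2.trans h1).trans h4
  have h6 : C * (s * C2 + (2 / r * t) ^ n * ((s ^ n)⁻¹ * (C1 * w)) + (2 / r * t) ^ n * ((2 / r * t) ^ 2 * C2)) ≤
      C * (C2 + (2 / r) ^ n * C1 + (2 / r) ^ n * (2 / r) ^ 2 * C2) * (s + t ^ n * ((s ^ n)⁻¹ * w) + t ^ n * t ^ 2) := by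
    rw [mul_pow, mul_pow, mul_assoc C]
    refine mul_le_mul_of_nonneg_left ?_ hC.le
    have a1 : 0 < (2 / r) ^ n := by positivity
    have a2 : 0 < (2 / r) ^ 2 := by positivity
    have a3 : 0 ≤ t ^ n * ((s ^ n)⁻¹ * w) := by positivity
    have a4 : 0 ≤ t ^ n * t ^ 2 := by positivity
    generalize (2 / r) ^ n = z at *
    generalize (2 / r) ^ 2 = z' at *
    have b1 : 0 ≤ C2 * (t ^ n * ((s ^ n)⁻¹ * w)) := by positivity
    have b2 : 0 ≤ C2 * (t ^ n * t ^ 2) := by positivity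
    have b3 : 0 ≤ z * C1 * s := by positivity
    have b4 : 0 ≤ z * C1 * (t ^ n * t ^ 2) := by positivity
    have b5 : 0 ≤ z * z' * C2 * s := by positivity
    have b6 : 0 ≤ z * z' * C2 * (t ^ n * ((s ^ n)⁻¹ * w)) := by positivity
    linarith
  have h7 := h5.trans h6
  rw [mul_assoc, ← div_eq_inv_mul, inv_pow, ← div_eq_inv_mul] at h7
  rw [div_div, div_le_iff₀ (by positivity)] at h7
  refine h7.trans (le_of_eq ?_)
  ring

def aff (β : Fin n → ℝ) (A : Mt n) (i : Fin n) (y : E n) : ℝ := β i + ∑ j, A i j * y j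
def fr (M : Mt n) : ℝ := ∑ i, ∑ j, M i j ^ 2

lemma fr0 (M : Mt n) : 0 ≤ fr M := Finset.sum_nonneg fun _ _ => Finset.sum_nonneg fun _ _ => sq_nonneg _

lemma fr_cont {X : E n → E n} (hX : ContDiff ℝ ∞ X) (A : Mt n) : Continuous fun y => fr (jac X y - A) :=
  continuous_finset_sum _ fun i _ => continuous_finset_sum _ fun j _ => (((jac_cont hX).matrix_elem i j).sub continuous_const).pow 2

lemma aff_sm (β : Fin n → ℝ) (A : Mt n) (i) : ContDiff ℝ ∞ (aff β A i) :=
  contDiff_const.add (ContDiff.sum fun j _ => contDiff_const.mul (smooth_coord j))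

lemma aff_pd (β : Fin n → ℝ) (A : Mt n) (i j) (x) : pd j (aff β A i) x = A i j := by
  have hs : ∀ j, ContDiff ℝ ∞ (fun y : E n => A i j * y j) := fun j => contDiff_const.mul (smooth_coord j)
  show pd j (fun y => β i + ∑ j, A i j * y j) x = _
  rw [pd_add (contDiff_const.dif x) ((ContDiff.sum fun j _ => hs j).dif x), pd_const, pd_sum _ (fun k _ => (hs k).dif x)]
  simp only [pd_const_mul ((smooth_coord _).dif x), pd_coord]
  simp

lemma aff_hess (β : Fin n → ℝ) (A : Mt n) (i) (x) : hess (aff β A i) x = 0 := by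
  ext p q
  rw [hess_apply]
  have : pd q (aff β A i) = fun _ => A i q := funext fun x => aff_pd β A i q x
  rw [this, pd_const]; rfl

lemma cacc_aff (n : ℕ) (l L : ℝ) (hl : 0 < l) (hL : 0 < L) : ∃ C : ℝ, 0 < C ∧ ∀ (k : ℝ) (X : E n → E n), Good k l L X → ∀ (β : Fin n → ℝ) (A : Mt n) (r R : ℝ), 0 < r → r < R →
    ∫ y in ball 0 r, fr (jac X y - A) ≤ C / (R - r) ^ 2 * ∫ y in ball 0 R, ∑ i, (X y i - aff β A i y) ^ 2 := by
  obtain ⟨C, hC, h⟩ := cacc_ball n l L hl hL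
  refine ⟨C, hC, fun k X hX β A r R hr hR => ?_⟩
  have hs : ∀ i, ContDiff ℝ ∞ (fun y => X y i) := fun i => smooth_comp_coord hX.sm i
  have hg : ∀ i, ContDiff ℝ ∞ (fun y => X y i - aff β A i y) := fun i => (hs i).sub (aff_sm β A i)
  have hgc : ∀ i, Continuous (fun y => (X y i - aff β A i y) ^ 2) := fun i => (hg i).continuous.pow 2
  have e1 : ∀ y, fr (jac X y - A) = ∑ i, gr (fun y => X y i - aff β A i y) y ⬝ᵥ gr (fun y => X y i - aff β A i y) y := by
    intro y
    refine Finset.sum_congr rfl fun i _ => Finset.sum_congr rfl fun j _ => ?_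
    have : gr (fun y => X y i - aff β A i y) y j = jac X y i j - A i j := by
      show pd j (fun y => X y i - aff β A i y) y = _
      rw [pd_sub ((hs i).dif y) ((aff_sm β A i).dif y), aff_pd]; rfl
    rw [this, Matrix.sub_apply, sq]
  simp only [e1]
  rw [integral_finset_sum _ fun i _ => intb (grsq_cont (hg i)) 0 r, integral_finset_sum _ fun i _ => intb (hgc i) 0 R, Finset.mul_sum]
  refine Finset.sum_le_sum fun i _ => h _ _ r R hX.coef (hg i) (fun y => ?_) hr hR
  rw [hess_sub (hs i) (aff_sm β A i), aff_hess, sub_zero, hX.harm, mul_zero]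

lemma ch_st (n : ℕ) {δ t0 w0 : ℝ} (hδ : 0 < δ) (ht : 0 < t0) (hw : 0 < w0) : ∃ t s w : ℝ, 0 < t ∧ t < t0 ∧ 0 < s ∧ s ≤ 1/4 ∧ 0 < w ∧ w ≤ w0 ∧
    s + t ^ n * ((s ^ n)⁻¹ * w) + t ^ n * t ^ 2 + t * w ^ 2 ≤ δ * t ^ (n + 1) := by
  obtain ⟨t, h1, h2⟩ : ∃ t, 0 < t ∧ t ≤ min (t0 / 2) (δ / 4) := ⟨_, by positivity, le_rfl⟩
  have h3 := h2.trans (min_le_left _ _)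
  have h4 := h2.trans (min_le_right _ _)
  obtain ⟨s, s1, s2⟩ : ∃ s, 0 < s ∧ s ≤ min (1/4) (δ / 4 * t ^ (n + 1)) := ⟨_, by positivity, le_rfl⟩
  obtain ⟨w, w1, w2⟩ : ∃ w, 0 < w ∧ w ≤ min (min w0 1) (δ / 4 * t ^ (n + 1) / (t ^ n * (s ^ n)⁻¹ + t)) := ⟨_, by positivity, le_rfl⟩
  have w3 := (w2.trans (min_le_left _ _)).trans (min_le_right _ _)
  have w4 := w2.trans (min_le_right _ _)
  rw [le_div_iff₀ (by positivity)] at w4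
  refine ⟨t, s, w, h1, by linarith, s1, s2.trans (min_le_left _ _), w1, (w2.trans (min_le_left _ _)).trans (min_le_left _ _), ?_⟩
  have a1 := s2.trans (min_le_right _ _)
  have a2 : t ^ n * t ^ 2 ≤ δ / 4 * t ^ (n + 1) := by
    have : t ^ n * t ^ 2 = t * t ^ (n + 1) := by ring
    rw [this]; gcongr
  have a3 : t * w ^ 2 ≤ t * w := by gcongr; nlinarith only [w1, w2, w3]
  have a4 : 0 ≤ δ / 4 * t ^ (n + 1) := by positivity
  linarith

lemma half_norm {B : Mt n} (h : ∀ v, (1 / 2) * (v ⬝ᵥ v) ≤ v ⬝ᵥ B *ᵥ v) (v : E n) : ‖v‖ ≤ 2 * ∑ i, |(B *ᵥ v.ofLp) i| := by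
  have h1 := h v.ofLp
  have h2 : v.ofLp ⬝ᵥ v.ofLp = ‖v‖ ^ 2 := by rw [norm_sq_eq]; exact Finset.sum_congr rfl fun i _ => (sq _).symm
  have h3 : v.ofLp ⬝ᵥ B *ᵥ v.ofLp ≤ ‖v‖ * ∑ i, |(B *ᵥ v.ofLp) i| := by
    rw [dotProduct, Finset.mul_sum]
    refine Finset.sum_le_sum fun i _ => (le_abs_self _).trans ?_
    rw [abs_mul]
    exact mul_le_mul_of_nonneg_right (PiLp.norm_apply_le v i) (abs_nonneg _)
  rw [h2] at h1
  by_contra hc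
  push Not at hc
  have : 0 ≤ ∑ i, |(B *ᵥ v.ofLp) i| := Finset.sum_nonneg fun i _ => abs_nonneg _
  nlinarith only [norm_nonneg v, this, hc, h1, h3]

set_option maxHeartbeats 1000000 in
lemma st2 (n : ℕ) (hn : 2 ≤ n) (k l L : ℝ) (hk : 1 ≤ k) (hl : 0 < l) (hL : 0 < L) (η : ℝ) (hη : 0 < η) : ∃ ε Λ ϑ : ℝ, 0 < ε ∧ 0 < Λ ∧ 0 < ϑ ∧ ϑ ≤ 1 ∧ ∀ (X : E n → E n) (e : Fin n → ℝ),
    Good k l L X → e ⬝ᵥ e = 1 → ∫ y in ball (0 : E n) Λ, jac X y *ᵥ e ⬝ᵥ jac X y *ᵥ e ≤ ε → ∃ A : Mt n, ∫ y in ball 0 ϑ, fr (jac X y - A) ≤ η * ϑ ^ n := by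
  obtain ⟨c, K, Λ, C, w0, t0, hc, hK, hΛ, hC, hw0, ht0, ht1, h⟩ := st2a n hn k l L hk
  obtain ⟨C', hC', hcac⟩ := cacc_aff n l L hl hL
  set ν := volume.real (ball (0 : E n) 1) with hν
  have ν0 : 0 < ν := ENNReal.toReal_pos (measure_ball_pos _ _ one_pos).ne' (measure_ball_lt_top).ne
  have n0 : (0 : ℝ) < n := by exact_mod_cast (by omega : 0 < n)
  obtain ⟨K1, hK1⟩ : ∃ K1, K1 = K + 2 * n * C := ⟨_, rfl⟩
  have K10 : 0 < K1 := by rw [hK1]; positivity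
  obtain ⟨δ, δ0, hδ⟩ : ∃ δ, 0 < δ ∧ δ ≤ min (c * ν / (2 * K1)) (η / 2 ^ n / (4 * C' / c * (81 * K1))) := ⟨_, by positivity, le_rfl⟩
  have δ1 := hδ.trans (min_le_left _ _)
  have δ2 := hδ.trans (min_le_right _ _)
  rw [le_div_iff₀ (by positivity)] at δ1 δ2
  obtain ⟨t, s, w, t0', tlt, s0, s1, hw, hww, hκ⟩ := ch_st n δ0 ht0 hw0
  refine ⟨w ^ 2, Λ, t / 2, by positivity, by linarith, by positivity, by linarith, fun X e hX he hq => ?_⟩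
  obtain ⟨hdl, hd0, b, B, hBs, hB, hint⟩ := h X e w hX he hw hww hq
  specialize hint s t s0 s1 t0' tlt
  set q : E n → ℝ := fun y => jac X y *ᵥ e ⬝ᵥ jac X y *ᵥ e with hqd
  have hqc : Continuous q := by
    have : Continuous fun y => jac X y *ᵥ e := (jac_cont hX.sm).matrix_mulVec continuous_const
    exact this.dotProduct this
  have hq0 : ∀ y, 0 ≤ q y := fun y => dot_self_nonneg _
  have hqt : ∫ y in ball (0 : E n) t, q y ≤ w ^ 2 := (setIntegral_mono_set (intb hqc 0 Λ) (ae_of_all _ hq0) (ball_subset_ball (by linarith)).eventuallyLE).trans hq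
  set d : E n → ℝ := fun y => (jac X y + Matrix.vecMulVec e e).det with hdd
  have hdc : Continuous d := ((jac_cont hX.sm).add continuous_const).matrix_det
  have hBu : IsUnit B.det := by
    by_contra hcon
    obtain ⟨v, v0, hv⟩ := Matrix.exists_mulVec_eq_zero_iff.2 (not_not.1 fun h0 => hcon (isUnit_iff_ne_zero.2 h0))
    have h1 := hB v
    rw [hv, dotProduct_zero] at h1
    exact v0 (dotProduct_self_eq_zero.1 (le_antisymm (by linarith) (dot_self_nonneg v)))
  set G := B⁻¹ with hG
  have hBG : B * G = 1 := Matrix.mul_nonsing_inv _ hBu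
  set A : Mt n := G - Matrix.vecMulVec e e with hA
  set β : Fin n → ℝ := fun i => Xh e X 0 i - (G *ᵥ b) i with hβ
  set Z : E n → E n := fun y => Xh e X y - Xh e X 0 - WithLp.toLp 2 (G *ᵥ (y.ofLp - b)) with hZ
  have hZi : ∀ y i, Z y i = X y i - aff β A i y := by
    intro y i
    have e1 : ∑ j, A i j * y j = (G *ᵥ y.ofLp) i - e i * ∑ j, e j * y j := by
      simp only [hA, Matrix.sub_apply, sub_mul, Finset.sum_sub_distrib, Matrix.vecMulVec_apply, Finset.mul_sum, mul_assoc]; rfl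
    simp only [hZ, aff, PiLp.sub_apply, Matrix.mulVec_sub, Pi.sub_apply, hβ, e1]
    simp only [Xh, PiLp.add_apply, PiLp.smul_apply, smul_eq_mul]; ring
  have hBZ : ∀ y i, (B *ᵥ (Z y).ofLp) i = -(y i - b i - ∑ j, B i j * (Xh e X y - Xh e X 0) j) := by
    intro y i
    have : (Z y).ofLp = (Xh e X y - Xh e X 0).ofLp - G *ᵥ (y.ofLp - b) := rfl
    rw [this, Matrix.mulVec_sub, Matrix.mulVec_mulVec, hBG, Matrix.one_mulVec]
    show ∑ j, B i j * (Xh e X y - Xh e X 0) j - (y i - b i) = _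
    ring
  have hZc : Continuous Z := by
    have h1 := (hX.smh e).continuous
    have : Continuous fun y : E n => WithLp.toLp 2 (G *ᵥ (y.ofLp - b)) := (PiLp.continuous_toLp 2 _).comp (Continuous.matrix_mulVec continuous_const ((PiLp.continuous_ofLp 2 _).sub continuous_const))
    exact (h1.sub continuous_const).sub this
  have hdz : Continuous fun y => d y * ‖Z y‖ := hdc.mul hZc.norm
  have hzz : Continuous fun y => ‖Z y‖ ^ 2 := hZc.norm.pow 2
  have hI : ∫ y in ball (0 : E n) t, d y * ‖Z y‖ ≤ 2 * n * C * (s + t ^ n * ((s ^ n)⁻¹ * w) + t ^ n * t ^ 2) := by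
    have hci : ∀ i, Continuous fun y : E n => d y * |y i - b i - ∑ j, B i j * (Xh e X y - Xh e X 0) j| := by
      intro i
      have h1 : ∀ j, Continuous fun y => (Xh e X y - Xh e X 0) j := fun j => (smooth_comp_coord (hX.smh e) j).continuous.sub continuous_const
      exact hdc.mul (Continuous.abs (((smooth_coord i).continuous.sub continuous_const).sub (continuous_finset_sum _ fun j _ => continuous_const.mul (h1 j))))
    have h1 : ∀ y, d y * ‖Z y‖ ≤ 2 * ∑ i, d y * |y i - b i - ∑ j, B i j * (Xh e X y - Xh e X 0) j| := by
      intro y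
      have := mul_le_mul_of_nonneg_left (half_norm hB (Z y)) (hd0 y).le
      simp only [hBZ, abs_neg] at this
      refine this.trans (le_of_eq ?_)
      rw [← Finset.mul_sum]; ring
    refine (setIntegral_mono (intb hdz 0 t) (intb (continuous_const.mul (continuous_finset_sum _ fun i _ => hci i)) 0 t) h1).trans ?_
    simp only [Pi.mul_apply]
    rw [integral_const_mul, integral_finset_sum _ fun i _ => intb (hci i) 0 t]
    refine (mul_le_mul_of_nonneg_left (Finset.sum_le_sum fun i _ => hint i) zero_le_two).trans (le_of_eq ?_)
    simp; ring
  have hlip : ∀ y y', ‖Z y' - Z y‖ ≤ 4 * ‖y' - y‖ := by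
    intro y y'
    have e1 : Z y' - Z y = (Xh e X y' - Xh e X y) - WithLp.toLp 2 (G *ᵥ (y' - y).ofLp) := by
      simp only [hZ, Matrix.mulVec_sub, WithLp.toLp_sub, WithLp.ofLp_sub]; abel
    have h2 := hX.lip2 he y y'
    have h3 : ‖(WithLp.toLp 2 (G *ᵥ (y' - y).ofLp) : E n)‖ ≤ 2 * ‖y' - y‖ := by
      have h1 := hB (G *ᵥ (y' - y).ofLp)
      rw [Matrix.mulVec_mulVec, hBG, Matrix.one_mulVec] at h1
      have h4 := (abs_le.1 (dot_le (WithLp.toLp 2 (G *ᵥ (y' - y).ofLp)) (y' - y))).2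
      have h5 := norm_sq_eq (WithLp.toLp 2 (G *ᵥ (y' - y).ofLp) : E n)
      have h6 : (G *ᵥ (y' - y).ofLp) ⬝ᵥ (G *ᵥ (y' - y).ofLp) = ‖(WithLp.toLp 2 (G *ᵥ (y' - y).ofLp) : E n)‖ ^ 2 := by
        rw [h5]; exact Finset.sum_congr rfl fun i _ => (sq _).symm
      rw [h6] at h1
      have h7 : (1 / 2) * ‖(WithLp.toLp 2 (G *ᵥ (y' - y).ofLp) : E n)‖ ^ 2 ≤ ‖(WithLp.toLp 2 (G *ᵥ (y' - y).ofLp) : E n)‖ * ‖y' - y‖ := h1.trans h4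
      generalize ‖(WithLp.toLp 2 (G *ᵥ (y' - y).ofLp) : E n)‖ = z at h7
      by_contra hcn
      push Not at hcn
      nlinarith only [norm_nonneg (y' - y), h7, hcn]
    rw [e1]
    exact (norm_sub_le _ _).trans (by linarith)
  have hvt : volume.real (ball (0 : E n) t) = t ^ n * ν := by
    rw [Measure.real, Measure.addHaar_ball_of_pos _ _ t0', ENNReal.toReal_mul, ENNReal.toReal_ofReal (by positivity), finrank_euclideanSpace_fin]; rfl
  obtain ⟨κ, hκd⟩ : ∃ κ, κ = s + t ^ n * ((s ^ n)⁻¹ * w) + t ^ n * t ^ 2 := ⟨_, rfl⟩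
  rw [← hκd] at hI hκ
  have κ0 : 0 ≤ κ := by rw [hκd]; positivity
  have tw0 : 0 ≤ t * w ^ 2 := by positivity
  have hs1 : ∀ y ∈ ball (0 : E n) t, ‖Z y‖ ≤ 9 * t := by
    have : ∃ y ∈ ball (0 : E n) t, ‖Z y‖ ≤ t := by
      by_contra hcon
      push Not at hcon
      have h1 : ∀ y ∈ ball (0 : E n) t, t * (c - K * q y) ≤ d y * ‖Z y‖ := by
        intro y hy
        have h2 := hdl y
        have h3 := mul_le_mul_of_nonneg_left (hcon y hy).le (hd0 y).le
        have h4 := mul_le_mul_of_nonneg_left h2 t0'.le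
        linarith
      have h2 := setIntegral_mono_on ((intb (continuous_const.sub (hqc.const_mul K)) 0 t).const_mul t) (intb hdz 0 t) measurableSet_ball h1
      simp only [Pi.sub_apply] at h2
      rw [integral_const_mul, integral_sub (intb continuous_const 0 t) ((intb hqc 0 t).const_mul K), integral_const_mul, setIntegral_const, smul_eq_mul, hvt] at h2
      have h3 := mul_le_mul_of_nonneg_left hqt (by positivity : 0 ≤ t * K)
      have h4 : δ * (2 * K1) * t ^ (n + 1) ≤ c * ν * t ^ (n + 1) := by gcongr
      have h5 : K1 * (κ + t * w ^ 2) ≤ K1 * (δ * t ^ (n + 1)) := by gcongr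
      have h6 : 0 < c * ν * t ^ (n + 1) := by positivity
      have h7 : t * (t ^ n * ν * c) = c * ν * t ^ (n + 1) := by ring
      have h8 : K1 * (κ + t * w ^ 2) = K * κ + K * (t * w ^ 2) + 2 * n * C * κ + 2 * n * C * (t * w ^ 2) := by rw [hK1]; ring
      have h9 : 0 ≤ K * κ := by positivity
      have h10 : 0 ≤ 2 * n * C * (t * w ^ 2) := by positivity
      have h11 : ∫ y in ball (0 : E n) t, d y * ‖Z y‖ ≤ 2 * n * C * κ := hI
      have h12 : t * (t ^ n * ν * c - K * ∫ y in ball (0 : E n) t, q y) ≤ ∫ y in ball (0 : E n) t, d y * ‖Z y‖ := h2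
      linarith
    obtain ⟨y0, hy0, hz0⟩ := this
    intro y hy
    have h1 := hlip y0 y
    rw [mem_ball_zero_iff] at hy hy0
    have h2 := norm_sub_le y y0
    have h3 := norm_add_le (Z y - Z y0) (Z y0)
    rw [sub_add_cancel] at h3
    linarith
  have hsq : c * ∫ y in ball (0 : E n) t, ‖Z y‖ ^ 2 ≤ 81 * t * K1 * (κ + t * w ^ 2) := by
    have h1 : ∀ y ∈ ball (0 : E n) t, c * ‖Z y‖ ^ 2 ≤ 9 * t * (d y * ‖Z y‖) + 81 * t ^ 2 * K * q y := by
      intro y hy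
      have h2 := hs1 y hy
      have z0 := norm_nonneg (Z y)
      have h3 : ‖Z y‖ ^ 2 ≤ 81 * t ^ 2 := by nlinarith only [h2, z0]
      have h4 := mul_le_mul_of_nonneg_right (hdl y) (sq_nonneg ‖Z y‖)
      have h5 := mul_le_mul_of_nonneg_left h3 (mul_nonneg hK.le (hq0 y))
      have h6 := mul_le_mul_of_nonneg_left h2 (mul_nonneg (hd0 y).le z0)
      have h7 : (c - K * q y) * ‖Z y‖ ^ 2 ≤ d y * ‖Z y‖ ^ 2 := h4
      have h8 : d y * ‖Z y‖ * ‖Z y‖ ≤ d y * ‖Z y‖ * (9 * t) := h6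
      linarith
    have h2 := setIntegral_mono_on ((intb hzz 0 t).const_mul c) (((intb hdz 0 t).const_mul (9 * t)).add ((intb hqc 0 t).const_mul (81 * t ^ 2 * K))) measurableSet_ball h1
    simp only [Pi.add_apply] at h2
    rw [integral_const_mul, integral_add ((intb hdz 0 t).const_mul (9 * t)) ((intb hqc 0 t).const_mul (81 * t ^ 2 * K)), integral_const_mul, integral_const_mul] at h2
    have h3 := mul_le_mul_of_nonneg_left hI (by positivity : 0 ≤ 9 * t)
    have h4 := mul_le_mul_of_nonneg_left hqt (by positivity : 0 ≤ 81 * t ^ 2 * K)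
    have h5 : 81 * t * K1 * (κ + t * w ^ 2) = 81 * t * K * κ + 81 * t ^ 2 * K * w ^ 2 + 9 * t * (2 * n * C * κ) * 9 + 162 * t * n * C * (t * w ^ 2) := by rw [hK1]; ring
    have h6 : 0 ≤ 81 * t * K * κ := by positivity
    have h7 : 0 ≤ 9 * t * (2 * n * C * κ) := by positivity
    have h8 : 0 ≤ 162 * t * n * C * (t * w ^ 2) := by positivity
    linarith
  refine ⟨A, (hcac k X hX β A (t / 2) t (by positivity) (by linarith)).trans ?_⟩
  have e1 : ∀ y, ∑ i, (X y i - aff β A i y) ^ 2 = ‖Z y‖ ^ 2 := fun y => by rw [norm_sq_eq]; exact Finset.sum_congr rfl fun i _ => by rw [hZi]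
  simp only [e1]
  have h1 : ∫ y in ball (0 : E n) t, ‖Z y‖ ^ 2 ≤ 81 * t * K1 * (δ * t ^ (n + 1)) / c := by
    rw [le_div_iff₀ hc, mul_comm]; refine hsq.trans ?_; gcongr
  have h2 := mul_le_mul_of_nonneg_left h1 (by positivity : 0 ≤ C' / (t - t / 2) ^ 2)
  refine h2.trans ?_
  have h3 : C' / (t - t / 2) ^ 2 * (81 * t * K1 * (δ * t ^ (n + 1)) / c) = δ * (4 * C' / c * (81 * K1)) * t ^ n := by
    have : t - t / 2 = t / 2 := by ring
    rw [this]; field_simp; ring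
  rw [h3]
  refine (mul_le_mul_of_nonneg_right δ2 (by positivity : 0 ≤ t ^ n)).trans (le_of_eq ?_)
  rw [div_pow]; ring

section
lemma prod_tay {ι : Type*} [DecidableEq ι] (s : Finset ι) {d x : ι → ℝ} {h R : ℝ} (hR : 1 ≤ R) (hh : 0 ≤ h) (hd : ∀ i, |d i| ≤ R) (hdx : ∀ i, |d i + x i| ≤ R) (hx : ∀ i, |x i| ≤ h) :
    |∏ i ∈ s, (d i + x i) - ∏ i ∈ s, d i - ∑ a ∈ s, x a * ∏ i ∈ s.erase a, d i| ≤ (s.card : ℝ) ^ 2 * R ^ s.card * h ^ 2 := by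
  induction s using Finset.induction_on with
  | empty => simp
  | insert b s hb ih =>
    have hp : ∀ t : Finset ι, |∏ i ∈ t, d i| ≤ R ^ t.card := fun t => by
      rw [Finset.abs_prod]; exact (Finset.prod_le_prod (fun i _ => abs_nonneg _) (fun i _ => hd i)).trans (by simp)
    have h1 : |∑ a ∈ s, x a * ∏ i ∈ s.erase a, d i| ≤ s.card * (h * R ^ s.card) := by
      refine (Finset.abs_sum_le_sum_abs _ _).trans ?_
      rw [← nsmul_eq_mul]
      refine Finset.sum_le_card_nsmul _ _ _ fun a _ => ?_
      rw [abs_mul]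
      exact mul_le_mul (hx a) ((hp _).trans (pow_le_pow_right₀ hR (Finset.card_le_card (Finset.erase_subset _ _)))) (abs_nonneg _) hh
    have e1 : ∑ a ∈ insert b s, x a * ∏ i ∈ (insert b s).erase a, d i = x b * ∏ i ∈ s, d i + d b * ∑ a ∈ s, x a * ∏ i ∈ s.erase a, d i := by
      rw [Finset.sum_insert hb, Finset.erase_insert hb, Finset.mul_sum]
      congr 1
      refine Finset.sum_congr rfl fun a ha => ?_
      have hne : b ≠ a := fun h => hb (h ▸ ha)
      rw [Finset.erase_insert_of_ne hne, Finset.prod_insert (fun h => hb (Finset.mem_of_mem_erase h))]; ring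
    rw [e1, Finset.prod_insert hb, Finset.prod_insert hb, Finset.card_insert_of_notMem hb]
    set P := ∏ i ∈ s, (d i + x i)
    set Q := ∏ i ∈ s, d i
    set Y := ∑ a ∈ s, x a * ∏ i ∈ s.erase a, d i
    have e2 : (d b + x b) * P - d b * Q - (x b * Q + d b * Y) = (d b + x b) * (P - Q - Y) + x b * Y := by ring
    rw [e2]
    have h2 := abs_add_le ((d b + x b) * (P - Q - Y)) (x b * Y)
    rw [abs_mul, abs_mul] at h2
    have h3 := mul_le_mul (hdx b) ih (abs_nonneg _) (by linarith)
    have h4 := mul_le_mul (hx b) h1 (abs_nonneg _) hh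
    refine h2.trans ((add_le_add h3 h4).trans ?_)
    push_cast
    have h5 : h * (s.card * (h * R ^ s.card)) ≤ R * (s.card * (h * R ^ s.card)) * h := by
      have : 0 ≤ h * (s.card * (h * R ^ s.card)) := by positivity
      nlinarith only [this, hR]
    have h6 : 0 ≤ (s.card + 1) * (R * R ^ s.card) * h ^ 2 := by positivity
    rw [pow_succ' R]; linarith

lemma det_tay {d : Fin n → ℝ} {H : Mt n} {h R : ℝ} (hR : 1 ≤ R) (hh : 0 ≤ h) (hd : ∀ i, |d i| ≤ R) (hM : ∀ i j, |(Matrix.diagonal d + H) i j| ≤ R) (hH : ∀ i j, |H i j| ≤ h) :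
    |(Matrix.diagonal d + H).det - ∏ i, d i - ∑ a, H a a * ∏ i ∈ Finset.univ.erase a, d i| ≤ ((n : ℝ) ^ 2 * R ^ n + n.factorial * R ^ n) * h ^ 2 := by
  have h1 := prod_tay Finset.univ (x := fun i => H i i) hR hh hd (fun i => by simpa using hM i i) (fun i => hH i i)
  rw [Finset.card_univ, Fintype.card_fin] at h1
  rw [Matrix.det_apply, ← Finset.add_sum_erase _ _ (Finset.mem_univ (1 : Equiv.Perm (Fin n)))]
  have h2 : |∑ σ ∈ Finset.univ.erase (1 : Equiv.Perm (Fin n)), Equiv.Perm.sign σ • ∏ i, (Matrix.diagonal d + H) (σ i) i| ≤ n.factorial * (R ^ n * h ^ 2) := by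
    refine (Finset.abs_sum_le_sum_abs _ _).trans ?_
    have h3 : ∀ σ ∈ Finset.univ.erase (1 : Equiv.Perm (Fin n)), |Equiv.Perm.sign σ • ∏ i, (Matrix.diagonal d + H) (σ i) i| ≤ R ^ n * h ^ 2 := by
      intro σ hσ
      have e1 : |Equiv.Perm.sign σ • ∏ i, (Matrix.diagonal d + H) (σ i) i| = ∏ i, |(Matrix.diagonal d + H) (σ i) i| := by
        rw [← Finset.abs_prod]
        rcases Int.units_eq_one_or (Equiv.Perm.sign σ) with hs | hs <;> simp [hs]
      rw [e1]
      obtain ⟨i0, hi⟩ : ∃ i, σ i ≠ i := by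
        by_contra hcon; push Not at hcon
        exact (Finset.ne_of_mem_erase hσ) (Equiv.ext hcon)
      have hj : σ (σ i0) ≠ σ i0 := fun h => hi (σ.injective h)
      have hb : ∀ i, σ i ≠ i → |(Matrix.diagonal d + H) (σ i) i| ≤ h := fun i hi => by
        rw [Matrix.add_apply, Matrix.diagonal_apply_ne _ hi, zero_add]; exact hH _ _
      rw [← Finset.mul_prod_erase _ _ (Finset.mem_univ i0), ← Finset.mul_prod_erase _ _ (Finset.mem_erase.2 ⟨hi, Finset.mem_univ (σ i0)⟩)]
      have h4 : ∏ i ∈ (Finset.univ.erase i0).erase (σ i0), |(Matrix.diagonal d + H) (σ i) i| ≤ R ^ n := by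
        refine (Finset.prod_le_prod (fun i _ => abs_nonneg _) (fun i _ => hM _ _)).trans ?_
        rw [Finset.prod_const]
        refine pow_le_pow_right₀ hR ((Finset.card_le_univ _).trans (by simp))
      have h5 := mul_le_mul (hb i0 hi) (mul_le_mul (hb _ hj) h4 (Finset.prod_nonneg fun i _ => abs_nonneg _) hh) (mul_nonneg (abs_nonneg _) (Finset.prod_nonneg fun i _ => abs_nonneg _)) hh
      exact h5.trans (le_of_eq (by ring))
    refine (Finset.sum_le_card_nsmul _ _ _ h3).trans ?_
    rw [nsmul_eq_mul]
    have : (Finset.univ.erase (1 : Equiv.Perm (Fin n))).card ≤ n.factorial := by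
      refine (Finset.card_le_univ _).trans ?_
      rw [Fintype.card_perm, Fintype.card_fin]
    gcongr
  have e2 : ∏ i, (Matrix.diagonal d + H) ((1 : Equiv.Perm (Fin n)) i) i = ∏ i, (d i + H i i) := Finset.prod_congr rfl fun i _ => by simp
  rw [e2, Equiv.Perm.sign_one, one_smul]
  have h3 := abs_add_le (∏ i, (d i + H i i) - ∏ i, d i - ∑ a, H a a * ∏ i ∈ Finset.univ.erase a, d i) (∑ σ ∈ Finset.univ.erase (1 : Equiv.Perm (Fin n)), Equiv.Perm.sign σ • ∏ i, (Matrix.diagonal d + H) (σ i) i)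
  refine le_trans (le_of_eq ?_) (h3.trans ((add_le_add h1 h2).trans (le_of_eq ?_)))
  · congr 1; ring
  · ring

open Polynomial in
lemma phi_ex (n : ℕ) (c1 c2 : ℝ) : ∃ γ : ℕ → ℝ, ∀ (s : Finset (Fin n)) (μ p : Fin n → ℝ), (∀ i, μ i * p i = 1) →
    ∑ j ∈ Finset.range (n + 1), γ j * ∏ i ∈ s, (μ i + j) = (∏ i ∈ s, μ i) * ((1/2) * ((∑ i ∈ s, p i) ^ 2 - ∑ i ∈ s, p i ^ 2) - c1 * ∑ i ∈ s, p i + c2) := by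
  let φ : ℝ[X] → ℝ := fun f => f.coeff 2 - c1 * f.coeff 1 + c2 * f.coeff 0
  refine ⟨fun j => φ (Lagrange.basis (Finset.range (n + 1)) (fun j : ℕ => (j : ℝ)) j), fun s μ p h => ?_⟩
  set f : ℝ[X] := ∏ i ∈ s, (X + C (μ i)) with hf
  have hc : f.coeff 0 = ∏ i ∈ s, μ i ∧ f.coeff 1 = (∏ i ∈ s, μ i) * ∑ i ∈ s, p i ∧ f.coeff 2 = (∏ i ∈ s, μ i) * ((1/2) * ((∑ i ∈ s, p i) ^ 2 - ∑ i ∈ s, p i ^ 2)) := by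
    rw [hf]
    clear_value f
    clear hf
    induction s using Finset.induction_on with
    | empty => simp [coeff_one]
    | insert b s hb ih =>
      obtain ⟨i0, i1, i2⟩ := ih
      simp only [Finset.prod_insert hb, Finset.sum_insert hb, add_mul, coeff_add, coeff_C_mul, coeff_X_mul, coeff_X_mul_zero, i0, i1, i2]
      have h1 := h b
      refine ⟨by ring, ?_, ?_⟩
      · linear_combination -(∏ i ∈ s, μ i) * h1
      · linear_combination -(∏ i ∈ s, μ i) * (∑ i ∈ s, p i) * h1
  have hdeg : f.degree < (Finset.range (n + 1)).card := by
    rw [hf, degree_prod]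
    simp only [degree_X_add_C, Finset.sum_const, Finset.card_range, nsmul_eq_mul, mul_one]
    have : s.card < n + 1 := by have := Finset.card_le_univ s; rw [Fintype.card_fin] at this; omega
    exact_mod_cast this
  have hi := Lagrange.eq_interpolate (v := fun j : ℕ => (j : ℝ)) (s := Finset.range (n + 1)) (f := f) (fun a _ b _ hab => Nat.cast_injective (R := ℝ) hab) hdeg
  have e1 : ∀ j : ℕ, f.eval (j : ℝ) = ∏ i ∈ s, (μ i + j) := fun j => by rw [hf, eval_prod]; simp [add_comm]
  have e2 : φ f = ∑ j ∈ Finset.range (n + 1), φ (Lagrange.basis (Finset.range (n + 1)) (fun j : ℕ => (j : ℝ)) j) * ∏ i ∈ s, (μ i + j) := by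
    conv_lhs => rw [hi]
    simp only [φ, Lagrange.interpolate_apply, finset_sum_coeff, coeff_C_mul, e1, Finset.mul_sum, ← Finset.sum_sub_distrib, ← Finset.sum_add_distrib]
    exact Finset.sum_congr rfl fun j _ => by ring
  rw [← e2]
  simp only [φ, hc.1, hc.2.1, hc.2.2]; ring

lemma fr_cj {O : Mt n} (h : O * Oᵀ = 1) (M : Mt n) : fr (Oᵀ * M * O) = fr M := by
  have e : ∀ M : Mt n, fr M = (M * Mᵀ).trace := fun M => Finset.sum_congr rfl fun i _ => Finset.sum_congr rfl fun j _ => sq _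
  rw [e, e, Matrix.transpose_mul, Matrix.transpose_mul, Matrix.transpose_transpose]
  have : Oᵀ * M * O * (Oᵀ * (Mᵀ * O)) = Oᵀ * (M * (O * Oᵀ) * Mᵀ * O) := by simp only [Matrix.mul_assoc]
  rw [this, h, Matrix.mul_one, Matrix.trace_mul_comm, Matrix.mul_assoc, h, Matrix.mul_one]

lemma fr_ent (M : Mt n) (i j) : |M i j| ≤ √(fr M) := by
  refine Real.abs_le_sqrt ?_
  exact (Finset.single_le_sum (f := fun j => M i j ^ 2) (fun j _ => sq_nonneg _) (Finset.mem_univ j)).trans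
    (Finset.single_le_sum (f := fun i => ∑ j, M i j ^ 2) (fun i _ => Finset.sum_nonneg fun j _ => sq_nonneg _) (Finset.mem_univ i))

lemma Adm.mdiag {k : ℝ} {S m : Mt n} (hS : Adm k S) (hm : m * (S + k • 1) = 1) : ∃ (O : Mt n) (μ p : Fin n → ℝ), O * Oᵀ = 1 ∧ Oᵀ * O = 1 ∧ (∀ i, μ i * p i = 1) ∧ (∀ i, 0 < μ i ∧ μ i ≤ 1) ∧
    m = O * Matrix.diagonal μ * Oᵀ ∧ (1/2) * ((∑ i, p i) ^ 2 - ∑ i, p i ^ 2) - ((n - 1) * k + 1) * ∑ i, p i + (n * (n - 1) / 2 * k ^ 2 + n * k) = 0 ∧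
    aM k m = O * Matrix.diagonal (fun i => (∏ j, μ j) * (p i * (∑ j, p j - p i - ((n - 1) * k + 1)) * p i)) * Oᵀ := by
  obtain ⟨O, q, o1, o2, -, hq, -, hF, hP⟩ := hS.diag
  have p0 : ∀ i, 0 < q i + k := fun i => by linarith [hq.pos i]
  have s1 : ∑ i, (q i + k) = ∑ i, q i + n * k := by rw [Finset.sum_add_distrib]; simp
  refine ⟨O, fun i => (q i + k)⁻¹, fun i => q i + k, o1, o2, fun i => inv_mul_cancel₀ (p0 i).ne', fun i => ⟨inv_pos.2 (p0 i), inv_le_one_of_one_le₀ (hq.pos i)⟩, ?_, ?_, ?_⟩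
  · have h1 : (O * Matrix.diagonal (fun i => (q i + k)⁻¹) * Oᵀ) * (S + k • 1) = 1 := by
      rw [hP, cj_mul o2]
      have : (fun i => (q i + k)⁻¹ * (q i + k)) = fun _ => 1 := funext fun i => inv_mul_cancel₀ (p0 i).ne'
      rw [this, cj_one o1, one_smul]
    rw [← Matrix.inv_eq_left_inv h1, Matrix.inv_eq_left_inv hm]
  · have s2 : ∑ i, (q i + k) ^ 2 = ∑ i, q i ^ 2 + 2 * k * ∑ i, q i + n * k ^ 2 := by
      simp only [add_sq, Finset.sum_add_distrib, Finset.mul_sum]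
      simp only [Finset.sum_const, Finset.card_univ, Fintype.card_fin, nsmul_eq_mul]
      congr 2; exact Finset.sum_congr rfl fun i _ => by ring
    rw [s1, s2]
    linear_combination (1/2) * hq.eq
  · rw [aM_eq hm, hP, hF, cj_mul o2, cj_mul o2, cj_smul, cj_det o2]
    congr 3
    funext i
    rw [Finset.prod_inv_distrib, s1]; ring

lemma quad (n : ℕ) (k : ℝ) : ∃ C : ℝ, 0 < C ∧ ∀ S m S0 A : Mt n, Adm k S → m * (S + k • 1) = 1 → Adm k S0 → A * (S0 + k • 1) = 1 → |(aM k A * (m - A)).trace| ≤ C * fr (m - A) := by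
  obtain ⟨γ, hγ⟩ := phi_ex n ((n - 1) * k + 1) (n * (n - 1) / 2 * k ^ 2 + n * k)
  obtain ⟨R, hRd⟩ : ∃ R : ℝ, R = 2 * n + 1 := ⟨_, rfl⟩
  have hR : 1 ≤ R := by rw [hRd]; have : (0 : ℝ) ≤ n := Nat.cast_nonneg n
                        linarith
  obtain ⟨C0, hC0⟩ : ∃ C0 : ℝ, C0 = (n : ℝ) ^ 2 * R ^ n + n.factorial * R ^ n := ⟨_, rfl⟩
  have C00 : 0 ≤ C0 := by rw [hC0]; positivity
  refine ⟨∑ j ∈ Finset.range (n + 1), |γ j| * C0 + 1, by positivity, fun S m S0 A hS hm hS0 hA => ?_⟩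
  obtain ⟨O, μ, p, o1, o2, hμp, hμ, hA', hg, ha⟩ := hS0.mdiag hA
  obtain ⟨O', μ', p', o1', o2', hμp', hμ', hm', hg', -⟩ := hS.mdiag hm
  set H := Oᵀ * (m - A) * O with hH
  have hfr : fr H = fr (m - A) := fr_cj o1 _
  have hOA : Oᵀ * A * O = Matrix.diagonal μ := by
    rw [hA']
    calc _ = (Oᵀ * O) * Matrix.diagonal μ * (Oᵀ * O) := by simp only [Matrix.mul_assoc]
      _ = _ := by rw [o2, Matrix.one_mul, Matrix.mul_one]
  have hmH : Matrix.diagonal μ + H = Oᵀ * m * O := by rw [hH, Matrix.mul_sub, Matrix.sub_mul, hOA]; abel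
  have hdiag : ∀ j : ℕ, Matrix.diagonal (fun i => μ i + j) + H = Oᵀ * (m + (j : ℝ) • 1) * O := by
    intro j
    rw [Matrix.mul_add, Matrix.add_mul, ← hmH]
    have : Oᵀ * ((j : ℝ) • (1 : Mt n)) * O = (j : ℝ) • 1 := by rw [Matrix.mul_smul, Matrix.mul_one, Matrix.smul_mul, o2]
    rw [this, ← Matrix.diagonal_add, Matrix.smul_one_eq_diagonal]; abel
  have hdet : ∀ j : ℕ, (Matrix.diagonal (fun i => μ i + j) + H).det = ∏ i, (μ' i + j) := by
    intro j
    rw [hdiag, Matrix.det_mul_right_comm, o2, Matrix.one_mul, hm', ← cj_one o1', cj_add, cj_det o2']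
  have hment : ∀ i i', |(Oᵀ * m * O) i i'| ≤ n := by
    intro i i'
    refine (fr_ent _ i i').trans ?_
    rw [fr_cj o1, Real.sqrt_le_iff]
    refine ⟨Nat.cast_nonneg n, ?_⟩
    have e : fr m = ∑ i, μ' i * μ' i := by
      have : fr m = (m * mᵀ).trace := Finset.sum_congr rfl fun i _ => Finset.sum_congr rfl fun j _ => sq _
      rw [this]
      have ht : mᵀ = m := by rw [hm']; simp [Matrix.mul_assoc]
      rw [ht, hm', cj_mul o2', cj_trace o2']
    rw [e]
    have h1 : ∑ i, μ' i * μ' i ≤ ∑ _i : Fin n, (1 : ℝ) := Finset.sum_le_sum fun i _ => by nlinarith [hμ' i]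
    simp only [Finset.sum_const, Finset.card_univ, Fintype.card_fin, nsmul_eq_mul, mul_one] at h1
    refine h1.trans ?_
    rcases Nat.eq_zero_or_pos n with h0 | h0
    · subst h0; simp
    · have : (1 : ℝ) ≤ n := by exact_mod_cast h0
      nlinarith
  have hj1 : ∀ j ∈ Finset.range (n + 1), (j : ℝ) ≤ n := fun j hj => by exact_mod_cast Nat.lt_succ_iff.1 (Finset.mem_range.1 hj)
  have htay : ∀ j ∈ Finset.range (n + 1), |∏ i, (μ' i + j) - ∏ i, (μ i + j) - ∑ a, H a a * ∏ i ∈ Finset.univ.erase a, (μ i + j)| ≤ C0 * fr (m - A) := by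
    intro j hj
    have j0 : (0 : ℝ) ≤ j := Nat.cast_nonneg j
    have h1 := det_tay (d := fun i => μ i + j) (H := H) hR (Real.sqrt_nonneg (fr H)) (fun i => by
      rw [abs_of_nonneg (by linarith [(hμ i).1]), hRd]; linarith [(hμ i).2, hj1 j hj]) (fun i i' => by
      have e : (Matrix.diagonal (fun i => μ i + j) + H) i i' = (Oᵀ * m * O) i i' + (j : ℝ) * (1 : Mt n) i i' := by
        rw [← hmH, ← Matrix.diagonal_add, ← Matrix.smul_one_eq_diagonal]
        simp only [Matrix.add_apply, Matrix.smul_apply, smul_eq_mul]; ring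
      rw [e, hRd]
      refine (abs_add_le _ _).trans ?_
      have h2 := hment i i'
      have h3 : |(j : ℝ) * (1 : Mt n) i i'| ≤ j := by rw [Matrix.one_apply]; split_ifs <;> simp [j0]
      linarith [hj1 j hj]) (fun i i' => fr_ent H i i')
    rw [hdet, Real.sq_sqrt (fr0 H), hfr, ← hC0] at h1
    exact h1
  have hsum := Finset.abs_sum_le_sum_abs (fun j => γ j * (∏ i, (μ' i + j) - ∏ i, (μ i + j) - ∑ a, H a a * ∏ i ∈ Finset.univ.erase a, (μ i + (j : ℕ)))) (Finset.range (n + 1))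
  have hs2 : ∑ j ∈ Finset.range (n + 1), |γ j * (∏ i, (μ' i + j) - ∏ i, (μ i + j) - ∑ a, H a a * ∏ i ∈ Finset.univ.erase a, (μ i + (j : ℕ)))| ≤ (∑ j ∈ Finset.range (n + 1), |γ j| * C0) * fr (m - A) := by
    rw [Finset.sum_mul]
    refine Finset.sum_le_sum fun j hj => ?_
    rw [abs_mul, mul_assoc]; exact mul_le_mul_of_nonneg_left (htay j hj) (abs_nonneg _)
  have e1 : ∑ j ∈ Finset.range (n + 1), γ j * (∏ i, (μ' i + j) - ∏ i, (μ i + j) - ∑ a, H a a * ∏ i ∈ Finset.univ.erase a, (μ i + (j : ℕ))) = (aM k A * (m - A)).trace := by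
    have h1 := hγ Finset.univ μ' p' hμp'
    have h2 := hγ Finset.univ μ p hμp
    rw [hg', mul_zero] at h1
    rw [hg, mul_zero] at h2
    have h3 : (aM k A * (m - A)).trace = ∑ a, (∏ j, μ j) * (p a * (∑ j, p j - p a - ((n - 1) * k + 1)) * p a) * H a a := by
      rw [ha, Matrix.mul_assoc, Matrix.mul_assoc, Matrix.trace_mul_comm, Matrix.mul_assoc, ← hH]
      simp [Matrix.trace, Matrix.diagonal_mul]
    rw [h3]
    have hL : ∑ j ∈ Finset.range (n + 1), γ j * (∏ i, (μ' i + j) - ∏ i, (μ i + j) - ∑ a, H a a * ∏ i ∈ Finset.univ.erase a, (μ i + (j : ℕ))) =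
        ∑ j ∈ Finset.range (n + 1), γ j * ∏ i, (μ' i + j) - ∑ j ∈ Finset.range (n + 1), γ j * ∏ i, (μ i + j) - ∑ j ∈ Finset.range (n + 1), ∑ a, γ j * (H a a * ∏ i ∈ Finset.univ.erase a, (μ i + (j : ℕ))) := by
      rw [← Finset.sum_sub_distrib, ← Finset.sum_sub_distrib]
      exact Finset.sum_congr rfl fun j _ => by rw [← Finset.mul_sum]; ring
    rw [hL, h1, h2, Finset.sum_comm, sub_zero, zero_sub, ← Finset.sum_neg_distrib]
    refine Finset.sum_congr rfl fun a _ => ?_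
    have h4 := hγ (Finset.univ.erase a) μ p hμp
    have e5 : ∑ j ∈ Finset.range (n + 1), γ j * (H a a * ∏ i ∈ Finset.univ.erase a, (μ i + (j : ℝ))) = H a a * ∑ j ∈ Finset.range (n + 1), γ j * ∏ i ∈ Finset.univ.erase a, (μ i + j) := by
      rw [Finset.mul_sum]; exact Finset.sum_congr rfl fun j _ => by ring
    rw [e5, h4]
    have f1 := Finset.mul_prod_erase Finset.univ μ (Finset.mem_univ a)
    have f2 := Finset.add_sum_erase Finset.univ p (Finset.mem_univ a)
    have f3 := Finset.add_sum_erase Finset.univ (fun i => p i ^ 2) (Finset.mem_univ a)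
    have f4 := hμp a
    rw [← f2, ← f3] at hg
    rw [← f1, ← f2]
    generalize ∏ i ∈ Finset.univ.erase a, μ i = e at *
    generalize ∑ i ∈ Finset.univ.erase a, p i = x at *
    generalize ∑ i ∈ Finset.univ.erase a, p i ^ 2 = z at *
    linear_combination -(H a a) * e * hg - (H a a) * e * (p a * (x - ((n-1)*k+1))) * f4
  rw [← e1]
  refine (hsum.trans hs2).trans ?_
  have := fr0 (m - A)
  rw [add_mul]; linarith
end

lemma cs_ball {f : E n → ℝ} (hf : Continuous f) (h0 : ∀ x, 0 ≤ f x) :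
    (∫ x in ball (0 : E n) 1, √(f x)) ^ 2 ≤ volume.real (ball (0 : E n) 1) * ∫ x in ball (0 : E n) 1, f x := by
  set ν := volume.real (ball (0 : E n) 1) with hν
  have ν0 : 0 < ν := ENNReal.toReal_pos (measure_ball_pos _ _ one_pos).ne' (measure_ball_lt_top).ne
  obtain ⟨m, hm⟩ : ∃ m, m = (∫ x in ball (0 : E n) 1, √(f x)) / ν := ⟨_, rfl⟩
  have h1 : 2 * m * (∫ x in ball (0 : E n) 1, √(f x)) ≤ (∫ x in ball (0 : E n) 1, f x) + m ^ 2 * ν := by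
    have : m ^ 2 * ν = ∫ x in ball (0 : E n) 1, m ^ 2 := by rw [setIntegral_const, smul_eq_mul, mul_comm]
    rw [this, ← integral_const_mul, ← integral_add (intb hf 0 1) (intb continuous_const 0 1)]
    refine setIntegral_mono ((intb hf.sqrt 0 1).const_mul _) ((intb hf 0 1).add (intb continuous_const 0 1)) fun x => ?_
    have := Real.sq_sqrt (h0 x)
    show 2 * m * √(f x) ≤ f x + m ^ 2
    nlinarith [sq_nonneg (√(f x) - m)]
  have h2 : m * ν = ∫ x in ball (0 : E n) 1, √(f x) := by rw [hm]; field_simp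
  rw [← h2] at h1 ⊢
  nlinarith

lemma fr_contr {B : Mt n} (hs : Bᵀ = B) (h : ∀ v, B *ᵥ v ⬝ᵥ B *ᵥ v ≤ v ⬝ᵥ v) (M : Mt n) : fr (B * M * B) ≤ fr M := by
  have ht : ∀ M : Mt n, fr Mᵀ = fr M := fun M => Finset.sum_comm
  have h1 : ∀ M : Mt n, fr (B * M) ≤ fr M := fun M => by
    rw [← ht, ← ht M]
    refine Finset.sum_le_sum fun j _ => ?_
    have := h (fun i => M i j)
    simp only [dotProduct, ← sq] at this; exact this
  refine (le_of_eq ?_).trans ((h1 (B * M)ᵀ).trans ((ht _).le.trans (h1 M)))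
  rw [← ht (B * M * B), Matrix.transpose_mul, hs]

lemma sqrtm {a : Mt n} {l L : ℝ} (hl : 0 < l) (hL : 0 < L) (hs : aᵀ = a) (h1 : ∀ v, l * (v ⬝ᵥ v) ≤ v ⬝ᵥ a *ᵥ v) (h2 : ∀ v, v ⬝ᵥ a *ᵥ v ≤ L * (v ⬝ᵥ v)) :
    ∃ B G : Mt n, Bᵀ = B ∧ B * G = 1 ∧ G * B = 1 ∧ a = L • (B * B) ∧ (∀ v, B *ᵥ v ⬝ᵥ B *ᵥ v ≤ v ⬝ᵥ v) ∧ (∀ v, (l / L) ^ 2 * (G *ᵥ v ⬝ᵥ G *ᵥ v) ≤ v ⬝ᵥ v) ∧ (l / L) ^ n ≤ B.det ∧ B.det ≤ 1 := by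
  obtain ⟨O, q, o1, o2, ha⟩ := diagz hs
  have hq : ∀ i, l ≤ q i ∧ q i ≤ L := by
    intro i
    have e1 : Oᵀ *ᵥ (O *ᵥ Pi.single i 1) = Pi.single i 1 := by rw [Matrix.mulVec_mulVec, o2, Matrix.one_mulVec]
    have e2 := cj_quad O q (O *ᵥ Pi.single i 1)
    have e3 := cj_norm o1 (O *ᵥ Pi.single i 1)
    rw [← ha, e1] at e2
    rw [e1] at e3
    have f1 := h1 (O *ᵥ Pi.single i 1)
    have f2 := h2 (O *ᵥ Pi.single i 1)
    rw [e2, ← e3] at f1 f2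
    simp [Pi.single_apply] at f1 f2
    exact ⟨f1, f2⟩
  have κ0 : 0 < l / L := by positivity
  obtain ⟨b, hb⟩ : ∃ b : Fin n → ℝ, b = fun i => √(q i / L) := ⟨_, rfl⟩
  have hb2 : ∀ i, b i * b i = q i / L := fun i => by rw [hb]; exact Real.mul_self_sqrt (div_nonneg (hl.le.trans (hq i).1) hL.le)
  have hb1 : ∀ i, b i ≤ 1 := fun i => by rw [hb]; exact Real.sqrt_le_one.2 ((div_le_one hL).2 (hq i).2)
  have hbn : ∀ i, 0 ≤ b i := fun i => by rw [hb]; exact Real.sqrt_nonneg _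
  have hbl : ∀ i, l / L ≤ b i := fun i => by
    have : l / L ≤ q i / L := by gcongr; exact (hq i).1
    nlinarith [hb2 i, hb1 i, hbn i]
  have hb0 : ∀ i, 0 < b i := fun i => κ0.trans_le (hbl i)
  have hsy : ∀ p : Fin n → ℝ, (O * Matrix.diagonal p * Oᵀ)ᵀ = O * Matrix.diagonal p * Oᵀ := fun p => by simp [Matrix.mul_assoc]
  have hqd : ∀ (p : Fin n → ℝ) v, (O * Matrix.diagonal p * Oᵀ) *ᵥ v ⬝ᵥ (O * Matrix.diagonal p * Oᵀ) *ᵥ v = ∑ i, p i * p i * (Oᵀ *ᵥ v) i ^ 2 := by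
    intro p v
    rw [Matrix.dotProduct_mulVec, ← Matrix.mulVec_transpose, hsy, dotProduct_comm, Matrix.mulVec_mulVec, cj_mul o2, cj_quad]
  refine ⟨O * Matrix.diagonal b * Oᵀ, O * Matrix.diagonal (fun i => (b i)⁻¹) * Oᵀ, hsy _, ?_, ?_, ?_, fun v => ?_, fun v => ?_, ?_, ?_⟩
  · rw [cj_mul o2]; simp only [fun i => mul_inv_cancel₀ (hb0 i).ne']; rw [cj_one o1, one_smul]
  · rw [cj_mul o2]; simp only [fun i => inv_mul_cancel₀ (hb0 i).ne']; rw [cj_one o1, one_smul]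
  · rw [cj_mul o2, cj_smul, ha]; simp only [hb2, mul_div_cancel₀ _ hL.ne']
  · rw [hqd, ← cj_norm o1 v]
    refine Finset.sum_le_sum fun i _ => ?_
    have : b i * b i ≤ 1 := by nlinarith [hb1 i, hbn i]
    nlinarith [sq_nonneg ((Oᵀ *ᵥ v) i)]
  · rw [hqd, ← cj_norm o1 v, Finset.mul_sum]
    refine Finset.sum_le_sum fun i _ => ?_
    have h3 : l / L * (b i)⁻¹ ≤ 1 := by rw [← div_eq_mul_inv]; exact (div_le_one (hb0 i)).2 (hbl i)
    have h4 : (l / L * (b i)⁻¹) ^ 2 ≤ 1 := pow_le_one₀ (mul_nonneg κ0.le (inv_nonneg.2 (hbn i))) h3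
    have := mul_le_mul_of_nonneg_right h4 (sq_nonneg ((Oᵀ *ᵥ v) i))
    linarith
  · rw [cj_det o2]
    refine (le_of_eq ?_).trans (Finset.prod_le_prod (fun i _ => κ0.le) fun i _ => hbl i)
    rw [Finset.prod_const, Finset.card_univ, Fintype.card_fin]
  · rw [cj_det o2]; exact Finset.prod_le_one (fun i _ => hbn i) fun i _ => hb1 i

lemma campH (n : ℕ) (hn : 2 ≤ n) (l L : ℝ) (hl : 0 < l) (hL : 0 < L) : ∃ C : ℝ, 0 < C ∧ ∀ U : E n → E n, ContDiff ℝ ∞ U → (∀ x, (jac U x)ᵀ = jac U x) →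
    ∀ a : Mt n, aᵀ = a → (∀ v, l * (v ⬝ᵥ v) ≤ v ⬝ᵥ a *ᵥ v) → (∀ v, v ⬝ᵥ a *ᵥ v ≤ L * (v ⬝ᵥ v)) → ∃ (β : Fin n → ℝ) (A : Mt n), ∀ s θ : ℝ, 0 < s → s ≤ 1/4 → 0 < θ → θ < 1/4 →
    ∫ y in ball (0 : E n) (l / L * θ), ∑ i, (U y i - aff β A i y) ^ 2 ≤ C * (s ^ 2 * (∫ y in ball (0 : E n) 1, fr (jac U y)) +
      θ ^ n * ((s ^ n)⁻¹ * ∫ y in ball (0 : E n) 1, |(a * jac U y).trace|) ^ 2 + θ ^ n * θ ^ 4 * ∫ y in ball (0 : E n) 1, fr (jac U y)) := by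
  obtain ⟨C0, hC0, hH⟩ := lemmaH n hn
  set ν := volume.real (ball (0 : E n) 1) with hν
  have ν0 : 0 < ν := ENNReal.toReal_pos (measure_ball_pos _ _ one_pos).ne' (measure_ball_lt_top).ne
  obtain ⟨κ, hκ⟩ : ∃ κ, κ = l / L := ⟨_, rfl⟩
  have κ0 : 0 < κ := by rw [hκ]; positivity
  have n0 : (0 : ℝ) < n := by exact_mod_cast (by omega : 0 < n)
  obtain ⟨K, hK⟩ : ∃ K, K = (κ ^ n)⁻¹ := ⟨_, rfl⟩
  have K0 : 0 < K := by rw [hK]; positivity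
  rw [← hκ]
  refine ⟨(κ ^ 2)⁻¹ * (n * (C0 * (K + (K / L) ^ 2 + ν * K))), by positivity, fun U hU hUs a has hal hau => ?_⟩
  obtain ⟨B, G, hBs, hBG, hGB, haB, hB1, hG1, hd1, hd2⟩ := sqrtm hl hL has hal hau
  rw [← hκ] at hd1 hG1
  have hd0 : 0 < B.det := (by positivity : 0 < κ ^ n).trans_le hd1
  set T : E n → E n := fun w => WithLp.toLp 2 fun i => aff 0 B i w with hT
  have hTs : ContDiff ℝ ∞ T := contDiff_euclidean.2 fun i => aff_sm 0 B i
  have hTv : ∀ w, (T w).ofLp = B *ᵥ w.ofLp := fun w => funext fun i => by simp [hT, aff, Matrix.mulVec, dotProduct]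
  have hTj : ∀ w, jac T w = B := fun w => by ext i j; exact aff_pd 0 B i j w
  have hnv : ∀ v : E n, v.ofLp ⬝ᵥ v.ofLp = ‖v‖ ^ 2 := fun v => by rw [norm_sq_eq]; exact Finset.sum_congr rfl fun i _ => (sq _).symm
  have hTn : ∀ w, ‖T w‖ ≤ ‖w‖ := fun w => by
    have := hB1 w.ofLp
    rw [← hTv, hnv, hnv] at this
    exact (sq_le_sq₀ (by positivity) (norm_nonneg _)).1 this
  have hTi : Function.Injective T := fun w w' h => by
    have h1 : G *ᵥ (T w).ofLp = G *ᵥ (T w').ofLp := by rw [h]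
    rw [hTv, hTv, Matrix.mulVec_mulVec, Matrix.mulVec_mulVec, hGB, Matrix.one_mulVec, Matrix.one_mulVec] at h1
    exact WithLp.ofLp_injective 2 h1
  have hcov : ∀ (s : Set (E n)), MeasurableSet s → ∀ f : E n → ℝ, ∫ y in T '' s, f y = B.det * ∫ x in s, f (T x) := by
    intro s hs f
    rw [cov hTs hs hTi]; simp only [hTj, abs_of_pos hd0]; rw [integral_const_mul]
  have hcv1 : ∀ f : E n → ℝ, Continuous f → (∀ x, 0 ≤ f x) → ∫ x in ball (0 : E n) 1, f (T x) ≤ K * ∫ y in ball (0 : E n) 1, f y := by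
    intro f hf h0
    have h1 := hcov _ (measurableSet_ball (x := (0 : E n)) (ε := 1)) f
    have h2 : ∫ y in T '' ball 0 1, f y ≤ ∫ y in ball (0 : E n) 1, f y := by
      refine setIntegral_mono_set (intb hf 0 1) (ae_of_all _ h0) (HasSubset.Subset.eventuallyLE ?_)
      rintro _ ⟨w, hw, rfl⟩
      rw [mem_ball_zero_iff] at hw ⊢
      exact (hTn w).trans_lt hw
    have h3 : 0 ≤ ∫ x in ball (0 : E n) 1, f (T x) := integral_nonneg fun x => h0 _
    rw [hK, ← div_eq_inv_mul, le_div_iff₀ (by positivity), mul_comm]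
    exact (mul_le_mul_of_nonneg_right hd1 h3).trans (h1.symm.le.trans h2)
  set W : Fin n → E n → ℝ := fun i w => ∑ b, B i b * U (T w) b with hW
  have hUT : ∀ b, ContDiff ℝ ∞ fun w => U (T w) b := fun b => (smooth_comp_coord hU b).comp hTs
  have hWs : ∀ i, ContDiff ℝ ∞ (W i) := fun i => ContDiff.sum fun b _ => contDiff_const.mul (hUT b)
  have hWp : ∀ i j w, pd j (W i) w = (B * jac U (T w) * B) i j := by
    intro i j w
    simp only [hW]
    rw [pd_sum _ fun b _ => (contDiff_const.mul (hUT b)).dif w]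
    rw [Matrix.mul_assoc, Matrix.mul_apply]
    refine Finset.sum_congr rfl fun b _ => ?_
    rw [pd_const_mul ((hUT b).dif w), pd_compE ((smooth_comp_coord hU b).dif _) (difE hTs w), Matrix.mul_apply]
    congr 1
    exact Finset.sum_congr rfl fun d _ => by rw [← hTj w]; rfl
  have hWy : ∀ w, (B * jac U (T w) * B)ᵀ = B * jac U (T w) * B := fun w => by
    rw [Matrix.transpose_mul, Matrix.transpose_mul, hBs, hUs, Matrix.mul_assoc]
  obtain ⟨b, M, hMs, -, hest⟩ := hH W hWs fun i j w => by rw [hWp, hWp, ← Matrix.transpose_apply (B * _ * B), hWy]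
  have cf : Continuous fun y => fr (jac U y) := by have := fr_cont hU 0; simpa using this
  have ct : Continuous fun y => |(a * jac U y).trace| := ((continuous_const.matrix_mul (jac_cont hU)).matrix_trace).abs
  set D := ∫ y in ball (0 : E n) 1, fr (jac U y) with hD
  set Q := ∫ y in ball (0 : E n) 1, |(a * jac U y).trace| with hQ
  have D0 : 0 ≤ D := integral_nonneg fun _ => fr0 _
  have Q0 : 0 ≤ Q := integral_nonneg fun _ => abs_nonneg _
  have hg1 : ∀ i, ∫ x in ball (0 : E n) 1, gr (W i) x ⬝ᵥ gr (W i) x ≤ K * D := by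
    intro i
    refine le_trans (setIntegral_mono (intb (grsq_cont (hWs i)) 0 1) (intb (cf.comp hTs.continuous) 0 1) fun x => ?_) (hcv1 _ cf fun _ => fr0 _)
    refine le_trans ?_ (fr_contr hBs hB1 _)
    have : gr (W i) x ⬝ᵥ gr (W i) x = ∑ j, (B * jac U (T x) * B) i j ^ 2 := Finset.sum_congr rfl fun j _ => by
      rw [← sq]; show pd j (W i) x ^ 2 = _; rw [hWp]
    rw [this]
    exact Finset.single_le_sum (f := fun i => ∑ j, (B * jac U (T x) * B) i j ^ 2) (fun i _ => Finset.sum_nonneg fun j _ => sq_nonneg _) (Finset.mem_univ i)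
  have hg2 : ∫ x in ball (0 : E n) 1, |∑ j, pd j (W j) x| ≤ K / L * Q := by
    have e : ∀ x, |∑ j, pd j (W j) x| = L⁻¹ * |(a * jac U (T x)).trace| := by
      intro x
      have : ∑ j, pd j (W j) x = (B * jac U (T x) * B).trace := Finset.sum_congr rfl fun j _ => hWp j j x
      rw [this, Matrix.trace_mul_comm, ← Matrix.mul_assoc, haB, Matrix.smul_mul, Matrix.trace_smul, smul_eq_mul, abs_mul, abs_of_pos hL, inv_mul_cancel_left₀ hL.ne']
    simp only [e]
    rw [integral_const_mul]
    refine (mul_le_mul_of_nonneg_left (hcv1 _ ct fun _ => abs_nonneg _) (by positivity)).trans (le_of_eq ?_)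
    ring
  refine ⟨G *ᵥ b, G * M * G, fun s θ hs hs1 hθ hθ1 => ?_⟩
  have hk : ∀ i, ∫ x in closedBall (0 : E n) θ, (W i x - (b i + ∑ j, M i j * x j)) ^ 2 ≤ C0 * (K + (K / L) ^ 2 + ν * K) * (s ^ 2 * D + θ ^ n * ((s ^ n)⁻¹ * Q) ^ 2 + θ ^ n * θ ^ 4 * D) := by
    intro i
    refine (hest s θ hs hs1 hθ hθ1 i).2.trans ?_
    rw [mul_assoc]
    refine mul_le_mul_of_nonneg_left ?_ hC0.le
    have h1 := hg1 i
    have h2 : ((s ^ n)⁻¹ * ∫ x in ball (0 : E n) 1, |∑ j, pd j (W j) x|) ^ 2 ≤ (K / L) ^ 2 * ((s ^ n)⁻¹ * Q) ^ 2 := by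
      rw [← mul_pow, mul_left_comm]
      have : 0 ≤ ∫ x in ball (0 : E n) 1, |∑ j, pd j (W j) x| := integral_nonneg fun _ => abs_nonneg _
      gcongr
    have h3 : (θ ^ 2 * ∫ x in ball (0 : E n) 1, √(gr (W i) x ⬝ᵥ gr (W i) x)) ^ 2 ≤ θ ^ 4 * (ν * (K * D)) := by
      rw [mul_pow, ← pow_mul]
      refine mul_le_mul_of_nonneg_left ((cs_ball (grsq_cont (hWs i)) fun _ => dot_self_nonneg _).trans ?_) (by positivity)
      exact mul_le_mul_of_nonneg_left h1 ν0.le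
    have g1 := mul_le_mul_of_nonneg_left h1 (sq_nonneg s)
    have g2 := mul_le_mul_of_nonneg_left h2 (pow_pos hθ n).le
    have g3 := mul_le_mul_of_nonneg_left h3 (pow_pos hθ n).le
    have q1 : 0 ≤ s ^ 2 * D := by positivity
    have q2 : 0 ≤ θ ^ n * ((s ^ n)⁻¹ * Q) ^ 2 := by positivity
    have q3 : 0 ≤ θ ^ n * θ ^ 4 * D := by positivity
    have r1 : 0 ≤ (K / L) ^ 2 := sq_nonneg _
    have r2 : 0 ≤ ν * K := by positivity
    generalize (K / L) ^ 2 = k2 at *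
    linarith [mul_nonneg r1 q1, mul_nonneg r2 q1, mul_nonneg K0.le q2, mul_nonneg r2 q2, mul_nonneg K0.le q3, mul_nonneg r1 q3]
  set f : E n → ℝ := fun y => ∑ i, (U y i - aff (G *ᵥ b) (G * M * G) i y) ^ 2 with hf
  have hfc : Continuous f := continuous_finset_sum _ fun i _ => ((smooth_comp_coord hU i).continuous.sub (aff_sm _ _ i).continuous).pow 2
  have hf0 : ∀ y, 0 ≤ f y := fun y => Finset.sum_nonneg fun i _ => sq_nonneg _
  have hfT : ∀ w, f (T w) ≤ (κ ^ 2)⁻¹ * ∑ i, (W i w - (b i + ∑ j, M i j * w j)) ^ 2 := by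
    intro w
    have h1 := hG1 fun i => W i w - (b i + ∑ j, M i j * w j)
    have e1 : (G *ᵥ fun i => W i w - (b i + ∑ j, M i j * w j)) = fun i => U (T w) i - aff (G *ᵥ b) (G * M * G) i (T w) := by
      have e2 : (fun i => W i w - (b i + ∑ j, M i j * w j)) = B *ᵥ (U (T w)).ofLp - (b + M *ᵥ w.ofLp) := rfl
      have e3 : (fun i => U (T w) i - aff (G *ᵥ b) (G * M * G) i (T w)) = (U (T w)).ofLp - (G *ᵥ b + (G * M * G) *ᵥ (T w).ofLp) := rfl
      rw [e2, e3, hTv, Matrix.mulVec_sub, Matrix.mulVec_add, Matrix.mulVec_mulVec, Matrix.mulVec_mulVec, Matrix.mulVec_mulVec, hGB, Matrix.one_mulVec, Matrix.mul_assoc (G * M), hGB, Matrix.mul_one]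
    rw [e1] at h1
    simp only [dotProduct, ← sq] at h1
    rw [← div_eq_inv_mul, le_div_iff₀ (by positivity), mul_comm]
    exact h1
  have hci : ∀ i, Continuous fun w : E n => (W i w - (b i + ∑ j, M i j * w j)) ^ 2 := fun i => ((hWs i).continuous.sub (aff_sm b M i).continuous).pow 2
  have hic : ∀ {g : E n → ℝ}, Continuous g → IntegrableOn g (closedBall 0 θ) := fun hg => hg.continuousOn.integrableOn_compact (isCompact_closedBall _ _)
  have hsub : ball (0 : E n) (κ * θ) ⊆ T '' closedBall 0 θ := by
    intro y hy
    rw [mem_ball_zero_iff] at hy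
    refine ⟨WithLp.toLp 2 (G *ᵥ y.ofLp), ?_, ?_⟩
    · rw [mem_closedBall_zero_iff]
      have h1 := hG1 y.ofLp
      have h2 := hnv (WithLp.toLp 2 (G *ᵥ y.ofLp) : E n)
      simp only at h2
      rw [h2, hnv, ← mul_pow] at h1
      have h3 := (sq_le_sq₀ (by positivity) (norm_nonneg _)).1 h1
      exact (mul_le_mul_iff_right₀ κ0).1 (h3.trans hy.le)
    · apply WithLp.ofLp_injective 2
      rw [hTv, Matrix.mulVec_mulVec, hBG, Matrix.one_mulVec]
  have hcb : IntegrableOn f (T '' closedBall 0 θ) := hfc.continuousOn.integrableOn_compact ((isCompact_closedBall _ _).image hTs.continuous)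
  refine (setIntegral_mono_set hcb (ae_of_all _ hf0) hsub.eventuallyLE).trans ?_
  rw [hcov _ measurableSet_closedBall]
  have h1 : ∫ x in closedBall (0 : E n) θ, f (T x) ≤ (κ ^ 2)⁻¹ * ∑ i, ∫ x in closedBall (0 : E n) θ, (W i x - (b i + ∑ j, M i j * x j)) ^ 2 := by
    rw [← integral_finset_sum _ fun i _ => hic (hci i), ← integral_const_mul]
    exact setIntegral_mono (hic (hfc.comp hTs.continuous)) ((hic (continuous_finset_sum _ fun i _ => hci i)).const_mul _) hfT
  have h2 := Finset.sum_le_sum fun i (_ : i ∈ Finset.univ) => hk i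
  have h3 : 0 ≤ ∫ x in closedBall (0 : E n) θ, f (T x) := integral_nonneg fun x => hf0 _
  refine (mul_le_of_le_one_left h3 hd2).trans (h1.trans ?_)
  refine (mul_le_mul_of_nonneg_left h2 (by positivity)).trans (le_of_eq ?_)
  simp; ring

lemma ch3 (n : ℕ) {ρ t0 q : ℝ} (hρ : 0 < ρ) (ht : 0 < t0) (hq : 0 < q) : ∃ t s ε : ℝ, 0 < t ∧ t < 1/4 ∧ t ≤ t0 ∧ 0 < s ∧ s ≤ 1/4 ∧ 0 < ε ∧
    ∀ δ ≤ ε, s ^ 2 + t ^ n * ((s ^ n)⁻¹ ^ 2 * (q * δ)) + t ^ n * t ^ 4 ≤ ρ * t ^ (n + 2) := by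
  obtain ⟨t, h1, h2⟩ : ∃ t, 0 < t ∧ t ≤ min (min (1/8) t0) (ρ / 3) := ⟨_, by positivity, le_rfl⟩
  have h3 := (h2.trans (min_le_left _ _)).trans (min_le_left _ _)
  have h4 := h2.trans (min_le_right _ _)
  obtain ⟨s, s1, s2⟩ : ∃ s, 0 < s ∧ s ≤ min (1/4) (ρ / 3 * t ^ (n + 2)) := ⟨_, by positivity, le_rfl⟩
  have s3 := s2.trans (min_le_left _ _)
  have s4 := s2.trans (min_le_right _ _)
  refine ⟨t, s, ρ / 3 * t ^ 2 / ((s ^ n)⁻¹ ^ 2 * q), h1, by linarith, (h2.trans (min_le_left _ _)).trans (min_le_right _ _), s1, s3, by positivity, fun δ hδ => ?_⟩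
  rw [le_div_iff₀ (by positivity)] at hδ
  have a1 : s ^ 2 ≤ s := by nlinarith
  have a2 : t ^ n * ((s ^ n)⁻¹ ^ 2 * (q * δ)) ≤ t ^ n * (ρ / 3 * t ^ 2) := mul_le_mul_of_nonneg_left (by linarith) (by positivity)
  have a3 : t ^ n * t ^ 4 ≤ t ^ n * (ρ / 3 * t ^ 2) := by
    refine mul_le_mul_of_nonneg_left ?_ (by positivity)
    have : t ^ 4 = t ^ 2 * t ^ 2 := by ring
    rw [this]
    refine mul_le_mul_of_nonneg_right ?_ (by positivity)
    nlinarith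
  have a4 : t ^ n * (ρ / 3 * t ^ 2) = ρ / 3 * t ^ (n + 2) := by ring
  linarith

lemma fr_tri (P Q A : Mt n) : fr (P - Q) ≤ 2 * fr (P - A) + 2 * fr (Q - A) := by
  simp only [fr, Finset.mul_sum, ← Finset.sum_add_distrib]
  refine Finset.sum_le_sum fun i _ => Finset.sum_le_sum fun j _ => ?_
  simp only [Matrix.sub_apply]
  nlinarith [sq_nonneg (P i j - A i j + (Q i j - A i j))]

lemma st3 (n : ℕ) (hn : 2 ≤ n) (k l L : ℝ) (hl : 0 < l) (hL : 0 < L) : ∃ ε θ : ℝ, 0 < ε ∧ 0 < θ ∧ θ < 1 ∧ ∀ (X : E n → E n) (A : Mt n) (δ : ℝ),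
    Good k l L X → 0 < δ → δ ≤ ε → ∫ y in ball (0 : E n) 1, fr (jac X y - A) ≤ δ → ∃ A' : Mt n, ∫ y in ball 0 θ, fr (jac X y - A') ≤ δ / 2 * θ ^ n := by
  obtain ⟨C1, C10, hC⟩ := campH n hn l L hl hL
  obtain ⟨C2, C20, hcac⟩ := cacc_aff n l L hl hL
  obtain ⟨Cq, Cq0, hquad⟩ := quad n k
  obtain ⟨κ, hκ⟩ : ∃ κ, κ = l / L := ⟨_, rfl⟩
  have κ0 : 0 < κ := by rw [hκ]; positivity
  rw [← hκ] at hC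
  set ν := volume.real (ball (0 : E n) 1) with hν
  have ν0 : 0 < ν := ENNReal.toReal_pos (measure_ball_pos _ _ one_pos).ne' (measure_ball_lt_top).ne
  obtain ⟨t, s, ε, t0, t1, t2, s0, s1, ε0, hch⟩ := ch3 n (ρ := κ ^ (n + 2) / (2 ^ n * 32 * C1 * C2)) (t0 := κ⁻¹) (q := 4 * Cq ^ 2) (by positivity) (by positivity) (by positivity)
  have hr1 : κ * t ≤ 1 := by
    have := mul_le_mul_of_nonneg_left t2 κ0.le
    rwa [mul_inv_cancel₀ κ0.ne'] at this
  have hr0 : 0 < κ * t := by positivity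
  refine ⟨ε, κ * t / 2, ε0, by positivity, by linarith, fun X A δ hX hδ hδε hint => ?_⟩
  obtain ⟨y0, hy0, hy⟩ : ∃ y0 ∈ ball (0 : E n) 1, fr (jac X y0 - A) ≤ ⨍ y in ball (0 : E n) 1, fr (jac X y - A) :=
    exists_le_setAverage (measure_ball_pos _ _ one_pos).ne' (measure_ball_lt_top).ne (intb (fr_cont hX.sm A) 0 1)
  rw [setAverage_eq, smul_eq_mul, ← div_eq_inv_mul, le_div_iff₀ ν0] at hy
  set m := jac X y0 with hm
  have hD : ∫ y in ball (0 : E n) 1, fr (jac X y - m) ≤ 4 * δ := by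
    have h1 : ∫ y in ball (0 : E n) 1, (2 * fr (jac X y - A) + 2 * fr (m - A)) ≤ 4 * δ := by
      rw [integral_add ((intb (fr_cont hX.sm A) 0 1).const_mul 2) (intb continuous_const 0 1), integral_const_mul, setIntegral_const, smul_eq_mul]
      show 2 * _ + ν * _ ≤ _
      linarith
    exact (setIntegral_mono (intb (fr_cont hX.sm m) 0 1) (((intb (fr_cont hX.sm A) 0 1).const_mul 2).add (intb continuous_const 0 1)) fun y => fr_tri _ _ _).trans h1
  obtain ⟨S0, hS0, hmS⟩ := hX.adm y0
  set U : E n → E n := fun y => X y - WithLp.toLp 2 fun i => aff 0 m i y with hU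
  have hUs : ContDiff ℝ ∞ U := hX.sm.sub (contDiff_euclidean.2 fun i => aff_sm 0 m i)
  have hUj : ∀ y, jac U y = jac X y - m := by
    intro y; ext i j
    show pd j (fun z => X z i - aff 0 m i z) y = _
    rw [pd_sub ((smooth_comp_coord hX.sm i).dif y) ((aff_sm 0 m i).dif y), aff_pd]; rfl
  have hQ : ∫ y in ball (0 : E n) 1, |(aM k m * jac U y).trace| ≤ Cq * (4 * δ) := by
    simp only [hUj]
    have ct : Continuous fun y => |(aM k m * (jac X y - m)).trace| := ((continuous_const.matrix_mul ((jac_cont hX.sm).sub continuous_const)).matrix_trace).abs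
    refine (setIntegral_mono (intb ct 0 1) ((intb (fr_cont hX.sm m) 0 1).const_mul Cq) fun y => ?_).trans ?_
    · obtain ⟨S, hS, hmm⟩ := hX.adm y
      exact hquad S _ S0 m hS hmm hS0 hmS
    · rw [integral_const_mul]; gcongr
  obtain ⟨β, A'', hβ⟩ := hC U hUs (fun y => by rw [hUj, Matrix.transpose_sub, hX.symj, hm, hX.symj]) (aM k m) (hX.coef.symm y0) (hX.coef.lower y0) (hX.coef.upper y0)
  have h1 := hβ s t s0 s1 t0 t1
  have e1 : ∀ y, ∑ i, (U y i - aff β A'' i y) ^ 2 = ∑ i, (X y i - aff β (m + A'') i y) ^ 2 := by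
    intro y
    refine Finset.sum_congr rfl fun i _ => ?_
    congr 1
    simp only [hU, aff, PiLp.sub_apply, Matrix.add_apply, add_mul, Finset.sum_add_distrib, Pi.zero_apply]; ring
  simp only [e1] at h1
  simp only [hUj] at h1 hQ
  refine ⟨m + A'', (hcac k X hX β (m + A'') (κ * t / 2) (κ * t) (by positivity) (by linarith)).trans ?_⟩
  set D := ∫ y in ball (0 : E n) 1, fr (jac X y - m) with hDd
  set Q := ∫ y in ball (0 : E n) 1, |(aM k m * (jac X y - m)).trace| with hQd
  have Q0 : 0 ≤ Q := integral_nonneg fun _ => abs_nonneg _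
  have h2 : s ^ 2 * D + t ^ n * ((s ^ n)⁻¹ * Q) ^ 2 + t ^ n * t ^ 4 * D ≤ 4 * δ * (s ^ 2 + t ^ n * ((s ^ n)⁻¹ ^ 2 * (4 * Cq ^ 2 * δ)) + t ^ n * t ^ 4) := by
    have g1 : s ^ 2 * D ≤ s ^ 2 * (4 * δ) := by gcongr
    have g2 : t ^ n * ((s ^ n)⁻¹ * Q) ^ 2 ≤ t ^ n * ((s ^ n)⁻¹ * (Cq * (4 * δ))) ^ 2 := by gcongr
    have g3 : t ^ n * t ^ 4 * D ≤ t ^ n * t ^ 4 * (4 * δ) := by gcongr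
    refine (add_le_add (add_le_add g1 g2) g3).trans (le_of_eq ?_)
    ring
  have h3 := mul_le_mul_of_nonneg_left (hch δ hδε) (by positivity : 0 ≤ 4 * δ)
  have h4 := h1.trans (mul_le_mul_of_nonneg_left (h2.trans h3) C10.le)
  refine (mul_le_mul_of_nonneg_left h4 (by positivity)).trans (le_of_eq ?_)
  have : κ * t - κ * t / 2 = κ * t / 2 := by ring
  rw [this, div_pow (κ * t) 2 n]
  field_simp
  ring

lemma int_ball_scale {R : ℝ} (hR : 0 < R) (r : ℝ) (f : E n → ℝ) : ∫ y in ball (0 : E n) r, f (R • y) = (R ^ n)⁻¹ * ∫ y in ball (0 : E n) (R * r), f y := by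
  rw [← integral_indicator measurableSet_ball, ← integral_indicator measurableSet_ball, ← int_scale 0 hR]
  congr 1; funext y
  simp only [indicator, mem_ball_zero_iff, zero_add, norm_smul, Real.norm_eq_abs, abs_of_pos hR, mul_lt_mul_iff_right₀ hR]

lemma Good.scale {k l L : ℝ} {X : E n → E n} (h : Good k l L X) {R : ℝ} (hR : 0 < R) :
    Good k l L (fun y => R⁻¹ • X (R • y)) ∧ ∀ y, jac (fun y => R⁻¹ • X (R • y)) y = jac X (R • y) := by
  have hi : R⁻¹ * R = 1 := inv_mul_cancel₀ hR.ne'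
  have hs : ∀ i, ContDiff ℝ ∞ fun y => X (R • y) i := fun i => (smooth_comp_coord h.sm i).comp (contDiff_id.const_smul R)
  have hp : ∀ i j y, pd j (fun y => X (R • y) i) y = R * pd j (fun z => X z i) (R • y) := fun i j y => by
    have := pd_scale (smooth_comp_coord h.sm i) R 0 j y
    simpa only [zero_add] using this
  have hj : ∀ y, jac (fun y => R⁻¹ • X (R • y)) y = jac X (R • y) := by
    intro y; ext i j
    show pd j (fun y => R⁻¹ * X (R • y) i) y = pd j (fun z => X z i) (R • y)
    rw [pd_const_mul ((hs i).dif y), hp, ← mul_assoc, hi, one_mul]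
  refine ⟨⟨h.hk, ?_, ?_, ?_, fun y => by rw [hj]; exact h.adm _, ?_, ?_⟩, hj⟩
  · exact (h.sm.comp (contDiff_id.const_smul R)).const_smul R⁻¹
  · exact ((MulAction.bijective (Units.mk0 R⁻¹ (inv_ne_zero hR.ne'))).comp h.bij).comp (MulAction.bijective (Units.mk0 R hR.ne'))
  · intro y y'
    have h1 := h.mono (R • y) (R • y')
    have h2 := mul_le_mul_of_nonneg_left h1 (sq_nonneg R⁻¹)
    rw [← smul_sub, norm_smul, Real.norm_eq_abs, mul_pow, sq_abs]
    refine h2.trans (le_of_eq ?_)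
    rw [Finset.mul_sum]
    refine Finset.sum_congr rfl fun i _ => ?_
    simp only [← smul_sub, PiLp.smul_apply, smul_eq_mul]
    linear_combination (R⁻¹ * (X (R • y') - X (R • y)) i * (y' - y) i) * hi
  · have := h.coef.scale 0 hR
    simpa only [zero_add, hj] using this
  · intro i y
    have h1 : hess (fun y => R⁻¹ * X (R • y) i) y = R⁻¹ • hess (fun y => X (R • y) i) y := hess_const_mul (hs i) _ _
    have h2 := hess_scale (smooth_comp_coord h.sm i) R 0 y
    simp only [zero_add] at h2
    rw [hj]
    show (_ * hess (fun y => R⁻¹ * X (R • y) i) y).trace = 0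
    rw [h1, h2, smul_smul, Matrix.mul_smul, Matrix.trace_smul, h.harm, smul_zero]

lemma const_of {f : E n → ℝ} (hf : Continuous f) (h : ∀ η > 0, ∃ a, ∫ y in ball (0 : E n) 1, (f y - a) ^ 2 ≤ η) : ∃ M, ∀ y ∈ ball (0 : E n) 1, f y = M := by
  set ν := volume.real (ball (0 : E n) 1) with hν
  have ν0 : 0 < ν := ENNReal.toReal_pos (measure_ball_pos _ _ one_pos).ne' (measure_ball_lt_top).ne
  obtain ⟨M, hM⟩ : ∃ M, M = (∫ y in ball (0 : E n) 1, f y) / ν := ⟨_, rfl⟩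
  have hM' : ∫ y in ball (0 : E n) 1, f y = M * ν := by rw [hM]; field_simp
  have hc : ∀ a, Continuous fun y => (f y - a) ^ 2 := fun a => (hf.sub continuous_const).pow 2
  have hv : ∀ a, ∫ y in ball (0 : E n) 1, (f y - M) ^ 2 ≤ ∫ y in ball (0 : E n) 1, (f y - a) ^ 2 := by
    intro a
    have h1 : ∀ a, ∫ y in ball (0 : E n) 1, (f y - a) ^ 2 = (∫ y in ball (0 : E n) 1, f y ^ 2) - 2 * a * (M * ν) + a ^ 2 * ν := by
      intro a
      have i1 : IntegrableOn (fun y => f y ^ 2) (ball 0 1) := intb (hf.pow 2) 0 1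
      have i2 : IntegrableOn (fun y => 2 * a * f y) (ball 0 1) := (intb hf 0 1).const_mul (2 * a)
      have i3 : IntegrableOn (fun y => f y ^ 2 - 2 * a * f y) (ball 0 1) := i1.sub i2
      have e : ∀ y, (f y - a) ^ 2 = f y ^ 2 - 2 * a * f y + a ^ 2 := fun y => by ring
      simp only [e]
      rw [integral_add i3 (intb continuous_const 0 1), integral_sub i1 i2, integral_const_mul, hM', setIntegral_const, smul_eq_mul, mul_comm (volume.real _)]
    rw [h1, h1]
    nlinarith [mul_nonneg ν0.le (sq_nonneg (a - M))]
  have h0 : ∫ y in ball (0 : E n) 1, (f y - M) ^ 2 = 0 := by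
    refine le_antisymm (le_of_forall_pos_le_add fun η hη => ?_) (integral_nonneg fun y => sq_nonneg _)
    obtain ⟨a, ha⟩ := h η hη
    rw [zero_add]; exact (hv a).trans ha
  refine ⟨M, fun y hy => ?_⟩
  rw [setIntegral_eq_zero_iff_of_nonneg_ae (ae_of_all _ fun y => sq_nonneg _) (intb (hc M) 0 1)] at h0
  have := Measure.eqOn_open_of_ae_eq h0 isOpen_ball (hc M).continuousOn continuousOn_const hy
  exact sub_eq_zero.1 (pow_eq_zero_iff two_ne_zero |>.1 this)

lemma case2 (hn : 2 ≤ n) {k : ℝ} {u : E n → ℝ} (h : Sol k u) (hB : ∀ B, ∃ x, B < Dv (hess u x)) : ∃ M, ∀ x, hess u x = M := by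
  obtain ⟨l, L, hl, hL, hell⟩ := ell n k h.hk
  obtain ⟨X, hG, hXY, hYX, hj⟩ := h.good hl hL hell
  have hd : ∀ x, 1 ≤ (hess u x + k • 1).det := fun x => (hell _ (h.adm x)).2.2.1
  obtain ⟨ε, θ, ε0, θ0, θ1, hst3⟩ := st3 n hn k l L hl hL
  obtain ⟨ε2, Λ, ϑ, ε20, Λ0, ϑ0, -, hst2⟩ := st2 n hn k l L h.hk hl hL ε ε0
  obtain ⟨Λ', δ, Λ'0, δ0, hslab⟩ := slab n k l L hl hL (ε := (Λ ^ n)⁻¹ * ε2) (by positivity)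
  have hk := h.hk
  obtain ⟨J, hJ⟩ : ∃ J, J = 200 * k ^ 3 := ⟨_, rfl⟩
  have J0 : 0 < J := by rw [hJ]; positivity
  set τ : E n → ℝ := fun x => (Dv (hess u x) + J) ^ (-(1/3:ℝ)) with hτ
  have hτs : ContDiff ℝ ∞ τ := by have := (h.Ltau 0).1; rwa [← hJ] at this
  have hD1 : ∀ x, 1 ≤ Dv (hess u x) := fun x => (h.adm x).one_le
  have hτ0 : ∀ x, 0 ≤ τ x := fun x => Real.rpow_nonneg (by linarith [hD1 x]) _
  have hdet : ∀ y, 0 ≤ (jac X y).det ∧ (jac X y).det ≤ L * (1 + J) * τ (X y) := by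
    intro y
    have e := (inv_of (hj y)).2
    have f1 := (hell _ (h.adm (X y))).2.2
    rw [e]
    refine ⟨inv_nonneg.2 (by linarith [f1.1]), ?_⟩
    have f2 := hD1 (X y)
    have f3 : (Dv (hess u (X y)) + J)⁻¹ ≤ τ (X y) := by
      rw [hτ, ← Real.rpow_neg_one]
      exact Real.rpow_le_rpow_of_exponent_le (by linarith) (by norm_num)
    refine le_trans ?_ (mul_le_mul_of_nonneg_left f3 (by positivity))
    rw [← div_eq_mul_inv, inv_eq_one_div, div_le_div_iff₀ (by linarith [f1.1]) (by linarith)]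
    have f4 := mul_le_mul_of_nonneg_right f1.2 (by positivity : 0 ≤ 1 + J)
    nlinarith
  obtain ⟨R0, R00, hR0⟩ := wh_infty n hn (z := fun y => τ (X y)) hG.coef (hτs.comp hG.sm) (fun y => hτ0 _) 1 one_pos
    (fun y => Real.rpow_le_one_of_one_le_of_nonpos (by linarith [hD1 (X y)]) (by norm_num))
    (fun y => h.sup hG.sm hXY hYX hj hd hτs (fun x => by have := (h.Ltau x).2; rwa [← hJ] at this) y)
    (fun c hc => by
      obtain ⟨x, hx⟩ := hB (c ^ (-3 : ℝ))
      refine ⟨Ym k u x, ?_⟩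
      show τ (X (Ym k u x)) < c
      rw [hXY]
      have h1 : 0 < c ^ (-3 : ℝ) := Real.rpow_pos_of_pos hc _
      have h2 := Real.rpow_lt_rpow_of_neg h1 (hx.trans (by linarith : Dv (hess u x) < Dv (hess u x) + J)) (by norm_num : (-(1/3:ℝ)) < 0)
      rwa [← Real.rpow_mul hc.le, show (-3 : ℝ) * -(1/3) = 1 by norm_num, Real.rpow_one] at h2)
    ((L * (1 + J))⁻¹ * ((Λ' ^ n)⁻¹ * (δ / 2))) (by positivity)
  have hmc := jac_cont hG.sm
  have base : ∀ R ≥ R0 * ϑ / (Λ' * Λ), ∃ A, ∫ y in ball (0 : E n) 1, fr (jac X (R • y) - A) ≤ ε := by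
    intro R hR
    have hRp : 0 < R := lt_of_lt_of_le (by positivity) hR
    obtain ⟨R1, hR1⟩ : ∃ R1, R1 = R / ϑ := ⟨_, rfl⟩
    have R1p : 0 < R1 := by rw [hR1]; positivity
    have R2p : 0 < R1 * Λ := by positivity
    obtain ⟨g1, j1⟩ := hG.scale R1p
    obtain ⟨g2, j2⟩ := hG.scale R2p
    have h3 := hR0 (R1 * Λ * Λ') (by rw [hR1]; rw [ge_iff_le, div_le_iff₀ (by positivity)] at hR; rw [ge_iff_le, mul_assoc, div_mul_eq_mul_div, le_div_iff₀ ϑ0]; linarith)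
    have h4 : ∫ y in ball (0 : E n) Λ', (jac X ((R1 * Λ) • y)).det < δ := by
      have i1 := int_ball_scale Λ'0 1 fun y => (jac X ((R1 * Λ) • y)).det
      simp only [smul_smul, mul_one] at i1
      have i2 : ∫ y in ball (0 : E n) 1, (jac X ((R1 * Λ * Λ') • y)).det ≤ (Λ' ^ n)⁻¹ * (δ / 2) := by
        have c1 : Continuous fun y => (jac X ((R1 * Λ * Λ') • y)).det := hmc.matrix_det.comp (continuous_const_smul _)
        have c2 : Continuous fun y => τ (X ((R1 * Λ * Λ') • y)) := (hτs.continuous.comp hG.sm.continuous).comp (continuous_const_smul _)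
        refine (setIntegral_mono (intb c1 0 1) ((intb c2 0 1).const_mul (L * (1 + J))) fun y => (hdet _).2).trans ?_
        rw [integral_const_mul]
        refine (mul_le_mul_of_nonneg_left h3 (by positivity)).trans (le_of_eq ?_)
        exact mul_inv_cancel_left₀ (by positivity) _
      rw [i1] at i2
      have := le_of_mul_le_mul_left i2 (by positivity)
      linarith
    obtain ⟨e, he, hi⟩ := hslab _ g2 (by simp only [j2]; exact h4) fun y => by rw [j2]; exact (hdet _).1
    simp only [j2] at hi
    have i3 := int_ball_scale Λ0 1 fun y => (jac X (R1 • y) *ᵥ e) ⬝ᵥ (jac X (R1 • y) *ᵥ e)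
    simp only [smul_smul, mul_one] at i3
    rw [i3] at hi
    have i4 := le_of_mul_le_mul_left hi (by positivity)
    obtain ⟨A, hA⟩ := hst2 _ e g1 he (by simp only [j1]; exact i4)
    simp only [j1] at hA
    have i5 := int_ball_scale ϑ0 1 fun y => fr (jac X (R1 • y) - A)
    simp only [smul_smul, mul_one] at i5
    have e1 : R1 * ϑ = R := by rw [hR1]; field_simp
    rw [e1] at i5
    refine ⟨A, ?_⟩
    rw [i5, ← div_eq_inv_mul, div_le_iff₀ (by positivity)]; exact hA
  have step : ∀ j : ℕ, ∀ R ≥ R0 * ϑ / (Λ' * Λ) * θ ^ j, ∃ A, ∫ y in ball (0 : E n) 1, fr (jac X (R • y) - A) ≤ ε / 2 ^ j := by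
    intro j
    induction j with
    | zero => simpa using base
    | succ j ih =>
      intro R hR
      have hRp : 0 < R := lt_of_lt_of_le (by positivity) hR
      obtain ⟨A, hA⟩ := ih (R / θ) (by rw [ge_iff_le, le_div_iff₀ θ0]; rw [pow_succ] at hR; linarith)
      obtain ⟨g1, j1⟩ := hG.scale (div_pos hRp θ0)
      obtain ⟨A', hA'⟩ := hst3 _ A (ε / 2 ^ j) g1 (by positivity) (div_le_self ε0.le (one_le_pow₀ one_le_two)) (by simp only [j1]; exact hA)
      simp only [j1] at hA'
      have i5 := int_ball_scale θ0 1 fun y => fr (jac X ((R / θ) • y) - A')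
      simp only [smul_smul, mul_one, div_mul_cancel₀ R θ0.ne'] at i5
      refine ⟨A', ?_⟩
      rw [i5, ← div_eq_inv_mul, div_le_iff₀ (by positivity), pow_succ, ← div_div]; exact hA'
  have hcon : ∀ R : ℝ, 0 < R → ∀ i j, ∃ M, ∀ y ∈ ball (0 : E n) 1, jac X (R • y) i j = M := by
    intro R hR i j
    have hc : Continuous fun y => jac X (R • y) := hmc.comp (continuous_const_smul _)
    refine const_of (hc.matrix_elem i j) fun η hη => ?_
    obtain ⟨a, ha⟩ := exists_pow_lt_of_lt_one (by positivity : 0 < R / (R0 * ϑ / (Λ' * Λ))) θ1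
    obtain ⟨b, hb⟩ := exists_pow_lt_of_lt_one (by positivity : 0 < η / ε) (by norm_num : (1/2 : ℝ) < 1)
    have k1 : θ ^ (a + b) ≤ θ ^ a := pow_le_pow_of_le_one θ0.le θ1.le (by omega)
    have k2 : (1/2 : ℝ) ^ (a + b) ≤ (1/2) ^ b := pow_le_pow_of_le_one (by norm_num) (by norm_num) (by omega)
    obtain ⟨A, hA⟩ := step (a + b) R (by
      have := k1.trans ha.le
      rwa [le_div_iff₀ (by positivity), mul_comm] at this)
    refine ⟨A i j, ?_⟩
    have c1 : Continuous fun y => (jac X (R • y) i j - A i j) ^ 2 := ((hc.matrix_elem i j).sub continuous_const).pow 2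
    have c2 : Continuous fun y => fr (jac X (R • y) - A) := (fr_cont hG.sm A).comp (continuous_const_smul _)
    refine (setIntegral_mono (intb c1 0 1) (intb c2 0 1) fun y => ?_).trans (hA.trans ?_)
    · have := fr_ent (jac X (R • y) - A) i j
      have h1 := Real.sq_sqrt (fr0 (jac X (R • y) - A))
      show (jac X (R • y) i j - A i j) ^ 2 ≤ _
      rw [← h1, ← sq_abs]
      exact pow_le_pow_left₀ (abs_nonneg _) this 2
    · have := k2.trans hb.le
      rw [le_div_iff₀ ε0, one_div, inv_pow] at this
      rw [div_eq_inv_mul]; exact this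
  have hX0 : ∀ y, jac X y = jac X 0 := by
    intro y
    ext i j
    obtain ⟨M, hM⟩ := hcon (‖y‖ + 1) (by positivity) i j
    have h1 := hM 0 (by simp)
    have h2 := hM ((‖y‖ + 1)⁻¹ • y) (by
      rw [mem_ball_zero_iff, norm_smul, norm_inv, Real.norm_eq_abs, abs_of_pos (by positivity), ← div_eq_inv_mul, div_lt_one (by positivity)]; linarith)
    rw [smul_smul, mul_inv_cancel₀ (by positivity), one_smul] at h2
    rw [smul_zero] at h1
    rw [h1, h2]
  refine ⟨(jac X 0)⁻¹ - k • 1, fun x => ?_⟩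
  have h1 := hj (Ym k u x)
  rw [hX0, hXY] at h1
  rw [(inv_of h1).1]; abel

lemma hess_con (hn : 2 ≤ n) {k : ℝ} {u : E n → ℝ} (h : Sol k u) : ∃ M, ∀ x, hess u x = M := by
  by_cases hB : ∃ B, ∀ x, Dv (hess u x) ≤ B
  · obtain ⟨B, hB⟩ := hB; exact case1 hn h hB
  · push Not at hB; exact case2 hn h hB

lemma quad_of {u : E n → ℝ} (hu : ContDiff ℝ ∞ u) {M : Mt n} (hM : ∀ x, hess u x = M) (x : E n) :
    u x = (1/2) * (∑ i, ∑ j, M i j * x i * x j) + (∑ i, pd i u 0 * x i) + u 0 := by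
  have hp : ∀ j z, pd j u z = pd j u 0 + ∑ i, M i j * z i := by
    intro j z
    have h1 := line_ftc (smooth_pd hu j) 0 z
    have e : ∀ t : ℝ, fderiv ℝ (pd j u) (t • z) z = ∑ i, M i j * z i := fun t => by
      rw [fderiv_eq_sum]
      refine Finset.sum_congr rfl fun i _ => ?_
      rw [← hM (t • z), hess_apply]; ring
    simp only [zero_add] at h1
    simp only [e, intervalIntegral.integral_const, sub_zero, one_smul] at h1
    linarith
  have h1 := line_ftc hu 0 x
  have e : ∀ t : ℝ, fderiv ℝ u (t • x) x = (∑ i, pd i u 0 * x i) + t * (∑ i, ∑ j, M i j * x i * x j) := fun t => by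
    rw [fderiv_eq_sum]
    rw [Finset.sum_congr rfl fun i _ => by rw [hp i (t • x)]]
    simp only [mul_add, Finset.sum_add_distrib]
    congr 1
    · exact Finset.sum_congr rfl fun i _ => mul_comm _ _
    · rw [Finset.sum_comm (f := fun i j => M i j * x i * x j), Finset.mul_sum]
      refine Finset.sum_congr rfl fun i _ => ?_
      rw [Finset.mul_sum, Finset.mul_sum]
      exact Finset.sum_congr rfl fun j _ => by simp only [PiLp.smul_apply, smul_eq_mul]; ring
  simp only [zero_add] at h1
  simp only [e] at h1
  rw [intervalIntegral.integral_add (by apply Continuous.intervalIntegrable; fun_prop) (by apply Continuous.intervalIntegrable; fun_prop), intervalIntegral.integral_const, intervalIntegral.integral_mul_const, integral_id] at h1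
  simp only [sub_zero, one_smul] at h1
  linarith

lemma sol_of {u : E n → ℝ} (hu : ContDiff ℝ (⊤ : ℕ∞) u) (hsym : ∀ x, (hess u x).IsHermitian)
    (hadm : ∀ x, InGamma n 2 ((hsym x).eigenvalues) ∧ sigma n 2 ((hsym x).eigenvalues) / sigma n 1 ((hsym x).eigenvalues) = 1)
    {K : ℝ} (hK : 0 < K) (hsc : ∀ x, (hess u x + K • (1 : Matrix (Fin n) (Fin n) ℝ)).PosDef) : Sol (K + 1) u := by
  refine ⟨by linarith, hu, fun x => ?_⟩
  set lam := (hsym x).eigenvalues with hlam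
  have s1 : sigma n 1 lam = ∑ i, lam i := by
    simp [sigma, Finset.powersetCard_one]
  have s2 : (∑ i, lam i) ^ 2 = ∑ i, lam i ^ 2 + 2 * sigma n 2 lam := by
    rw [sigma]
    generalize (Finset.univ : Finset (Fin n)) = s
    induction s using Finset.induction_on with
    | empty => rw [Finset.powersetCard_eq_empty.2 (by simp)]; simp
    | insert b s hb ih =>
      rw [Finset.powersetCard_succ_insert hb, Finset.sum_union, Finset.sum_image, Finset.powersetCard_one, Finset.sum_map, Finset.sum_insert hb, Finset.sum_insert hb]
      · have e : ∀ i ∈ s, ∏ j ∈ insert b {i}, lam j = lam b * lam i := fun i hi => Finset.prod_pair (fun h => hb (h ▸ hi))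
        simp only [Function.Embedding.coeFn_mk]
        rw [Finset.sum_congr rfl e, ← Finset.mul_sum]
        linear_combination ih
      · intro p hp q hq hpq
        have h1 : b ∉ p := fun h => hb ((Finset.mem_powersetCard.1 hp).1 h)
        have h2 : b ∉ q := fun h => hb ((Finset.mem_powersetCard.1 hq).1 h)
        rw [← Finset.erase_insert h1, hpq, Finset.erase_insert h2]
      · rw [Finset.disjoint_left]
        intro p hp hq
        obtain ⟨q, -, rfl⟩ := Finset.mem_image.1 hq
        exact hb ((Finset.mem_powersetCard.1 hp).1 (Finset.mem_insert_self _ _))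
  have ht : (hess u x).trace = ∑ i, lam i := by
    have := (hsym x).trace_eq_sum_eigenvalues
    simpa using this
  have ht2 : (hess u x * hess u x).trace = ∑ i, lam i ^ 2 := by
    have h1 := (hsym x).spectral_theorem
    rw [Unitary.conjStarAlgAut_apply] at h1
    have o2 : ((hsym x).eigenvectorUnitary : Mt n)ᵀ * (hsym x).eigenvectorUnitary = 1 := Unitary.star_mul_self_of_mem (hsym x).eigenvectorUnitary.2
    have h2 : hess u x = (hsym x).eigenvectorUnitary * Matrix.diagonal lam * ((hsym x).eigenvectorUnitary : Mt n)ᵀ := h1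
    generalize ((hsym x).eigenvectorUnitary : Mt n) = O at o2 h2
    rw [h2, cj_mul o2, cj_trace o2]
    exact Finset.sum_congr rfl fun i _ => (sq _).symm
  obtain ⟨hg, hq⟩ := hadm x
  have g1 := hg 1 le_rfl one_le_two
  rw [div_eq_one_iff_eq g1.ne', s1] at hq
  rw [s1] at g1
  rw [hq] at s2
  have hD : Dv (hess u x) = ∑ i, lam i - 1 := by rw [Dv, ht]
  have p2 : 0 ≤ ∑ i, lam i ^ 2 := Finset.sum_nonneg fun i _ => sq_nonneg _
  refine ⟨hsym x, fun v => ?_, ?_, ?_⟩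
  · have h1 := (hsc x).posSemidef.dotProduct_mulVec_nonneg v
    have e : hess u x + (K + 1) • (1 : Mt n) = (hess u x + K • 1) + 1 := by rw [add_smul, one_smul, add_assoc]
    rw [e, Matrix.add_mulVec, Matrix.one_mulVec, dotProduct_add]
    simp only [star_trivial] at h1
    linarith
  · rw [hD]; nlinarith
  · rw [hD, ht2]; linarith

end HQ

/-- Liouville'"'"'s theorem for semi-convex entire solutions of `σ₂/σ₁ = 1`. -/
theorem stmt_6 (n : ℕ) (hn : 2 ≤ n)
    (u : EuclideanSpace ℝ (Fin n) → ℝ) (hu : ContDiff ℝ (⊤ : ℕ∞) u)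
    (hsym : ∀ x, (hess u x).IsHermitian)
    (hadm : ∀ x, InGamma n 2 ((hsym x).eigenvalues) ∧
      sigma n 2 ((hsym x).eigenvalues) / sigma n 1 ((hsym x).eigenvalues) = 1)
    (hsemiconvex : ∃ K : ℝ, 0 < K ∧
      ∀ x, (hess u x + K • (1 : Matrix (Fin n) (Fin n) ℝ)).PosDef) :
    ∃ (A : Matrix (Fin n) (Fin n) ℝ) (b : Fin n → ℝ) (c : ℝ), A.IsSymm ∧
      ∀ x : EuclideanSpace ℝ (Fin n),
        u x = (1 / 2) * (∑ i, ∑ j, A i j * x i * x j) + (∑ i, b i * x i) + c := by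
  obtain ⟨K, hK, hsc⟩ := hsemiconvex
  have h := sol_of hu hsym hadm hK hsc
  obtain ⟨M, hM⟩ := hess_con hn h
  have hs := (h.adm 0).symm
  rw [hM] at hs
  exact ⟨M, fun i => pd i u 0, u 0, hs, quad_of hu hM⟩
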